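/- (Twisted second moment bound.) Let Q₁, Q₂ ≥ 1/2, Q* := min{Q₁, Q₂}, let h = h₁h₂² ∈ F₃ with μ(h₁h₂)² = 1 and conductor norm H := N(h₁h₂), let a(𝔟) satisfy a(𝔟) ≪_ε N(𝔟)^ε for every ε > 0, let 1/2 ≤ R ≤ (Q₁Q₂H)^{100}, and for q ∈ F₃ set ℛ(q) := ∑_{0 ≠ 𝔟 ⊴ ℤ[ω], N(𝔟) ≤ R} a(𝔟) χ_q(𝔟) N(𝔟)^{−1/2}. Then for any s = σ + it with t ∈ ℝ, σ ∈ [1/2, 1], and T := |t| + 1: ∑_{q ∈ F₃(Q₁, Q₂), (q, h) = 1} |L(s, χ_{qh}) · ℛ(qh)|² ≪_{ε,σ} (Q₁Q₂HT)^ε ( Q* (Q₁Q₂H)^{1/2} T R + (Q* H)^{1/3} Q₁Q₂ (TR)^{2/3} ) for every ε > 0. -/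

import Mathlib

noncomputable section

open Complex

namespace CubicPaper

/-- `ω = e^{2πi/3}`. -/
def ωc : ℂ := Complex.exp (2 * Real.pi * Complex.I / 3)

/-- The ring of Eisenstein integers `ℤ[ω]`, realized as a subring of `ℂ`. -/
def Eis : Subring ℂ := Subring.closure {ωc}

/-- `ω` as an Eisenstein integer. -/
def ωE : Eis := ⟨ωc, Subring.subset_closure (Set.mem_singleton _)⟩

/-- The ramified prime `λ = 1 + 2ω`. -/
def lam : Eis := 1 + 2 * ωE

/-- The norm `N(x) = |x|²`. -/
def Nm (x : Eis) : ℝ := Complex.normSq (x : ℂ)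

/-- The norm as a natural number. -/
def NmN (x : Eis) : ℕ := ⌊Nm x⌋₊

/-- `Rep x` : `x` is the canonical generator `λ^k c`, `c ≡ 1 (mod 3)`, of a nonzero ideal;
nonzero ideals of `ℤ[ω]` are in bijection with elements satisfying `Rep`. -/
def Rep (x : Eis) : Prop := ∃ (k : ℕ) (c : Eis), (3 : Eis) ∣ (c - 1) ∧ x = lam ^ k * c

/-- `ě(z) = e^{2πi(z + z̄)}`. -/
def eE (z : ℂ) : ℂ := Complex.exp (2 * Real.pi * Complex.I * (z + (starRingEnd ℂ) z))

/-- Characterizing axioms of the cubic residue symbol; `χ b a` denotes `(a/b)₃`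
(the lower entry `b ≡ 1 (mod 3)` comes first). -/
structure IsCubicSymbol (χ : Eis → Eis → Eis) : Prop where
  one_bot : ∀ a, χ 1 a = 1
  mul_bot : ∀ b₁ b₂ a, (3 : Eis) ∣ (b₁ - 1) → (3 : Eis) ∣ (b₂ - 1) →
    χ (b₁ * b₂) a = χ b₁ a * χ b₂ a
  prime_vals : ∀ π a, Prime π → (3 : Eis) ∣ (π - 1) →
    χ π a = 0 ∨ χ π a = 1 ∨ χ π a = ωE ∨ χ π a = ωE ^ 2
  prime_congr : ∀ π a, Prime π → (3 : Eis) ∣ (π - 1) →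
    π ∣ (a ^ ((NmN π - 1) / 3) - χ π a)
  prime_eq_zero : ∀ π a, Prime π → (3 : Eis) ∣ (π - 1) → (χ π a = 0 ↔ π ∣ a)

/-- Characterizing axioms of the Möbius function on `ℤ[ω]`. -/
structure IsMoebius (μ : Eis → ℤ) : Prop where
  isUnit : ∀ u : Eis, IsUnit u → μ u = 1
  prime_mul : ∀ p x, Prime p → ¬ p ∣ x → μ (p * x) = - μ x
  eq_zero : ∀ x : Eis, ¬ Squarefree x → μ x = 0

/-- The cubic Gauss sum `g₃(m, c) = ∑_{d mod c} χ_c(d) ě(md/c)`. -/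
def g₃ (χ : Eis → Eis → Eis) (m c : Eis) : ℂ :=
  ∑ᶠ d : Eis ⧸ Ideal.span {c}, ((χ c d.out : Eis) : ℂ) * eE (((m * d.out : Eis) : ℂ) / (c : ℂ))

/-- The normalized cubic Gauss sum `g̃₃(m, c) = N(c)^{-1/2} g₃(m, c)`. -/
def g₃n (χ : Eis → Eis → Eis) (m c : Eis) : ℂ :=
  ((Real.sqrt (Nm c) : ℂ))⁻¹ * g₃ χ m c

/-- Euler's totient on `ℤ[ω]`. -/
def phiE (b : Eis) : ℕ := Nat.card {x : Eis ⧸ Ideal.span {b} // IsUnit x}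

/-- The kernel `Φ_j(y) = (1/2πi)∫_{(2)} (2π)^{-jw} y^{-w} (Γ(1/2+w)/Γ(1/2))^j dw/w`. -/
def Φ (j : ℕ) (y : ℝ) : ℂ :=
  (1 / (2 * Real.pi)) * ∫ t : ℝ,
    (2 * Real.pi : ℂ) ^ (-((j : ℂ) * (2 + t * Complex.I))) *
    (y : ℂ) ^ (-(2 + t * Complex.I)) *
    (Complex.Gamma (1 / 2 + (2 + t * Complex.I)) / Complex.Gamma (1 / 2)) ^ j /
    (2 + t * Complex.I)

/-- `A₁(q)`, the sum appearing in the approximate functional equation for `L(1/2, χ_q)`. -/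
def A₁ (χ : Eis → Eis → Eis) (q : Eis) : ℂ :=
  ∑' n : {x : Eis // Rep x},
    ((χ q n.1 : Eis) : ℂ) * (Nm n.1 : ℂ) ^ (-(1/2 : ℂ)) *
      Φ 1 (Nm n.1 / Real.sqrt (3 * Nm q))

/-- `A₂(q)`, the double sum appearing in the approximate functional equation for
`|L(1/2, χ_q)|²`. -/
def A₂ (χ : Eis → Eis → Eis) (q : Eis) : ℂ :=
  ∑' p : {x : Eis // Rep x} × {x : Eis // Rep x},
    ((χ q p.1.1 : Eis) : ℂ) * (starRingEnd ℂ) ((χ q p.2.1 : Eis) : ℂ) *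
      ((Nm p.1.1 * Nm p.2.1 : ℝ) : ℂ) ^ (-(1/2 : ℂ)) *
      Φ 2 (Nm p.1.1 * Nm p.2.1 / (3 * Nm q))

/-- `M_Y(q) = ∑_{𝔩² ∣ q, N(𝔩) ≤ Y} μ(𝔩)` (sum over nonzero ideals `𝔩`, i.e. over
canonical generators). -/
def MY (μ : Eis → ℤ) (Y : ℝ) (q : Eis) : ℤ :=
  ∑ᶠ l ∈ {l : Eis | Rep l ∧ l ^ 2 ∣ q ∧ Nm l ≤ Y}, μ l

/-- `R_Y(q) = ∑_{𝔩² ∣ q, N(𝔩) > Y} μ(𝔩)`. -/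
def RY (μ : Eis → ℤ) (Y : ℝ) (q : Eis) : ℤ :=
  ∑ᶠ l ∈ {l : Eis | Rep l ∧ l ^ 2 ∣ q ∧ Y < Nm l}, μ l

/-- The mollifier `𝓜(q) = ∑_𝔟 λ(𝔟) √N(𝔟) χ_q(𝔟)` attached to coefficients `lm`
(supported on canonical generators of squarefree ideals coprime to 3). -/
def Moll (χ : Eis → Eis → Eis) (lm : Eis → ℂ) (q : Eis) : ℂ :=
  ∑ᶠ b : Eis, lm b * (Real.sqrt (Nm b) : ℂ) * ((χ q b : Eis) : ℂ)

/-- `𝒮_M(β; F) = ∑_{q ≡ 1 (9)} M_Y(q) β_q F(N(q)/X)`. -/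
def SM (μ : Eis → ℤ) (Y X : ℝ) (F : ℝ → ℝ) (β : Eis → ℂ) : ℂ :=
  ∑ᶠ q ∈ {q : Eis | (9 : Eis) ∣ (q - 1)}, (MY μ Y q : ℂ) * β q * (F (Nm q / X) : ℂ)

/-- `𝒮_R(|β|; F) = ∑_{q ≡ 1 (9)} |R_Y(q)| ‖β_q‖ F(N(q)/X)`. -/
def SR (μ : Eis → ℤ) (Y X : ℝ) (F : ℝ → ℝ) (β : Eis → ℂ) : ℝ :=
  ∑ᶠ q ∈ {q : Eis | (9 : Eis) ∣ (q - 1)}, |(RY μ Y q : ℝ)| * ‖β q‖ * F (Nm q / X)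

/-- A test function: Schwartz (here: smooth), compactly supported in `(1,2)`,
with `0 ≤ F ≤ 1`. -/
structure IsTestFn (F : ℝ → ℝ) : Prop where
  smooth : ContDiff ℝ (⊤ : ℕ∞) F
  supp : ∀ t, F t ≠ 0 → 1 < t ∧ t < 2
  nonneg : ∀ t, 0 ≤ F t
  le_one : ∀ t, F t ≤ 1

/-- `F̌(0) = ∫₀^∞ F(t) dt`. -/
def Fcheck0 (F : ℝ → ℝ) : ℝ := ∫ t in Set.Ioi (0:ℝ), F t

/-- `F̌'(0) = ∫₀^∞ F(t) log t dt`. -/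
def Fcheck'0 (F : ℝ → ℝ) : ℝ := ∫ t in Set.Ioi (0:ℝ), F t * Real.log t

/-- The Dedekind zeta function of `ℚ(ω)` (at real `s > 1`). -/
def zetaK (s : ℝ) : ℝ := ∑' n : {x : Eis // Rep x}, (Nm n.1) ^ (-s)

/-- Product of `f(N(𝔭))` over the prime ideals `𝔭 ∤ 3` of `ℤ[ω]`, i.e. over primes
`π ≡ 1 (mod 3)` (one in each associate class). -/
def primeProd (f : ℝ → ℝ) : ℝ :=
  ∏' π : {p : Eis // Prime p ∧ (3 : Eis) ∣ (p - 1)}, f (Nm π.1)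

/-- Product of `f(N(𝔭))` over the prime ideals `𝔭 ∤ 3` dividing `x` (a finite product). -/
def primeDivProd (f : ℝ → ℝ) (x : Eis) : ℝ :=
  ∏ᶠ π ∈ {p : Eis | Prime p ∧ (3 : Eis) ∣ (p - 1) ∧ p ∣ x}, f (Nm π)

/-- The Hecke `L`-series `∑_𝔫 χ_q(𝔫) N(𝔫)^{-s}` (convergent for `Re(s) > 1`). -/
def heckeSeries (χ : Eis → Eis → Eis) (q : Eis) (s : ℂ) : ℂ :=
  ∑' n : {x : Eis // Rep x}, ((χ q n.1 : Eis) : ℂ) * (Nm n.1 : ℂ) ^ (-s)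

/-- `L` is the (unique) entire continuation of the Hecke `L`-series of `χ_q`. -/
def IsHeckeL (χ : Eis → Eis → Eis) (q : Eis) (L : ℂ → ℂ) : Prop :=
  Differentiable ℂ L ∧ ∀ s : ℂ, 1 < s.re → L s = heckeSeries χ q s

/-- Membership in the family `F₃` of conductors of primitive cubic Hecke characters
congruent to `1 (mod 9)`. -/
def memF₃ (q : Eis) : Prop :=
  ∃ q₁ q₂ : Eis, (3 : Eis) ∣ (q₁ - 1) ∧ (3 : Eis) ∣ (q₂ - 1) ∧ Squarefree (q₁ * q₂) ∧
    NmN (q₁ * q₂ ^ 2) % 9 = 1 ∧ q = q₁ * q₂ ^ 2 ∧ (9 : Eis) ∣ (q - 1) ∧ q ≠ 1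

/-- `ψ_α(r, s) = ∑_{c ≡ 1 (3), (c, α) = 1} g₃(r, c) N(c)^{-s}`. -/
def ψa (χ : Eis → Eis → Eis) (α r : Eis) (s : ℂ) : ℂ :=
  ∑' c : {c : Eis // (3 : Eis) ∣ (c - 1) ∧ IsCoprime c α},
    g₃ χ r c.1 * (Nm c.1 : ℂ) ^ (-s)

/-- `ψ(r, s) = ∑_{c ≡ 1 (3)} g₃(r, c) N(c)^{-s}`. -/
def ψ₀ (χ : Eis → Eis → Eis) (r : Eis) (s : ℂ) : ℂ :=
  ∑' c : {c : Eis // (3 : Eis) ∣ (c - 1)}, g₃ χ r c.1 * (Nm c.1 : ℂ) ^ (-s)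

/-- `Δ_α(s) = ∏_{π ≡ 1 (3) prime, π ∣ α} (1 - N(π)^{2-3s})`. -/
def Δprod (α : Eis) (s : ℂ) : ℂ :=
  ∏ᶠ π ∈ {p : Eis | Prime p ∧ (3 : Eis) ∣ (p - 1) ∧ p ∣ α},
    (1 - (Nm π : ℂ) ^ ((2 : ℂ) - 3 * s))

/-- `Ψ` is the (unique) continuation of `ψ(r, ·)` to the strip `1 < Re(s) < 2`,
holomorphic away from `s = 4/3`. -/
def IsPsiContinuation (χ : Eis → Eis → Eis) (r : Eis) (Ψ : ℂ → ℂ) : Prop :=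
  (∀ s : ℂ, 1 < s.re → s.re < 2 → s ≠ 4/3 → DifferentiableAt ℂ Ψ s) ∧
  (∀ s : ℂ, 3/2 < s.re → s.re < 2 → Ψ s = ψ₀ χ r s)


/-- Membership in `F₃(Q₁, Q₂)`, with explicit `≍`-constants `c₁ ≤ c₂`. -/
def memF₃Q (c₁ c₂ Q₁ Q₂ : ℝ) (q : Eis) : Prop :=
  ∃ q₁ q₂ : Eis, (3 : Eis) ∣ (q₁ - 1) ∧ (3 : Eis) ∣ (q₂ - 1) ∧ Squarefree (q₁ * q₂) ∧
    NmN (q₁ * q₂ ^ 2) % 9 = 1 ∧ q = q₁ * q₂ ^ 2 ∧ (9 : Eis) ∣ (q - 1) ∧ q ≠ 1 ∧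
    c₁ * Q₁ ≤ Nm q₁ ∧ Nm q₁ ≤ c₂ * Q₁ ∧ c₁ * Q₂ ≤ Nm q₂ ∧ Nm q₂ ≤ c₂ * Q₂

/-- The cubic Dirichlet polynomial `ℛ(q) = ∑_{N(𝔟) ≤ R} a(𝔟) χ_q(𝔟) N(𝔟)^{-1/2}`. -/
def Rpoly (χ : Eis → Eis → Eis) (a : Eis → ℂ) (R : ℝ) (q : Eis) : ℂ :=
  ∑ᶠ b ∈ {b : Eis | Rep b ∧ Nm b ≤ R},
    a b * ((χ q b : Eis) : ℂ) * ((Real.sqrt (Nm b) : ℂ))⁻¹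

lemma ωc_eq : ωc = ⟨-1/2, Real.sqrt 3 / 2⟩ := by
  unfold ωc
  have : (2 * Real.pi * Complex.I / 3 : ℂ) = ((2 * Real.pi / 3 : ℝ) : ℂ) * Complex.I := by
    push_cast; ring
  rw [this, Complex.exp_mul_I, ← Complex.ofReal_cos, ← Complex.ofReal_sin]
  have h1 : (2 * Real.pi / 3 : ℝ) = Real.pi - Real.pi / 3 := by ring
  rw [h1, Real.cos_pi_sub, Real.sin_pi_sub, Real.cos_pi_div_three, Real.sin_pi_div_three]
  apply Complex.ext <;> simp <;> norm_num

lemma ωc_re : ωc.re = -1/2 := by rw [ωc_eq]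
lemma ωc_im : ωc.im = Real.sqrt 3 / 2 := by rw [ωc_eq]

lemma ωc_sq : ωc ^ 2 = -1 - ωc := by
  rw [ωc_eq, sq]
  have h3 : Real.sqrt 3 * Real.sqrt 3 = 3 := Real.mul_self_sqrt (by norm_num)
  apply Complex.ext <;> simp <;> nlinarith

lemma ωE_sq : ωE ^ 2 = -1 - ωE := by
  apply Subtype.ext; simpa [ωE] using ωc_sq

lemma ωE_cube : ωE ^ 3 = 1 := by
  linear_combination (ωE - 1) * ωE_sq

@[simp] lemma coe_ωE : ((ωE : Eis) : ℂ) = ωc := rfl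

def mk (a b : ℤ) : Eis := (a : Eis) + (b : Eis) * ωE

lemma coe_mk (a b : ℤ) : ((mk a b : Eis) : ℂ) = a + b * ωc := by
  simp [mk]

lemma exists_mk (x : Eis) : ∃ a b : ℤ, x = mk a b := by
  obtain ⟨x, hx⟩ := x
  refine Subring.closure_induction (p := fun x hx => ∃ a b : ℤ, (⟨x, hx⟩ : Eis) = mk a b) ?_ ?_ ?_ ?_ ?_ ?_ hx
  · intro x hx
    obtain rfl := Set.mem_singleton_iff.1 hx
    exact ⟨0, 1, by apply Subtype.ext; simp [coe_mk]⟩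
  · exact ⟨0, 0, by apply Subtype.ext; simp [coe_mk]⟩
  · exact ⟨1, 0, by apply Subtype.ext; simp [coe_mk]⟩
  · rintro x y hx hy ⟨a, b, h⟩ ⟨c, d, h'⟩
    refine ⟨a + c, b + d, ?_⟩
    apply Subtype.ext
    have h1 := congrArg Subtype.val h
    have h2 := congrArg Subtype.val h'
    simp only [coe_mk] at h1 h2 ⊢
    rw [h1, h2]; push_cast; ring
  · rintro x hx ⟨a, b, h⟩
    refine ⟨-a, -b, ?_⟩
    apply Subtype.ext
    have h1 := congrArg Subtype.val h
    simp only [coe_mk] at h1 ⊢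
    rw [h1]; push_cast; ring
  · rintro x y hx hy ⟨a, b, h⟩ ⟨c, d, h'⟩
    refine ⟨a * c - b * d, a * d + b * c - b * d, ?_⟩
    apply Subtype.ext
    have h1 := congrArg Subtype.val h
    have h2 := congrArg Subtype.val h'
    simp only [coe_mk] at h1 h2 ⊢
    rw [h1, h2]; push_cast
    linear_combination (b * d : ℂ) * ωc_sq

lemma mk_inj {a b c d : ℤ} (h : mk a b = mk c d) : a = c ∧ b = d := by
  have h1 := congrArg (fun x : Eis => (x : ℂ)) h
  simp only [coe_mk] at h1
  have him := congrArg Complex.im h1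
  have hre := congrArg Complex.re h1
  simp [ωc_re, ωc_im] at him hre
  subst him
  refine ⟨?_, rfl⟩
  have h : (a:ℝ) = c := by linarith
  exact_mod_cast h

lemma Nm_mk (a b : ℤ) : Nm (mk a b) = ((a ^ 2 - a * b + b ^ 2 : ℤ) : ℝ) := by
  unfold Nm
  rw [coe_mk, Complex.normSq_apply]
  have h3 : Real.sqrt 3 * Real.sqrt 3 = 3 := Real.mul_self_sqrt (by norm_num)
  simp [ωc_re, ωc_im]
  linear_combination (b:ℝ)^2/4 * h3

lemma Nm_nonneg (x : Eis) : 0 ≤ Nm x := Complex.normSq_nonneg _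

lemma Nm_eq_NmN (x : Eis) : Nm x = NmN x := by
  obtain ⟨a, b, rfl⟩ := exists_mk x
  unfold NmN
  have h := Nm_mk a b
  have h0 := Nm_nonneg (mk a b)
  rw [h] at h0 ⊢
  have h0' : 0 ≤ a ^ 2 - a * b + b ^ 2 := by exact_mod_cast h0
  obtain ⟨n, hn⟩ := Int.eq_ofNat_of_zero_le h0'
  rw [hn]
  have : (((n : ℕ) : ℤ) : ℝ) = (n : ℝ) := by norm_cast
  rw [this, Nat.floor_natCast]

lemma NmN_mk (a b : ℤ) : (NmN (mk a b) : ℤ) = a ^ 2 - a * b + b ^ 2 := by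
  have h := Nm_mk a b
  rw [Nm_eq_NmN] at h
  exact_mod_cast h

@[simp] lemma Nm_mul (x y : Eis) : Nm (x * y) = Nm x * Nm y := by
  simp [Nm]
@[simp] lemma Nm_pow (x : Eis) (k : ℕ) : Nm (x ^ k) = Nm x ^ k := by
  simp [Nm]
@[simp] lemma Nm_one : Nm 1 = 1 := by simp [Nm]
@[simp] lemma Nm_zero : Nm 0 = 0 := by simp [Nm]
@[simp] lemma Nm_neg (x : Eis) : Nm (-x) = Nm x := by simp [Nm]
@[simp] lemma NmN_mul (x y : Eis) : NmN (x * y) = NmN x * NmN y := by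
  have := Nm_mul x y
  simp only [Nm_eq_NmN] at this
  exact_mod_cast this
@[simp] lemma NmN_one : NmN 1 = 1 := by simp [NmN]
@[simp] lemma NmN_zero : NmN 0 = 0 := by simp [NmN]

@[simp] lemma Nm_eq_zero {x : Eis} : Nm x = 0 ↔ x = 0 := by
  simp [Nm]
lemma Nm_pos {x : Eis} (hx : x ≠ 0) : 0 < Nm x :=
  lt_of_le_of_ne (Nm_nonneg x) (fun h => hx (Nm_eq_zero.1 h.symm))
lemma NmN_pos {x : Eis} (hx : x ≠ 0) : 0 < NmN x := by
  have := Nm_pos hx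
  rw [Nm_eq_NmN] at this
  exact_mod_cast this
@[simp] lemma NmN_eq_zero {x : Eis} : NmN x = 0 ↔ x = 0 := by
  constructor
  · intro h; by_contra hx; exact absurd (NmN_pos hx) (by omega)
  · rintro rfl; simp
lemma one_le_Nm {x : Eis} (hx : x ≠ 0) : 1 ≤ Nm x := by
  rw [Nm_eq_NmN]; exact_mod_cast NmN_pos hx

lemma Nm_eq_norm_sq (x : Eis) : Nm x = ‖(x : ℂ)‖ ^ 2 := by
  rw [Nm, Complex.normSq_eq_norm_sq]

/-- conjugation on `Eis` -/
lemma conj_mem (x : Eis) : (starRingEnd ℂ) (x : ℂ) ∈ Eis := by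
  obtain ⟨a, b, rfl⟩ := exists_mk x
  have : (starRingEnd ℂ) ((mk a b : Eis) : ℂ) = ((mk (a - b) (-b) : Eis) : ℂ) := by
    rw [coe_mk, coe_mk]
    have h : (starRingEnd ℂ) ωc = -1 - ωc := by
      rw [ωc_eq]; apply Complex.ext <;> simp; norm_num
    simp [h]; ring
  rw [this]; exact (mk (a - b) (-b)).2

def cj : Eis →+* Eis where
  toFun x := ⟨(starRingEnd ℂ) (x : ℂ), conj_mem x⟩
  map_one' := by apply Subtype.ext; simp
  map_mul' x y := by apply Subtype.ext; simp
  map_zero' := by apply Subtype.ext; simp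
  map_add' x y := by apply Subtype.ext; simp

@[simp] lemma coe_cj (x : Eis) : ((cj x : Eis) : ℂ) = (starRingEnd ℂ) (x : ℂ) := rfl
@[simp] lemma cj_cj (x : Eis) : cj (cj x) = x := by apply Subtype.ext; simp
@[simp] lemma Nm_cj (x : Eis) : Nm (cj x) = Nm x := by simp [Nm]
@[simp] lemma NmN_cj (x : Eis) : NmN (cj x) = NmN x := by simp [NmN]
lemma mul_cj (x : Eis) : x * cj x = (NmN x : Eis) := by
  apply Subtype.ext
  simp only [Subring.coe_mul, coe_cj, Complex.mul_conj, Subring.coe_natCast]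
  have := Nm_eq_NmN x
  unfold Nm at this
  rw [this]; simp
lemma cj_ωE : cj ωE = ωE ^ 2 := by
  rw [ωE_sq]
  apply Subtype.ext
  simp only [coe_cj, coe_ωE, AddSubgroupClass.coe_sub, NegMemClass.coe_neg, OneMemClass.coe_one]
  rw [ωc_eq]; apply Complex.ext <;> simp; norm_num
def cjE : Eis ≃+* Eis := RingEquiv.ofRingHom cj cj (by ext x; simp) (by ext x; simp)
@[simp] lemma cjE_apply (x : Eis) : cjE x = cj x := rfl

lemma isUnit_iff_NmN {x : Eis} : IsUnit x ↔ NmN x = 1 := by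
  constructor
  · rintro ⟨u, rfl⟩
    have : NmN (u : Eis) * NmN ((u⁻¹ : Eisˣ) : Eis) = 1 := by
      rw [← NmN_mul]; simp
    exact Nat.eq_one_of_mul_eq_one_right this
  · intro h
    have := mul_cj x
    rw [h] at this
    exact IsUnit.of_mul_eq_one _ (by simpa using this)

/-- division with remainder -/
lemma exists_quot (x y : Eis) (hy : y ≠ 0) : ∃ q : Eis, NmN (x - y * q) < NmN y := by
  obtain ⟨A, B, hAB⟩ := exists_mk (x * cj y)
  set n := NmN y with hn
  have hnpos : 0 < n := NmN_pos hy
  obtain ⟨a, ha⟩ : ∃ a : ℤ, 2 * |A - n * a| ≤ n := by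
    refine ⟨round ((A : ℚ) / n), ?_⟩
    have := abs_sub_round ((A : ℚ) / n)
    have h1 : |(A : ℚ) - n * round ((A : ℚ) / n)| = n * |(A : ℚ) / n - round ((A : ℚ) / n)| := by
      rw [← abs_of_pos (show (0:ℚ) < n by exact_mod_cast hnpos), ← abs_mul,
        abs_of_pos (show (0:ℚ) < n by exact_mod_cast hnpos)]
      congr 1; field_simp
    have h2 : 2 * |(A : ℚ) - n * round ((A : ℚ) / n)| ≤ n := by
      rw [h1]
      have : (0:ℚ) < n := by exact_mod_cast hnpos
      nlinarith
    exact_mod_cast h2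
  obtain ⟨b, hb⟩ : ∃ a : ℤ, 2 * |B - n * a| ≤ n := by
    refine ⟨round ((B : ℚ) / n), ?_⟩
    have := abs_sub_round ((B : ℚ) / n)
    have h1 : |(B : ℚ) - n * round ((B : ℚ) / n)| = n * |(B : ℚ) / n - round ((B : ℚ) / n)| := by
      rw [← abs_of_pos (show (0:ℚ) < n by exact_mod_cast hnpos), ← abs_mul,
        abs_of_pos (show (0:ℚ) < n by exact_mod_cast hnpos)]
      congr 1; field_simp
    have h2 : 2 * |(B : ℚ) - n * round ((B : ℚ) / n)| ≤ n := by
      rw [h1]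
      have : (0:ℚ) < n := by exact_mod_cast hnpos
      nlinarith
    exact_mod_cast h2
  refine ⟨mk a b, ?_⟩
  have key : (x - y * mk a b) * cj y = mk (A - n * a) (B - n * b) := by
    have h2 := mul_cj y
    rw [← hn] at h2
    have h3 : mk (A - n * a) (B - n * b) = mk A B - (n : Eis) * mk a b := by
      simp [mk]; ring
    rw [h3, ← hAB]
    linear_combination (-mk a b) * h2
  have h4 : ((NmN (x - y * mk a b) * n : ℕ) : ℤ) =
      (A - n * a)^2 - (A - n * a) * (B - n * b) + (B - n * b)^2 := by
    rw [← NmN_mk, ← key, NmN_mul, NmN_cj]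
  set u := A - n * a
  set v := B - n * b
  have hu := abs_le.1 (show |2 * u| ≤ n by rw [abs_mul]; simpa using ha)
  have hv := abs_le.1 (show |2 * v| ≤ n by rw [abs_mul]; simpa using hb)
  have hn0 : (0:ℤ) < n := by exact_mod_cast hnpos
  have h5 : (u^2 - u * v + v^2) < n * n := by nlinarith
  rw [← h4] at h5
  have h6 : NmN (x - y * mk a b) * n < n * n := by exact_mod_cast h5
  exact lt_of_mul_lt_mul_right h6 (Nat.zero_le _)

instance : IsPrincipalIdealRing Eis := by
  constructor
  intro I
  by_cases hI : I = ⊥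
  · exact ⟨0, by simp [hI]⟩
  have hex : ∃ n : ℕ, ∃ x ∈ I, x ≠ 0 ∧ NmN x = n := by
    obtain ⟨x, hx, h0⟩ := Submodule.exists_mem_ne_zero_of_ne_bot hI
    exact ⟨_, x, hx, h0, rfl⟩
  classical
  obtain ⟨y, hy, hy0, hyn⟩ := Nat.find_spec hex
  refine ⟨y, le_antisymm ?_ ?_⟩
  · intro x hx
    obtain ⟨q, hq⟩ := exists_quot x y hy0
    rw [Ideal.submodule_span_eq, Ideal.mem_span_singleton]
    by_cases h : x - y * q = 0
    · exact ⟨q, sub_eq_zero.1 h⟩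
    · exfalso
      have := Nat.find_min' hex ⟨_, I.sub_mem hx (I.mul_mem_right q hy), h, rfl⟩
      omega
  · rw [Ideal.submodule_span_eq, Ideal.span_le]; simpa using hy

example : UniqueFactorizationMonoid Eis := inferInstance

lemma lam_sq : lam ^ 2 = -3 := by
  unfold lam; linear_combination 4 * ωE_sq
lemma lam_eq_mk : lam = mk 1 2 := by simp [lam, mk]
lemma NmN_lam : NmN lam = 3 := by
  have := NmN_mk 1 2
  rw [← lam_eq_mk] at this
  norm_num at this; exact_mod_cast this
lemma Nm_lam : Nm lam = 3 := by rw [Nm_eq_NmN, NmN_lam]; norm_num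
lemma lam_ne_zero : lam ≠ 0 := by
  intro h; have := NmN_lam; rw [h] at this; simp at this

lemma prime_of_NmN_prime {x : Eis} (h : (NmN x).Prime) : Prime x := by
  rw [← irreducible_iff_prime]
  constructor
  · rw [isUnit_iff_NmN]; exact h.one_lt.ne'
  · intro a b hab
    rw [hab, NmN_mul] at h
    rw [isUnit_iff_NmN, isUnit_iff_NmN]
    rcases Nat.prime_mul_iff.1 h with h | h
    · right; exact h.2
    · left; exact h.2

lemma prime_lam : Prime lam := prime_of_NmN_prime (by rw [NmN_lam]; norm_num)

lemma lam_dvd_three : lam ∣ 3 := ⟨-lam, by linear_combination lam_sq⟩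

/-- primary elements -/
def Pr (c : Eis) : Prop := (3 : Eis) ∣ (c - 1)

lemma Pr_one : Pr 1 := by simp [Pr]
lemma Pr.mul {a b : Eis} (ha : Pr a) (hb : Pr b) : Pr (a * b) := by
  obtain ⟨x, hx⟩ := ha
  obtain ⟨y, hy⟩ := hb
  exact ⟨a * y + x, by linear_combination a * hy + hx⟩
lemma Pr.pow {a : Eis} (ha : Pr a) (k : ℕ) : Pr (a ^ k) := by
  induction k with
  | zero => simpa using Pr_one
  | succ k ih => rw [pow_succ]; exact ih.mul ha
lemma Pr.cj {a : Eis} (ha : Pr a) : Pr (cj a) := by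
  obtain ⟨x, hx⟩ := ha
  refine ⟨CubicPaper.cj x, ?_⟩
  have := congrArg CubicPaper.cj hx
  rw [map_sub, map_mul, map_one] at this
  rw [this]; congr 1; exact map_ofNat CubicPaper.cj 3
lemma Pr.of_mul {a b : Eis} (ha : Pr a) (hb : Pr (a * b)) : Pr b := by
  obtain ⟨x, hx⟩ := ha
  obtain ⟨y, hy⟩ := hb
  exact ⟨y - x * b, by linear_combination hy - b * hx⟩
lemma Pr.not_lam_dvd {a : Eis} (ha : Pr a) : ¬ lam ∣ a := by
  intro h
  have h1 : lam ∣ 1 := by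
    have := dvd_sub h (lam_dvd_three.trans ha)
    simpa using this
  exact prime_lam.not_unit (isUnit_of_dvd_one h1)
lemma Pr.ne_zero {a : Eis} (ha : Pr a) : a ≠ 0 := by
  rintro rfl; exact ha.not_lam_dvd (dvd_zero _)
lemma three_dvd_mk {a b : ℤ} : (3 : Eis) ∣ mk a b ↔ 3 ∣ a ∧ 3 ∣ b := by
  constructor
  · rintro ⟨x, hx⟩
    obtain ⟨c, d, rfl⟩ := exists_mk x
    have : mk a b = mk (3 * c) (3 * d) := by rw [hx]; simp [mk]; ring
    obtain ⟨rfl, rfl⟩ := mk_inj this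
    exact ⟨⟨c, rfl⟩, ⟨d, rfl⟩⟩
  · rintro ⟨⟨c, rfl⟩, ⟨d, rfl⟩⟩
    exact ⟨mk c d, by simp [mk]; ring⟩
lemma Pr_mk {a b : ℤ} : Pr (mk a b) ↔ a % 3 = 1 ∧ b % 3 = 0 := by
  unfold Pr
  have : mk a b - 1 = mk (a - 1) b := by simp [mk]; ring
  rw [this, three_dvd_mk]; omega
lemma Pr.NmN_mod {a : Eis} (ha : Pr a) : NmN a % 3 = 1 := by
  obtain ⟨x, y, rfl⟩ := exists_mk a
  rw [Pr_mk] at ha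
  have := NmN_mk x y
  obtain ⟨k, hk⟩ : ∃ k, x = 3 * k + 1 := ⟨x / 3, by omega⟩
  obtain ⟨l, hl⟩ : ∃ l, y = 3 * l := ⟨y / 3, by omega⟩
  subst hk hl
  have h2 : (NmN (mk (3 * k + 1) (3 * l)) : ℤ) = 3 * (3 * k ^2 + 2 * k - 3 * k * l - l + 3 * l^2) + 1 := by
    rw [this]; ring
  omega

lemma isUnit_ωE : IsUnit ωE := IsUnit.of_mul_eq_one (ωE ^ 2) (by rw [← ωE_cube]; ring)

lemma exists_unit_Pr {x : Eis} (hx : ¬ lam ∣ x) : ∃ u : Eisˣ, Pr (u * x) := by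
  obtain ⟨a, b, rfl⟩ := exists_mk x
  have hab : (a + b) % 3 ≠ 0 := by
    intro h
    apply hx
    obtain ⟨c, hc⟩ : (3:ℤ) ∣ a + b := by omega
    have h1 : mk a b = 3 * (c : Eis) + b * (lam * (1 + ωE)) := by
      have h2 : (a : Eis) = 3 * c - b := by
        have : a = 3 * c - b := by omega
        rw [this]; push_cast; ring
      unfold mk lam
      rw [h2]; linear_combination (-2 * b : Eis) * ωE_sq
    rw [h1]
    exact dvd_add (lam_dvd_three.mul_right _) (Dvd.intro _ (by ring : lam * ((1 + ωE) * b) = _))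
  obtain ⟨w, hw⟩ := isUnit_ωE
  have hw1 : (w : Eis) * mk a b = mk (-b) (a - b) := by
    rw [hw]; simp [mk]; linear_combination (b : Eis) * ωE_sq
  have hw2 : ((w * w : Eisˣ) : Eis) * mk a b = mk (b - a) (-a) := by
    rw [Units.val_mul, mul_assoc, hw1, hw]; simp [mk]; linear_combination (a - b : Eis) * ωE_sq
  have hn : ∀ c d, ((-1 : Eisˣ) : Eis) * mk c d = mk (-c) (-d) := by
    intro c d; simp [mk]; ring
  have key : (a % 3 = 1 ∧ b % 3 = 0) ∨ (a % 3 = 2 ∧ b % 3 = 0) ∨ (a % 3 = 0 ∧ b % 3 = 1) ∨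
      (a % 3 = 0 ∧ b % 3 = 2) ∨ (a % 3 = 1 ∧ b % 3 = 1) ∨ (a % 3 = 2 ∧ b % 3 = 2) := by omega
  rcases key with h | h | h | h | h | h
  · exact ⟨1, by simpa [Pr_mk] using h⟩
  · exact ⟨-1, by rw [hn, Pr_mk]; omega⟩
  · exact ⟨w * w, by rw [hw2, Pr_mk]; omega⟩
  · exact ⟨-1 * (w * w), by rw [Units.val_mul, mul_assoc, hw2, hn, Pr_mk]; omega⟩
  · exact ⟨-1 * w, by rw [Units.val_mul, mul_assoc, hw1, hn, Pr_mk]; omega⟩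
  · exact ⟨w, by rw [hw1, Pr_mk]; omega⟩

lemma unit_cases {u : Eis} (hu : IsUnit u) :
    u = 1 ∨ u = -1 ∨ u = ωE ∨ u = -ωE ∨ u = ωE ^ 2 ∨ u = -ωE ^ 2 := by
  obtain ⟨a, b, rfl⟩ := exists_mk u
  rw [isUnit_iff_NmN] at hu
  have h := NmN_mk a b
  rw [hu] at h
  have ha : a ^ 2 ≤ 1 := by push_cast at h; nlinarith [sq_nonneg (2 * b - a)]
  have hb : b ^ 2 ≤ 1 := by push_cast at h; nlinarith [sq_nonneg (2 * a - b)]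
  have ha1 : -1 ≤ a := by nlinarith
  have ha2 : a ≤ 1 := by nlinarith
  have hb1 : -1 ≤ b := by nlinarith
  have hb2 : b ≤ 1 := by nlinarith
  have e := ωE_sq
  interval_cases a <;> interval_cases b <;> norm_num at h
  · right; right; right; right; left; rw [e]; simp [mk]; ring
  · right; left; simp [mk]
  · right; right; right; left; simp [mk]
  · right; right; left; simp [mk]
  · left; simp [mk]
  · right; right; right; right; right; rw [e]; simp [mk]; ring

lemma unit_Pr {u : Eis} (hu : IsUnit u) (h : Pr u) : u = 1 := by
  have e : ωE = mk 0 1 := by simp [mk]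
  have e2 : ωE ^ 2 = mk (-1) (-1) := by rw [ωE_sq]; simp [mk]; ring
  have e3 : -ωE ^ 2 = mk 1 1 := by rw [ωE_sq]; simp [mk]; ring
  have e4 : -ωE = mk 0 (-1) := by simp [mk]
  have e5 : (-1 : Eis) = mk (-1) 0 := by simp [mk]
  rcases unit_cases hu with h' | h' | h' | h' | h' | h'
  · exact h'
  all_goals
    exfalso
    rw [h'] at h
    first | rw [e3] at h | rw [e2] at h | rw [e4] at h | rw [e5] at h | rw [e] at h
    rw [Pr_mk] at h; omega

lemma Pr_associated {a b : Eis} (ha : Pr a) (hb : Pr b) (h : Associated a b) : a = b := by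
  obtain ⟨u, rfl⟩ := h
  have := unit_Pr u.isUnit (ha.of_mul hb)
  rw [this, mul_one]

instance : Finite Eisˣ := by
  have : Set.Finite {u : Eis | u = 1 ∨ u = -1 ∨ u = ωE ∨ u = -ωE ∨ u = ωE ^ 2 ∨ u = -ωE ^ 2} := by
    apply Set.Finite.subset (s := (({1, -1, ωE, -ωE, ωE^2, -ωE^2} : Set Eis))) (by simp)
    intro x hx; simpa using hx
  have h2 := this.to_subtype
  exact Finite.of_injective (β := {u : Eis | u = 1 ∨ u = -1 ∨ u = ωE ∨ u = -ωE ∨ u = ωE ^ 2 ∨ u = -ωE ^ 2})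
    (fun u => ⟨u, unit_cases u.isUnit⟩) (fun u v h => by
      apply Units.ext; simpa using h)

lemma Rep.ne_zero {x : Eis} (h : Rep x) : x ≠ 0 := by
  obtain ⟨k, c, hc, rfl⟩ := h
  exact mul_ne_zero (pow_ne_zero _ lam_ne_zero) (Pr.ne_zero hc)

lemma exists_Rep {x : Eis} (hx : x ≠ 0) : ∃ u : Eisˣ, Rep (u * x) := by
  have hfin : FiniteMultiplicity lam x := FiniteMultiplicity.of_prime_left prime_lam hx
  obtain ⟨c, hc, hd⟩ := hfin.exists_eq_pow_mul_and_not_dvd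
  obtain ⟨u, hu⟩ := exists_unit_Pr hd
  exact ⟨u, _, _, hu, by rw [hc]; ring⟩

lemma Rep_unique {x y : Eis} (hx : Rep x) (hy : Rep y) (h : Associated x y) : x = y := by
  obtain ⟨k, c, hc, rfl⟩ := hx
  obtain ⟨l, d, hd, rfl⟩ := hy
  have key : ∀ (k l : ℕ) (c d : Eis), Pr d → lam ^ k * c ∣ lam ^ l * d → k ≤ l := by
    intro k l c d hd h
    have h1 : lam ^ k ∣ lam ^ l * d := (Dvd.intro _ rfl).trans h
    have h2 : IsCoprime (lam ^ k) d :=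
      IsCoprime.pow_left ((Irreducible.coprime_iff_not_dvd prime_lam.irreducible).2 (Pr.not_lam_dvd hd))
    have h3 := h2.dvd_of_dvd_mul_right h1
    exact (pow_dvd_pow_iff lam_ne_zero prime_lam.not_unit).1 h3
  have hkl : k = l := le_antisymm (key _ _ _ _ hd h.dvd) (key _ _ _ _ hc h.symm.dvd)
  subst hkl
  have : Associated c d := by
    obtain ⟨u, hu⟩ := h
    exact ⟨u, mul_left_cancel₀ (pow_ne_zero k lam_ne_zero) (by rw [← hu]; ring)⟩
  rw [Pr_associated hc hd this]

def eisBasis : Module.Basis (Fin 2) ℤ Eis := by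
  refine Module.Basis.mk (v := ![1, ωE]) ?_ ?_
  · rw [LinearIndependent.pair_iff]
    intro s t h
    have : mk s t = mk 0 0 := by
      simp [mk] at h ⊢; exact h
    exact mk_inj this
  · rintro x -
    obtain ⟨a, b, rfl⟩ := exists_mk x
    have : mk a b = a • (1 : Eis) + b • ωE := by simp [mk]
    rw [this]
    apply Submodule.add_mem
    · exact Submodule.smul_mem _ _ (Submodule.subset_span ⟨0, rfl⟩)
    · exact Submodule.smul_mem _ _ (Submodule.subset_span ⟨1, rfl⟩)

instance : Module.Free ℤ Eis := Module.Free.of_basis eisBasis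
instance : Module.Finite ℤ Eis := Module.Finite.of_basis eisBasis

lemma eisBasis_repr (a b : ℤ) : eisBasis.repr (mk a b) = Finsupp.single 0 a + Finsupp.single 1 b := by
  have h0 : eisBasis 0 = 1 := by simp [eisBasis]
  have h1 : eisBasis 1 = ωE := by simp [eisBasis]
  have : mk a b = a • eisBasis 0 + b • eisBasis 1 := by rw [h0, h1]; simp [mk]
  rw [this, map_add, map_zsmul, map_zsmul, Module.Basis.repr_self, Module.Basis.repr_self]; simp

lemma norm_mk (a b : ℤ) : Algebra.norm ℤ (mk a b) = a ^ 2 - a * b + b ^ 2 := by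
  have h0 : eisBasis 0 = 1 := by simp [eisBasis]
  have h1 : eisBasis 1 = ωE := by simp [eisBasis]
  have h2 : mk a b * ωE = mk (-b) (a - b) := by
    simp [mk]; linear_combination (b : Eis) * ωE_sq
  rw [Algebra.norm_eq_matrix_det eisBasis, Matrix.det_fin_two]
  simp [Algebra.leftMulMatrix_eq_repr_mul, h0, h1, h2, eisBasis_repr]
  ring

lemma card_quot (r : Eis) : Nat.card (Eis ⧸ Ideal.span {r}) = NmN r := by
  have h := Ideal.absNorm_span_singleton r
  rw [Ideal.absNorm_apply, Submodule.cardQuot_apply] at h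
  obtain ⟨a, b, rfl⟩ := exists_mk r
  rw [h, norm_mk, ← NmN_mk]; simp

lemma finite_quot {r : Eis} (hr : r ≠ 0) : Finite (Eis ⧸ Ideal.span {r}) :=
  Nat.finite_of_card_ne_zero (by rw [card_quot]; exact (NmN_pos hr).ne')

lemma Nm_mk_ge (a b : ℤ) : (3/4 : ℝ) * ‖(![a, b] : Fin 2 → ℤ)‖ ^ 2 ≤ Nm (mk a b) := by
  rw [Nm_mk]; push_cast
  have h : ‖(![a, b] : Fin 2 → ℤ)‖ = |(a:ℝ)| ∨ ‖(![a, b] : Fin 2 → ℤ)‖ = |(b:ℝ)| := by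
    rcases le_total |(a:ℝ)| |(b:ℝ)| with h | h
    · right
      apply le_antisymm
      · rw [pi_norm_le_iff_of_nonneg (abs_nonneg _)]
        intro i; fin_cases i
        · simpa [Int.norm_eq_abs] using h
        · simp [Int.norm_eq_abs]
      · have := norm_le_pi_norm (![a, b] : Fin 2 → ℤ) 1
        simpa [Int.norm_eq_abs] using this
    · left
      apply le_antisymm
      · rw [pi_norm_le_iff_of_nonneg (abs_nonneg _)]
        intro i; fin_cases i
        · simp [Int.norm_eq_abs]
        · simpa [Int.norm_eq_abs] using h
      · have := norm_le_pi_norm (![a, b] : Fin 2 → ℤ) 0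
        simpa [Int.norm_eq_abs] using this
  rcases h with h | h <;> rw [h, sq_abs]
  · nlinarith [sq_nonneg ((a:ℝ) - 2 * b)]
  · nlinarith [sq_nonneg (2 * (a:ℝ) - b)]

def eisEquiv : (Fin 2 → ℤ) ≃ Eis :=
  Equiv.ofBijective (fun v => mk (v 0) (v 1)) ⟨by
    intro v w h
    obtain ⟨h0, h1⟩ := mk_inj h
    funext i; fin_cases i <;> assumption, by
    intro x
    obtain ⟨a, b, rfl⟩ := exists_mk x
    exact ⟨![a, b], by simp⟩⟩

lemma Nm_eisEquiv_ge (v : Fin 2 → ℤ) : (3/4 : ℝ) * ‖v‖ ^ 2 ≤ Nm (eisEquiv v) := by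
  have := Nm_mk_ge (v 0) (v 1)
  have h : ![v 0, v 1] = v := by funext i; fin_cases i <;> rfl
  rw [h] at this; exact this

lemma summable_Nm {s : ℝ} (hs : 1 < s) : Summable fun x : Eis => Nm x ^ (-s) := by
  rw [← eisEquiv.summable_iff]
  have h := (EisensteinSeries.summable_one_div_norm_rpow (k := 2 * s) (by linarith)).mul_left ((3/4:ℝ) ^ (-s))
  refine Summable.of_nonneg_of_le (fun v => Real.rpow_nonneg (Nm_nonneg _) _) (fun v => ?_) h
  by_cases hv : v = 0
  · subst hv
    have : Nm (eisEquiv 0) = 0 := by simp [eisEquiv, mk]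
    simp only [Function.comp, this]
    rw [Real.zero_rpow (by linarith)]
    positivity
  · have hv' : 0 < ‖v‖ := norm_pos_iff.2 hv
    have h1 := Nm_eisEquiv_ge v
    have h2 : (Nm (eisEquiv v)) ^ (-s) ≤ ((3/4 : ℝ) * ‖v‖ ^ 2) ^ (-s) :=
      Real.rpow_le_rpow_of_nonpos (by positivity) h1 (by linarith)
    refine h2.trans (le_of_eq ?_)
    rw [Real.mul_rpow (by norm_num) (by positivity)]
    congr 1
    rw [← Real.rpow_natCast, ← Real.rpow_mul hv'.le]; congr 1; push_cast; ring

lemma sum_Nm_le {ε : ℝ} (hε : 0 < ε) : ∃ C : ℝ, 0 < C ∧ ∀ (s : Finset Eis) (X β : ℝ), 0 ≤ X → β ≤ 1 + ε →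
    (∀ x ∈ s, x ≠ 0 ∧ Nm x ≤ X) → ∑ x ∈ s, Nm x ^ (-β) ≤ C * X ^ (1 + ε - β) := by
  have hS := summable_Nm (s := 1 + ε) (by linarith)
  refine ⟨(∑' x : Eis, Nm x ^ (-(1+ε))) + 1, ?_, ?_⟩
  · have : 0 ≤ ∑' x : Eis, Nm x ^ (-(1+ε)) := tsum_nonneg (fun x => Real.rpow_nonneg (Nm_nonneg _) _)
    linarith
  intro s X β hXpos hβ hs
  have h1 : ∑ x ∈ s, Nm x ^ (-β) ≤ ∑ x ∈ s, Nm x ^ (-(1+ε)) * X ^ (1 + ε - β) := by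
    apply Finset.sum_le_sum
    intro x hx
    obtain ⟨hx1, hx2⟩ := hs x hx
    have : Nm x ^ (-β) = Nm x ^ (-(1+ε)) * Nm x ^ (1 + ε - β) := by
      rw [← Real.rpow_add (Nm_pos hx1)]; congr 1; ring
    rw [this]
    apply mul_le_mul_of_nonneg_left _ (Real.rpow_nonneg (Nm_nonneg _) _)
    exact Real.rpow_le_rpow (Nm_nonneg _) hx2 (by linarith)
  refine h1.trans ?_
  rw [← Finset.sum_mul]
  apply mul_le_mul_of_nonneg_right _ (Real.rpow_nonneg hXpos _)
  have := hS.sum_le_tsum s (fun x _ => Real.rpow_nonneg (Nm_nonneg _) _)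
  linarith

lemma finite_Nm_le (X : ℝ) : {x : Eis | Nm x ≤ X}.Finite := by
  obtain ⟨C, hC, h⟩ := sum_Nm_le (ε := 1) one_pos
  have : {x : Eis | x ≠ 0 ∧ Nm x ≤ X}.Finite := by
    by_cases hX : X < 0
    · convert Set.finite_empty (α := Eis)
      ext x; simp; intro _; exact hX.trans_le (Nm_nonneg x)
    push Not at hX
    by_contra hinf
    obtain ⟨t, ht, hc⟩ := Set.Infinite.exists_subset_card_eq hinf (⌈C * X ^ (2:ℝ)⌉₊ + 1)
    have := h t X 0 hX (by norm_num) (fun x hx => ht hx)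
    simp [hc] at this
    have h3 := Nat.le_ceil (C * X ^ (2:ℝ))
    norm_num at this h3
    linarith
  apply (this.union (Set.finite_singleton 0)).subset
  intro x hx
  by_cases h0 : x = 0
  · right; simpa using h0
  · left; exact ⟨h0, hx⟩

/-- elements nonzero of norm at most `X` -/
def Ball (X : ℝ) : Finset Eis := Set.Finite.toFinset (s := {x : Eis | x ≠ 0 ∧ Nm x ≤ X}) ((finite_Nm_le X).subset (fun x hx => hx.2))
lemma mem_Ball {X : ℝ} {x : Eis} : x ∈ Ball X ↔ x ≠ 0 ∧ Nm x ≤ X := by simp [Ball]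

/-! primary primes and squarefree elements -/
abbrev PP := {p : Eis // Prime p ∧ Pr p}
def el (P : Finset PP) : Eis := ∏ p ∈ P, p.1
@[simp] lemma el_empty : el ∅ = 1 := by simp [el]
lemma el_insert {p : PP} {P : Finset PP} (h : p ∉ P) : el (insert p P) = p.1 * el P := by
  simp [el, Finset.prod_insert h]
lemma el_union {P Q : Finset PP} (h : Disjoint P Q) : el (P ∪ Q) = el P * el Q :=
  Finset.prod_union h
lemma el_sdiff {P Q : Finset PP} (h : Q ⊆ P) : el (P \ Q) * el Q = el P :=
  Finset.prod_sdiff h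
lemma el_Pr (P : Finset PP) : Pr (el P) := by
  induction P using Finset.induction_on with
  | empty => simpa using Pr_one
  | insert p P hp ih => rw [el_insert hp]; exact p.2.2.mul ih
lemma el_ne_zero (P : Finset PP) : el P ≠ 0 := (el_Pr P).ne_zero
lemma PP_assoc {p q : PP} (h : p.1 ∣ q.1) : p = q :=
  Subtype.ext (Pr_associated p.2.2 q.2.2 ((p.2.1.dvd_prime_iff_associated q.2.1).1 h))
lemma dvd_el {p : PP} {P : Finset PP} : p.1 ∣ el P ↔ p ∈ P := by
  constructor
  · intro h
    obtain ⟨q, hq, hpq⟩ := (Prime.dvd_finset_prod_iff p.2.1 _).1 h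
    rw [PP_assoc hpq]; exact hq
  · intro h; exact Finset.dvd_prod_of_mem _ h
lemma el_inj {P Q : Finset PP} (h : el P = el Q) : P = Q := by
  ext p; rw [← dvd_el, h, dvd_el]
lemma isCoprime_PP {p : PP} {x : Eis} : IsCoprime p.1 x ↔ ¬ p.1 ∣ x :=
  Irreducible.coprime_iff_not_dvd p.2.1.irreducible
lemma isCoprime_el {P : Finset PP} {x : Eis} : IsCoprime (el P) x ↔ ∀ p ∈ P, ¬ p.1 ∣ x := by
  unfold el
  rw [IsCoprime.prod_left_iff]
  simp only [isCoprime_PP]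
lemma isCoprime_el_el {P Q : Finset PP} : IsCoprime (el P) (el Q) ↔ Disjoint P Q := by
  rw [isCoprime_el, Finset.disjoint_left]
  simp only [dvd_el]
lemma el_squarefree (P : Finset PP) : Squarefree (el P) := by
  induction P using Finset.induction_on with
  | empty => simp
  | insert p P hp ih =>
    rw [el_insert hp, squarefree_mul_iff]
    refine ⟨?_, p.2.1.squarefree, ih⟩
    exact (isCoprime_PP.2 (fun h => hp (dvd_el.1 h))).isRelPrime
lemma Nm_el (P : Finset PP) : Nm (el P) = ∏ p ∈ P, Nm p.1 := by
  induction P using Finset.induction_on with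
  | empty => simp
  | insert p P hp ih => rw [el_insert hp, Finset.prod_insert hp, Nm_mul, ih]

lemma exists_PP {p : Eis} (hp : Prime p) (h : ¬ lam ∣ p) : ∃ (u : Eisˣ) (q : PP), p = u * q.1 := by
  obtain ⟨u, hu⟩ := exists_unit_Pr h
  refine ⟨u⁻¹, ⟨u * p, ?_, hu⟩, by simp⟩
  exact (Associated.prime_iff ⟨u, by ring⟩).1 hp

lemma exists_el {x : Eis} (hx : Pr x) (hs : Squarefree x) : ∃ P, x = el P := by
  have key : ∀ x : Eis, x ≠ 0 → ¬ lam ∣ x → Squarefree x → ∃ (u : Eisˣ) (P : Finset PP), x = u * el P := by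
    intro x hx
    induction x using UniqueFactorizationMonoid.induction_on_prime with
    | h₁ => exact absurd rfl hx
    | h₂ x hu => intro _ _; exact ⟨hu.unit, ∅, by simp⟩
    | h₃ a p ha hp ih =>
      intro hl hs
      obtain ⟨u, P, hP⟩ := ih ha (fun h => hl (h.mul_left _)) (hs.of_mul_right)
      obtain ⟨v, q, hq⟩ := exists_PP hp (fun h => hl (h.mul_right _))
      have hqP : q ∉ P := by
        intro h
        obtain ⟨y, hy⟩ := dvd_el.2 h
        apply q.2.1.not_unit
        apply hs q.1
        exact ⟨v * u * y, by rw [hP, hq, hy]; ring⟩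
      exact ⟨v * u, insert q P, by rw [el_insert hqP, hP, hq]; push_cast; ring⟩
  obtain ⟨u, P, hP⟩ := key x hx.ne_zero hx.not_lam_dvd hs
  have : (u : Eis) = 1 := by
    apply unit_Pr u.isUnit
    have := (el_Pr P).of_mul (b := u) (by rw [mul_comm, ← hP]; exact hx)
    exact this
  exact ⟨P, by rw [hP, this, one_mul]⟩

/-- units times small powers of `lam` -/
def VV : Set Eis := {v | ∃ (u : Eisˣ) (i : ℕ), i < 3 ∧ v = u * lam ^ i}
lemma VV_finite : VV.Finite := by
  have : VV ⊆ Set.range (fun p : Eisˣ × Fin 3 => (p.1 : Eis) * lam ^ (p.2 : ℕ)) := by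
    rintro v ⟨u, i, hi, rfl⟩
    exact ⟨(u, ⟨i, hi⟩), rfl⟩
  exact (Set.finite_range _).subset this
def VF : Finset Eis := VV_finite.toFinset
lemma VV_ne_zero {v : Eis} (h : v ∈ VF) : v ≠ 0 := by
  obtain ⟨u, i, hi, rfl⟩ := (VV_finite.mem_toFinset).1 h
  exact mul_ne_zero u.ne_zero (pow_ne_zero _ lam_ne_zero)

lemma exists_fact {x : Eis} (hx : x ≠ 0) : ∃ v ∈ VF, ∃ A B : Finset PP, ∃ c : Eis, c ≠ 0 ∧
    Disjoint A B ∧ x = v * el A * el B ^ 2 * c ^ 3 := by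
  have hV : ∀ v, v ∈ VF ↔ v ∈ VV := fun v => VV_finite.mem_toFinset
  induction x using UniqueFactorizationMonoid.induction_on_prime with
  | h₁ => exact absurd rfl hx
  | h₂ x hu =>
    exact ⟨x, (hV x).2 ⟨hu.unit, 0, by norm_num, by simp⟩, ∅, ∅, 1, one_ne_zero, by simp, by simp⟩
  | h₃ a p ha hp ih =>
    obtain ⟨v, hv, A, B, c, hc, hd, he⟩ := ih ha
    obtain ⟨u, i, hi, rfl⟩ := (hV v).1 hv
    by_cases hl : lam ∣ p
    · obtain ⟨w, hw⟩ := (prime_lam.dvd_prime_iff_associated hp).1 hl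
      by_cases h2 : i < 2
      · exact ⟨u * w * lam ^ (i+1), (hV _).2 ⟨u * w, i+1, by omega, by push_cast; ring⟩, A, B, c, hc, hd, by
          rw [he, ← hw]; ring⟩
      · have : i = 2 := by omega
        subst this
        exact ⟨u * w, (hV _).2 ⟨u * w, 0, by omega, by push_cast; ring⟩, A, B, lam * c,
          mul_ne_zero lam_ne_zero hc, hd, by rw [he, ← hw]; ring⟩
    · obtain ⟨w, q, hq⟩ := exists_PP hp hl
      have hv' : (u * w : Eis) * lam ^ i ∈ VF := (hV _).2 ⟨u * w, i, hi, by push_cast; ring⟩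
      by_cases hA : q ∈ A
      · have hB : q ∉ B := Finset.disjoint_left.1 hd hA
        refine ⟨_, hv', A.erase q, insert q B, c, hc, ?_, ?_⟩
        · rw [Finset.disjoint_insert_right]
          exact ⟨by simp, hd.mono_left (Finset.erase_subset _ _)⟩
        · rw [el_insert hB, he, hq]
          have : el A = q.1 * el (A.erase q) := by
            rw [← el_insert (by simp), Finset.insert_erase hA]
          rw [this]; ring
      · by_cases hB : q ∈ B
        · refine ⟨_, hv', A, B.erase q, q.1 * c, mul_ne_zero q.2.1.ne_zero hc,
            hd.mono_right (Finset.erase_subset _ _), ?_⟩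
          have : el B = q.1 * el (B.erase q) := by
            rw [← el_insert (by simp), Finset.insert_erase hB]
          rw [he, hq, this]; ring
        · refine ⟨_, hv', insert q A, B, c, hc, ?_, ?_⟩
          · rw [Finset.disjoint_insert_left]; exact ⟨hB, hd⟩
          · rw [el_insert hA, he, hq]; ring

/-- squarefree primary elements of norm at most `X` -/
def SS (X : ℝ) : Finset (Finset PP) :=
  Set.Finite.toFinset (s := {P : Finset PP | Nm (el P) ≤ X})
    (Set.Finite.of_finite_image (f := el) ((finite_Nm_le X).subset (by rintro _ ⟨P, hP, rfl⟩; exact hP))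
      (fun P _ Q _ h => el_inj h))
lemma mem_SS {X : ℝ} {P : Finset PP} : P ∈ SS X ↔ Nm (el P) ≤ X := by simp [SS]
lemma one_le_Nm_el (P : Finset PP) : 1 ≤ Nm (el P) := one_le_Nm (el_ne_zero P)

lemma sum_SS_le {ε : ℝ} (hε : 0 < ε) : ∃ C : ℝ, 0 < C ∧ ∀ (s : Finset (Finset PP)) (X β : ℝ), 0 ≤ X → β ≤ 1 + ε →
    (∀ P ∈ s, Nm (el P) ≤ X) → ∑ P ∈ s, Nm (el P) ^ (-β) ≤ C * X ^ (1 + ε - β) := by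
  obtain ⟨C, hC, h⟩ := sum_Nm_le hε
  refine ⟨C, hC, fun s X β hX hβ hs => ?_⟩
  have := h (s.image el) X β hX hβ (by
    intro x hx
    obtain ⟨P, hP, rfl⟩ := Finset.mem_image.1 hx
    exact ⟨el_ne_zero P, hs P hP⟩)
  rwa [Finset.sum_image (fun P _ Q _ h => el_inj h)] at this

/-- divisor type bound -/
lemma pow_card_le {ε : ℝ} (hε : 0 < ε) (k : ℝ) (hk : 1 ≤ k) : ∃ C : ℝ, 1 ≤ C ∧ ∀ P : Finset PP,
    k ^ P.card ≤ C * Nm (el P) ^ ε := by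
  have hk0 : 0 < k := by linarith
  have hfin : {p : PP | Nm p.1 ≤ k ^ (1/ε)}.Finite :=
    Set.Finite.of_finite_image (f := Subtype.val) ((finite_Nm_le (k ^ (1/ε))).subset
      (by rintro _ ⟨P, hP, rfl⟩; exact hP)) (fun P _ Q _ h => Subtype.ext h)
  set F := hfin.toFinset with hF
  refine ⟨k ^ F.card, one_le_pow₀ hk, fun P => ?_⟩
  have key : ∀ p : PP, k ≤ (if p ∈ F then k else 1) * Nm p.1 ^ ε := by
    intro p
    split_ifs with h
    · have := Real.one_le_rpow (one_le_Nm p.2.1.ne_zero) hε.le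
      nlinarith
    · rw [one_mul]
      have h' : k ^ (1/ε) < Nm p.1 := by simpa [hF] using h
      calc k = (k ^ (1/ε)) ^ ε := by rw [← Real.rpow_mul hk0.le]; field_simp; simp
        _ ≤ _ := Real.rpow_le_rpow (by positivity) h'.le hε.le
  calc k ^ P.card = ∏ p ∈ P, k := by simp
    _ ≤ ∏ p ∈ P, ((if p ∈ F then k else 1) * Nm p.1 ^ ε) :=
        Finset.prod_le_prod (fun _ _ => hk0.le) (fun p _ => key p)
    _ = (∏ p ∈ P, (if p ∈ F then k else 1)) * Nm (el P) ^ ε := by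
        rw [Finset.prod_mul_distrib, Nm_el, Real.finsetProd_rpow _ _ (fun p _ => Nm_nonneg _)]
    _ ≤ _ := by
        apply mul_le_mul_of_nonneg_right _ (Real.rpow_nonneg (Nm_nonneg _) _)
        rw [Finset.prod_ite]
        simp only [Finset.prod_const, one_pow, mul_one]
        apply pow_le_pow_right₀ hk
        apply Finset.card_le_card
        intro p hp; exact (Finset.mem_filter.1 hp).2

/-- residue field -/
abbrev KK (p : PP) := Eis ⧸ Ideal.span {p.1}
instance (p : PP) : (Ideal.span {p.1}).IsMaximal :=
  PrincipalIdealRing.isMaximal_of_irreducible p.2.1.irreducible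
instance (p : PP) : Field (KK p) := Ideal.Quotient.field _
instance (p : PP) : Finite (KK p) := finite_quot p.2.1.ne_zero
instance (p : PP) : Fintype (KK p) := Fintype.ofFinite _
instance (p : PP) : DecidableEq (KK p) := Classical.decEq _
lemma card_KK (p : PP) : Fintype.card (KK p) = NmN p.1 := by
  rw [← card_quot, Nat.card_eq_fintype_card]
/-- reduction -/
def rd (p : PP) : Eis →+* KK p := Ideal.Quotient.mk _
lemma rd_eq_zero {p : PP} {a : Eis} : rd p a = 0 ↔ p.1 ∣ a := by
  rw [rd, Ideal.Quotient.eq_zero_iff_mem, Ideal.mem_span_singleton]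
lemma rd_eq {p : PP} {a b : Eis} : rd p a = rd p b ↔ p.1 ∣ a - b := by
  rw [← rd_eq_zero, map_sub, sub_eq_zero]
lemma rd_surj (p : PP) : Function.Surjective (rd p) := Ideal.Quotient.mk_surjective
lemma NmN_PP (p : PP) : NmN p.1 % 3 = 1 := p.2.2.NmN_mod
/-- exponent -/
def ex (p : PP) : ℕ := (NmN p.1 - 1) / 3
lemma ex_eq (p : PP) : 3 * ex p + 1 = NmN p.1 := by
  have := NmN_PP p; unfold ex; omega
lemma ex_pos (p : PP) : 0 < ex p := by
  have h := ex_eq p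
  have : NmN p.1 ≠ 1 := by
    rw [Ne, ← isUnit_iff_NmN]; exact p.2.1.not_unit
  omega
lemma not_dvd_lam (p : PP) : ¬ p.1 ∣ lam := by
  intro h
  have := ((p.2.1.dvd_prime_iff_associated prime_lam).1 h)
  exact p.2.2.not_lam_dvd this.symm.dvd
/-- cube roots of unity -/
def Cu (u : Eis) : Prop := u = 1 ∨ u = ωE ∨ u = ωE ^ 2
lemma Cu.mul {u v : Eis} (hu : Cu u) (hv : Cu v) : Cu (u * v) := by
  have h := ωE_cube
  have h4 : ωE ^ 2 * ωE ^ 2 = ωE := by linear_combination ωE * h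
  have h3 : ωE ^ 2 * ωE = 1 := by linear_combination h
  have h3' : ωE * ωE ^ 2 = 1 := by linear_combination h
  have h2 : ωE * ωE = ωE ^ 2 := by ring
  rcases hu with rfl | rfl | rfl <;> rcases hv with rfl | rfl | rfl <;> simp [Cu, h4, h3, h3', h2]
lemma Cu.cube {u : Eis} (hu : Cu u) : u ^ 3 = 1 := by
  have h := ωE_cube
  rcases hu with rfl | rfl | rfl
  · simp
  · exact h
  · linear_combination (ωE^3+1) * h
lemma Cu.cj {u : Eis} (hu : Cu u) : cj u = u ^ 2 := by
  rcases hu with rfl | rfl | rfl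
  · simp
  · exact cj_ωE
  · rw [map_pow, cj_ωE]
lemma Cu.pow {u : Eis} (hu : Cu u) (k : ℕ) : Cu (u ^ k) := by
  induction k with
  | zero => left; simp
  | succ k ih => rw [pow_succ]; exact ih.mul hu
lemma Cu.ne_zero {u : Eis} (hu : Cu u) : u ≠ 0 := by
  intro h; have := hu.cube; rw [h] at this; simp at this
lemma Cu.eq_of_dvd {p : PP} {u v : Eis} (hu : Cu u) (hv : Cu v) (h : p.1 ∣ u - v) : u = v := by
  have e := ωE_sq
  have c := ωE_cube
  by_contra hne
  apply not_dvd_lam p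
  refine h.trans ?_
  unfold lam
  rcases hu with rfl | rfl | rfl <;> rcases hv with rfl | rfl | rfl <;> first
    | exact absurd rfl hne
    | skip
  · exact ⟨ωE, by linear_combination e⟩
  · exact ⟨-ωE ^ 2, by linear_combination e - ωE * c⟩
  · exact ⟨-ωE, by linear_combination e⟩
  · exact ⟨1, by linear_combination e⟩
  · exact ⟨ωE ^ 2, by linear_combination e - ωE * c⟩
  · exact ⟨-1, by linear_combination e⟩

lemma exists_cs (p : PP) (a : Eis) (h : ¬ p.1 ∣ a) : ∃ u, Cu u ∧ p.1 ∣ a ^ ex p - u := by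
  have h0 : rd p a ≠ 0 := by rwa [Ne, rd_eq_zero]
  have h1 := FiniteField.pow_card_sub_one_eq_one _ h0
  rw [card_KK, ← ex_eq, Nat.add_sub_cancel, mul_comm, pow_mul, ← map_pow, ← map_pow, ← map_one (rd p), rd_eq] at h1
  have e := ωE_sq
  have c := ωE_cube
  have h2 : (a ^ ex p) ^ 3 - 1 = (a ^ ex p - 1) * ((a ^ ex p - ωE) * (a ^ ex p - ωE ^ 2)) := by
    generalize a ^ ex p = y
    linear_combination c + (y ^ 2 - y * ωE) * e
  rw [h2] at h1
  rcases p.2.1.dvd_or_dvd h1 with h | h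
  · exact ⟨1, Or.inl rfl, h⟩
  · rcases p.2.1.dvd_or_dvd h with h | h
    · exact ⟨ωE, Or.inr (Or.inl rfl), h⟩
    · exact ⟨ωE ^ 2, Or.inr (Or.inr rfl), h⟩

open Classical in
/-- the cubic residue symbol for a primary prime -/
def cs (p : PP) (a : Eis) : Eis :=
  if h : p.1 ∣ a then 0 else Classical.choose (exists_cs p a h)
lemma cs_Cu {p : PP} {a : Eis} (h : ¬ p.1 ∣ a) : Cu (cs p a) := by
  rw [cs, dif_neg h]; exact (Classical.choose_spec (exists_cs p a h)).1
lemma cs_congr_pow (p : PP) (a : Eis) : p.1 ∣ a ^ ex p - cs p a := by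
  by_cases h : p.1 ∣ a
  · rw [cs, dif_pos h, sub_zero]; exact dvd_pow h (ex_pos p).ne'
  · rw [cs, dif_neg h]; exact (Classical.choose_spec (exists_cs p a h)).2
lemma cs_eq_zero {p : PP} {a : Eis} : cs p a = 0 ↔ p.1 ∣ a := by
  constructor
  · intro h; by_contra h'; exact (cs_Cu h').ne_zero h
  · intro h; rw [cs, dif_pos h]
lemma rd_cs (p : PP) (a : Eis) : rd p (cs p a) = rd p a ^ ex p := by
  rw [← map_pow, eq_comm, rd_eq]; exact cs_congr_pow p a
lemma cs_unique {p : PP} {a u : Eis} (hu : Cu u) (h : rd p u = rd p a ^ ex p) : cs p a = u := by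
  have ha : ¬ p.1 ∣ a := by
    intro h'
    rw [← rd_eq_zero] at h'
    rw [h', zero_pow (ex_pos p).ne'] at h
    have := congrArg (· ^ 3) h
    simp only [← map_pow, hu.cube] at this
    simp at this
  apply Cu.eq_of_dvd (p := p) (cs_Cu ha) hu
  rw [← rd_eq, rd_cs, h]
lemma cs_congr {p : PP} {a b : Eis} (h : p.1 ∣ a - b) : cs p a = cs p b := by
  by_cases ha : p.1 ∣ a
  · have hb : p.1 ∣ b := by
      have := dvd_sub ha h; simpa using this
    rw [cs_eq_zero.2 ha, cs_eq_zero.2 hb]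
  · have hb : ¬ p.1 ∣ b := by
      intro hb; apply ha; have := dvd_add h hb; simpa using this
    apply cs_unique (cs_Cu hb)
    rw [rd_cs, rd_eq.2 h]
lemma cs_mul (p : PP) (a b : Eis) : cs p (a * b) = cs p a * cs p b := by
  by_cases ha : p.1 ∣ a
  · rw [cs_eq_zero.2 ha, cs_eq_zero.2 (ha.mul_right _), zero_mul]
  by_cases hb : p.1 ∣ b
  · rw [cs_eq_zero.2 hb, cs_eq_zero.2 (hb.mul_left _), mul_zero]
  apply cs_unique ((cs_Cu ha).mul (cs_Cu hb))
  rw [map_mul, rd_cs, rd_cs, map_mul, mul_pow]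
lemma cs_one (p : PP) : cs p 1 = 1 := cs_unique (Or.inl rfl) (by simp)
lemma cs_pow (p : PP) (a : Eis) (k : ℕ) : cs p (a ^ k) = cs p a ^ k := by
  induction k with
  | zero => simp [cs_one]
  | succ k ih => rw [pow_succ, pow_succ, cs_mul, ih]
lemma cs_neg_one (p : PP) : cs p (-1) = 1 := by
  have h : cs p (-1) ^ 2 = 1 := by rw [← cs_pow]; simp [cs_one]
  have h3 := (cs_Cu (p := p) (a := -1) (by
    intro h; exact p.2.1.not_unit (isUnit_of_dvd_unit h (by simp)))).cube
  linear_combination h3 - cs p (-1) * h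
lemma cs_neg (p : PP) (a : Eis) : cs p (-a) = cs p a := by
  rw [← neg_one_mul, cs_mul, cs_neg_one, one_mul]
lemma cs_ωE (p : PP) : cs p ωE = ωE ^ ex p :=
  cs_unique (Cu.pow (Or.inr (Or.inl rfl)) _) (by rw [map_pow])
lemma cs_prod (p : PP) {ι : Type*} (s : Finset ι) (f : ι → Eis) : cs p (∏ i ∈ s, f i) = ∏ i ∈ s, cs p (f i) := by
  classical
  induction s using Finset.induction_on with
  | empty => simp [cs_one]
  | insert i s hi ih => rw [Finset.prod_insert hi, Finset.prod_insert hi, cs_mul, ih]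

/-- conjugate prime -/
def cjP (p : PP) : PP := ⟨cj p.1, (MulEquiv.prime_iff cjE).2 p.2.1, p.2.2.cj⟩
lemma cj_dvd {a b : Eis} (h : a ∣ b) : cj a ∣ cj b := map_dvd cj h
lemma cs_cjP (p : PP) (a : Eis) : cs (cjP p) (cj a) = cj (cs p a) := by
  by_cases ha : p.1 ∣ a
  · rw [cs_eq_zero.2 ha, cs_eq_zero.2 (cj_dvd ha), map_zero]
  · have hu := cs_Cu ha
    apply cs_unique
    · rw [hu.cj]; exact hu.pow 2
    · have := cj_dvd (cs_congr_pow p a)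
      rw [map_sub, map_pow] at this
      have hex : ex (cjP p) = ex p := by simp [ex, cjP]
      rw [hex, ← map_pow, eq_comm, rd_eq]
      exact this

/-- multiplicative character -/
def mc (p : PP) : MulChar (KK p) Eis where
  toFun x := cs p (Function.surjInv (rd_surj p) x)
  map_one' := by
    rw [cs_congr (b := 1), cs_one]
    rw [← rd_eq, Function.surjInv_eq (rd_surj p), map_one]
  map_mul' x y := by
    rw [← cs_mul]; apply cs_congr
    rw [← rd_eq, map_mul]; simp only [Function.surjInv_eq (rd_surj p)]
  map_nonunit' x hx := by
    rw [cs_eq_zero, ← rd_eq_zero, Function.surjInv_eq (rd_surj p)]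
    by_contra h; exact hx (IsUnit.mk0 _ h)
lemma mc_rd (p : PP) (a : Eis) : mc p (rd p a) = cs p a := by
  show cs p _ = _
  apply cs_congr; rw [← rd_eq, Function.surjInv_eq (rd_surj p)]
lemma rd_mc (p : PP) (x : KK p) : rd p (mc p x) = x ^ ex p := by
  obtain ⟨a, rfl⟩ := rd_surj p x
  rw [mc_rd, rd_cs]
lemma mc_cube (p : PP) : mc p ^ 3 = 1 := by
  apply MulChar.ext; intro x
  obtain ⟨a, ha⟩ := rd_surj p x.1
  rw [MulChar.pow_apply_coe, MulChar.one_apply_coe, ← ha, mc_rd]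
  apply (cs_Cu _).cube
  rw [← rd_eq_zero, ha]; exact x.ne_zero
lemma mc_ne_one (p : PP) : mc p ≠ 1 := by
  intro h
  have h1 : ∑ x : KK p, x ^ ex p = 0 := FiniteField.sum_pow_lt_card_sub_one _ _ (by
    rw [card_KK, ← ex_eq]; have := ex_pos p; omega)
  have h2 : ∑ x : KK p, x ^ ex p = rd p (∑ x : KK p, mc p x) := by
    rw [map_sum]; simp only [rd_mc]
  rw [h1, h, MulChar.sum_one_eq_card_units, Fintype.card_units, card_KK] at h2
  have h3 : ((NmN p.1 : ℕ) : KK p) = 0 := by rw [← card_KK]; exact Nat.cast_card_eq_zero _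
  have : 1 ≤ NmN p.1 := by have := ex_eq p; omega
  rw [Nat.cast_sub this] at h2
  simp [h3] at h2
lemma mc_order (p : PP) : orderOf (mc p) = 3 := by
  haveI : Fact (Nat.Prime 3) := ⟨by norm_num⟩
  exact orderOf_eq_prime (mc_cube p) (mc_ne_one p)
lemma mc_sq_ne_one (p : PP) : mc p * mc p ≠ 1 := by
  intro h
  have := mc_cube p
  rw [pow_succ, pow_two, h, one_mul] at this
  exact mc_ne_one p this

lemma prim_root : IsPrimitiveRoot ωE 3 := by
  rw [IsPrimitiveRoot.iff_orderOf]
  haveI : Fact (Nat.Prime 3) := ⟨by norm_num⟩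
  apply orderOf_eq_prime ωE_cube
  intro h
  have : mk 0 1 = mk 1 0 := by simp [mk, h]
  have := (mk_inj this).1
  omega

lemma jac_dvd (p : PP) : p.1 ∣ jacobiSum (mc p) (mc p) := by
  rw [← rd_eq_zero, jacobiSum, map_sum]
  simp only [map_mul, rd_mc]
  have key : ∀ x : KK p, x ^ ex p * (1 - x) ^ ex p = ∑ j ∈ Finset.range (ex p + 1),
      ((-1) ^ (j + ex p) * ((ex p).choose j : KK p)) * x ^ (ex p + (ex p - j)) := by
    intro x
    rw [sub_pow, Finset.mul_sum]
    apply Finset.sum_congr rfl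
    intro j _
    rw [pow_add x]; simp; ring
  simp only [key]
  rw [Finset.sum_comm]
  apply Finset.sum_eq_zero
  intro j _
  rw [← Finset.mul_sum, FiniteField.sum_pow_lt_card_sub_one, mul_zero]
  rw [card_KK, ← ex_eq]; have := ex_pos p; omega

lemma jac_norm (p : PP) : NmN (jacobiSum (mc p) (mc p)) = NmN p.1 := by
  set f : Eis →+* ℂ := Eis.subtype
  have finj : Function.Injective f := Subtype.val_injective
  set φ := (mc p).ringHomComp f with hφ
  have h1 : φ ≠ 1 := by
    rw [hφ, ← MulChar.ringHomComp_one f]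
    intro h; exact mc_ne_one p (MulChar.injective_ringHomComp finj h)
  have h2 : φ * φ ≠ 1 := by
    rw [hφ, ← MulChar.ringHomComp_mul, ← MulChar.ringHomComp_one f]
    intro h; exact mc_sq_ne_one p (MulChar.injective_ringHomComp finj h)
  have hchar : ringChar ℂ ≠ ringChar (KK p) := by
    have : ringChar ℂ = 0 := CharP.ringChar_zero_iff_CharZero ℂ |>.2 inferInstance
    rw [this]; exact (CharP.ringChar_ne_zero_of_finite _).symm
  have h := jacobiSum_mul_jacobiSum_inv hchar h1 h1 h2
  have h3 : jacobiSum φ⁻¹ φ⁻¹ = (starRingEnd ℂ) (jacobiSum φ φ) := by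
    simp only [jacobiSum, map_sum, map_mul]
    apply Finset.sum_congr rfl; intro x _
    rw [starRingEnd_apply, starRingEnd_apply, MulChar.star_apply', MulChar.star_apply']
  rw [h3, Complex.mul_conj, card_KK] at h
  have h4 : jacobiSum φ φ = f (jacobiSum (mc p) (mc p)) := jacobiSum_ringHomComp _ _ _
  rw [h4] at h
  have h5 : Nm (jacobiSum (mc p) (mc p)) = NmN p.1 := by exact_mod_cast h
  rw [Nm_eq_NmN] at h5; exact_mod_cast h5

lemma jac_eq (p : PP) : jacobiSum (mc p) (mc p) = - p.1 := by
  obtain ⟨z, hz⟩ := jac_dvd p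
  have hn := jac_norm p
  rw [hz, NmN_mul] at hn
  have hz1 : NmN z = 1 := by
    have := NmN_pos p.2.1.ne_zero
    exact Nat.eq_of_mul_eq_mul_left this (by rw [hn, mul_one])
  obtain ⟨y, -, hy⟩ := exists_jacobiSum_eq_neg_one_add (n := 3) (by norm_num) (mc_cube p) (mc_cube p)
    (by rw [card_KK, ← ex_eq]; simp) prim_root
  have h1 : Pr (p.1 * (-z)) := by
    refine ⟨y * ωE, ?_⟩
    have e := ωE_sq
    linear_combination hz - hy - y * e
  have h2 : -z = 1 := unit_Pr ((isUnit_iff_NmN.2 hz1).neg) (p.2.2.of_mul h1)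
  rw [hz]; linear_combination -p.1 * h2

lemma gauss_iter {R R' : Type*} [CommRing R] [Fintype R] [CommRing R'] (p : ℕ) [Fact p.Prime] [CharP R' p]
    (φ : MulChar R R') (ψ : AddChar R R') (k : ℕ) :
    gaussSum φ ψ ^ p ^ k = gaussSum (φ ^ p ^ k) (ψ ^ p ^ k) := by
  induction k with
  | zero => simp
  | succ k ih => rw [pow_succ, pow_mul, ih, gaussSum_frob p, ← pow_mul, ← pow_mul]

lemma recip_aux (p₁ p₂ : PP) (hne : ringChar (KK p₂) ≠ ringChar (KK p₁)) :
    cs p₁ (NmN p₂.1 : Eis) * cs p₂ ((NmN p₁.1 : Eis) * p₁.1) = 1 := by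
  let ψ' := AddChar.FiniteField.primitiveChar (KK p₁) (KK p₂) hne
  let E := CyclotomicField ψ'.n (KK p₂)
  let ψ : AddChar (KK p₁) E := ψ'.char
  have hψ : ψ.IsPrimitive := ψ'.prim
  let f : Eis →+* E := (algebraMap (KK p₂) E).comp (rd p₂)
  have hf : ∀ x, f x = 0 ↔ p₂.1 ∣ x := by
    intro x
    rw [← rd_eq_zero]
    show algebraMap (KK p₂) E (rd p₂ x) = 0 ↔ _
    rw [map_eq_zero]
  set φ := (mc p₁).ringHomComp f with hφ
  have hφ1 : ∀ a, φ (rd p₁ a) = f (cs p₁ a) := by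
    intro a; rw [hφ, MulChar.ringHomComp_apply, mc_rd]
  have hφ3 : φ ^ 3 = 1 := by
    rw [hφ, MulChar.ringHomComp_pow, mc_cube, MulChar.ringHomComp_one]
  have hφne : φ ≠ 1 := by
    intro h
    apply mc_ne_one p₁
    apply MulChar.ext; intro x
    obtain ⟨a, ha⟩ := rd_surj p₁ x.1
    have hax : ¬ p₁.1 ∣ a := by rw [← rd_eq_zero, ha]; exact x.ne_zero
    rw [MulChar.one_apply_coe, ← ha, mc_rd]
    apply Cu.eq_of_dvd (p := p₂) (cs_Cu hax) (Or.inl rfl)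
    rw [← hf, map_sub, ← hφ1, h, ha, MulChar.one_apply_coe, map_one, sub_self]
  have hord : orderOf φ = 3 := by
    haveI : Fact (Nat.Prime 3) := ⟨by norm_num⟩
    exact orderOf_eq_prime hφ3 hφne
  have hchar2 : ringChar E = ringChar (KK p₂) := (Algebra.ringChar_eq (KK p₂) E).symm
  obtain ⟨k, hp, hc⟩ := FiniteField.card (KK p₂) (ringChar (KK p₂))
  haveI : Fact (ringChar (KK p₂)).Prime := ⟨hp⟩
  haveI : CharP E (ringChar (KK p₂)) := by rw [← hchar2]; exact ringChar.charP E
  have hg3 := gaussSum_pow_eq_prod_jacobiSum (χ := φ) (ψ := ψ) (by rw [hord]; norm_num) hψ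
  rw [hord] at hg3
  have e1 : Finset.Ico 1 (3 - 1) = {1} := rfl
  rw [e1, Finset.prod_singleton, pow_one, hφ, jacobiSum_ringHomComp, jac_eq, ← hφ] at hg3
  have e2 : φ (-1) = 1 := by
    have := hφ1 (-1)
    rw [cs_neg_one, map_neg, map_one, map_one] at this; exact this
  rw [e2, one_mul, card_KK, ← map_natCast f, ← map_mul, mul_neg] at hg3
  set g := gaussSum φ ψ with hg
  have hcard0 : (Fintype.card (KK p₁) : E) ≠ 0 := by
    obtain ⟨k', hp', hc'⟩ := FiniteField.card (KK p₁) (ringChar (KK p₁))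
    rw [hc']
    push_cast
    apply pow_ne_zero
    intro h0
    have h1 := (ringChar.spec E (ringChar (KK p₁))).1 h0
    rw [hchar2] at h1
    exact hne ((Nat.prime_dvd_prime_iff_eq hp hp').1 h1)
  have hg0 : g ≠ 0 := gaussSum_ne_zero_of_nontrivial hcard0 hφne hψ
  have hN2 : NmN p₂.1 = ringChar (KK p₂) ^ (k : ℕ) := by rw [← card_KK, hc]
  have hfr : g ^ NmN p₂.1 = gaussSum (φ ^ NmN p₂.1) (ψ ^ NmN p₂.1) := by
    rw [hN2]; exact gauss_iter (ringChar (KK p₂)) φ ψ k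
  have h4 : φ ^ NmN p₂.1 = φ := by
    rw [← ex_eq p₂, pow_succ, pow_mul, hφ3, one_pow, one_mul]
  rw [h4, AddChar.pow_mulShift] at hfr
  have hunit : IsUnit ((NmN p₂.1 : ℕ) : KK p₁) := by
    apply IsUnit.mk0
    rw [hN2]; push_cast
    apply pow_ne_zero
    intro h0
    have h1 := (ringChar.spec (KK p₁) (ringChar (KK p₂))).1 h0
    haveI : Fact (ringChar (KK p₁)).Prime := ⟨CharP.char_is_prime (KK p₁) _⟩
    exact hne ((Nat.prime_dvd_prime_iff_eq (CharP.char_is_prime (KK p₁) _) hp).1 h1).symm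
  have h5 := gaussSum_mulShift φ ψ hunit.unit
  rw [IsUnit.unit_spec, ← hfr, ← hg] at h5
  have h6 : φ ((NmN p₂.1 : ℕ) : KK p₁) = f (cs p₁ (NmN p₂.1 : Eis)) := by
    rw [← hφ1, map_natCast (rd p₁)]
  have h7 : g ^ NmN p₂.1 = f (cs p₂ ((NmN p₁.1 : Eis) * p₁.1)) * g := by
    rw [← ex_eq p₂, pow_succ, pow_mul, hg3]
    congr 1
    rw [← map_pow, ← cs_neg]
    rw [← sub_eq_zero, ← map_sub, hf]
    exact cs_congr_pow p₂ _
  rw [h6, h7, ← mul_assoc, ← map_mul] at h5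
  have h8 : f (cs p₁ (NmN p₂.1 : Eis) * cs p₂ ((NmN p₁.1 : Eis) * p₁.1)) = 1 := by
    apply mul_right_cancel₀ hg0; rw [h5, one_mul]
  have hnd1 : ¬ p₁.1 ∣ (NmN p₂.1 : Eis) := by
    rw [← rd_eq_zero, map_natCast]; exact hunit.ne_zero
  have hnd2 : ¬ p₂.1 ∣ (NmN p₁.1 : Eis) * p₁.1 := by
    rw [← cs_eq_zero]; intro h0; rw [h0, mul_zero, map_zero] at h8; exact zero_ne_one h8
  apply Cu.eq_of_dvd (p := p₂) ((cs_Cu hnd1).mul (cs_Cu hnd2)) (Or.inl rfl)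
  rw [← hf, map_sub, h8, map_one, sub_self]

lemma recip1 (p₁ p₂ : PP) (hne : ringChar (KK p₂) ≠ ringChar (KK p₁)) : cs p₁ p₂.1 = cs p₂ p₁.1 := by
  have h1 := recip_aux p₁ p₂ hne
  have h2 := recip_aux p₂ p₁ hne.symm
  rw [← mul_cj, ← mul_cj, cs_mul, cs_mul, cs_mul] at h1 h2
  generalize cs p₁ p₂.1 = a at *
  generalize cs p₂ p₁.1 = b at *
  generalize cs p₁ (cj p₂.1) = c at *
  generalize cs p₂ (cj p₁.1) = d at *
  -- a c b d b = 1, b d a c a = 1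
  linear_combination b * h2 - a * h1

lemma same_char {p₁ p₂ : PP} (h : ringChar (KK p₂) = ringChar (KK p₁)) : p₂ = p₁ ∨ p₂ = cjP p₁ := by
  obtain ⟨k, hp, hc⟩ := FiniteField.card (KK p₁) (ringChar (KK p₁))
  have h1 : p₂.1 ∣ (NmN p₁.1 : Eis) := by
    rw [← rd_eq_zero, map_natCast, ← card_KK, hc, ← h]
    push_cast
    rw [ringChar.Nat.cast_ringChar, zero_pow k.ne_zero]
  rw [← mul_cj] at h1
  rcases p₂.2.1.dvd_or_dvd h1 with h | h
  · left; exact PP_assoc h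
  · right; exact PP_assoc (q := cjP p₁) h

lemma exists_multiset {x : Eis} (hx : Pr x) : ∃ s : Multiset PP, x = (s.map Subtype.val).prod := by
  have key : ∀ x : Eis, x ≠ 0 → ¬ lam ∣ x → ∃ (u : Eisˣ) (s : Multiset PP), x = u * (s.map Subtype.val).prod := by
    intro x hx
    induction x using UniqueFactorizationMonoid.induction_on_prime with
    | h₁ => exact absurd rfl hx
    | h₂ x hu => intro _; exact ⟨hu.unit, 0, by simp⟩
    | h₃ a p ha hp ih =>
      intro hl
      obtain ⟨u, P, hP⟩ := ih ha (fun h => hl (h.mul_left _))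
      obtain ⟨v, q, hq⟩ := exists_PP hp (fun h => hl (h.mul_right _))
      exact ⟨v * u, q ::ₘ P, by rw [Multiset.map_cons, Multiset.prod_cons, hP, hq]; push_cast; ring⟩
  obtain ⟨u, P, hP⟩ := key x hx.ne_zero hx.not_lam_dvd
  have hPr : ∀ s : Multiset PP, Pr (s.map Subtype.val).prod := by
    intro s
    induction s using Multiset.induction_on with
    | empty => simpa using Pr_one
    | cons p s ih => rw [Multiset.map_cons, Multiset.prod_cons]; exact p.2.2.mul ih
  have : (u : Eis) = 1 := by
    apply unit_Pr u.isUnit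
    exact (hPr P).of_mul (b := u) (by rw [mul_comm, ← hP]; exact hx)
  exact ⟨P, by rw [hP, this, one_mul]⟩

lemma cs_multiset (p : PP) (s : Multiset PP) :
    cs p (s.map Subtype.val).prod = (s.map (fun q => cs p q.1)).prod := by
  induction s using Multiset.induction_on with
  | empty => simp [cs_one]
  | cons q s ih => simp [cs_mul, ih]

lemma recip_conj (p : PP) (hne : p ≠ cjP p) : cs p (cj p.1) = 1 := by
  set a := -(p.1 + cj p.1) with ha
  have haP : Pr a := by
    obtain ⟨x, hx⟩ := p.2.2
    obtain ⟨y, hy⟩ := p.2.2.cj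
    exact ⟨-x - y - 1, by linear_combination -hx - hy⟩
  have hcja : cj a = a := by simp [ha, add_comm]
  obtain ⟨s, hs⟩ := exists_multiset haP
  have hnd : ¬ p.1 ∣ cj p.1 := fun h => hne (PP_assoc (q := cjP p) h)
  have hnd' : ¬ cj p.1 ∣ p.1 := fun h => hne (PP_assoc (p := cjP p) h).symm
  have h1 : cs p a = cs p (cj p.1) := by
    rw [← cs_neg]; apply cs_congr; exact ⟨1, by rw [ha]; ring⟩
  have hq : ∀ q ∈ s, q.1 ∣ a := by
    intro q hq; rw [hs]; exact Multiset.dvd_prod (Multiset.mem_map_of_mem _ hq)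
  have hq1 : ∀ q ∈ s, q ≠ p := by
    rintro q hqs rfl
    apply hnd
    have := dvd_sub (hq _ hqs).neg_right (dvd_refl q.1)
    rw [ha] at this; simpa using this
  have hq2 : ∀ q ∈ s, q ≠ cjP p := by
    rintro q hqs rfl
    apply hnd'
    have := dvd_sub (hq _ hqs).neg_right (dvd_refl (cjP p).1)
    rw [ha] at this; simpa [cjP] using this
  have hr1 : ∀ q ∈ s, cs p q.1 = cs q p.1 := fun q hqs => recip1 p q (by
    intro h; rcases same_char h with h | h
    · exact hq1 q hqs h
    · exact hq2 q hqs h)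
  have hr2 : ∀ q ∈ s, cs (cjP p) q.1 = cs q (cjP p).1 := fun q hqs => recip1 (cjP p) q (by
    intro h; rcases same_char h with h | h
    · exact hq2 q hqs h
    · apply hq1 q hqs; rw [h]; apply Subtype.ext; simp [cjP])
  have h2 : cs p a = (s.map (fun q => cs q p.1)).prod := by
    rw [hs, cs_multiset]; congr 1; exact Multiset.map_congr rfl hr1
  have h3 : cs (cjP p) a = (s.map (fun q => cs q p.1)).prod := by
    rw [hs, cs_multiset]; congr 1; apply Multiset.map_congr rfl
    intro q hqs
    rw [hr2 q hqs, ← cs_neg]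
    apply cs_congr
    have := hq q hqs
    rw [ha] at this
    have h : -(cjP p).1 - p.1 = -(p.1 + cj p.1) := by simp [cjP]; ring
    rw [h]; exact this
  have h4 : cs (cjP p) a = cj (cs p a) := by rw [← cs_cjP, hcja]
  have hC : Cu (cs p a) := by rw [h1]; exact cs_Cu hnd
  rw [← h1]
  have h5 : cs p a ^ 2 = cs p a := by rw [← hC.cj, ← h4, h3, h2]
  exact mul_left_cancel₀ hC.ne_zero (by rw [mul_one, ← pow_two, h5])

/-- cubic reciprocity for primes -/
lemma recip (p q : PP) : cs p q.1 = cs q p.1 := by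
  by_cases h : ringChar (KK q) = ringChar (KK p)
  · rcases same_char h with rfl | rfl
    · rfl
    · by_cases hne : p = cjP p
      · rw [← hne]
      · have h1 := recip_conj p hne
        have h2 := recip_conj (cjP p) (by
          intro h; apply hne
          have : p = cjP (cjP p) := by apply Subtype.ext; simp [cjP]
          rw [← h] at this; exact this)
        simp [cjP] at h1 h2 ⊢
        rw [h1, h2]
  · exact recip1 p q h

/-- complex valued symbol attached to a squarefree primary element -/
def ch (P : Finset PP) (a : Eis) : ℂ := ∏ p ∈ P, ((cs p a : Eis) : ℂ)

lemma ch_mul (P : Finset PP) (a b : Eis) : ch P (a * b) = ch P a * ch P b := by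
  simp [ch, cs_mul, Finset.prod_mul_distrib]
lemma ch_pow (P : Finset PP) (a : Eis) (k : ℕ) : ch P (a ^ k) = ch P a ^ k := by
  simp [ch, cs_pow, Finset.prod_pow]
@[simp] lemma ch_one (P : Finset PP) : ch P 1 = 1 := by simp [ch, cs_one]
@[simp] lemma ch_empty (a : Eis) : ch ∅ a = 1 := by simp [ch]
lemma ch_union {P Q : Finset PP} (h : Disjoint P Q) (a : Eis) : ch (P ∪ Q) a = ch P a * ch Q a :=
  Finset.prod_union h
lemma ch_congr {P : Finset PP} {a b : Eis} (h : el P ∣ a - b) : ch P a = ch P b := by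
  unfold ch
  apply Finset.prod_congr rfl
  intro p hp; rw [cs_congr ((dvd_el.2 hp).trans h)]
lemma ch_eq_zero {P : Finset PP} {a : Eis} : ch P a = 0 ↔ ∃ p ∈ P, p.1 ∣ a := by
  unfold ch; rw [Finset.prod_eq_zero_iff]
  simp [cs_eq_zero]
lemma ch_ne_zero_iff {P : Finset PP} {a : Eis} : ch P a ≠ 0 ↔ IsCoprime (el P) a := by
  rw [isCoprime_el, Ne, ch_eq_zero]; push Not; rfl
lemma Cu_norm {u : Eis} (h : Cu u) : ‖(u : ℂ)‖ = 1 := by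
  have := congrArg (fun x : Eis => ‖(x : ℂ)‖) h.cube
  simp at this
  exact (pow_eq_one_iff_of_nonneg (norm_nonneg _) (by norm_num)).1 this
lemma cs_norm_le (p : PP) (a : Eis) : ‖(cs p a : ℂ)‖ ≤ 1 := by
  by_cases h : p.1 ∣ a
  · rw [cs_eq_zero.2 h]; simp
  · rw [Cu_norm (cs_Cu h)]
lemma ch_norm_le (P : Finset PP) (a : Eis) : ‖ch P a‖ ≤ 1 := by
  unfold ch; rw [norm_prod]
  exact Finset.prod_le_one (fun _ _ => norm_nonneg _) (fun p _ => cs_norm_le p a)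
lemma ch_norm {P : Finset PP} {a : Eis} (h : IsCoprime (el P) a) : ‖ch P a‖ = 1 := by
  unfold ch; rw [norm_prod]
  apply Finset.prod_eq_one
  intro p hp
  exact Cu_norm (cs_Cu (isCoprime_el.1 h p hp))
lemma cs_sq_conj (p : PP) (a : Eis) : ((cs p a : Eis) : ℂ) ^ 2 = (starRingEnd ℂ) (cs p a : ℂ) := by
  by_cases h : p.1 ∣ a
  · rw [cs_eq_zero.2 h]; simp
  · rw [← coe_cj, (cs_Cu h).cj]; simp
lemma ch_sq (P : Finset PP) (a : Eis) : ch P a ^ 2 = (starRingEnd ℂ) (ch P a) := by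
  unfold ch; rw [map_prod, ← Finset.prod_pow]
  exact Finset.prod_congr rfl (fun p _ => cs_sq_conj p a)
lemma ch_recip (P Q : Finset PP) : ch P (el Q) = ch Q (el P) := by
  unfold ch el
  simp only [cs_prod]
  push_cast
  rw [Finset.prod_comm]
  simp only [recip]

lemma eE_add (z w : ℂ) : eE (z + w) = eE z * eE w := by
  unfold eE; rw [← Complex.exp_add, map_add]; congr 1; ring
lemma eE_zero : eE 0 = 1 := by simp [eE]
lemma eE_re (z : ℂ) : eE z = Complex.exp ((2 * Real.pi * (2 * z.re) : ℝ) * I) := by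
  unfold eE; rw [Complex.add_conj]; congr 1; push_cast; ring
lemma eE_norm (z : ℂ) : ‖eE z‖ = 1 := by
  rw [eE_re, Complex.norm_exp_ofReal_mul_I]
lemma eE_neg (z : ℂ) : eE (-z) = (starRingEnd ℂ) (eE z) := by
  unfold eE; rw [← Complex.exp_conj]; congr 1
  simp only [map_mul, map_add, conj_I, conj_ofReal, map_ofNat, conj_conj, map_neg]; ring
lemma eE_eq_one {z : ℂ} : eE z = 1 ↔ ∃ n : ℤ, 2 * z.re = n := by
  rw [eE_re, Complex.exp_eq_one_iff]
  constructor
  · rintro ⟨n, hn⟩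
    refine ⟨n, ?_⟩
    have h : (((2 * z.re : ℝ) : ℂ)) * (2 * Real.pi * I) = n * (2 * Real.pi * I) := by
      rw [← hn]; push_cast; ring
    have := mul_right_cancel₀ Complex.two_pi_I_ne_zero h
    exact_mod_cast this
  · rintro ⟨n, hn⟩
    refine ⟨n, ?_⟩
    rw [hn]; push_cast; ring

lemma coe_lam : (lam : ℂ) = (Real.sqrt 3 : ℝ) * I := by
  have : (lam : ℂ) = 1 + 2 * ωc := rfl
  rw [this, ωc_eq]; apply Complex.ext <;> simp <;> ring
lemma lam_ne : (lam : ℂ) ≠ 0 := by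
  intro h; exact lam_ne_zero (Subtype.ext h)

lemma eE_lam (x : Eis) : eE ((x : ℂ) / lam) = 1 := by
  rw [eE_eq_one]
  obtain ⟨a, b, rfl⟩ := exists_mk x
  refine ⟨b, ?_⟩
  have h3 : Real.sqrt 3 * Real.sqrt 3 = 3 := Real.mul_self_sqrt (by norm_num)
  have hω : ωc = -1/2 + (Real.sqrt 3 : ℝ) / 2 * I := by
    rw [ωc_eq]; apply Complex.ext <;> simp
  have h : ((mk a b : Eis) : ℂ) / lam = ((b / 2 : ℝ) : ℂ) + ((-(a - b / 2) / Real.sqrt 3 : ℝ) : ℂ) * I := by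
    rw [div_eq_iff lam_ne, coe_lam, coe_mk, hω]
    have h3' : ((Real.sqrt 3 : ℝ) : ℂ) ≠ 0 := by simp
    have : ((Real.sqrt 3 : ℝ) : ℂ) * (Real.sqrt 3 : ℝ) = 3 := by rw [← ofReal_mul, h3]; simp
    push_cast
    field_simp
    ring_nf
    simp only [I_sq]
    ring
  rw [h]; simp; ring

lemma dual {z : ℂ} (h : ∀ x : Eis, eE ((x : ℂ) * z) = 1) : ∃ y : Eis, (lam : ℂ) * z = y := by
  obtain ⟨m, hm⟩ := eE_eq_one.1 (h 1)
  obtain ⟨n, hn⟩ := eE_eq_one.1 (h ωE)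
  have h3 : Real.sqrt 3 * Real.sqrt 3 = 3 := Real.mul_self_sqrt (by norm_num)
  have e : ((ωE : Eis) : ℂ) = ωc := rfl
  rw [e, ωc_eq] at hn
  simp at hm hn
  refine ⟨mk (n + m) m, ?_⟩
  rw [coe_mk, coe_lam, ωc_eq]
  apply Complex.ext
  · simp; linarith
  · simp; linear_combination Real.sqrt 3 / 2 * hm

/-- sum over residues -/
def qs (r : Eis) (F : Eis → ℂ) : ℂ := ∑ᶠ d : Eis ⧸ Ideal.span {r}, F d.out

lemma out_dvd (r x : Eis) : r ∣ (Ideal.Quotient.mk (Ideal.span {r}) x).out - x := by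
  rw [← Ideal.mem_span_singleton, ← Ideal.Quotient.eq]
  exact Quotient.out_eq _
lemma mk_out (r : Eis) (d : Eis ⧸ Ideal.span {r}) : Ideal.Quotient.mk (Ideal.span {r}) d.out = d := Quotient.out_eq _

/-- Gauss sum data of a primitive character mod r -/
structure GaussData (r : Eis) (ψ : Eis → ℂ) (W : ℂ) : Prop where
  hr : r ≠ 0
  per : ∀ x y, r ∣ x - y → ψ x = ψ y
  mul : ∀ x y, ψ (x * y) = ψ x * ψ y
  le : ∀ x, ‖ψ x‖ ≤ 1
  W1 : ‖W‖ = 1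
  gs : ∀ k : Eis, qs r (fun d => ψ d * eE ((k * d : Eis) / (lam * r))) = Real.sqrt (Nm r) * W * (starRingEnd ℂ) (ψ k)

lemma eE_per {r : Eis} (hr : r ≠ 0) (k : Eis) {x y : Eis} (h : r ∣ x - y) :
    eE ((k * x : Eis) / (lam * r)) = eE ((k * y : Eis) / (lam * r)) := by
  obtain ⟨c, hc⟩ := h
  have hx : x = y + r * c := by linear_combination hc
  have hr' : (r : ℂ) ≠ 0 := fun h => hr (Subtype.ext h)
  have : ((k * x : Eis) : ℂ) / (lam * r) = ((k * y : Eis) : ℂ) / (lam * r) + ((k * c : Eis) : ℂ) / lam := by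
    have := lam_ne
    rw [hx]; push_cast; field_simp
  rw [this, eE_add, eE_lam, mul_one]

lemma qs_mul {r₁ r₂ : Eis} (h₁ : r₁ ≠ 0) (h₂ : r₂ ≠ 0) (hc : IsCoprime r₁ r₂) (F : Eis → ℂ)
    (hF : ∀ x y, r₁ * r₂ ∣ x - y → F x = F y) :
    qs (r₁ * r₂) F = qs r₁ (fun d₁ => qs r₂ (fun d₂ => F (d₁ * r₂ + d₂ * r₁))) := by
  haveI := finite_quot h₁
  haveI := finite_quot h₂
  haveI := finite_quot (mul_ne_zero h₁ h₂)
  letI := Fintype.ofFinite (Eis ⧸ Ideal.span {r₁})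
  letI := Fintype.ofFinite (Eis ⧸ Ideal.span {r₂})
  letI := Fintype.ofFinite (Eis ⧸ Ideal.span {r₁ * r₂})
  unfold qs
  simp only [finsum_eq_sum_of_fintype]
  rw [← Fintype.sum_prod_type']
  symm
  apply Fintype.sum_bijective (fun d : (Eis ⧸ Ideal.span {r₁}) × (Eis ⧸ Ideal.span {r₂}) =>
    Ideal.Quotient.mk (Ideal.span {r₁ * r₂}) (d.1.out * r₂ + d.2.out * r₁))
  · rw [Fintype.bijective_iff_injective_and_card]
    constructor
    · rintro ⟨a, b⟩ ⟨a', b'⟩ h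
      simp only at h
      rw [Ideal.Quotient.eq, Ideal.mem_span_singleton] at h
      have e1 : r₁ ∣ a.out - a'.out := by
        apply hc.dvd_of_dvd_mul_right
        have := (dvd_mul_right r₁ r₂).trans h
        have h2 : (a.out - a'.out) * r₂ = (a.out * r₂ + b.out * r₁ - (a'.out * r₂ + b'.out * r₁)) - r₁ * (b.out - b'.out) := by ring
        rw [h2]; exact dvd_sub this (dvd_mul_right _ _)
      have e2 : r₂ ∣ b.out - b'.out := by
        apply hc.symm.dvd_of_dvd_mul_right
        have := (dvd_mul_left r₂ r₁).trans h
        have h2 : (b.out - b'.out) * r₁ = (a.out * r₂ + b.out * r₁ - (a'.out * r₂ + b'.out * r₁)) - r₂ * (a.out - a'.out) := by ring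
        rw [h2]; exact dvd_sub this (dvd_mul_right _ _)
      rw [← Ideal.mem_span_singleton, ← Ideal.Quotient.eq, mk_out, mk_out] at e1 e2
      rw [e1, e2]
    · rw [Fintype.card_prod, ← Nat.card_eq_fintype_card, ← Nat.card_eq_fintype_card, ← Nat.card_eq_fintype_card,
        card_quot, card_quot, card_quot, NmN_mul]
  · rintro ⟨a, b⟩
    apply (hF _ _ (out_dvd _ _)).symm

lemma qs_const_mul (r : Eis) (hr : r ≠ 0) (c : ℂ) (F : Eis → ℂ) : qs r (fun d => c * F d) = c * qs r F := by
  haveI := finite_quot hr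
  letI := Fintype.ofFinite (Eis ⧸ Ideal.span {r})
  unfold qs
  simp only [finsum_eq_sum_of_fintype, Finset.mul_sum]
lemma qs_mul_const (r : Eis) (hr : r ≠ 0) (c : ℂ) (F : Eis → ℂ) : qs r (fun d => F d * c) = qs r F * c := by
  rw [mul_comm, ← qs_const_mul r hr]; congr 1; ext; ring

lemma coe_ne {r : Eis} (hr : r ≠ 0) : (r : ℂ) ≠ 0 := fun h => hr (Subtype.ext h)

lemma GaussData.prod {r₁ r₂ : Eis} {ψ₁ ψ₂ : Eis → ℂ} {W₁ W₂ : ℂ} (g₁ : GaussData r₁ ψ₁ W₁) (g₂ : GaussData r₂ ψ₂ W₂)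
    (hc : IsCoprime r₁ r₂) (h1 : ‖ψ₁ r₂‖ = 1) (h2 : ‖ψ₂ r₁‖ = 1) :
    GaussData (r₁ * r₂) (fun x => ψ₁ x * ψ₂ x) (ψ₁ r₂ * ψ₂ r₁ * (W₁ * W₂)) where
  hr := mul_ne_zero g₁.hr g₂.hr
  per x y h := by
    rw [g₁.per x y ((dvd_mul_right _ _).trans h), g₂.per x y ((dvd_mul_left _ _).trans h)]
  mul x y := by rw [g₁.mul, g₂.mul]; ring
  le x := by
    rw [norm_mul]
    exact mul_le_one₀ (g₁.le x) (norm_nonneg _) (g₂.le x)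
  W1 := by simp [h1, h2, g₁.W1, g₂.W1]
  gs k := by
    rw [qs_mul g₁.hr g₂.hr hc]
    · have key : ∀ d₁ d₂ : Eis, (ψ₁ (d₁ * r₂ + d₂ * r₁) * ψ₂ (d₁ * r₂ + d₂ * r₁)) *
          eE ((k * (d₁ * r₂ + d₂ * r₁) : Eis) / (lam * (r₁ * r₂ : Eis))) =
          (ψ₁ d₁ * eE ((k * d₁ : Eis) / (lam * r₁))) * (ψ₁ r₂ * ψ₂ r₁) * (ψ₂ d₂ * eE ((k * d₂ : Eis) / (lam * r₂))) := by
        intro d₁ d₂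
        have e1 : ψ₁ (d₁ * r₂ + d₂ * r₁) = ψ₁ d₁ * ψ₁ r₂ := by
          rw [← g₁.mul]; apply g₁.per; exact ⟨d₂, by ring⟩
        have e2 : ψ₂ (d₁ * r₂ + d₂ * r₁) = ψ₂ d₂ * ψ₂ r₁ := by
          rw [← g₂.mul]; apply g₂.per; exact ⟨d₁, by ring⟩
        have e3 : ((k * (d₁ * r₂ + d₂ * r₁) : Eis) : ℂ) / (lam * (r₁ * r₂ : Eis)) =
          (k * d₁ : Eis) / (lam * r₁) + (k * d₂ : Eis) / (lam * r₂) := by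
          have := lam_ne
          have := coe_ne g₁.hr
          have := coe_ne g₂.hr
          push_cast; field_simp
        rw [e1, e2, e3, eE_add]; ring
      simp only [key]
      simp only [qs_const_mul _ g₂.hr, g₂.gs, mul_assoc]
      simp only [← mul_assoc]
      rw [show (fun d₁ : Eis => ψ₁ d₁ * eE ((k * d₁ : Eis) / (lam * r₁)) * ψ₁ r₂ * ψ₂ r₁ * (Real.sqrt (Nm r₂) : ℂ) * W₂ * (starRingEnd ℂ) (ψ₂ k)) =
        fun d₁ : Eis => (ψ₁ d₁ * eE ((k * d₁ : Eis) / (lam * r₁))) * (ψ₁ r₂ * ψ₂ r₁ * (Real.sqrt (Nm r₂) : ℂ) * W₂ * (starRingEnd ℂ) (ψ₂ k)) by ext; ring]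
      rw [qs_mul_const _ g₁.hr, g₁.gs, Nm_mul, Real.sqrt_mul (Nm_nonneg _), map_mul]
      push_cast; ring
    · intro x y h
      rw [eE_per (mul_ne_zero g₁.hr g₂.hr) k h, g₁.per x y ((dvd_mul_right _ _).trans h), g₂.per x y ((dvd_mul_left _ _).trans h)]

lemma GaussData.conj {r : Eis} {ψ : Eis → ℂ} {W : ℂ} (g : GaussData r ψ W) (h1 : ψ (-1) = 1) :
    GaussData r (fun x => (starRingEnd ℂ) (ψ x)) ((starRingEnd ℂ) W) where
  hr := g.hr
  per x y h := by rw [g.per x y h]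
  mul x y := by rw [g.mul, map_mul]
  le x := by simpa using g.le x
  W1 := by simpa using g.W1
  gs k := by
    have h := congrArg (starRingEnd ℂ) (g.gs (-k))
    have e : ψ (-k) = ψ k := by rw [show -k = (-1) * k by ring, g.mul, h1, one_mul]
    rw [e, map_mul, map_mul, conj_ofReal] at h
    rw [← h]
    haveI := finite_quot g.hr
    letI := Fintype.ofFinite (Eis ⧸ Ideal.span {r})
    unfold qs
    simp only [finsum_eq_sum_of_fintype]
    rw [map_sum]
    apply Finset.sum_congr rfl
    intro d _
    rw [map_mul, ← eE_neg]
    congr 2; push_cast; ring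

/-- additive character of the residue field -/
def ac (p : PP) : AddChar (KK p) ℂ where
  toFun x := eE (((1:Eis) * x.out : Eis) / (lam * p.1))
  map_zero_eq_one' := by
    rw [eE_per p.2.1.ne_zero 1 (y := 0)]
    · simp [eE_zero]
    · rw [← rd_eq]; show Ideal.Quotient.mk _ _ = _; rw [mk_out]; simp
  map_add_eq_mul' x y := by
    rw [eE_per p.2.1.ne_zero 1 (y := x.out + y.out), ← eE_add]
    · congr 1; push_cast; ring
    · rw [← rd_eq]; show Ideal.Quotient.mk _ _ = Ideal.Quotient.mk _ _; rw [mk_out, map_add, mk_out, mk_out]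
lemma ac_rd (p : PP) (a : Eis) : ac p (rd p a) = eE ((a : ℂ) / (lam * p.1)) := by
  show eE (((1:Eis) * (rd p a).out : Eis) / (lam * p.1)) = _
  have := eE_per p.2.1.ne_zero 1 (y := a) (out_dvd p.1 a)
  simp only [one_mul] at this ⊢
  exact this
lemma ac_prim (p : PP) : (ac p).IsPrimitive := by
  apply AddChar.IsPrimitive.of_ne_one
  intro h
  obtain ⟨y, hy⟩ := dual (z := 1 / (lam * p.1)) (by
    intro x
    have := ac_rd p x
    rw [h, AddChar.one_apply] at this
    rw [mul_one_div]; exact this.symm)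
  apply p.2.1.not_unit
  have hp := coe_ne p.2.1.ne_zero
  have hl := lam_ne
  field_simp at hy
  exact isUnit_iff_dvd_one.2 ⟨y, Subtype.ext (by push_cast; exact hy)⟩

lemma gauss_prime (p : PP) : ∃ W, GaussData p.1 (ch {p}) W := by
  set φ := (mc p).ringHomComp Eis.subtype with hφ
  have hφ1 : ∀ a, φ (rd p a) = ch {p} a := by
    intro a; rw [hφ, MulChar.ringHomComp_apply, mc_rd]; simp [ch]
  have hφne : φ ≠ 1 := by
    intro h; apply mc_ne_one p
    apply MulChar.ext; intro x
    have h1 := congrArg (fun f => f x.1) h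
    simp only [hφ, MulChar.ringHomComp_apply, MulChar.one_apply_coe] at h1
    rw [MulChar.one_apply_coe]; exact Subtype.ext h1
  set g := gaussSum φ (ac p) with hg
  have hqs : ∀ k, qs p.1 (fun d => ch {p} d * eE ((k * d : Eis) / (lam * p.1))) = gaussSum φ ((ac p).mulShift (rd p k)) := by
    intro k
    unfold qs
    rw [finsum_eq_sum_of_fintype]
    unfold gaussSum
    apply Finset.sum_congr rfl
    intro d _
    rw [AddChar.mulShift_apply]
    have : d = rd p d.out := (mk_out _ _).symm
    conv_rhs => rw [this, hφ1, ← map_mul, ac_rd]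
  have hconj : (starRingEnd ℂ) g = gaussSum φ⁻¹ (ac p)⁻¹ := by
    rw [hg]; unfold gaussSum
    rw [map_sum]
    apply Finset.sum_congr rfl
    intro x _
    rw [map_mul]
    obtain ⟨a, rfl⟩ := rd_surj p x
    congr 1
    · rw [MulChar.inv_apply_eq_inv', hφ1]
      by_cases ha : p.1 ∣ a
      · have : ch {p} a = 0 := by rw [ch_eq_zero]; exact ⟨p, by simp, ha⟩
        rw [this]; simp
      · have : ‖ch {p} a‖ = 1 := by simp [ch, Cu_norm (cs_Cu ha)]
        rw [Complex.inv_def, Complex.normSq_eq_norm_sq, this]; simp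
    · rw [AddChar.inv_apply, ← map_neg, ac_rd, ac_rd, ← eE_neg]
      congr 1; push_cast; ring
  have hgg : g * (starRingEnd ℂ) g = (NmN p.1 : ℂ) := by
    rw [hconj, gaussSum_mul_gaussSum_eq_card hφne (ac_prim p), card_KK]
  have hNp : (0:ℝ) < Nm p.1 := Nm_pos p.2.1.ne_zero
  have hgn : ‖g‖ = Real.sqrt (Nm p.1) := by
    rw [Complex.mul_conj, Complex.normSq_eq_norm_sq] at hgg
    rw [eq_comm, Real.sqrt_eq_iff_eq_sq hNp.le (norm_nonneg _), Nm_eq_NmN]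
    exact_mod_cast hgg.symm
  have hs : (Real.sqrt (Nm p.1) : ℂ) ≠ 0 := by
    rw [Ne, ofReal_eq_zero]; exact (Real.sqrt_pos.2 hNp).ne'
  refine ⟨g / Real.sqrt (Nm p.1), ⟨p.2.1.ne_zero, fun x y h => ch_congr (by simpa [el] using h), ch_mul _, ch_norm_le _, ?_, ?_⟩⟩
  · rw [norm_div, hgn, Complex.norm_real, Real.norm_of_nonneg (Real.sqrt_nonneg _), div_self]
    exact (Real.sqrt_pos.2 hNp).ne'
  · intro k
    rw [hqs, mul_div_cancel₀ _ hs]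
    by_cases hk : p.1 ∣ k
    · have h0 : ch {p} k = 0 := by rw [ch_eq_zero]; exact ⟨p, by simp, hk⟩
      rw [h0, rd_eq_zero.2 hk, map_zero, mul_zero]
      unfold gaussSum
      simp only [AddChar.mulShift_apply, zero_mul, AddChar.map_zero_eq_one, mul_one]
      exact MulChar.sum_eq_zero_of_ne_one hφne
    · have hu : IsUnit (rd p k) := IsUnit.mk0 _ (by rwa [Ne, rd_eq_zero])
      have h1 := gaussSum_mulShift φ (ac p) hu.unit
      rw [IsUnit.unit_spec, hφ1, ← hg] at h1
      have hn : ‖ch {p} k‖ = 1 := by simp [ch, Cu_norm (cs_Cu hk)]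
      rw [← h1]
      have : ch {p} k * (starRingEnd ℂ) (ch {p} k) = 1 := by
        rw [Complex.mul_conj, Complex.normSq_eq_norm_sq, hn]; simp
      linear_combination -(gaussSum φ ((ac p).mulShift (rd p k))) * this

lemma ch_neg_one (P : Finset PP) : ch P (-1) = 1 := by simp [ch, cs_neg_one]

lemma ch_norm_disj {P Q : Finset PP} (h : Disjoint P Q) : ‖ch P (el Q)‖ = 1 :=
  ch_norm (isCoprime_el_el.2 h)

lemma gauss_el (P : Finset PP) : ∃ W, GaussData (el P) (ch P) W := by
  induction P using Finset.induction_on with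
  | empty =>
    refine ⟨1, ⟨el_ne_zero _, fun x y h => ch_congr h, ch_mul _, ch_norm_le _, by simp, ?_⟩⟩
    intro k
    unfold qs
    have : Subsingleton (Eis ⧸ Ideal.span {el ∅}) := by
      rw [el_empty]; simp only [Ideal.span_singleton_one]; infer_instance
    have h0 : ∀ d : Eis, ch ∅ d * eE ((k * d : Eis) / (lam * (el ∅ : Eis))) = 1 := by
      intro d; rw [el_empty, ch_empty]
      have := eE_lam (k * d)
      rw [one_mul]
      simpa using this
    simp only [h0]
    letI : Unique (Eis ⧸ Ideal.span {el ∅}) := ⟨⟨0⟩, fun a => Subsingleton.elim _ _⟩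
    rw [finsum_unique]
    simp [el_empty, Nm_one]
  | insert p P hp ih =>
    obtain ⟨W, hW⟩ := ih
    obtain ⟨V, hV⟩ := gauss_prime p
    have hd : Disjoint {p} P := by simpa using hp
    have hel : el {p} = p.1 := by simp [el]
    have e1 := ch_norm_disj hd
    have e2 := ch_norm_disj hd.symm
    have e3 : IsCoprime p.1 (el P) := by rw [← hel]; exact isCoprime_el_el.2 hd
    rw [hel] at e2
    have := hV.prod hW e3 e1 e2
    rw [el_insert hp]
    refine ⟨ch {p} (el P) * ch P p.1 * (V * W), ?_⟩
    convert this using 1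
    ext x
    rw [← ch_union hd]; rfl

/-- normalized Gauss sum -/
def wG (P : Finset PP) : ℂ := (gauss_el P).choose
lemma wG_spec (P : Finset PP) : GaussData (el P) (ch P) (wG P) := (gauss_el P).choose_spec

/-- the character with A, B disjoint -/
def chAB (A B : Finset PP) (x : Eis) : ℂ := ch A x * (starRingEnd ℂ) (ch B x)

lemma gauss_AB {A B : Finset PP} (h : Disjoint A B) :
    GaussData (el A * el B) (chAB A B) (wG A * (starRingEnd ℂ) (wG B)) := by
  have e1 := ch_norm_disj h
  have e2 := ch_norm_disj h.symm
  have := (wG_spec A).prod ((wG_spec B).conj (ch_neg_one B)) (isCoprime_el_el.2 h) e1 (by simpa using e2)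
  have e : ch A (el B) * (starRingEnd ℂ) (ch B (el A)) = 1 := by
    rw [ch_recip, Complex.mul_conj, Complex.normSq_eq_norm_sq, e2]; simp
  rw [e, one_mul] at this
  exact this

/-- coordinates -/
def eq2 : ℤ × ℤ ≃ Eis := Equiv.ofBijective (fun p => mk p.1 p.2)
  ⟨fun p q h => by
    obtain ⟨h1, h2⟩ := mk_inj h
    exact Prod.ext h1 h2, fun x => by obtain ⟨a, b, rfl⟩ := exists_mk x; exact ⟨(a, b), rfl⟩⟩
lemma eq2_apply (a b : ℤ) : eq2 (a, b) = mk a b := rfl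

lemma exp_neg_le_sq {y : ℝ} (hy : 0 < y) : Real.exp (-y) ≤ 2 * y ^ (-2 : ℝ) := by
  have h := Real.pow_div_factorial_le_exp y hy.le 2
  rw [Real.exp_neg, Real.rpow_neg hy.le, Real.rpow_two]
  have : (Nat.factorial 2 : ℝ) = 2 := by norm_num [Nat.factorial]
  rw [this] at h
  have h2 : (Real.exp y)⁻¹ ≤ (y^2/2)⁻¹ := inv_anti₀ (by positivity) h
  rw [inv_div] at h2
  rw [← div_eq_mul_inv]; exact h2

lemma summable_gauss {c : ℝ} (hc : 0 < c) : Summable (fun x : Eis => Real.exp (-(c * Nm x))) := by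
  have h := (summable_Nm (s := 2) (by norm_num)).mul_left (2 * c ^ (-2:ℝ))
  have h2 : Summable (fun x : Eis => if x = 0 then (1:ℝ) else 0) :=
    summable_of_ne_finset_zero (s := {0}) (by intro b hb; simp at hb; simp [hb])
  refine Summable.of_nonneg_of_le (fun _ => (Real.exp_pos _).le) ?_ (h.add h2)
  intro x
  by_cases hx : x = 0
  · subst hx
    simp only [Nm_zero, mul_zero, neg_zero, Real.exp_zero, if_true]
    have : (0:ℝ) ≤ 2 * c ^ (-2:ℝ) * 0 ^ (-2:ℝ) := by positivity
    linarith
  · simp only [hx, if_false, add_zero]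
    have hN := Nm_pos hx
    refine (exp_neg_le_sq (by positivity)).trans ?_
    rw [Real.mul_rpow hc.le hN.le, mul_assoc]

lemma summable_gauss_shift {c : ℝ} (hc : 0 < c) (z : ℂ) :
    Summable (fun x : Eis => Real.exp (-(c * ‖(x:ℂ) + z‖ ^ 2))) := by
  refine Summable.of_nonneg_of_le (fun _ => (Real.exp_pos _).le) ?_
    ((summable_gauss (c := c / 2) (by positivity)).mul_left (Real.exp (c * ‖z‖ ^ 2)))
  intro x
  rw [← Real.exp_add]
  apply Real.exp_le_exp.2
  have h1 : ‖(x:ℂ)‖ ≤ ‖(x:ℂ) + z‖ + ‖z‖ := by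
    have := norm_sub_le ((x:ℂ) + z) z
    simpa using this
  rw [Nm_eq_norm_sq]
  have h2 : ‖(x:ℂ)‖ ^ 2 ≤ 2 * ‖(x:ℂ) + z‖ ^ 2 + 2 * ‖z‖ ^ 2 := by
    have h3 := pow_le_pow_left₀ (norm_nonneg _) h1 2
    nlinarith [sq_nonneg (‖(x:ℂ) + z‖ - ‖z‖)]
  nlinarith

lemma quad_rev {α : ℝ} (hα : 0 < α) (β : ℝ) :
    (∑' n : ℤ, cexp (-Real.pi / α * (n + β) ^ 2)) =
      (α ^ (1/2 : ℝ) : ℝ) * ∑' n : ℤ, cexp (-Real.pi * α * n ^ 2 - 2 * Real.pi * I * β * n) := by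
  have h := Complex.tsum_exp_neg_quadratic (a := (α : ℂ)) (by simpa using hα) (-I * β)
  have e : ∀ n : ℤ, (n : ℂ) + I * (-I * β) = n + β := by
    intro n; linear_combination (-(β:ℂ)) * I_sq
  simp only [e] at h
  have h0 : ((α : ℂ)) ^ (1/2 : ℂ) ≠ 0 := by
    rw [Ne, Complex.cpow_eq_zero_iff]; simp [hα.ne']
  have h1 : ((α ^ (1/2 : ℝ) : ℝ) : ℂ) = (α : ℂ) ^ (1/2 : ℂ) := by
    rw [ofReal_cpow hα.le]; simp
  rw [h1]
  have h2 : ∀ n : ℤ, -(Real.pi:ℂ) * α * n ^ 2 - 2 * Real.pi * I * β * n = -(Real.pi:ℂ) * α * n ^ 2 + 2 * Real.pi * (-I * β) * n := by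
    intro n; ring
  simp only [h2]
  rw [h]
  field_simp

lemma normSq_coord (p q : ℝ) : ‖(p:ℂ) + q * ωc‖ ^ 2 = (p - q / 2) ^ 2 + 3 / 4 * q ^ 2 := by
  rw [← Complex.normSq_eq_norm_sq, ωc_eq, Complex.normSq_apply]
  have h3 : Real.sqrt 3 * Real.sqrt 3 = 3 := Real.mul_self_sqrt (by norm_num)
  simp
  linear_combination (q ^ 2 / 4) * h3

lemma eE_coord (a b : ℝ) : eE (((a:ℂ) + b * ωc) / lam) = cexp (2 * Real.pi * I * b) := by
  rw [eE_re]
  have h3 : Real.sqrt 3 * Real.sqrt 3 = 3 := Real.mul_self_sqrt (by norm_num)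
  have hω : ωc = -1/2 + (Real.sqrt 3 : ℝ) / 2 * I := by
    rw [ωc_eq]; apply Complex.ext <;> simp
  have h : ((a:ℂ) + b * ωc) / lam = ((b / 2 : ℝ) : ℂ) + ((-(a - b / 2) / Real.sqrt 3 : ℝ) : ℂ) * I := by
    rw [div_eq_iff lam_ne, coe_lam, hω]
    have h3' : ((Real.sqrt 3 : ℝ) : ℂ) ≠ 0 := by simp
    have : ((Real.sqrt 3 : ℝ) : ℂ) * (Real.sqrt 3 : ℝ) = 3 := by rw [← ofReal_mul, h3]; simp
    push_cast
    field_simp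
    ring_nf
    simp only [I_sq]
    ring
  rw [h]; congr 1; simp; ring

lemma exists_coord (z : ℂ) : ∃ u v : ℝ, z = u + v * ωc := by
  have h3 : Real.sqrt 3 * Real.sqrt 3 = 3 := Real.mul_self_sqrt (by norm_num)
  have h0 : Real.sqrt 3 ≠ 0 := by simp
  refine ⟨z.re + z.im / Real.sqrt 3, 2 * z.im / Real.sqrt 3, ?_⟩
  rw [ωc_eq]
  apply Complex.ext
  · simp; ring
  · simp; field_simp

lemma summable_int_gauss {a : ℝ} (ha : 0 < a) (s : ℝ) : Summable (fun n : ℤ => Real.exp (-(a * (n + s) ^ 2))) := by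
  have h := (summable_gauss_shift ha (s:ℂ)).comp_injective (i := fun n : ℤ => mk n 0) (by
    intro a b h; exact (mk_inj h).1)
  refine h.congr ?_
  intro n
  simp only [Function.comp, coe_mk]
  congr 3
  have : ((n:ℂ) + (0:ℤ) * ωc + s) = ((n + s : ℝ) : ℂ) := by push_cast; ring
  rw [this, Complex.norm_real, Real.norm_eq_abs, sq_abs]

lemma theta_base {t : ℝ} (ht : 0 < t) (z : ℂ) :
    ∑' x : Eis, cexp (-((2 * Real.pi * t / Real.sqrt 3 * ‖(x:ℂ) + z‖ ^ 2 : ℝ) : ℂ)) =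
      (1 / t) * ∑' k : Eis, cexp (-((2 * Real.pi / (t * Real.sqrt 3) * Nm k : ℝ) : ℂ)) * eE ((k : ℂ) * z / lam) := by
  obtain ⟨u, v, hz⟩ := exists_coord z
  have hs3 : 0 < Real.sqrt 3 := Real.sqrt_pos.2 (by norm_num)
  have h33 : Real.sqrt 3 * Real.sqrt 3 = 3 := Real.mul_self_sqrt (by norm_num)
  have hpi := Real.pi_pos
  set α : ℝ := Real.sqrt 3 / (2 * t) with hα
  set a : ℝ := Real.sqrt 3 * t / 2 with ha
  have hα0 : 0 < α := by positivity
  have ha0 : 0 < a := by positivity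
  -- the intermediate double sum
  let G : ℤ → ℤ → ℂ := fun b m => cexp (-(Real.pi * a * (b + v) ^ 2 : ℝ)) *
    cexp (-Real.pi * α * m ^ 2 - 2 * Real.pi * I * (u - (b + v) / 2 : ℝ) * m)
  have hGn : ∀ b m, ‖G b m‖ = Real.exp (-(Real.pi * a * (b + v) ^ 2)) * Real.exp (-(Real.pi * α * (m + 0) ^ 2)) := by
    intro b m
    simp only [G]
    rw [norm_mul, Complex.norm_exp, Complex.norm_exp]
    congr 1
    · congr 1
      have e : (-Real.pi * α * m ^ 2 - 2 * Real.pi * I * (u - (b + v) / 2 : ℝ) * m : ℂ) =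
        ((-Real.pi * α * m ^ 2 : ℝ) : ℂ) + ((-2 * Real.pi * (u - (b + v) / 2) * m : ℝ) : ℂ) * I := by
        push_cast; ring
      rw [e, add_re, ofReal_re, re_ofReal_mul]; simp
  have hGs : Summable (fun p : ℤ × ℤ => G p.1 p.2) := by
    apply Summable.of_norm
    simp only [hGn]
    have h1 := summable_int_gauss (a := Real.pi * a) (by positivity) v
    have h2 := summable_int_gauss (a := Real.pi * α) (by positivity) 0
    exact h1.mul_of_nonneg h2 (fun _ => (Real.exp_pos _).le) (fun _ => (Real.exp_pos _).le)
  have hL : ∑' x : Eis, cexp (-((2 * Real.pi * t / Real.sqrt 3 * ‖(x:ℂ) + z‖ ^ 2 : ℝ) : ℂ)) =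
      (α ^ (1/2 : ℝ) : ℝ) * ∑' b : ℤ, ∑' m : ℤ, G b m := by
    rw [← eq2.tsum_eq, ← (Equiv.prodComm ℤ ℤ).tsum_eq]
    have hsum : Summable (fun p : ℤ × ℤ => cexp (-((2 * Real.pi * t / Real.sqrt 3 * ‖((eq2 ((Equiv.prodComm ℤ ℤ) p) : Eis):ℂ) + z‖ ^ 2 : ℝ) : ℂ))) := by
      apply Summable.of_norm
      have := (summable_gauss_shift (c := 2 * Real.pi * t / Real.sqrt 3) (by positivity) z)
      have h2 := ((Equiv.prodComm ℤ ℤ).trans eq2).summable_iff.2 this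
      refine h2.congr ?_
      intro p
      rw [← ofReal_neg, Complex.norm_exp_ofReal]; rfl
    rw [hsum.tsum_prod, ← tsum_mul_left]
    congr 1; ext b
    have hq := quad_rev hα0 (u - (b + v) / 2)
    rw [show (∑' m : ℤ, G b m) = cexp (-(Real.pi * a * (b + v) ^ 2 : ℝ)) *
      ∑' m : ℤ, cexp (-Real.pi * α * m ^ 2 - 2 * Real.pi * I * (u - (b + v) / 2 : ℝ) * m) from tsum_mul_left]
    rw [mul_left_comm, ← hq, ← tsum_mul_left]
    congr 1; ext n
    rw [← Complex.exp_add]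
    congr 1
    simp only [Equiv.prodComm_apply, Prod.swap_prod_mk, eq2_apply, coe_mk]
    have : ((n:ℂ) + b * ωc + z) = ((n + u : ℝ) : ℂ) + ((b + v : ℝ) : ℂ) * ωc := by rw [hz]; push_cast; ring
    rw [this, normSq_coord]
    have e1 : 2 * Real.pi * t / Real.sqrt 3 * ((n + u - (b + v) / 2) ^ 2 + 3 / 4 * (b + v) ^ 2) =
      Real.pi * a * (b + v) ^ 2 + Real.pi / α * (n + (u - (b + v) / 2)) ^ 2 := by
      rw [hα, ha]; field_simp
      linear_combination (-4*(b+v)^2) * h33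
    rw [e1]; push_cast; ring
  rw [hL]
  have hcomm : ∑' b : ℤ, ∑' m : ℤ, G b m = ∑' m : ℤ, ∑' b : ℤ, G b m :=
    (Summable.tsum_comm (f := G) hGs).symm
  rw [hcomm]
  let T : ℤ → ℤ → ℂ := fun m n => cexp (-((2 * Real.pi / (t * Real.sqrt 3) * ((n - m / 2) ^ 2 + 3 / 4 * m ^ 2) : ℝ) : ℂ)) *
    cexp (2 * Real.pi * I * (v * n - u * m : ℝ))
  have hG2 : ∀ m : ℤ, ∑' b : ℤ, G b m = (1 / a ^ (1/2 : ℝ) : ℝ) * ∑' n : ℤ, T m n := by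
    intro m
    have hq := Complex.tsum_exp_neg_quadratic (a := (a : ℂ)) (by simpa using ha0) (-a * v + I * m / 2)
    have h1 : ((a ^ (1/2 : ℝ) : ℝ) : ℂ) = (a : ℂ) ^ (1/2 : ℂ) := by
      rw [ofReal_cpow ha0.le]; simp
    rw [ofReal_div, h1, ofReal_one]
    set K : ℂ := -(Real.pi * a * v ^ 2 : ℝ) + Real.pi * I * m * v - Real.pi * α * m ^ 2 - 2 * Real.pi * I * u * m with hK
    have hGe : ∀ b : ℤ, G b m = cexp K * cexp (-Real.pi * a * b ^ 2 + 2 * Real.pi * (-a * v + I * m / 2) * b) := by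
      intro b
      simp only [G]; rw [← Complex.exp_add, ← Complex.exp_add]; congr 1
      rw [hK]; push_cast; ring
    simp only [hGe]
    rw [tsum_mul_left, hq, mul_left_comm, ← tsum_mul_left]
    congr 2; ext n
    simp only [T]
    rw [← Complex.exp_add, ← Complex.exp_add]; congr 1
    have hac : (a : ℂ) ≠ 0 := by exact_mod_cast ha0.ne'
    have e0 : (n:ℂ) + I * (-a * v + I * m / 2) = n - m / 2 - I * a * v := by
      linear_combination (m / 2 : ℂ) * I_sq
    have e1 : -(Real.pi:ℂ) / a * (n + I * (-a * v + I * m / 2)) ^ 2 =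
       - ((Real.pi / a * (n - m / 2) ^ 2 : ℝ) : ℂ) + 2 * Real.pi * I * v * (n - m / 2) + Real.pi * a * v ^ 2 := by
      rw [e0]; push_cast; field_simp; ring_nf; rw [I_sq]; ring
    rw [e1, hK]
    have e2 : 2 * Real.pi / (t * Real.sqrt 3) * ((n - m / 2) ^ 2 + 3 / 4 * m ^ 2) =
       Real.pi / a * (n - m / 2) ^ 2 + Real.pi * α * m ^ 2 := by
      rw [hα, ha]; field_simp
      linear_combination (-4*m^2 : ℝ) * h33
    rw [e2]; push_cast; ring
  simp only [hG2]
  rw [tsum_mul_left, ← mul_assoc]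
  have hconst : ((α ^ (1/2 : ℝ) : ℝ) : ℂ) * ((1 / a ^ (1/2 : ℝ) : ℝ) : ℂ) = 1 / t := by
    rw [← ofReal_mul, mul_one_div, ← Real.div_rpow hα0.le ha0.le]
    have : α / a = (1 / t) ^ (2:ℝ) := by rw [Real.rpow_two, hα, ha]; field_simp
    rw [this, ← Real.rpow_mul (by positivity)]; norm_num
  rw [hconst]
  congr 1
  -- reindex
  let e : ℤ × ℤ ≃ ℤ × ℤ := ⟨fun p => (p.2 - p.1, -p.1), fun p => (-p.2, p.1 - p.2), fun p => by simp, fun p => by simp⟩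
  rw [← (e.trans eq2).tsum_eq (fun k : Eis => cexp (-((2 * Real.pi / (t * Real.sqrt 3) * Nm k : ℝ) : ℂ)) * eE ((k : ℂ) * z / lam))]
  have hTe : ∀ p : ℤ × ℤ, cexp (-((2 * Real.pi / (t * Real.sqrt 3) * Nm ((e.trans eq2) p) : ℝ) : ℂ)) * eE ((((e.trans eq2) p : Eis) : ℂ) * z / lam) = T p.1 p.2 := by
    rintro ⟨m, n⟩
    have e1 : (e.trans eq2) (m, n) = mk (n - m) (-m) := rfl
    simp only [T]
    rw [e1]
    congr 1
    · congr 3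
      rw [Nm_eq_norm_sq, coe_mk]
      have := normSq_coord (n - m) (-m)
      push_cast at this ⊢
      rw [this]; ring
    · have hw : ωc ^ 2 = -1 - ωc := by
        have := congrArg (fun x : Eis => (x:ℂ)) ωE_sq
        simpa using this
      have : ((mk (n - m) (-m) : Eis) : ℂ) * z = ((u * (n - m) + v * m : ℝ) : ℂ) + ((v * n - u * m : ℝ) : ℂ) * ωc := by
        rw [coe_mk, hz]; push_cast
        linear_combination (-(m:ℂ) * v) * hw
      rw [this, eE_coord]
  simp only [hTe]
  have hTs : Summable (fun p : ℤ × ℤ => T p.1 p.2) := by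
    simp only [← hTe]
    apply Summable.of_norm
    have := (e.trans eq2).summable_iff.2 (summable_gauss (c := 2 * Real.pi / (t * Real.sqrt 3)) (by positivity))
    refine this.congr ?_
    intro p
    rw [norm_mul, eE_norm, mul_one, ← ofReal_neg, Complex.norm_exp_ofReal]; rfl
  exact (hTs.tsum_prod (f := fun p : ℤ × ℤ => T p.1 p.2)).symm

/-- residue decomposition -/
def resEquiv {r : Eis} (hr : r ≠ 0) : (Eis ⧸ Ideal.span {r}) × Eis ≃ Eis := Equiv.ofBijective
  (fun p => p.1.out + r * p.2) (by
    constructor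
    · rintro ⟨d, y⟩ ⟨d', y'⟩ h
      simp only at h
      have h1 : d = d' := by
        have := congrArg (Ideal.Quotient.mk (Ideal.span {r})) h
        have hr0 : Ideal.Quotient.mk (Ideal.span {r}) r = 0 := by
          rw [Ideal.Quotient.eq_zero_iff_mem]; exact Ideal.mem_span_singleton_self r
        simpa [map_add, map_mul, mk_out, hr0] using this
      subst h1
      have h2 : r * y = r * y' := by linear_combination h
      rw [mul_left_cancel₀ hr h2]
    · intro x
      obtain ⟨c, hc⟩ := out_dvd r x
      exact ⟨(Ideal.Quotient.mk _ x, -c), by simp only; linear_combination hc⟩)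

lemma tsum_residue {r : Eis} (hr : r ≠ 0) {f : Eis → ℂ} (hf : Summable f) :
    ∑' x, f x = qs r (fun d => ∑' y, f (d + r * y)) := by
  haveI := finite_quot hr
  letI := Fintype.ofFinite (Eis ⧸ Ideal.span {r})
  rw [← (resEquiv hr).tsum_eq]
  have h := (resEquiv hr).summable_iff.2 hf
  unfold qs
  rw [finsum_eq_sum_of_fintype]
  exact (h.tsum_prod).trans (tsum_fintype _)

/-- theta function -/
def tf (ψ : Eis → ℂ) (c y : ℝ) : ℂ := ∑' x : Eis, ψ x * cexp (-((c * y * Nm x : ℝ) : ℂ))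

lemma tf_norm (ψ : Eis → ℂ) (hψ : ∀ x, ‖ψ x‖ ≤ 1) (c y : ℝ) (x : Eis) :
    ‖ψ x * cexp (-((c * y * Nm x : ℝ) : ℂ))‖ ≤ Real.exp (-(c * y * Nm x)) := by
  rw [norm_mul, ← ofReal_neg, Complex.norm_exp_ofReal]
  exact mul_le_of_le_one_left (Real.exp_pos _).le (hψ x)

lemma tf_summable (ψ : Eis → ℂ) (hψ : ∀ x, ‖ψ x‖ ≤ 1) {c y : ℝ} (hc : 0 < c) (hy : 0 < y) :
    Summable (fun x : Eis => ψ x * cexp (-((c * y * Nm x : ℝ) : ℂ))) :=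
  Summable.of_norm_bounded (summable_gauss (mul_pos hc hy)) (tf_norm ψ hψ c y)

/-- the constant of the functional equation -/
def cG (r : Eis) : ℝ := 2 * Real.pi / (Real.sqrt 3 * Real.sqrt (Nm r))
lemma cG_pos {r : Eis} (hr : r ≠ 0) : 0 < cG r := by
  have h1 := Real.sqrt_pos.2 (Nm_pos hr)
  have := Real.pi_pos
  unfold cG; positivity

set_option maxHeartbeats 1000000 in
lemma theta_psi {r : Eis} {ψ : Eis → ℂ} {W : ℂ} (g : GaussData r ψ W) {y : ℝ} (hy : 0 < y) :
    tf ψ (cG r) (1 / y) = (W * y) * tf (fun x => (starRingEnd ℂ) (ψ x)) (cG r) y := by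
  have hc := cG_pos g.hr
  have hs := Real.sqrt_pos.2 (Nm_pos g.hr)
  have hs3 : 0 < Real.sqrt 3 := Real.sqrt_pos.2 (by norm_num)
  have hss : Real.sqrt (Nm r) * Real.sqrt (Nm r) = Nm r := Real.mul_self_sqrt (Nm_nonneg r)
  have hrc := coe_ne g.hr
  have hpi := Real.pi_pos
  have hyc : (y : ℂ) ≠ 0 := by exact_mod_cast hy.ne'
  have hsc : (Real.sqrt (Nm r) : ℂ) ≠ 0 := by exact_mod_cast hs.ne'
  unfold tf
  rw [tsum_residue g.hr (tf_summable ψ g.le hc (by positivity))]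
  have h1 : ∀ d : Eis, ∑' x : Eis, ψ (d + r * x) * cexp (-((cG r * (1 / y) * Nm (d + r * x) : ℝ) : ℂ)) =
      ψ d * ((y / Real.sqrt (Nm r)) * ∑' k : Eis, cexp (-((cG r * y * Nm k : ℝ) : ℂ)) * eE ((k * d : Eis) / (lam * r))) := by
    intro d
    have hb := theta_base (t := Real.sqrt (Nm r) / y) (by positivity) ((d : ℂ) / r)
    have e1 : ∀ x : Eis, ψ (d + r * x) * cexp (-((cG r * (1 / y) * Nm (d + r * x) : ℝ) : ℂ)) =
      ψ d * cexp (-((2 * Real.pi * (Real.sqrt (Nm r) / y) / Real.sqrt 3 * ‖(x:ℂ) + (d : ℂ) / r‖ ^ 2 : ℝ) : ℂ)) := by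
      intro x
      rw [g.per (d + r * x) d ⟨x, by ring⟩]
      congr 4
      have : ((d + r * x : Eis) : ℂ) = r * ((x : ℂ) + d / r) := by push_cast; field_simp; ring
      rw [Nm_eq_norm_sq, this, norm_mul, mul_pow, ← Nm_eq_norm_sq r]
      unfold cG
      generalize ‖(x:ℂ) + d / r‖ ^ 2 = A
      generalize Real.sqrt (Nm r) = S at hss hs ⊢
      rw [← hss]
      field_simp
    simp only [e1]
    rw [tsum_mul_left, hb]
    congr 2
    · push_cast; field_simp
    · congr 1; ext k
      congr 1
      · congr 4; unfold cG; field_simp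
      · congr 1; push_cast; have := lam_ne; field_simp
  simp only [h1]
  haveI := finite_quot g.hr
  letI := Fintype.ofFinite (Eis ⧸ Ideal.span {r})
  have hsum : ∀ d : Eis, Summable (fun k : Eis => ψ d * ((y / Real.sqrt (Nm r) : ℂ)) * (cexp (-((cG r * y * Nm k : ℝ) : ℂ)) * eE ((k * d : Eis) / (lam * r)))) := by
    intro d
    apply Summable.mul_left
    apply Summable.of_norm_bounded (summable_gauss (mul_pos hc hy))
    intro k
    rw [norm_mul, eE_norm, mul_one, ← ofReal_neg, Complex.norm_exp_ofReal]
  have h2 : qs r (fun d => ψ d * ((y / Real.sqrt (Nm r)) * ∑' k : Eis, cexp (-((cG r * y * Nm k : ℝ) : ℂ)) * eE ((k * d : Eis) / (lam * r)))) =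
     ∑' k : Eis, qs r (fun d => ψ d * ((y / Real.sqrt (Nm r) : ℂ)) * (cexp (-((cG r * y * Nm k : ℝ) : ℂ)) * eE ((k * d : Eis) / (lam * r)))) := by
    unfold qs
    simp only [finsum_eq_sum_of_fintype]
    rw [Summable.tsum_finsetSum (fun d _ => hsum d.out)]
    apply Finset.sum_congr rfl
    intro d _
    rw [tsum_mul_left, mul_assoc]
  rw [h2, ← tsum_mul_left]
  congr 1; ext k
  have h3 : (fun d : Eis => ψ d * ((y / Real.sqrt (Nm r) : ℂ)) * (cexp (-((cG r * y * Nm k : ℝ) : ℂ)) * eE ((k * d : Eis) / (lam * r)))) =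
    fun d : Eis => ((y / Real.sqrt (Nm r) : ℂ) * cexp (-((cG r * y * Nm k : ℝ) : ℂ))) * (ψ d * eE ((k * d : Eis) / (lam * r))) := by
    ext d; ring
  rw [h3, qs_const_mul _ g.hr, g.gs]
  field_simp

lemma tf_cont (ψ : Eis → ℂ) (hψ : ∀ x, ‖ψ x‖ ≤ 1) {c : ℝ} (hc : 0 < c) : ContinuousOn (tf ψ c) (Set.Ioi 0) := by
  intro y hy
  have hy' : 0 < y := hy
  have : ContinuousOn (tf ψ c) (Set.Ioi (y / 2)) := by
    unfold tf
    apply continuousOn_tsum (u := fun x : Eis => Real.exp (-(c * (y / 2) * Nm x)))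
    · intro x; fun_prop
    · exact summable_gauss (by positivity)
    · intro x z hz
      refine (tf_norm ψ hψ c z x).trans (Real.exp_le_exp.2 ?_)
      have : c * (y / 2) * Nm x ≤ c * z * Nm x := by
        have := Nm_nonneg x
        have hz' : y / 2 ≤ z := le_of_lt hz
        gcongr
      linarith
  exact (this.continuousAt (Ioi_mem_nhds (by linarith))).continuousWithinAt

lemma tf_top (ψ : Eis → ℂ) (hψ : ∀ x, ‖ψ x‖ ≤ 1) (h0 : ψ 0 = 0) {c : ℝ} (hc : 0 < c) (s : ℝ) :
    (fun y => tf ψ c y) =O[Filter.atTop] (fun y : ℝ => y ^ s) := by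
  have h1 : (fun y => tf ψ c y) =O[Filter.atTop] (fun y : ℝ => Real.exp (-(c / 2) * y)) := by
    apply Asymptotics.IsBigO.of_bound (∑' x : Eis, Real.exp (-(c / 2 * Nm x)))
    filter_upwards [Filter.eventually_ge_atTop 1] with y hy
    rw [Real.norm_of_nonneg (Real.exp_pos _).le, ← tsum_mul_right]
    unfold tf
    apply tsum_of_norm_bounded ((summable_gauss (half_pos hc)).mul_right _).hasSum
    intro x
    by_cases hx : x = 0
    · subst hx; rw [h0, zero_mul, norm_zero]; positivity
    · refine (tf_norm ψ hψ c y x).trans ?_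
      rw [← Real.exp_add]
      apply Real.exp_le_exp.2
      have := one_le_Nm hx
      nlinarith [mul_nonneg (sub_nonneg.2 hy) (sub_nonneg.2 this), mul_le_mul hy this zero_le_one (by linarith),
        mul_nonneg hc.le (mul_nonneg (sub_nonneg.2 hy) (by linarith : 0 ≤ Nm x)), mul_nonneg hc.le (mul_nonneg (by linarith : 0 ≤ y) (sub_nonneg.2 this))]
  exact h1.trans (isLittleO_exp_neg_mul_rpow_atTop (by positivity) s).isBigO

/-- the functional equation pair -/
def fePair {r : Eis} {ψ : Eis → ℂ} {W : ℂ} (g : GaussData r ψ W) (h0 : ψ 0 = 0) : WeakFEPair ℂ where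
  f := tf ψ (cG r)
  g := tf (fun x => (starRingEnd ℂ) (ψ x)) (cG r)
  k := 1
  ε := W
  f₀ := 0
  g₀ := 0
  hf_int := (tf_cont ψ g.le (cG_pos g.hr)).locallyIntegrableOn measurableSet_Ioi
  hg_int := (tf_cont _ (fun x => by simpa using g.le x) (cG_pos g.hr)).locallyIntegrableOn measurableSet_Ioi
  hk := one_pos
  hε := by intro h; have := g.W1; rw [h] at this; simp at this
  h_feq := by
    intro y hy
    rw [theta_psi g hy]; simp
  hf_top := by
    intro s; simpa using tf_top ψ g.le h0 (cG_pos g.hr) s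
  hg_top := by
    intro s; simpa using tf_top _ (fun x => by simpa using g.le x) (by simp [h0]) (cG_pos g.hr) s

lemma fePair_strong {r : Eis} {ψ : Eis → ℂ} {W : ℂ} (g : GaussData r ψ W) (h0 : ψ 0 = 0) : IsStrongFEPair (fePair g h0) := ⟨rfl, rfl⟩

/-- full L series -/
def LS (ψ : Eis → ℂ) (s : ℂ) : ℂ := ∑' x : Eis, ψ x * (Nm x : ℂ) ^ (-s)

lemma LS_summable (ψ : Eis → ℂ) (hψ : ∀ x, ‖ψ x‖ ≤ 1) {s : ℂ} (hs : 1 < s.re) :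
    Summable (fun x : Eis => ψ x * (Nm x : ℂ) ^ (-s)) := by
  apply Summable.of_norm_bounded (summable_Nm hs)
  intro x
  rw [norm_mul]
  by_cases hx : x = 0
  · subst hx; rw [Nm_zero, ofReal_zero, Complex.zero_cpow (by intro h; have := congrArg Complex.re h; simp at this; linarith)]
    simp; positivity
  · rw [Complex.norm_cpow_eq_rpow_re_of_pos (Nm_pos hx)]
    exact mul_le_of_le_one_left (by have := Nm_nonneg x; positivity) (hψ x)

instance : Countable Eis := eisEquiv.symm.injective.countable

lemma mellin_tf (ψ : Eis → ℂ) (hψ : ∀ x, ‖ψ x‖ ≤ 1) (h0 : ψ 0 = 0) {c : ℝ} (hc : 0 < c) {s : ℂ} (hs : 1 < s.re) :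
    mellin (tf ψ c) s = Gamma s * (c : ℂ) ^ (-s) * LS ψ s := by
  have h := hasSum_mellin (a := ψ) (p := fun x => c * Nm x) (F := tf ψ c) (s := s) ?_ (by linarith) ?_ ?_
  · rw [← h.tsum_eq, LS, ← tsum_mul_left]
    congr 1; ext x
    rw [ofReal_mul, Complex.mul_cpow_ofReal_nonneg hc.le (Nm_nonneg x), Complex.cpow_neg, Complex.cpow_neg]
    by_cases hx : x = 0
    · subst hx; simp [h0]
    · field_simp
  · intro x
    by_cases hx : x = 0
    · left; rw [hx, h0]
    · right; have := Nm_pos hx; positivity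
  · intro t ht
    have := (tf_summable ψ hψ hc ht).hasSum
    unfold tf
    convert this using 1
    ext x
    rw [ofReal_exp]; congr 3
    push_cast; ring
  · refine Summable.of_nonneg_of_le (fun x => ?_) ?_ ((summable_Nm hs).mul_left (c ^ (-s.re)))
    · have := Nm_nonneg x; positivity
    · intro x
      have := Nm_nonneg x
      rw [Real.mul_rpow hc.le this, Real.rpow_neg hc.le, Real.rpow_neg this, ← mul_inv, ← one_div]
      exact div_le_div_of_nonneg_right (hψ x) (by positivity)

lemma entire_eq {F G : ℂ → ℂ} (hF : Differentiable ℂ F) (hG : Differentiable ℂ G)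
    (h : ∀ s : ℂ, 1 < s.re → F s = G s) : F = G := by
  have hF' : AnalyticOnNhd ℂ F Set.univ := fun z _ => hF.analyticAt z
  have hG' : AnalyticOnNhd ℂ G Set.univ := fun z _ => hG.analyticAt z
  apply hF'.eq_of_eventuallyEq hG' (z₀ := 2)
  have : {s : ℂ | 1 < s.re} ∈ nhds (2:ℂ) := (isOpen_lt continuous_const Complex.continuous_re).mem_nhds (by simp)
  filter_upwards [this] with s hs using h s hs

/-- functional equation in the region of convergence of the dual series -/
lemma L_eq_Lam {r : Eis} {ψ : Eis → ℂ} {W : ℂ} (g : GaussData r ψ W) (h0 : ψ 0 = 0) {L : ℂ → ℂ}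
    (hL : Differentiable ℂ L) (hL1 : ∀ s : ℂ, 1 < s.re → L s = LS ψ s) (s : ℂ) :
    L s = (fePair g h0).Λ s * (Gamma s)⁻¹ * (cG r : ℂ) ^ s := by
  have hc := cG_pos g.hr
  have hcc : (cG r : ℂ) ≠ 0 := by exact_mod_cast hc.ne'
  have hd : Differentiable ℂ (fun s => (fePair g h0).Λ s * (Gamma s)⁻¹ * (cG r : ℂ) ^ s) := by
    apply Differentiable.mul
    · exact (fePair_strong g h0).differentiable_Λ.mul differentiable_one_div_Gamma
    · intro s; exact (differentiableAt_id.const_cpow (Or.inl hcc))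
  have := entire_eq hL hd (by
    intro s hs
    rw [hL1 s hs, (fePair_strong g h0).Λ_eq]
    have e : mellin (fePair g h0).f s = _ := mellin_tf ψ g.le h0 hc hs
    rw [e, Complex.cpow_neg]
    have h1 : Gamma s ≠ 0 := Complex.Gamma_ne_zero_of_re_pos (by linarith)
    have h2 : (cG r : ℂ) ^ s ≠ 0 := by rw [Ne, Complex.cpow_eq_zero_iff]; tauto
    field_simp)
  exact congrFun this s

lemma L_FE {r : Eis} {ψ : Eis → ℂ} {W : ℂ} (g : GaussData r ψ W) (h0 : ψ 0 = 0) {L : ℂ → ℂ}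
    (hL : Differentiable ℂ L) (hL1 : ∀ s : ℂ, 1 < s.re → L s = LS ψ s) {s : ℂ} (hs : s.re < 0) :
    L s = W * (cG r : ℂ) ^ (2 * s - 1) * (Gamma (1 - s) * (Gamma s)⁻¹) * LS (fun x => (starRingEnd ℂ) (ψ x)) (1 - s) := by
  have hc := cG_pos g.hr
  have hcc : (cG r : ℂ) ≠ 0 := by exact_mod_cast hc.ne'
  rw [L_eq_Lam g h0 hL hL1]
  have hs' : 1 < (1 - s).re := by simp; linarith
  have h1 := (fePair g h0).functional_equation (1 - s)
  have h2 : ((fePair g h0).k : ℂ) - (1 - s) = s := by simp [fePair]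
  rw [h2] at h1
  have h3 : (fePair g h0).symm.Λ (1 - s) = Gamma (1-s) * (cG r:ℂ)^(-(1-s)) * LS (fun x => (starRingEnd ℂ) (ψ x)) (1-s) := by
    rw [(fePair_strong g h0).symm_Λ_eq]
    exact mellin_tf (fun x => (starRingEnd ℂ) (ψ x)) (fun x => by simpa using g.le x) (by simp [h0]) hc hs'
  rw [h1, h3]
  have h4 : (fePair g h0).ε = W := rfl
  rw [h4, smul_eq_mul, show 2 * s - 1 = s + (-(1 - s)) by ring, Complex.cpow_add _ _ hcc]
  ring

lemma csum {ι : Type*} (s : Finset ι) (f g : ι → ℂ) :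
    ‖∑ i ∈ s, f i * g i‖ ^ 2 ≤ (∑ i ∈ s, ‖f i‖ ^ 2) * ∑ i ∈ s, ‖g i‖ ^ 2 := by
  refine le_trans ?_ (Finset.sum_mul_sq_le_sq_mul_sq s (fun i => ‖f i‖) (fun i => ‖g i‖))
  refine pow_le_pow_left₀ (norm_nonneg _) ?_ 2
  refine (norm_sum_le _ _).trans (le_of_eq ?_)
  simp [norm_mul]

/-- weighted Cauchy -/
lemma csum_w {ι : Type*} (s : Finset ι) (w : ι → ℝ) (hw : ∀ i ∈ s, 0 < w i) (g : ι → ℂ) :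
    ‖∑ i ∈ s, g i‖ ^ 2 ≤ (∑ i ∈ s, w i) * ∑ i ∈ s, (w i)⁻¹ * ‖g i‖ ^ 2 := by
  have h := Finset.sum_mul_sq_le_sq_mul_sq s (fun i => Real.sqrt (w i)) (fun i => (Real.sqrt (w i))⁻¹ * ‖g i‖)
  have e1 : ∑ i ∈ s, Real.sqrt (w i) * ((Real.sqrt (w i))⁻¹ * ‖g i‖) = ∑ i ∈ s, ‖g i‖ := by
    apply Finset.sum_congr rfl; intro i hi
    have := (Real.sqrt_pos.2 (hw i hi)).ne'
    field_simp
  have e2 : ∑ i ∈ s, Real.sqrt (w i) ^ 2 = ∑ i ∈ s, w i := by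
    apply Finset.sum_congr rfl; intro i hi
    exact Real.sq_sqrt (hw i hi).le
  have e3 : ∑ i ∈ s, ((Real.sqrt (w i))⁻¹ * ‖g i‖) ^ 2 = ∑ i ∈ s, (w i)⁻¹ * ‖g i‖ ^ 2 := by
    apply Finset.sum_congr rfl; intro i hi
    rw [mul_pow, inv_pow, Real.sq_sqrt (hw i hi).le]
  rw [e1, e2, e3] at h
  exact (pow_le_pow_left₀ (norm_nonneg _) (norm_sum_le _ _) 2).trans h

lemma duality {ι κ : Type*} (S : Finset ι) (T : Finset κ) (k : ι → κ → ℂ) (B : ℝ) (hB : 0 ≤ B)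
    (h : ∀ e : κ → ℂ, ∑ i ∈ S, ‖∑ t ∈ T, e t * k i t‖ ^ 2 ≤ B * ∑ t ∈ T, ‖e t‖ ^ 2) (d : ι → ℂ) :
    ∑ t ∈ T, ‖∑ i ∈ S, d i * k i t‖ ^ 2 ≤ B * ∑ i ∈ S, ‖d i‖ ^ 2 := by
  set V := ∑ t ∈ T, ‖∑ i ∈ S, d i * k i t‖ ^ 2 with hV
  have hV0 : 0 ≤ V := by positivity
  have hD0 : 0 ≤ ∑ i ∈ S, ‖d i‖ ^ 2 := by positivity
  have h1 := h (fun t => (starRingEnd ℂ) (∑ i ∈ S, d i * k i t))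
  have h2 : (V : ℂ) = ∑ i ∈ S, d i * ∑ t ∈ T, (starRingEnd ℂ) (∑ i ∈ S, d i * k i t) * k i t := by
    rw [hV]; push_cast
    simp only [Finset.mul_sum]
    rw [Finset.sum_comm]
    apply Finset.sum_congr rfl; intro t _
    rw [← Complex.mul_conj', Finset.sum_mul]
    apply Finset.sum_congr rfl; intro i _; ring
  have h3 := csum S d (fun i => ∑ t ∈ T, (starRingEnd ℂ) (∑ i ∈ S, d i * k i t) * k i t)
  rw [← h2] at h3
  simp only [norm_real, RCLike.norm_conj] at h3 h1
  rw [Real.norm_of_nonneg hV0] at h3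
  have h4 : V ^ 2 ≤ (B * ∑ i ∈ S, ‖d i‖ ^ 2) * V := by
    refine h3.trans ?_
    calc _ ≤ (∑ i ∈ S, ‖d i‖ ^ 2) * (B * V) := by gcongr
      _ = _ := by ring
  rcases hV0.eq_or_lt with h0 | h0
  · rw [← h0]; positivity
  · nlinarith

/-- large sieve inequality over squarefree moduli -/
def LS1 (M N B : ℝ) : Prop := ∀ c : Finset PP → ℂ,
  ∑ A ∈ SS M, ‖∑ P ∈ SS N, c P * ch P (el A)‖ ^ 2 ≤ B * ∑ P ∈ SS N, ‖c P‖ ^ 2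

def LS2 (K N B : ℝ) : Prop := ∀ c : Finset PP → ℂ,
  ∑ m ∈ Ball K, ‖∑ P ∈ SS N, c P * ch P m‖ ^ 2 ≤ B * ∑ P ∈ SS N, ‖c P‖ ^ 2

lemma SS_mono {M M' : ℝ} (h : M ≤ M') : SS M ⊆ SS M' := fun P hP => mem_SS.2 ((mem_SS.1 hP).trans h)
lemma SS_empty {M : ℝ} (h : M < 1) : SS M = ∅ := by
  ext P; simp [mem_SS]; exact h.trans_le (one_le_Nm_el P)

lemma LS1.mono {M M' N B B' : ℝ} (h : LS1 M' N B) (hM : M ≤ M') (hB : B ≤ B') : LS1 M N B' := by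
  intro c
  refine le_trans (Finset.sum_le_sum_of_subset_of_nonneg (SS_mono hM) (fun _ _ _ => by positivity)) ((h c).trans ?_)
  gcongr

lemma LS1.symm {M N B : ℝ} (hB : 0 ≤ B) (h : LS1 M N B) : LS1 N M B := by
  intro c
  have := duality (SS M) (SS N) (fun A P => ch P (el A)) B hB h c
  simpa only [ch_recip] using this

def PLS (α : ℝ) : Prop := ∀ ε : ℝ, 0 < ε → ∃ C : ℝ, 0 < C ∧ ∀ M N : ℝ, 1 ≤ M → 1 ≤ N →
  LS1 M N (C * (M * N) ^ ε * (M + (M * N) ^ (2/3 : ℝ) + N ^ α))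

lemma sum_le_of_surj {ι κ : Type*} (S : Finset ι) (T : Finset κ) (φ : κ → ι) (f : ι → ℝ) (hf : ∀ i, 0 ≤ f i)
    (h : ∀ i ∈ S, ∃ t ∈ T, φ t = i) : ∑ i ∈ S, f i ≤ ∑ t ∈ T, f (φ t) := by
  classical
  refine le_trans (Finset.sum_le_sum_of_subset_of_nonneg (t := T.image φ) ?_ (fun _ _ _ => hf _)) ?_
  · intro i hi; obtain ⟨t, ht, rfl⟩ := h i hi; exact Finset.mem_image_of_mem _ ht
  · exact Finset.sum_image_le_of_nonneg (fun _ _ => hf _)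

lemma one_le_VF {v : Eis} (h : v ∈ VF) : 1 ≤ Nm v := one_le_Nm (VV_ne_zero h)

lemma fact_Nm {K : ℝ} {v c : Eis} {A B : Finset PP} (hv : v ∈ VF) (hc : c ≠ 0)
    (h : Nm (v * el A * el B ^ 2 * c ^ 3) ≤ K) : Nm (el A) * Nm (el B) ^ 2 * Nm c ^ 3 ≤ K := by
  rw [Nm_mul, Nm_mul, Nm_mul, Nm_pow, Nm_pow] at h
  have h1 := one_le_VF hv
  have h2 := one_le_Nm_el A
  have h3 := one_le_Nm_el B
  have h4 := one_le_Nm hc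
  refine le_trans ?_ h
  have : 0 ≤ Nm (el A) * Nm (el B) ^ 2 * Nm c ^ 3 := by positivity
  nlinarith

lemma fact_sum (f : Eis → ℝ) (hf : ∀ x, 0 ≤ f x) (K : ℝ) (hK : 0 ≤ K) :
    ∑ m ∈ Ball K, f m ≤ ∑ p ∈ VF ×ˢ Ball K,
      ((∑ B ∈ SS ((K / Nm p.2 ^ 3) ^ (1/3 : ℝ)), ∑ A ∈ SS (K / Nm p.2 ^ 3 / Nm (el B) ^ 2), f (p.1 * el A * el B ^ 2 * p.2 ^ 3)) +
       (∑ A ∈ SS ((K / Nm p.2 ^ 3) ^ (1/3 : ℝ)), ∑ B ∈ SS ((K / Nm p.2 ^ 3 / Nm (el A)) ^ (1/2 : ℝ)), f (p.1 * el A * el B ^ 2 * p.2 ^ 3))) := by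
  let T1 : Finset (Σ _ : Eis × Eis, Σ _ : Finset PP, Finset PP) := (VF ×ˢ Ball K).sigma (fun p => (SS ((K / Nm p.2 ^ 3) ^ (1/3 : ℝ))).sigma
    fun B => SS (K / Nm p.2 ^ 3 / Nm (el B) ^ 2))
  let T2 : Finset (Σ _ : Eis × Eis, Σ _ : Finset PP, Finset PP) := (VF ×ˢ Ball K).sigma (fun p => (SS ((K / Nm p.2 ^ 3) ^ (1/3 : ℝ))).sigma
    fun A => SS ((K / Nm p.2 ^ 3 / Nm (el A)) ^ (1/2 : ℝ)))
  let φ : (Σ _ : Eis × Eis, Σ _ : Finset PP, Finset PP) ⊕ (Σ _ : Eis × Eis, Σ _ : Finset PP, Finset PP) → Eis :=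
    Sum.elim (fun x => x.1.1 * el x.2.2 * el x.2.1 ^ 2 * x.1.2 ^ 3) (fun x => x.1.1 * el x.2.1 * el x.2.2 ^ 2 * x.1.2 ^ 3)
  have h := sum_le_of_surj (Ball K) (T1.disjSum T2) φ f hf ?_
  · rw [Finset.sum_disjSum] at h
    refine h.trans (le_of_eq ?_)
    rw [Finset.sum_add_distrib]
    simp only [T1, T2, Finset.sum_sigma, φ, Sum.elim_inl, Sum.elim_inr]
  · intro m hm
    obtain ⟨hm0, hmK⟩ := mem_Ball.1 hm
    obtain ⟨v, hv, A, B, c, hc, -, rfl⟩ := exists_fact hm0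
    have h0 := fact_Nm hv hc hmK
    have h2 := one_le_Nm_el A
    have h3 := one_le_Nm_el B
    have h4 := one_le_Nm hc
    have hcK : c ∈ Ball K := by
      rw [mem_Ball]; refine ⟨hc, le_trans ?_ h0⟩
      have e1 : Nm c ≤ Nm c ^ 3 := le_self_pow₀ h4 (by norm_num)
      have e2 : 1 ≤ Nm (el A) * Nm (el B) ^ 2 := by
        have := one_le_pow₀ h3 (n := 2); nlinarith
      nlinarith [Nm_nonneg c]
    have h5 : Nm (el A) * Nm (el B) ^ 2 ≤ K / Nm c ^ 3 := by rw [le_div_iff₀ (by positivity)]; exact h0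
    set Kc := K / Nm c ^ 3 with hKc
    have hKc0 : 0 ≤ Kc := by positivity
    by_cases hB : Nm (el B) ≤ Kc ^ (1/3 : ℝ)
    · refine ⟨Sum.inl ⟨(v, c), B, A⟩, ?_, rfl⟩
      simp only [Finset.inl_mem_disjSum, T1, Finset.mem_sigma, Finset.mem_product, mem_SS]
      refine ⟨⟨hv, hcK⟩, hB, ?_⟩
      rw [le_div_iff₀ (by positivity)]; exact h5
    · push Not at hB
      refine ⟨Sum.inr ⟨(v, c), A, B⟩, ?_, rfl⟩
      simp only [Finset.inr_mem_disjSum, T2, Finset.mem_sigma, Finset.mem_product, mem_SS]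
      refine ⟨⟨hv, hcK⟩, ?_, ?_⟩
      · have e : (Kc ^ (1/3 : ℝ)) ^ 3 = Kc := by
          rw [← Real.rpow_natCast, ← Real.rpow_mul hKc0]; norm_num
        set Z := Kc ^ (1/3 : ℝ) with hZ
        have hZ0 : 0 ≤ Z := by positivity
        show Nm (el A) ≤ Z
        by_contra hA; push Not at hA
        have : Z ^ 3 < Nm (el A) * Nm (el B) ^ 2 := by
          calc Z ^ 3 = Z * Z ^ 2 := by ring
            _ < Nm (el A) * Nm (el B) ^ 2 := by
              apply mul_lt_mul' hA.le _ (by positivity) (by linarith)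
              exact pow_lt_pow_left₀ hB hZ0 (by norm_num)
        linarith
      · have : Nm (el B) ^ 2 ≤ Kc / Nm (el A) := by rw [le_div_iff₀ (by positivity)]; linarith
        show Nm (el B) ≤ (Kc / Nm (el A)) ^ (1/2 : ℝ)
        rw [← Real.sqrt_eq_rpow]
        exact Real.le_sqrt_of_sq_le this

lemma F1_num1 {K N α b : ℝ} (hK : 1 ≤ K) (hN : 1 ≤ N) (hα : 1 ≤ α) (hb : 1 ≤ b) (hb' : b ≤ K ^ (1/3 : ℝ)) :
    N + (K / b ^ 2 * N) ^ (2/3 : ℝ) + (K / b ^ 2) ^ α ≤ (N * K ^ (1/3 : ℝ) + (K * N) ^ (2/3 : ℝ) + K ^ α) * b ^ (-1 : ℝ) := by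
  have hb0 : 0 < b := by linarith
  have hK0 : 0 < K := by linarith
  have hN0 : 0 < N := by linarith
  rw [Real.rpow_neg_one, ← div_eq_mul_inv, le_div_iff₀ hb0]
  have key : ∀ γ : ℝ, 1/2 ≤ γ → (b ^ 2) ^ (-γ) * b ≤ 1 := by
    intro γ hγ
    rw [← Real.rpow_natCast, ← Real.rpow_mul hb0.le, ← Real.rpow_add_one hb0.ne']
    apply Real.rpow_le_one_of_one_le_of_nonpos hb
    push_cast; linarith
  have e1 : (K / b ^ 2 * N) ^ (2/3 : ℝ) = (K * N) ^ (2/3 : ℝ) * (b ^ 2) ^ (-(2/3) : ℝ) := by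
    rw [div_mul_eq_mul_div, Real.div_rpow (by positivity) (by positivity), Real.rpow_neg (by positivity), div_eq_mul_inv]
  have e2 : (K / b ^ 2) ^ α = K ^ α * (b ^ 2) ^ (-α) := by
    rw [Real.div_rpow (by positivity) (by positivity), Real.rpow_neg (by positivity), div_eq_mul_inv]
  rw [e1, e2, add_mul, add_mul]
  have k1 := key (2/3) (by norm_num)
  have k2 := key α (by linarith)
  have p1 : 0 < (K * N) ^ (2/3 : ℝ) := by positivity
  have p2 : 0 < K ^ α := by positivity
  have : N * b ≤ N * K ^ (1/3 : ℝ) := by gcongr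
  nlinarith

lemma F1_num2 {K N α a : ℝ} (hK : 1 ≤ K) (hN : 1 ≤ N) (hα : 1 ≤ α) (hb : 1 ≤ a) (hb' : a ≤ K ^ (1/3 : ℝ)) :
    N + ((K / a) ^ (1/2 : ℝ) * N) ^ (2/3 : ℝ) + ((K / a) ^ (1/2 : ℝ)) ^ α ≤ (N * K ^ (1/3 : ℝ) + (K * N) ^ (2/3 : ℝ) + K ^ α) * a ^ (-1 : ℝ) := by
  have hb0 : 0 < a := by linarith
  have hK0 : 0 < K := by linarith
  have hN0 : 0 < N := by linarith
  rw [Real.rpow_neg_one, ← div_eq_mul_inv, le_div_iff₀ hb0]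
  have e1 : ((K / a) ^ (1/2 : ℝ) * N) ^ (2/3 : ℝ) * a = N ^ (2/3:ℝ) * (K ^ (1/3 : ℝ) * a ^ (2/3 : ℝ)) := by
    rw [Real.mul_rpow (by positivity) hN0.le, ← Real.rpow_mul (by positivity), Real.div_rpow hK0.le hb0.le]
    rw [show (2/3 : ℝ) = 1 - 1/3 by norm_num, show (1/2 * (1 - 1/3) : ℝ) = 1/3 by norm_num, Real.rpow_sub hb0, Real.rpow_one]
    field_simp
  have e2 : ((K / a) ^ (1/2 : ℝ)) ^ α * a = K ^ (α / 2) * a ^ (1 - α / 2) := by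
    rw [← Real.rpow_mul (by positivity), Real.div_rpow hK0.le hb0.le, Real.rpow_sub hb0, Real.rpow_one, show 1/2 * α = α / 2 by ring]
    field_simp
  have k1 : K ^ (1/3 : ℝ) * a ^ (2/3 : ℝ) ≤ K ^ (2/3 : ℝ) := by
    calc K ^ (1/3 : ℝ) * a ^ (2/3 : ℝ) ≤ K ^ (1/3 : ℝ) * (K ^ (1/3 : ℝ)) ^ (2/3 : ℝ) := by gcongr
      _ = K ^ (5/9 : ℝ) := by rw [← Real.rpow_mul hK0.le, ← Real.rpow_add hK0]; norm_num
      _ ≤ _ := Real.rpow_le_rpow_of_exponent_le hK (by norm_num)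
  have k2 : K ^ (α / 2) * a ^ (1 - α / 2) ≤ K ^ α := by
    calc K ^ (α / 2) * a ^ (1 - α / 2) ≤ K ^ (α / 2) * a ^ (1/2 : ℝ) := by
          gcongr 2; linarith
      _ ≤ K ^ (α / 2) * (K ^ (1/3 : ℝ)) ^ (1/2 : ℝ) := by gcongr
      _ = K ^ (α / 2 + 1/6) := by rw [← Real.rpow_mul hK0.le, ← Real.rpow_add hK0]; norm_num
      _ ≤ _ := Real.rpow_le_rpow_of_exponent_le hK (by linarith)
  have e3 : (K * N) ^ (2/3 : ℝ) = N ^ (2/3:ℝ) * K ^ (2/3 : ℝ) := by rw [Real.mul_rpow hK0.le hN0.le]; ring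
  rw [add_mul, add_mul, e1, e2, e3]
  gcongr

lemma F1_num3 {K N α c : ℝ} (hK : 1 ≤ K) (hN : 1 ≤ N) (hα : 1 ≤ α) (hc : 1 ≤ c) :
    N * (K / c ^ 3) ^ (1/3 : ℝ) + (K / c ^ 3 * N) ^ (2/3 : ℝ) + (K / c ^ 3) ^ α ≤ (N * K ^ (1/3 : ℝ) + (K * N) ^ (2/3 : ℝ) + K ^ α) * c ^ (-1 : ℝ) := by
  have hb0 : 0 < c := by linarith
  have hK0 : 0 < K := by linarith
  have hN0 : 0 < N := by linarith
  rw [Real.rpow_neg_one, ← div_eq_mul_inv, le_div_iff₀ hb0]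
  have key : ∀ γ : ℝ, 1/3 ≤ γ → (c ^ 3) ^ (-γ) * c ≤ 1 := by
    intro γ hγ
    rw [← Real.rpow_natCast, ← Real.rpow_mul hb0.le, ← Real.rpow_add_one hb0.ne']
    apply Real.rpow_le_one_of_one_le_of_nonpos hc
    push_cast; linarith
  have e1 : (K / c ^ 3 * N) ^ (2/3 : ℝ) = (K * N) ^ (2/3 : ℝ) * (c ^ 3) ^ (-(2/3) : ℝ) := by
    rw [div_mul_eq_mul_div, Real.div_rpow (by positivity) (by positivity), Real.rpow_neg (by positivity), div_eq_mul_inv]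
  have e2 : ∀ α : ℝ, (K / c ^ 3) ^ α = K ^ α * (c ^ 3) ^ (-α) := by
    intro α
    rw [Real.div_rpow (by positivity) (by positivity), Real.rpow_neg (by positivity), div_eq_mul_inv]
  rw [e1, e2, e2, add_mul, add_mul]
  have k1 := key (2/3) (by norm_num)
  have k2 := key α (by linarith)
  have k3 := key (1/3) (by norm_num)
  have p1 : 0 < (K * N) ^ (2/3 : ℝ) := by positivity
  have p2 : 0 < K ^ α := by positivity
  have p3 : 0 < N * K ^ (1/3:ℝ) := by positivity
  nlinarith

def Q2 (K N α : ℝ) : ℝ := N * K ^ (1/3 : ℝ) + (K * N) ^ (2/3 : ℝ) + K ^ α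

lemma Q2_nonneg {K N α : ℝ} (hK : 0 ≤ K) (hN : 0 ≤ N) : 0 ≤ Q2 K N α := by unfold Q2; positivity

lemma F1 {α : ℝ} (hα : 1 ≤ α) (h : PLS α) (ε : ℝ) (hε : 0 < ε) : ∃ C : ℝ, 0 < C ∧ ∀ K N : ℝ, 1 ≤ K → 1 ≤ N →
    LS2 K N (C * (K * N) ^ ε * Q2 K N α) := by
  obtain ⟨C1, hC1, h1⟩ := h (ε / 3) (by positivity)
  obtain ⟨C2, hC2, h2⟩ := sum_SS_le (ε := ε / 3) (by positivity)
  obtain ⟨C3, hC3, h3⟩ := sum_Nm_le (ε := ε / 3) (by positivity)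
  refine ⟨C1 * (2 * C2) * (VF.card * C3) + 1, by positivity, ?_⟩
  intro K N hK hN c
  have hK0 : 0 < K := by linarith
  have hN0 : 0 < N := by linarith
  set S := ∑ P ∈ SS N, ‖c P‖ ^ 2 with hS
  have hS0 : 0 ≤ S := by positivity
  have hKN : 1 ≤ K * N := by nlinarith
  -- the basic bound
  have hb : ∀ M : ℝ, 0 ≤ M → M ≤ K → ∀ c' : Finset PP → ℂ, (∀ P, ‖c' P‖ ≤ ‖c P‖) →
      ∑ A ∈ SS M, ‖∑ P ∈ SS N, c' P * ch P (el A)‖ ^ 2 ≤ C1 * (K * N) ^ (ε / 3) * (N + (M * N) ^ (2/3 : ℝ) + M ^ α) * S := by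
    intro M hM0 hMK c' hc'
    by_cases hM : M < 1
    · rw [SS_empty hM, Finset.sum_empty]; positivity
    push Not at hM
    have := (h1 N M hN hM).symm (by positivity) c'
    refine this.trans ?_
    have e : ∑ P ∈ SS N, ‖c' P‖ ^ 2 ≤ S := Finset.sum_le_sum (fun P _ => by gcongr; exact hc' P)
    rw [mul_comm N M]
    gcongr
  -- inner sums
  have hin : ∀ p ∈ VF ×ˢ Ball K,
      ((∑ B ∈ SS ((K / Nm p.2 ^ 3) ^ (1/3 : ℝ)), ∑ A ∈ SS (K / Nm p.2 ^ 3 / Nm (el B) ^ 2), ‖∑ P ∈ SS N, c P * ch P (p.1 * el A * el B ^ 2 * p.2 ^ 3)‖ ^ 2) +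
       (∑ A ∈ SS ((K / Nm p.2 ^ 3) ^ (1/3 : ℝ)), ∑ B ∈ SS ((K / Nm p.2 ^ 3 / Nm (el A)) ^ (1/2 : ℝ)), ‖∑ P ∈ SS N, c P * ch P (p.1 * el A * el B ^ 2 * p.2 ^ 3)‖ ^ 2))
      ≤ C1 * (K * N) ^ (ε / 3) * (2 * C2) * (K * N) ^ (ε / 3) * Q2 K N α * S * Nm p.2 ^ (-1 : ℝ) := by
    rintro ⟨v, d⟩ hp
    simp only [Finset.mem_product, mem_Ball] at hp
    obtain ⟨hv, hd0, hdK⟩ := hp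
    simp only
    have hd1 := one_le_Nm hd0
    have n3 := F1_num3 hK hN hα hd1
    set Kc := K / Nm d ^ 3 with hKc
    have hKc0 : 0 < Kc := by positivity
    have hKcK : Kc ≤ K := div_le_self hK0.le (one_le_pow₀ hd1)
    by_cases hKc1 : Kc < 1
    · rw [SS_empty (Real.rpow_lt_one hKc0.le hKc1 (by norm_num)), Finset.sum_empty, Finset.sum_empty]
      have := Q2_nonneg (α := α) hK0.le hN0.le
      have := Nm_nonneg d
      rw [add_zero]; positivity
    push Not at hKc1
    have hx : ∑ B ∈ SS (Kc ^ (1/3 : ℝ)), Nm (el B) ^ (-1 : ℝ) ≤ C2 * (K * N) ^ (ε / 3) := by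
      refine (h2 (SS (Kc ^ (1/3 : ℝ))) K 1 hK0.le (by linarith) ?_).trans ?_
      · intro P hP
        refine (mem_SS.1 hP).trans ?_
        calc Kc ^ (1/3 : ℝ) ≤ Kc ^ (1 : ℝ) := Real.rpow_le_rpow_of_exponent_le hKc1 (by norm_num)
          _ ≤ K := by rw [Real.rpow_one]; exact hKcK
      · rw [show 1 + ε / 3 - 1 = ε / 3 by ring]
        have : K ≤ K * N := by nlinarith
        gcongr
    have b1 : ∑ B ∈ SS (Kc ^ (1/3 : ℝ)), ∑ A ∈ SS (Kc / Nm (el B) ^ 2), ‖∑ P ∈ SS N, c P * ch P (v * el A * el B ^ 2 * d ^ 3)‖ ^ 2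
        ≤ ∑ B ∈ SS (Kc ^ (1/3 : ℝ)), C1 * (K * N) ^ (ε / 3) * (Q2 Kc N α * Nm (el B) ^ (-1 : ℝ)) * S := by
      apply Finset.sum_le_sum
      intro B hB
      have hB1 := one_le_Nm_el B
      have hle : Kc / Nm (el B) ^ 2 ≤ K := (div_le_self hKc0.le (one_le_pow₀ hB1)).trans hKcK
      have := hb (Kc / Nm (el B) ^ 2) (by positivity) hle (fun P => c P * ch P (v * el B ^ 2 * d ^ 3)) (fun P => by
        rw [norm_mul]; exact mul_le_of_le_one_right (norm_nonneg _) (ch_norm_le _ _))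
      have e : ∀ A, ∑ P ∈ SS N, c P * ch P (v * el A * el B ^ 2 * d ^ 3) = ∑ P ∈ SS N, c P * ch P (v * el B ^ 2 * d ^ 3) * ch P (el A) := by
        intro A; apply Finset.sum_congr rfl; intro P _
        rw [mul_assoc (c P), ← ch_mul]; congr 2; ring
      simp only [e]
      refine this.trans ?_
      have nn := F1_num1 hKc1 hN hα hB1 (mem_SS.1 hB)
      unfold Q2
      gcongr
    have b2 : ∑ A ∈ SS (Kc ^ (1/3 : ℝ)), ∑ B ∈ SS ((Kc / Nm (el A)) ^ (1/2 : ℝ)), ‖∑ P ∈ SS N, c P * ch P (v * el A * el B ^ 2 * d ^ 3)‖ ^ 2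
        ≤ ∑ A ∈ SS (Kc ^ (1/3 : ℝ)), C1 * (K * N) ^ (ε / 3) * (Q2 Kc N α * Nm (el A) ^ (-1 : ℝ)) * S := by
      apply Finset.sum_le_sum
      intro A hA
      have hA1 := one_le_Nm_el A
      have hle : (Kc / Nm (el A)) ^ (1/2 : ℝ) ≤ K := by
        calc (Kc / Nm (el A)) ^ (1/2 : ℝ) ≤ K ^ (1/2 : ℝ) := by
              gcongr; exact (div_le_self hKc0.le hA1).trans hKcK
          _ ≤ K ^ (1:ℝ) := Real.rpow_le_rpow_of_exponent_le hK (by norm_num)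
          _ = K := Real.rpow_one K
      have := hb ((Kc / Nm (el A)) ^ (1/2 : ℝ)) (by positivity) hle (fun P => (starRingEnd ℂ) (c P * ch P (v * el A * d ^ 3))) (fun P => by
        rw [RCLike.norm_conj, norm_mul]; exact mul_le_of_le_one_right (norm_nonneg _) (ch_norm_le _ _))
      have e : ∀ B, ‖∑ P ∈ SS N, c P * ch P (v * el A * el B ^ 2 * d ^ 3)‖ = ‖∑ P ∈ SS N, (starRingEnd ℂ) (c P * ch P (v * el A * d ^ 3)) * ch P (el B)‖ := by
        intro B; rw [← RCLike.norm_conj, map_sum]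
        congr 1
        apply Finset.sum_congr rfl; intro P _
        have : v * el A * el B ^ 2 * d ^ 3 = (v * el A * d ^ 3) * el B ^ 2 := by ring
        rw [this, ch_mul P (v * el A * d ^ 3), ch_pow, ch_sq, ← mul_assoc, map_mul (starRingEnd ℂ) (_ * _), Complex.conj_conj]
      simp only [e]
      refine this.trans ?_
      have nn := F1_num2 hKc1 hN hα hA1 (mem_SS.1 hA)
      unfold Q2
      gcongr
    refine (add_le_add b1 b2).trans ?_
    rw [← Finset.sum_mul, ← Finset.mul_sum, ← Finset.mul_sum]
    have hq : Q2 Kc N α ≤ Q2 K N α * Nm d ^ (-1 : ℝ) := n3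
    have hq0 : 0 ≤ Q2 Kc N α := Q2_nonneg hKc0.le hN0.le
    set X := ∑ B ∈ SS (Kc ^ (1/3 : ℝ)), Nm (el B) ^ (-1 : ℝ)
    have hX0 : 0 ≤ X := Finset.sum_nonneg (fun B _ => Real.rpow_nonneg (Nm_nonneg _) _)
    calc _ = 2 * (C1 * (K * N) ^ (ε / 3)) * S * (Q2 Kc N α * X) := by ring
      _ ≤ 2 * (C1 * (K * N) ^ (ε / 3)) * S * ((Q2 K N α * Nm d ^ (-1 : ℝ)) * (C2 * (K * N) ^ (ε / 3))) := by
          have := hq0.trans hq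
          gcongr
      _ = _ := by ring
  refine (fact_sum (fun m => ‖∑ P ∈ SS N, c P * ch P m‖ ^ 2) (fun _ => by positivity) K hK0.le).trans ((Finset.sum_le_sum hin).trans ?_)
  rw [← Finset.mul_sum, Finset.sum_product]
  simp only [Finset.sum_const, nsmul_eq_mul]
  have hy : ∑ d ∈ Ball K, Nm d ^ (-1 : ℝ) ≤ C3 * (K * N) ^ (ε / 3) := by
    refine (h3 (Ball K) K 1 hK0.le (by linarith) (fun x hx => mem_Ball.1 hx)).trans ?_
    rw [show 1 + ε / 3 - 1 = ε / 3 by ring]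
    have : K ≤ K * N := by nlinarith
    gcongr
  have hq0 : 0 ≤ Q2 K N α := Q2_nonneg hK0.le hN0.le
  have he : (K * N) ^ ε = (K * N) ^ (ε / 3) * (K * N) ^ (ε / 3) * (K * N) ^ (ε / 3) := by
    rw [← Real.rpow_add (by linarith), ← Real.rpow_add (by linarith)]; congr 1; ring
  calc _ ≤ C1 * (K * N) ^ (ε / 3) * (2 * C2) * (K * N) ^ (ε / 3) * Q2 K N α * S * (VF.card * (C3 * (K * N) ^ (ε / 3))) := by gcongr
    _ = (C1 * (2 * C2) * (VF.card * C3)) * (K * N) ^ ε * Q2 K N α * S := by rw [he]; ring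
    _ ≤ (C1 * (2 * C2) * (VF.card * C3) + 1) * (K * N) ^ ε * Q2 K N α * S := by
      gcongr; linarith

section sep
variable {α β κ : Type*} (𝒜 : Finset α) (ℬ : Finset β) (𝒦 : Finset κ) (s : α → ℝ) (t : β → ℝ) (r : κ → ℝ)
  (X : α → κ → ℂ) (Y : β → κ → ℂ)

def gsep (a b k : ℝ) : ℝ := a * b + a * k + b * k + a * b * k

def Tsep (n : ℕ) (u : α → ℝ) (v : β → ℝ) (w : κ → ℝ) : ℂ :=
  ∑ k ∈ 𝒦, ∑ a ∈ 𝒜, ∑ b ∈ ℬ, (w k : ℂ) * ((u a : ℂ) * X a k) * ((v b : ℂ) * Y b k) * ((gsep (s a) (t b) (r k) : ℝ) : ℂ) ^ n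

lemma Tsep_succ (n : ℕ) (u : α → ℝ) (v : β → ℝ) (w : κ → ℝ) :
    Tsep 𝒜 ℬ 𝒦 s t r X Y (n + 1) u v w =
      (1/4) * Tsep 𝒜 ℬ 𝒦 s t r X Y n (fun a => u a * (2 * s a)) (fun b => v b * (2 * t b)) w +
      (1/4) * Tsep 𝒜 ℬ 𝒦 s t r X Y n (fun a => u a * (2 * s a)) v (fun k => w k * (2 * r k)) +
      (1/4) * Tsep 𝒜 ℬ 𝒦 s t r X Y n u (fun b => v b * (2 * t b)) (fun k => w k * (2 * r k)) +
      (1/8) * Tsep 𝒜 ℬ 𝒦 s t r X Y n (fun a => u a * (2 * s a)) (fun b => v b * (2 * t b)) (fun k => w k * (2 * r k)) := by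
  unfold Tsep
  simp only [Finset.mul_sum, ← Finset.sum_add_distrib]
  refine Finset.sum_congr rfl fun k _ => Finset.sum_congr rfl fun a _ => Finset.sum_congr rfl fun b _ => ?_
  rw [pow_succ]
  nth_rewrite 2 [gsep]
  push_cast
  ring

lemma Tsep_le {E : ℝ} (hs : ∀ a, 0 ≤ s a ∧ s a ≤ 1/2) (ht : ∀ b, 0 ≤ t b ∧ t b ≤ 1/2) (hr : ∀ k, 0 ≤ r k ∧ r k ≤ 1/2)
  (hE : ∀ (u : α → ℝ) (v : β → ℝ), (∀ a, 0 ≤ u a ∧ u a ≤ 1) → (∀ b, 0 ≤ v b ∧ v b ≤ 1) →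
    ∑ k ∈ 𝒦, ‖∑ a ∈ 𝒜, (u a : ℂ) * X a k‖ * ‖∑ b ∈ ℬ, (v b : ℂ) * Y b k‖ ≤ E) (n : ℕ) : ∀ (u : α → ℝ) (v : β → ℝ) (w : κ → ℝ), (∀ a, 0 ≤ u a ∧ u a ≤ 1) → (∀ b, 0 ≤ v b ∧ v b ≤ 1) →
    (∀ b, 0 ≤ w b ∧ w b ≤ 1) → ‖Tsep 𝒜 ℬ 𝒦 s t r X Y n u v w‖ ≤ (7/8) ^ n * E := by
  induction n with
  | zero =>
    intro u v w hu hv hw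
    rw [pow_zero, one_mul]
    refine le_trans ?_ (hE u v hu hv)
    unfold Tsep
    refine (norm_sum_le _ _).trans (Finset.sum_le_sum fun k _ => ?_)
    have : ∑ a ∈ 𝒜, ∑ b ∈ ℬ, (w k : ℂ) * ((u a : ℂ) * X a k) * ((v b : ℂ) * Y b k) * ((gsep (s a) (t b) (r k) : ℝ) : ℂ) ^ 0
        = w k * ((∑ a ∈ 𝒜, (u a : ℂ) * X a k) * (∑ b ∈ ℬ, (v b : ℂ) * Y b k)) := by
      rw [Finset.sum_mul_sum, Finset.mul_sum]
      simp only [Finset.mul_sum]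
      refine Finset.sum_congr rfl fun a _ => Finset.sum_congr rfl fun b _ => ?_
      ring
    rw [this, norm_mul, norm_mul, norm_real, Real.norm_of_nonneg (hw k).1]
    exact mul_le_of_le_one_left (by positivity) (hw k).2
  | succ n ih =>
    intro u v w hu hv hw
    have hm : ∀ {x y : ℝ}, (0 ≤ x ∧ x ≤ 1) → (0 ≤ y ∧ y ≤ 1/2) → 0 ≤ x * (2 * y) ∧ x * (2 * y) ≤ 1 := by
      intro x y hx hy
      exact ⟨mul_nonneg hx.1 (by linarith), mul_le_one₀ hx.2 (by linarith) (by linarith)⟩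
    have i1 := ih (fun a => u a * (2 * s a)) (fun b => v b * (2 * t b)) w (fun a => hm (hu a) (hs a)) (fun b => hm (hv b) (ht b)) hw
    have i2 := ih (fun a => u a * (2 * s a)) v (fun k => w k * (2 * r k)) (fun a => hm (hu a) (hs a)) hv (fun k => hm (hw k) (hr k))
    have i3 := ih u (fun b => v b * (2 * t b)) (fun k => w k * (2 * r k)) hu (fun b => hm (hv b) (ht b)) (fun k => hm (hw k) (hr k))
    have i4 := ih (fun a => u a * (2 * s a)) (fun b => v b * (2 * t b)) (fun k => w k * (2 * r k)) (fun a => hm (hu a) (hs a)) (fun b => hm (hv b) (ht b)) (fun k => hm (hw k) (hr k))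
    rw [Tsep_succ]
    refine (norm_add_le _ _).trans ?_
    refine (add_le_add_left ((norm_add_le _ _).trans (add_le_add_left (norm_add_le _ _) _)) _).trans ?_
    simp only [norm_mul]
    have n4 : ‖(1/4 : ℂ)‖ = 1/4 := by norm_num
    have n8 : ‖(1/8 : ℂ)‖ = 1/8 := by norm_num
    rw [n4, n8, pow_succ]
    linarith

lemma sep {E : ℝ} (hs : ∀ a, 0 ≤ s a ∧ s a ≤ 1/2) (ht : ∀ b, 0 ≤ t b ∧ t b ≤ 1/2) (hr : ∀ k, 0 ≤ r k ∧ r k ≤ 1/2)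
  (hE : ∀ (u : α → ℝ) (v : β → ℝ), (∀ a, 0 ≤ u a ∧ u a ≤ 1) → (∀ b, 0 ≤ v b ∧ v b ≤ 1) →
    ∑ k ∈ 𝒦, ‖∑ a ∈ 𝒜, (u a : ℂ) * X a k‖ * ‖∑ b ∈ ℬ, (v b : ℂ) * Y b k‖ ≤ E) {ρ : ℝ} (hρ : 0 ≤ ρ) :
    ‖∑ k ∈ 𝒦, ∑ a ∈ 𝒜, ∑ b ∈ ℬ, X a k * Y b k * ((Real.exp (-(ρ * ((1 + s a) * (1 + t b) * (1 + r k)))) : ℝ) : ℂ)‖ ≤ Real.exp (-(ρ / 8)) * E := by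
  have hu : ∀ {x : ℝ}, 0 ≤ x ∧ x ≤ 1/2 → 0 ≤ Real.exp (-(ρ * x)) ∧ Real.exp (-(ρ * x)) ≤ 1 := fun {x} hx =>
    ⟨(Real.exp_pos _).le, Real.exp_le_one_iff.2 (by have := mul_nonneg hρ hx.1; linarith)⟩
  set U : ℕ → ℂ := fun n => Tsep 𝒜 ℬ 𝒦 s t r X Y n (fun a => Real.exp (-(ρ * s a))) (fun b => Real.exp (-(ρ * t b))) (fun k => Real.exp (-(ρ * r k))) with hU
  have hb : ∀ n, ‖U n‖ ≤ (7/8) ^ n * E := fun n => Tsep_le 𝒜 ℬ 𝒦 s t r X Y hs ht hr hE n _ _ _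
    (fun a => hu (hs a)) (fun a => hu (ht a)) (fun a => hu (hr a))
  have key : HasSum (fun n : ℕ => (Real.exp (-ρ) : ℂ) * ((-ρ : ℂ) ^ n / n.factorial) * U n)
      (∑ k ∈ 𝒦, ∑ a ∈ 𝒜, ∑ b ∈ ℬ, X a k * Y b k * ((Real.exp (-(ρ * ((1 + s a) * (1 + t b) * (1 + r k)))) : ℝ) : ℂ)) := by
    simp only [hU, Tsep, Finset.mul_sum]
    refine hasSum_sum fun k _ => hasSum_sum fun a _ => hasSum_sum fun b _ => ?_
    have h1 := NormedSpace.expSeries_div_hasSum_exp (-(ρ : ℂ) * ((gsep (s a) (t b) (r k) : ℝ) : ℂ))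
    rw [← Complex.exp_eq_exp_ℂ] at h1
    have h2 := h1.mul_left ((Real.exp (-ρ) : ℂ) * ((Real.exp (-(ρ * r k)) : ℂ) * ((Real.exp (-(ρ * s a)) : ℂ) * X a k) * ((Real.exp (-(ρ * t b)) : ℂ) * Y b k)))
    have hv : Real.exp (-(ρ * ((1 + s a) * (1 + t b) * (1 + r k)))) = Real.exp (-ρ) * Real.exp (-(ρ * r k)) * Real.exp (-(ρ * s a)) * Real.exp (-(ρ * t b)) * Real.exp (-ρ * gsep (s a) (t b) (r k)) := by
      simp only [← Real.exp_add]; congr 1; unfold gsep; ring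
    have e2 : X a k * Y b k * ((Real.exp (-(ρ * ((1 + s a) * (1 + t b) * (1 + r k)))) : ℝ) : ℂ) = ((Real.exp (-ρ) : ℂ) * ((Real.exp (-(ρ * r k)) : ℂ) * ((Real.exp (-(ρ * s a)) : ℂ) * X a k) * ((Real.exp (-(ρ * t b)) : ℂ) * Y b k))) * Complex.exp (-(ρ : ℂ) * ((gsep (s a) (t b) (r k) : ℝ) : ℂ)) := by
      rw [hv]; push_cast; ring
    rw [e2]
    refine h2.congr_fun ?_
    intro n
    rw [mul_pow]; ring
  have hb2 : HasSum (fun n : ℕ => Real.exp (-ρ) * E * ((7/8 * ρ) ^ n / n.factorial)) (Real.exp (-ρ) * E * Real.exp (7/8 * ρ)) := by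
    have h1 := NormedSpace.expSeries_div_hasSum_exp (7/8 * ρ)
    rw [← Real.exp_eq_exp_ℝ] at h1
    exact h1.mul_left _
  have := tsum_of_norm_bounded hb2 (f := fun n : ℕ => (Real.exp (-ρ) : ℂ) * ((-ρ : ℂ) ^ n / n.factorial) * U n) ?_
  · rw [key.tsum_eq] at this
    refine this.trans (le_of_eq ?_)
    rw [mul_right_comm, ← Real.exp_add]; congr 2; ring
  · intro n
    rw [norm_mul, norm_mul, norm_real, Real.norm_of_nonneg (Real.exp_pos _).le, norm_div, norm_pow, norm_neg, norm_real, Real.norm_of_nonneg hρ]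
    rw [show ‖(n.factorial : ℂ)‖ = n.factorial by simp]
    calc _ ≤ Real.exp (-ρ) * (ρ ^ n / n.factorial) * ((7/8) ^ n * E) := by gcongr; exact hb n
      _ = _ := by rw [mul_pow]; ring
end sep

lemma el_dvd_iff {D : Finset PP} {m : Eis} : el D ∣ m ↔ ∀ p ∈ D, p.1 ∣ m := by
  constructor
  · intro h p hp; exact (dvd_el.2 hp).trans h
  · intro h
    apply Finset.prod_dvd_of_coprime
    · intro p hp q hq hpq
      exact isCoprime_PP.2 (fun h' => hpq (PP_assoc h'))
    · exact h

open Classical in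
lemma ch_indicator (G : Finset PP) (m : Eis) :
    ch G m * (starRingEnd ℂ) (ch G m) = ∑ D ∈ G.powerset, (-1 : ℂ) ^ D.card * (if el D ∣ m then 1 else 0) := by
  classical
  set F := G.filter (fun p => p.1 ∣ m) with hF
  have h1 : ∑ D ∈ G.powerset, (-1 : ℂ) ^ D.card * (if el D ∣ m then 1 else 0) = ∑ D ∈ F.powerset, (-1 : ℂ) ^ D.card := by
    simp only [mul_ite, mul_one, mul_zero]
    rw [← Finset.sum_filter]
    apply Finset.sum_congr _ (fun _ _ => rfl)
    ext D
    simp only [Finset.mem_filter, Finset.mem_powerset, el_dvd_iff, hF]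
    constructor
    · rintro ⟨h, h'⟩ p hp; exact Finset.mem_filter.2 ⟨h hp, h' p hp⟩
    · intro h; exact ⟨fun p hp => (Finset.mem_filter.1 (h hp)).1, fun p hp => (Finset.mem_filter.1 (h hp)).2⟩
  rw [h1]
  have h2 : ∑ D ∈ F.powerset, (-1 : ℂ) ^ D.card = if F = ∅ then 1 else 0 := by
    have := Finset.sum_powerset_neg_one_pow_card (x := F)
    exact_mod_cast congrArg (Int.cast : ℤ → ℂ) this
  rw [h2, Complex.mul_conj, Complex.normSq_eq_norm_sq]
  split_ifs with h
  · rw [ch_norm]; · simp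
    rw [isCoprime_el]; intro p hp hd
    have : p ∈ F := Finset.mem_filter.2 ⟨hp, hd⟩
    rw [h] at this; simp at this
  · obtain ⟨p, hp⟩ := Finset.nonempty_iff_ne_empty.2 h
    rw [ch_eq_zero.2 ⟨p, (Finset.mem_filter.1 hp).1, (Finset.mem_filter.1 hp).2⟩]; simp

def c0 : ℝ := 2 * Real.pi / Real.sqrt 3
lemma c0_pos : 0 < c0 := by unfold c0; positivity

lemma chAB_norm_le (A B : Finset PP) (x : Eis) : ‖chAB A B x‖ ≤ 1 := by
  unfold chAB; rw [norm_mul, RCLike.norm_conj]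
  exact mul_le_one₀ (ch_norm_le _ _) (norm_nonneg _) (ch_norm_le _ _)

lemma chAB_mul (A B : Finset PP) (x y : Eis) : chAB A B (x * y) = chAB A B x * chAB A B y := by
  unfold chAB; rw [ch_mul, ch_mul, map_mul]; ring

open Classical in
lemma tsum_dvd {d : Eis} (hd : d ≠ 0) (f : Eis → ℂ) :
    ∑' m : Eis, (if d ∣ m then f m else 0) = ∑' x : Eis, f (d * x) := by
  have hinj : Function.Injective (fun x : Eis => d * x) := mul_right_injective₀ hd
  have := hinj.tsum_eq (f := fun m => if d ∣ m then f m else 0) (by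
    intro m hm
    simp only [Function.mem_support, ne_eq, ite_eq_right_iff, Classical.not_imp] at hm
    obtain ⟨⟨x, rfl⟩, -⟩ := hm
    exact ⟨x, rfl⟩)
  rw [← this]; simp

lemma tf_dilate {d : Eis} (hd : d ≠ 0) {A B : Finset PP} (h : Disjoint A B) {M : ℝ} (hM : 0 < M) :
    ∑' x : Eis, chAB A B (d * x) * cexp (-((c0 / M * Nm (d * x) : ℝ) : ℂ)) =
      chAB A B d * (wG A * (starRingEnd ℂ) (wG B)) * ((M / (Nm d * Real.sqrt (Nm (el A) * Nm (el B))) : ℝ) : ℂ) *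
      ∑' k : Eis, (starRingEnd ℂ) (chAB A B k) * cexp (-((c0 * M / (Nm d * (Nm (el A) * Nm (el B))) * Nm k : ℝ) : ℂ)) := by
  have hd0 := Nm_pos hd
  have hA := one_le_Nm_el A
  have hB := one_le_Nm_el B
  have hr : 0 < Nm (el A) * Nm (el B) := by positivity
  have hsr : 0 < Real.sqrt (Nm (el A) * Nm (el B)) := Real.sqrt_pos.2 hr
  have hss : Real.sqrt (Nm (el A) * Nm (el B)) * Real.sqrt (Nm (el A) * Nm (el B)) = Nm (el A) * Nm (el B) := Real.mul_self_sqrt hr.le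
  have hcG : cG (el A * el B) = c0 / Real.sqrt (Nm (el A) * Nm (el B)) := by
    unfold cG c0; rw [Nm_mul]; field_simp
  set y : ℝ := M / (Nm d * Real.sqrt (Nm (el A) * Nm (el B))) with hy
  have hy0 : 0 < y := by positivity
  have h1 := theta_psi (gauss_AB h) hy0
  have e1 : ∑' x : Eis, chAB A B (d * x) * cexp (-((c0 / M * Nm (d * x) : ℝ) : ℂ)) = chAB A B d * tf (chAB A B) (cG (el A * el B)) (1 / y) := by
    unfold tf; rw [← tsum_mul_left]
    congr 1; ext x
    rw [chAB_mul, mul_assoc, Nm_mul]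
    congr 4
    norm_cast
    rw [hcG, hy]; field_simp
  have e2 : tf (fun x => (starRingEnd ℂ) (chAB A B x)) (cG (el A * el B)) y = ∑' k : Eis, (starRingEnd ℂ) (chAB A B k) * cexp (-((c0 * M / (Nm d * (Nm (el A) * Nm (el B))) * Nm k : ℝ) : ℂ)) := by
    unfold tf; congr 1; ext x
    congr 4
    rw [hcG, hy, div_mul_div_comm]
    congr 2
    linear_combination Nm d * hss
  rw [e1, h1, e2]; ring

open Classical in
lemma pair_split (P1 P2 : Finset PP) (m : Eis) : ch P1 m * (starRingEnd ℂ) (ch P2 m) =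
    ∑ D ∈ (P1 ∩ P2).powerset, (-1 : ℂ) ^ D.card * (if el D ∣ m then chAB (P1 \ (P1 ∩ P2)) (P2 \ (P1 ∩ P2)) m else 0) := by
  set G := P1 ∩ P2 with hG
  have h1 : ch P1 m = ch (P1 \ G) m * ch G m := by
    rw [← ch_union Finset.sdiff_disjoint, Finset.sdiff_union_of_subset Finset.inter_subset_left]
  have h2 : ch P2 m = ch (P2 \ G) m * ch G m := by
    rw [← ch_union Finset.sdiff_disjoint, Finset.sdiff_union_of_subset Finset.inter_subset_right]
  have : ch P1 m * (starRingEnd ℂ) (ch P2 m) = (ch G m * (starRingEnd ℂ) (ch G m)) * chAB (P1 \ G) (P2 \ G) m := by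
    rw [h1, h2, map_mul]; unfold chAB; ring
  rw [this, ch_indicator, Finset.sum_mul]
  apply Finset.sum_congr rfl; intro D _
  split_ifs <;> ring

lemma sdiff_disj (P1 P2 : Finset PP) : by classical exact Disjoint (P1 \ (P1 ∩ P2)) (P2 \ (P1 ∩ P2)) := by
  classical
  rw [Finset.disjoint_left]; intro p hp hq
  simp only [Finset.mem_sdiff, Finset.mem_inter] at hp hq
  tauto

lemma chexp_summable (ψ : Eis → ℂ) (hψ : ∀ x, ‖ψ x‖ ≤ 1) {c : ℝ} (hc : 0 < c) :
    Summable fun x : Eis => ψ x * cexp (-((c * Nm x : ℝ) : ℂ)) := by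
  simpa using tf_summable ψ hψ hc one_pos

/-- the dual weight sum attached to a pair -/
def Hk (M : ℝ) (D A B : Finset PP) (k : Eis) : ℂ :=
  chAB A B (el D) * (wG A * (starRingEnd ℂ) (wG B)) * ((M / (Nm (el D) * Real.sqrt (Nm (el A) * Nm (el B))) : ℝ) : ℂ) *
    ((starRingEnd ℂ) (chAB A B k) * cexp (-((c0 * M / (Nm (el D) * (Nm (el A) * Nm (el B))) * Nm k : ℝ) : ℂ)))

lemma Hk_summable {M : ℝ} (hM : 0 < M) (D A B : Finset PP) : Summable (Hk M D A B) := by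
  unfold Hk
  apply Summable.mul_left
  have hA := one_le_Nm_el A
  have hB := one_le_Nm_el B
  have hD := one_le_Nm_el D
  have := c0_pos
  exact chexp_summable (fun k => (starRingEnd ℂ) (chAB A B k)) (fun x => by rw [RCLike.norm_conj]; exact chAB_norm_le _ _ _) (by positivity)

open Classical in
lemma pair_poisson (P1 P2 : Finset PP) {M : ℝ} (hM : 0 < M) :
    ∑' m : Eis, ch P1 m * (starRingEnd ℂ) (ch P2 m) * cexp (-((c0 / M * Nm m : ℝ) : ℂ)) =
    ∑ D ∈ (P1 ∩ P2).powerset, (-1 : ℂ) ^ D.card * ∑' k, Hk M D (P1 \ (P1 ∩ P2)) (P2 \ (P1 ∩ P2)) k := by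
  have hc := c0_pos
  have hs : ∀ D : Finset PP, Summable fun m : Eis => (if el D ∣ m then chAB (P1 \ (P1 ∩ P2)) (P2 \ (P1 ∩ P2)) m * cexp (-((c0 / M * Nm m : ℝ) : ℂ)) else 0) := by
    intro D
    have := chexp_summable (fun m => if el D ∣ m then chAB (P1 \ (P1 ∩ P2)) (P2 \ (P1 ∩ P2)) m else 0) (fun x => by
      split_ifs
      · exact chAB_norm_le _ _ _
      · simp) (c := c0 / M) (by positivity)
    simpa only [ite_mul, zero_mul] using this
  have e : ∀ m : Eis, ch P1 m * (starRingEnd ℂ) (ch P2 m) * cexp (-((c0 / M * Nm m : ℝ) : ℂ)) =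
      ∑ D ∈ (P1 ∩ P2).powerset, (-1 : ℂ) ^ D.card * (if el D ∣ m then chAB (P1 \ (P1 ∩ P2)) (P2 \ (P1 ∩ P2)) m * cexp (-((c0 / M * Nm m : ℝ) : ℂ)) else 0) := by
    intro m
    rw [pair_split, Finset.sum_mul]
    apply Finset.sum_congr rfl; intro D _
    split_ifs <;> ring
  simp only [e]
  rw [Summable.tsum_finsetSum (fun D _ => (hs D).mul_left _)]
  apply Finset.sum_congr rfl; intro D _
  rw [tsum_mul_left, tsum_dvd (el_ne_zero D) (fun m => chAB (P1 \ (P1 ∩ P2)) (P2 \ (P1 ∩ P2)) m * cexp (-((c0 / M * Nm m : ℝ) : ℂ))),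
    tf_dilate (el_ne_zero D) (sdiff_disj P1 P2) hM]
  unfold Hk
  rw [tsum_mul_left]

open Classical in
lemma LS2_re {K N B : ℝ} (h : LS2 K N B) (S : Finset (Finset PP)) (G : Finset PP)
    (hS : ∀ P ∈ S, G ⊆ P ∧ Nm (el (P \ G)) ≤ N) (c : Finset PP → ℂ) :
    ∑ m ∈ Ball K, ‖∑ P ∈ S, c P * ch (P \ G) m‖ ^ 2 ≤ B * ∑ P ∈ S, ‖c P‖ ^ 2 := by
  set S' := S.image (fun P => P \ G) with hS'
  have hinj : ∀ P ∈ S, ∀ Q ∈ S, P \ G = Q \ G → P = Q := by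
    intro P hP Q hQ h
    rw [← Finset.sdiff_union_of_subset (hS P hP).1, h, Finset.sdiff_union_of_subset (hS Q hQ).1]
  have hsub : S' ⊆ SS N := by
    intro A hA
    obtain ⟨P, hP, rfl⟩ := Finset.mem_image.1 hA
    exact mem_SS.2 (hS P hP).2
  set c' : Finset PP → ℂ := fun A => if A ∈ S' then c (A ∪ G) else 0 with hc'
  have key : ∀ (E : Type) [AddCommMonoid E] (f : ℂ → Finset PP → E) (hf : ∀ A, f 0 A = 0),
      ∑ A ∈ SS N, f (c' A) A = ∑ P ∈ S, f (c P) (P \ G) := by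
    intro E _ f hf
    rw [← Finset.sum_subset hsub (fun A _ hA => by simp [hc', hA, hf]), hS', Finset.sum_image hinj]
    apply Finset.sum_congr rfl
    intro P hP
    have : P \ G ∈ S' := Finset.mem_image_of_mem _ hP
    simp only [hc', this, if_true]
    rw [Finset.sdiff_union_of_subset (hS P hP).1]
  have h1 := h c'
  rw [key ℝ (fun z _ => ‖z‖ ^ 2) (by simp)] at h1
  refine le_trans (le_of_eq ?_) h1
  apply Finset.sum_congr rfl; intro m _
  rw [key ℂ (fun z A => z * ch A m) (by simp)]

/-- lattice points of norm below `1.5^J` -/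
def Bl (J : ℕ) : Finset Eis := (Ball ((3/2 : ℝ) ^ J)).filter (fun k => Nm k < (3/2 : ℝ) ^ J)
lemma mem_Bl {J : ℕ} {k : Eis} : k ∈ Bl J ↔ k ≠ 0 ∧ Nm k < (3/2 : ℝ) ^ J := by
  unfold Bl; simp only [Finset.mem_filter, mem_Ball]
  exact ⟨fun h => ⟨h.1.1, h.2⟩, fun h => ⟨⟨h.1, h.2.le⟩, h.2⟩⟩
lemma Bl_mono : Monotone Bl := by
  refine monotone_nat_of_le_succ fun J k hk => ?_
  rw [mem_Bl] at hk ⊢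
  refine ⟨hk.1, hk.2.trans_le ?_⟩
  exact pow_le_pow_right₀ (by norm_num) (Nat.le_succ J)
lemma Bl_zero : Bl 0 = ∅ := by
  ext k; simp only [mem_Bl, pow_zero, Finset.notMem_empty, iff_false]
  rintro ⟨h, h'⟩; have := one_le_Nm h; linarith

open Classical in
/-- shells -/
def Sl (j : ℕ) : Finset Eis := Bl (j + 1) \ Bl j
lemma mem_Sl {j : ℕ} {k : Eis} : k ∈ Sl j ↔ k ≠ 0 ∧ (3/2 : ℝ) ^ j ≤ Nm k ∧ Nm k < (3/2 : ℝ) ^ (j + 1) := by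
  unfold Sl; simp only [Finset.mem_sdiff, mem_Bl]
  constructor
  · rintro ⟨⟨h, h1⟩, h2⟩; refine ⟨h, ?_, h1⟩; by_contra h3; exact h2 ⟨h, not_le.1 h3⟩
  · rintro ⟨h, h1, h2⟩; exact ⟨⟨h, h2⟩, fun h3 => absurd h1 (not_le.2 h3.2)⟩

lemma sum_Bl {E : Type*} [AddCommMonoid E] (f : Eis → E) (J : ℕ) : ∑ k ∈ Bl J, f k = ∑ j ∈ Finset.range J, ∑ k ∈ Sl j, f k := by
  classical
  induction J with
  | zero => simp [Bl_zero]
  | succ n ih =>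
    rw [Finset.sum_range_succ, ← ih, Sl, add_comm (∑ k ∈ Bl n, f k), Finset.sum_sdiff (Bl_mono (Nat.le_succ n))]

lemma tsum_shell_le {f : Eis → ℂ} (hf : Summable f) (h0 : f 0 = 0) {b : ℕ → ℝ} {B : ℝ} (hb : HasSum b B) (hb0 : ∀ j, 0 ≤ b j)
    (h : ∀ j, ‖∑ k ∈ Sl j, f k‖ ≤ b j) : ‖∑' k, f k‖ ≤ B := by
  have hB : Filter.Tendsto (fun J => insert 0 (Bl J)) Filter.atTop Filter.atTop := by
    refine Filter.tendsto_atTop_finset_of_monotone ?_ ?_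
    · intro a b hab; exact Finset.insert_subset_insert _ (Bl_mono hab)
    · intro k
      obtain ⟨n, hn⟩ := pow_unbounded_of_one_lt (Nm k) (show (1:ℝ) < 3/2 by norm_num)
      by_cases hk : k = 0
      · exact ⟨0, by simp [hk]⟩
      · exact ⟨n, Finset.mem_insert_of_mem (mem_Bl.2 ⟨hk, hn⟩)⟩
  have h1 := (hf.hasSum.comp hB).norm
  refine le_of_tendsto h1 (Filter.Eventually.of_forall fun J => ?_)
  simp only [Function.comp]
  rw [Finset.sum_insert (by simp [mem_Bl]), h0, zero_add, sum_Bl]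
  exact (norm_sum_le _ _).trans ((Finset.sum_le_sum fun j _ => h j).trans (sum_le_hasSum _ (fun j _ => hb0 j) hb))

lemma exp_rpow {τ x : ℝ} (hτ : 0 < τ) (hx : 0 < x) : Real.exp (-x) ≤ τ ^ τ * x ^ (-τ) := by
  have h1 : x / τ ≤ Real.exp (x / τ) := by have := Real.add_one_le_exp (x / τ); linarith
  have h2 : (x / τ) ^ τ ≤ Real.exp x := by
    calc (x / τ) ^ τ ≤ (Real.exp (x / τ)) ^ τ := by gcongr
      _ = Real.exp x := by rw [← Real.exp_mul]; congr 1; field_simp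
  rw [Real.div_rpow hx.le hτ.le] at h2
  rw [Real.exp_neg, Real.rpow_neg hx.le, ← div_eq_mul_inv, inv_eq_one_div, div_le_div_iff₀ (Real.exp_pos _) (by positivity)]
  rw [div_le_iff₀ (by positivity)] at h2
  linarith

def XX (D : Finset PP) (c : ℂ) (A : Finset PP) (k : Eis) : ℂ :=
  c * ch A (el D) * wG A * ((Real.sqrt (Nm (el A)))⁻¹ : ℝ) * (starRingEnd ℂ) (ch A k)

lemma Hk_factor (M : ℝ) (D A B : Finset PP) (c1 c2 : ℂ) (k : Eis) :
    c1 * (starRingEnd ℂ) c2 * Hk M D A B k = ((M / Nm (el D) : ℝ) : ℂ) * (XX D c1 A k * (starRingEnd ℂ) (XX D c2 B k) *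
      ((Real.exp (-(c0 * M / (Nm (el D) * (Nm (el A) * Nm (el B))) * Nm k)) : ℝ) : ℂ)) := by
  unfold Hk XX chAB
  simp only [map_mul, Complex.conj_conj, conj_ofReal]
  rw [Real.sqrt_mul (Nm_nonneg _)]
  push_cast
  have hA := one_le_Nm_el A
  have hB := one_le_Nm_el B
  have hD := one_le_Nm_el D
  have h1 : ((Real.sqrt (Nm (el A)) : ℝ) : ℂ) ≠ 0 := by rw [ofReal_ne_zero]; exact (Real.sqrt_pos.2 (by linarith)).ne'
  have h2 : ((Real.sqrt (Nm (el B)) : ℝ) : ℂ) ≠ 0 := by rw [ofReal_ne_zero]; exact (Real.sqrt_pos.2 (by linarith)).ne'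
  have h3 : ((Nm (el D) : ℝ) : ℂ) ≠ 0 := by rw [ofReal_ne_zero]; linarith
  field_simp

lemma XX_conj_sum (K : ℝ) {N B : ℝ} (hB : 0 ≤ B) (h : LS2 K N B) (S : Finset (Finset PP)) (G D : Finset PP)
    {N0 : ℝ} (hN0 : 0 < N0) (hS : by classical exact ∀ P ∈ S, G ⊆ P ∧ Nm (el (P \ G)) ≤ N ∧ N0 ≤ Nm (el (P \ G))) (c : Finset PP → ℂ)
    (u : Finset PP → ℝ) (hu : ∀ a, 0 ≤ u a ∧ u a ≤ 1) (T : Finset Eis) (hT : T ⊆ Ball K) :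
    by classical exact ∑ k ∈ T, ‖∑ P ∈ S, (u P : ℂ) * XX D (c P) (P \ G) k‖ ^ 2 ≤ B * (N0⁻¹ * ∑ P ∈ S, ‖c P‖ ^ 2) := by
  classical
  refine (Finset.sum_le_sum_of_subset_of_nonneg hT (fun _ _ _ => by positivity)).trans ?_
  set d : Finset PP → ℂ := fun P => (starRingEnd ℂ) ((u P : ℂ) * (c P * ch (P \ G) (el D) * wG (P \ G) * ((Real.sqrt (Nm (el (P \ G))))⁻¹ : ℝ))) with hd
  have h1 := LS2_re h S G (fun P hP => ⟨(hS P hP).1, (hS P hP).2.1⟩) d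
  have e : ∀ k, ‖∑ P ∈ S, (u P : ℂ) * XX D (c P) (P \ G) k‖ = ‖∑ P ∈ S, d P * ch (P \ G) k‖ := by
    intro k
    rw [← RCLike.norm_conj, map_sum]
    congr 1; apply Finset.sum_congr rfl; intro P _
    unfold XX; rw [hd]; simp only [map_mul, Complex.conj_conj]; ring
  simp only [e]
  refine h1.trans ?_
  gcongr
  rw [Finset.mul_sum]
  apply Finset.sum_le_sum
  intro P hP
  have h0 := hS P hP
  have hA := one_le_Nm_el (P \ G)
  rw [hd]; simp only [RCLike.norm_conj, norm_mul, norm_real]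
  rw [(wG_spec _).W1, Real.norm_of_nonneg (hu P).1, Real.norm_of_nonneg (by positivity)]
  have e1 : ((Real.sqrt (Nm (el (P \ G))))⁻¹) ^ 2 ≤ N0⁻¹ := by
    rw [inv_pow, Real.sq_sqrt (by linarith)]; exact inv_anti₀ hN0 h0.2.2
  have e2 : u P ^ 2 ≤ 1 := pow_le_one₀ (hu P).1 (hu P).2
  have e3 : ‖ch (P \ G) (el D)‖ ^ 2 ≤ 1 := pow_le_one₀ (norm_nonneg _) (ch_norm_le _ _)
  calc _ = (u P ^ 2) * ‖ch (P \ G) (el D)‖ ^ 2 * (((Real.sqrt (Nm (el (P \ G))))⁻¹) ^ 2 * ‖c P‖ ^ 2) := by ring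
    _ ≤ 1 * 1 * (N0⁻¹ * ‖c P‖ ^ 2) := by gcongr
    _ = _ := by ring

lemma XX_cs (K : ℝ) {N B : ℝ} (hB : 0 ≤ B) (h : LS2 K N B) (S : Finset (Finset PP)) (G D : Finset PP)
    {N0 : ℝ} (hN0 : 0 < N0) (hS : by classical exact ∀ P ∈ S, G ⊆ P ∧ Nm (el (P \ G)) ≤ N ∧ N0 ≤ Nm (el (P \ G))) (c : Finset PP → ℂ)
    (u v : Finset PP → ℝ) (hu : ∀ a, 0 ≤ u a ∧ u a ≤ 1) (hv : ∀ a, 0 ≤ v a ∧ v a ≤ 1) (T : Finset Eis) (hT : T ⊆ Ball K) :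
    by classical exact ∑ k ∈ T, ‖∑ P ∈ S, (u P : ℂ) * XX D (c P) (P \ G) k‖ * ‖∑ P ∈ S, (v P : ℂ) * (starRingEnd ℂ) (XX D (c P) (P \ G) k)‖
      ≤ B * (N0⁻¹ * ∑ P ∈ S, ‖c P‖ ^ 2) := by
  classical
  have h1 := XX_conj_sum K hB h S G D hN0 hS c u hu T hT
  have h2 := XX_conj_sum K hB h S G D hN0 hS c v hv T hT
  have e : ∀ k, ‖∑ P ∈ S, (v P : ℂ) * (starRingEnd ℂ) (XX D (c P) (P \ G) k)‖ = ‖∑ P ∈ S, (v P : ℂ) * XX D (c P) (P \ G) k‖ := by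
    intro k; rw [← RCLike.norm_conj, map_sum]
    simp only [map_mul, Complex.conj_conj, conj_ofReal]
  simp only [e]
  have : ∀ k ∈ T, ‖∑ P ∈ S, (u P : ℂ) * XX D (c P) (P \ G) k‖ * ‖∑ P ∈ S, (v P : ℂ) * XX D (c P) (P \ G) k‖ ≤
    (‖∑ P ∈ S, (u P : ℂ) * XX D (c P) (P \ G) k‖ ^ 2 + ‖∑ P ∈ S, (v P : ℂ) * XX D (c P) (P \ G) k‖ ^ 2) / 2 := by
    intro k _
    nlinarith [sq_nonneg (‖∑ P ∈ S, (u P : ℂ) * XX D (c P) (P \ G) k‖ - ‖∑ P ∈ S, (v P : ℂ) * XX D (c P) (P \ G) k‖)]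
  refine (Finset.sum_le_sum this).trans ?_
  rw [← Finset.sum_div, Finset.sum_add_distrib]
  linarith

lemma Nm_sdiff {P G : Finset PP} (h : G ⊆ P) : by classical exact Nm (el (P \ G)) = Nm (el P) / Nm (el G) := by
  classical
  have := one_le_Nm_el G
  rw [eq_div_iff (by linarith), ← Nm_mul, el_sdiff h]

open Classical in
lemma shell_bound {M N0 B : ℝ} (hM : 0 < M) (hN0 : 0 < N0) (j : ℕ) (S : Finset (Finset PP)) (G D : Finset PP) (hB : 0 ≤ B)
    (h : LS2 ((3/2 : ℝ) ^ (j + 1)) (3/2 * N0 / Nm (el G)) B)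
    (hS : ∀ P ∈ S, G ⊆ P ∧ N0 ≤ Nm (el P) ∧ Nm (el P) ≤ 3/2 * N0) (c : Finset PP → ℂ) :
    ‖∑ k ∈ Sl j, ∑ P1 ∈ S, ∑ P2 ∈ S, c P1 * (starRingEnd ℂ) (c P2) * Hk M D (P1 \ G) (P2 \ G) k‖ ≤
      M / Nm (el D) * (Real.exp (-((c0 * M / Nm (el D) * (3/2 : ℝ) ^ j * (Nm (el G) / (3/2 * N0)) ^ 2) / 8)) * (B * ((N0 / Nm (el G))⁻¹ * ∑ P ∈ S, ‖c P‖ ^ 2))) := by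
  have hG := one_le_Nm_el G
  have hD := one_le_Nm_el D
  have hc0 := c0_pos
  set s : Finset PP → ℝ := fun P => if P ∈ S then 3/2 * N0 / Nm (el P) - 1 else 0 with hs
  set r : Eis → ℝ := fun k => if k ∈ Sl j then Nm k / (3/2 : ℝ) ^ j - 1 else 0 with hr
  have hs' : ∀ P, 0 ≤ s P ∧ s P ≤ 1/2 := by
    intro P
    simp only [hs]; split_ifs with hP
    · obtain ⟨-, h1, h2⟩ := hS P hP
      have hp : 0 < Nm (el P) := by linarith
      constructor
      · rw [sub_nonneg, le_div_iff₀ hp]; linarith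
      · rw [sub_le_iff_le_add, div_le_iff₀ hp]; linarith
    · norm_num
  have hr' : ∀ k, 0 ≤ r k ∧ r k ≤ 1/2 := by
    intro k
    simp only [hr]; split_ifs with hk
    · obtain ⟨-, h1, h2⟩ := mem_Sl.1 hk
      have hp : (0:ℝ) < (3/2) ^ j := by positivity
      constructor
      · rw [sub_nonneg, le_div_iff₀ hp]; linarith
      · rw [sub_le_iff_le_add, div_le_iff₀ hp]; rw [pow_succ] at h2; linarith
    · norm_num
  have hT : Sl j ⊆ Ball ((3/2 : ℝ) ^ (j + 1)) := by
    intro k hk; obtain ⟨h0, h1, h2⟩ := mem_Sl.1 hk; exact mem_Ball.2 ⟨h0, h2.le⟩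
  have key := sep S S (Sl j) s s r (fun P k => XX D (c P) (P \ G) k) (fun P k => (starRingEnd ℂ) (XX D (c P) (P \ G) k)) hs' hs' hr'
    (fun u v hu hv => XX_cs _ hB h S G D (N0 := N0 / Nm (el G)) (by positivity) (fun P hP => by
      obtain ⟨h0, h1, h2⟩ := hS P hP
      rw [Nm_sdiff h0]
      exact ⟨h0, by gcongr, by gcongr⟩) c u v hu hv (Sl j) hT) (ρ := c0 * M / Nm (el D) * (3/2 : ℝ) ^ j * (Nm (el G) / (3/2 * N0)) ^ 2) (by positivity)
  have e : ∑ k ∈ Sl j, ∑ P1 ∈ S, ∑ P2 ∈ S, c P1 * (starRingEnd ℂ) (c P2) * Hk M D (P1 \ G) (P2 \ G) k =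
      ((M / Nm (el D) : ℝ) : ℂ) * ∑ k ∈ Sl j, ∑ P1 ∈ S, ∑ P2 ∈ S, XX D (c P1) (P1 \ G) k * (starRingEnd ℂ) (XX D (c P2) (P2 \ G) k) *
        ((Real.exp (-((c0 * M / Nm (el D) * (3/2 : ℝ) ^ j * (Nm (el G) / (3/2 * N0)) ^ 2) * ((1 + s P1) * (1 + s P2) * (1 + r k)))) : ℝ) : ℂ) := by
    simp only [Finset.mul_sum]
    refine Finset.sum_congr rfl fun k hk => Finset.sum_congr rfl fun P1 h1 => Finset.sum_congr rfl fun P2 h2 => ?_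
    rw [Hk_factor]
    have e1 : c0 * M / (Nm (el D) * (Nm (el (P1 \ G)) * Nm (el (P2 \ G)))) * Nm k = (c0 * M / Nm (el D) * (3/2 : ℝ) ^ j * (Nm (el G) / (3/2 * N0)) ^ 2) * ((1 + s P1) * (1 + s P2) * (1 + r k)) := by
      rw [Nm_sdiff (hS P1 h1).1, Nm_sdiff (hS P2 h2).1]
      simp only [hs, hr, h1, h2, hk, if_true]
      have := (one_le_Nm_el P1)
      have := (one_le_Nm_el P2)
      field_simp
      ring
    rw [e1]
  rw [e, norm_mul, norm_real, Real.norm_of_nonneg (by positivity)]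
  gcongr

lemma geo_hasSum {η : ℝ} (hη : 0 < η) : HasSum (fun j : ℕ => ((3/2 : ℝ) ^ j) ^ (-η)) (1 - (3/2 : ℝ) ^ (-η))⁻¹ := by
  have h1 : (3/2 : ℝ) ^ (-η) < 1 := Real.rpow_lt_one_of_one_lt_of_neg (by norm_num) (by linarith)
  have := hasSum_geometric_of_lt_one (by positivity) h1
  refine this.congr_fun ?_
  intro j
  rw [← Real.rpow_natCast, ← Real.rpow_natCast, ← Real.rpow_mul (by norm_num), ← Real.rpow_mul (by norm_num)]
  congr 1; ring

/-- numerics for one exponent pair -/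
lemma T_num {β γ η : ℝ} (hβ : 0 ≤ β) (hγ : 0 ≤ γ) (hη : 0 < η) (hη1 : η ≤ 1) (h1 : 1 ≤ 2 * β + γ) : ∃ C : ℝ, 0 < C ∧ ∀ M N0 κ d g : ℝ, 1 ≤ M → 1 ≤ N0 → 1 ≤ κ → 1 ≤ d → d ≤ g → g ≤ 3/2 * N0 →
    M / d * (Real.exp (-((c0 * M / d * κ * (g / (3/2 * N0)) ^ 2) / 8)) * (((κ * (3/2)) * (3/2 * N0 / g)) ^ η * ((κ * (3/2)) ^ β * (3/2 * N0 / g) ^ γ) * (N0 / g)⁻¹))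
      ≤ C * κ ^ (-η) * N0 ^ (5 * η) * (M ^ (1 - β) * N0 ^ (2 * β + γ - 1)) := by
  have hc := c0_pos
  set τ := β + 2 * η with hτ
  have hτ0 : 0 < τ := by positivity
  refine ⟨τ ^ τ * (c0 / 18) ^ (-τ) * (9/4) ^ η * (3/2) ^ β * (3/2) ^ γ, by positivity, ?_⟩
  intro M N0 κ d g hM hN0 hκ hd hdg hg
  have hg1 : 1 ≤ g := hd.trans hdg
  have pM : 0 < M := by linarith
  have pN : 0 < N0 := by linarith
  have pκ : 0 < κ := by linarith
  have pd : 0 < d := by linarith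
  have pg : 0 < g := by linarith
  have e0 : (c0 * M / d * κ * (g / (3/2 * N0)) ^ 2) / 8 = (c0 / 18) * (κ * (M * g ^ 2 / (N0 ^ 2 * d))) := by field_simp; norm_num
  have hx : 0 < (c0 / 18) * (κ * (M * g ^ 2 / (N0 ^ 2 * d))) := by positivity
  rw [e0]
  have e1 := exp_rpow hτ0 hx
  have e2 : ((c0 / 18) * (κ * (M * g ^ 2 / (N0 ^ 2 * d)))) ^ (-τ) = (c0 / 18) ^ (-τ) * κ ^ (-β) * κ ^ (-(2 * η)) * (M ^ (-β) * M ^ (-(2 * η)) * (g ^ (-(2 * β)) * g ^ (-(4 * η))) * (N0 ^ (2 * β) * N0 ^ (4 * η)) * (d ^ β * d ^ (2 * η))) := by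
    rw [Real.mul_rpow (by positivity) (by positivity), Real.mul_rpow (by positivity) (by positivity), Real.div_rpow (x := M * g ^ 2) (by positivity) (by positivity),
      Real.mul_rpow (by positivity) (by positivity), Real.mul_rpow (by positivity) (by positivity)]
    have a1 : ∀ {x : ℝ}, 0 < x → x ^ (-τ) = x ^ (-β) * x ^ (-(2 * η)) := fun hx => by rw [← Real.rpow_add hx]; congr 1; rw [hτ]; ring
    have a2 : (g ^ 2) ^ (-τ) = g ^ (-(2 * β)) * g ^ (-(4 * η)) := by
      rw [← Real.rpow_natCast, ← Real.rpow_mul pg.le, ← Real.rpow_add pg]; congr 1; rw [hτ]; push_cast; ring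
    have a3 : (N0 ^ 2) ^ (-τ) = (N0 ^ (2 * β) * N0 ^ (4 * η))⁻¹ := by
      rw [← Real.rpow_natCast, ← Real.rpow_mul pN.le, ← Real.rpow_add pN, ← Real.rpow_neg pN.le]; congr 1; rw [hτ]; push_cast; ring
    have a4 : d ^ (-τ) = (d ^ β * d ^ (2 * η))⁻¹ := by
      rw [← Real.rpow_add pd, Real.rpow_neg pd.le]
    rw [a1 pκ, a1 pM, a2, a3, a4, ← mul_inv, div_inv_eq_mul]; ring
  rw [e2] at e1
  have e3 : ((κ * (3/2)) * (3/2 * N0 / g)) ^ η = (9/4) ^ η * κ ^ η * N0 ^ η * g ^ (-η) := by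
    rw [show (κ * (3/2)) * (3/2 * N0 / g) = (9/4) * κ * N0 / g by ring, Real.div_rpow (by positivity) pg.le, Real.mul_rpow (by positivity) pN.le, Real.mul_rpow (by norm_num) pκ.le,
      Real.rpow_neg pg.le, div_eq_mul_inv]
  have e4 : (κ * (3/2)) ^ β = κ ^ β * (3/2) ^ β := Real.mul_rpow pκ.le (by norm_num)
  have e5 : (3/2 * N0 / g) ^ γ = (3/2) ^ γ * N0 ^ γ * g ^ (-γ) := by
    rw [Real.div_rpow (by positivity) pg.le, Real.mul_rpow (by norm_num) pN.le, Real.rpow_neg pg.le, div_eq_mul_inv]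
  rw [e3, e4, e5, inv_div]
  have k1 : κ ^ (-β) * κ ^ (-(2 * η)) * κ ^ η * κ ^ β = κ ^ (-η) := by
    rw [← Real.rpow_add pκ, ← Real.rpow_add pκ, ← Real.rpow_add pκ]; congr 1; ring
  have k2 : N0 ^ (2 * β) * N0 ^ (4 * η) * N0 ^ η * N0 ^ γ * N0⁻¹ = N0 ^ (5 * η) * N0 ^ (2 * β + γ - 1) := by
    rw [← Real.rpow_neg_one, ← Real.rpow_add pN, ← Real.rpow_add pN, ← Real.rpow_add pN, ← Real.rpow_add pN, ← Real.rpow_add pN]; congr 1; ring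
  have k3 : M * M ^ (-β) = M ^ (1 - β) := by rw [sub_eq_add_neg, Real.rpow_add pM, Real.rpow_one]
  have k4 : M ^ (-(2 * η)) ≤ 1 := Real.rpow_le_one_of_one_le_of_nonpos hM (by linarith)
  have k5 : d⁻¹ * (g ^ (-(2 * β)) * g ^ (-(4 * η))) * (d ^ β * d ^ (2 * η)) * g ^ (-η) * g ^ (-γ) * g ≤ 1 := by
    have : d⁻¹ * (d ^ β * d ^ (2 * η)) = d ^ (β - 1 + 2 * η) := by
      rw [← Real.rpow_neg_one, ← Real.rpow_add pd, ← Real.rpow_add pd]; congr 1; ring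
    have t2 : g ^ (-(2 * β)) * g ^ (-(4 * η)) * g ^ (-η) * g ^ (-γ) * g = g ^ (1 - 2 * β - γ - 5 * η) := by
      nth_rewrite 5 [← Real.rpow_one g]
      rw [← Real.rpow_add pg, ← Real.rpow_add pg, ← Real.rpow_add pg, ← Real.rpow_add pg]; congr 1; ring
    calc _ = (d⁻¹ * (d ^ β * d ^ (2 * η))) * (g ^ (-(2 * β)) * g ^ (-(4 * η)) * g ^ (-η) * g ^ (-γ) * g) := by ring
      _ = d ^ (β - 1 + 2 * η) * g ^ (1 - 2 * β - γ - 5 * η) := by rw [this, t2]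
      _ ≤ 1 := by
        by_cases hb : β - 1 + 2 * η ≤ 0
        · exact mul_le_one₀ (Real.rpow_le_one_of_one_le_of_nonpos hd hb) (by positivity) (Real.rpow_le_one_of_one_le_of_nonpos hg1 (by linarith))
        · push Not at hb
          calc _ ≤ g ^ (β - 1 + 2 * η) * g ^ (1 - 2 * β - γ - 5 * η) := by gcongr
            _ = g ^ (-β - γ - 3 * η) := by rw [← Real.rpow_add pg]; congr 1; ring
            _ ≤ 1 := Real.rpow_le_one_of_one_le_of_nonpos hg1 (by linarith)
  calc _ ≤ M / d * ((τ ^ τ * ((c0 / 18) ^ (-τ) * κ ^ (-β) * κ ^ (-(2 * η)) * (M ^ (-β) * M ^ (-(2 * η)) * (g ^ (-(2 * β)) * g ^ (-(4 * η))) * (N0 ^ (2 * β) * N0 ^ (4 * η)) * (d ^ β * d ^ (2 * η))))) *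
        ((9/4) ^ η * κ ^ η * N0 ^ η * g ^ (-η) * (κ ^ β * (3/2) ^ β * ((3/2) ^ γ * N0 ^ γ * g ^ (-γ))) * (g / N0))) := by gcongr
    _ = (τ ^ τ * (c0 / 18) ^ (-τ) * (9/4) ^ η * (3/2) ^ β * (3/2) ^ γ) * (κ ^ (-β) * κ ^ (-(2 * η)) * κ ^ η * κ ^ β) * (N0 ^ (2 * β) * N0 ^ (4 * η) * N0 ^ η * N0 ^ γ * N0⁻¹) * (M * M ^ (-β)) *
        (M ^ (-(2 * η)) * (d⁻¹ * (g ^ (-(2 * β)) * g ^ (-(4 * η))) * (d ^ β * d ^ (2 * η)) * g ^ (-η) * g ^ (-γ) * g)) := by ring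
    _ ≤ (τ ^ τ * (c0 / 18) ^ (-τ) * (9/4) ^ η * (3/2) ^ β * (3/2) ^ γ) * (κ ^ (-β) * κ ^ (-(2 * η)) * κ ^ η * κ ^ β) * (N0 ^ (2 * β) * N0 ^ (4 * η) * N0 ^ η * N0 ^ γ * N0⁻¹) * (M * M ^ (-β)) *
        (1 * 1) := by gcongr
    _ = _ := by rw [k1, k2, k3]; ring


open Classical in
lemma T_bound {ι : Type} (I : Finset ι) (β γ : ι → ℝ) (hβ : ∀ i, 0 ≤ β i) (hγ : ∀ i, 0 ≤ γ i) (h1 : ∀ i, 1 ≤ 2 * β i + γ i)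
    {η : ℝ} (hη : 0 < η) (hη1 : η ≤ 1) {C : ℝ} (hC : 0 < C)
    (hLS : ∀ K N : ℝ, 1 ≤ K → 1 ≤ N → LS2 K N (C * (K * N) ^ η * ∑ i ∈ I, K ^ β i * N ^ γ i)) :
    ∃ C' : ℝ, 0 < C' ∧ ∀ M N0 : ℝ, 1 ≤ M → 1 ≤ N0 → ∀ (S : Finset (Finset PP)) (G D : Finset PP), D ⊆ G →
      (∀ P ∈ S, G ⊆ P ∧ N0 ≤ Nm (el P) ∧ Nm (el P) ≤ 3/2 * N0) → ∀ c : Finset PP → ℂ,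
      ‖∑ P1 ∈ S, ∑ P2 ∈ S, c P1 * (starRingEnd ℂ) (c P2) * ∑' k, (if k = 0 then 0 else Hk M D (P1 \ G) (P2 \ G) k)‖ ≤
        C' * N0 ^ (5 * η) * (∑ i ∈ I, M ^ (1 - β i) * N0 ^ (2 * β i + γ i - 1)) * ∑ P ∈ S, ‖c P‖ ^ 2 := by
  choose Cn hCn hn using fun i => T_num (hβ i) (hγ i) hη hη1 (h1 i)
  set Cs := ∑ i ∈ I, Cn i with hCs
  have hCs0 : 0 ≤ Cs := Finset.sum_nonneg fun i _ => (hCn i).le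
  have hCi : ∀ i ∈ I, Cn i ≤ Cs := fun i hi => Finset.single_le_sum (fun i _ => (hCn i).le) hi
  have hgeo := geo_hasSum hη
  set g0 := (1 - (3/2 : ℝ) ^ (-η))⁻¹ with hg0
  have hg0' : 0 ≤ g0 := by rw [← hgeo.tsum_eq]; exact tsum_nonneg fun j => by positivity
  refine ⟨C * Cs * g0 + 1, by positivity, ?_⟩
  intro M N0 hM hN0 S G D hDG hS c
  have pM : 0 < M := by linarith
  have pN : 0 < N0 := by linarith
  by_cases hne : S = ∅
  · subst hne; simp
  obtain ⟨P0, hP0⟩ := Finset.nonempty_iff_ne_empty.2 hne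
  have hG1 := one_le_Nm_el G
  have hD1 := one_le_Nm_el D
  have hmono : ∀ {X Y : Finset PP}, X ⊆ Y → Nm (el X) ≤ Nm (el Y) := by
    intro X Y h
    rw [← el_sdiff h, Nm_mul]
    have := one_le_Nm_el (Y \ X); have := one_le_Nm_el X; nlinarith
  have hDG' := hmono hDG
  have hGN : Nm (el G) ≤ 3/2 * N0 := (hmono (hS P0 hP0).1).trans (hS P0 hP0).2.2
  set Sc := ∑ P ∈ S, ‖c P‖ ^ 2 with hSc
  have hSc0 : 0 ≤ Sc := by positivity
  set W := ∑ i ∈ I, M ^ (1 - β i) * N0 ^ (2 * β i + γ i - 1) with hW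
  have hW0 : 0 ≤ W := Finset.sum_nonneg fun i _ => by positivity
  have hsum : ∀ P1 P2 : Finset PP, Summable fun k : Eis => (if k = 0 then 0 else Hk M D (P1 \ G) (P2 \ G) k) := by
    intro P1 P2
    refine Summable.of_norm_bounded (Hk_summable pM D (P1 \ G) (P2 \ G)).norm ?_
    intro k; split_ifs <;> simp
  have e : ∑ P1 ∈ S, ∑ P2 ∈ S, c P1 * (starRingEnd ℂ) (c P2) * ∑' k, (if k = 0 then 0 else Hk M D (P1 \ G) (P2 \ G) k)
      = ∑' k, ∑ P1 ∈ S, ∑ P2 ∈ S, c P1 * (starRingEnd ℂ) (c P2) * (if k = 0 then 0 else Hk M D (P1 \ G) (P2 \ G) k) := by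
    rw [Summable.tsum_finsetSum (fun P1 _ => summable_sum fun P2 _ => (hsum P1 P2).mul_left _)]
    apply Finset.sum_congr rfl; intro P1 _
    rw [Summable.tsum_finsetSum (fun P2 _ => (hsum P1 P2).mul_left _)]
    apply Finset.sum_congr rfl; intro P2 _
    rw [tsum_mul_left]
  rw [e]
  have hb := (hgeo.mul_left (C * Cs * N0 ^ (5 * η) * W * Sc))
  have := tsum_shell_le (f := fun k => ∑ P1 ∈ S, ∑ P2 ∈ S, c P1 * (starRingEnd ℂ) (c P2) * (if k = 0 then 0 else Hk M D (P1 \ G) (P2 \ G) k))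
    (summable_sum fun P1 _ => summable_sum fun P2 _ => (hsum P1 P2).mul_left _) (by simp) hb (fun j => by positivity) ?_
  · refine this.trans ?_
    calc _ = (C * Cs * g0) * N0 ^ (5 * η) * W * Sc := by ring
      _ ≤ _ := by gcongr; linarith
  · intro j
    set κ : ℝ := (3/2 : ℝ) ^ j with hκ
    have hκ1 : 1 ≤ κ := one_le_pow₀ (by norm_num)
    have hN' : 1 ≤ 3/2 * N0 / Nm (el G) := by rw [le_div_iff₀ (by linarith)]; linarith
    have e1 : ∑ k ∈ Sl j, ∑ P1 ∈ S, ∑ P2 ∈ S, c P1 * (starRingEnd ℂ) (c P2) * (if k = 0 then 0 else Hk M D (P1 \ G) (P2 \ G) k)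
        = ∑ k ∈ Sl j, ∑ P1 ∈ S, ∑ P2 ∈ S, c P1 * (starRingEnd ℂ) (c P2) * Hk M D (P1 \ G) (P2 \ G) k := by
      apply Finset.sum_congr rfl; intro k hk
      simp only [(mem_Sl.1 hk).1, if_false]
    rw [e1]
    have hK : (3/2 : ℝ) ^ (j + 1) = κ * (3/2) := by rw [hκ, pow_succ]
    have := shell_bound pM pN j S G D ?_ (hLS ((3/2 : ℝ) ^ (j + 1)) _ (one_le_pow₀ (by norm_num)) hN') hS c
    swap
    · refine mul_nonneg (by positivity) (Finset.sum_nonneg fun i _ => by positivity)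
    refine this.trans ?_
    rw [hK, ← hκ, ← hSc]
    calc _ = C * Sc * ∑ i ∈ I, M / Nm (el D) * (Real.exp (-((c0 * M / Nm (el D) * κ * (Nm (el G) / (3/2 * N0)) ^ 2) / 8)) * (((κ * (3/2)) * (3/2 * N0 / Nm (el G))) ^ η * ((κ * (3/2)) ^ β i * (3/2 * N0 / Nm (el G)) ^ γ i) * (N0 / Nm (el G))⁻¹)) := by
          clear_value Sc
          simp only [Finset.mul_sum, Finset.sum_mul]
          apply Finset.sum_congr rfl; intro i _; ring
      _ ≤ C * Sc * ∑ i ∈ I, Cs * κ ^ (-η) * N0 ^ (5 * η) * (M ^ (1 - β i) * N0 ^ (2 * β i + γ i - 1)) := by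
          apply mul_le_mul_of_nonneg_left _ (by positivity)
          apply Finset.sum_le_sum; intro i hi
          refine (hn i M N0 κ (Nm (el D)) (Nm (el G)) hM hN0 hκ1 hD1 hDG' hGN).trans ?_
          have := hCi i hi
          gcongr
      _ = _ := by rw [← Finset.mul_sum]; ring

open Classical in
lemma mobius_ps {α : Type*} (Y : Finset α) : ∀ f : Finset α → ℂ,
    ∑ X ∈ Y.powerset, ∑ G ∈ X.powerset, (-1 : ℂ) ^ (X.card + G.card) * f G = f Y := by
  induction Y using Finset.induction_on with
  | empty => intro f; simp
  | insert a Y ha ih =>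
    intro f
    rw [Finset.sum_powerset_insert ha, ih f]
    have : ∀ X ∈ Y.powerset, ∑ G ∈ (insert a X).powerset, (-1 : ℂ) ^ ((insert a X).card + G.card) * f G =
        - (∑ G ∈ X.powerset, (-1 : ℂ) ^ (X.card + G.card) * f G) + ∑ G ∈ X.powerset, (-1 : ℂ) ^ (X.card + G.card) * f (insert a G) := by
      intro X hX
      have haX : a ∉ X := fun h => ha (Finset.mem_powerset.1 hX h)
      rw [Finset.sum_powerset_insert haX, ← Finset.sum_neg_distrib]
      congr 1
      · apply Finset.sum_congr rfl; intro G _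
        rw [Finset.card_insert_of_notMem haX]; ring
      · apply Finset.sum_congr rfl; intro G hG
        have haG : a ∉ G := fun h => haX (Finset.mem_powerset.1 hG h)
        rw [Finset.card_insert_of_notMem haX, Finset.card_insert_of_notMem haG]; ring
    rw [Finset.sum_congr rfl this, Finset.sum_add_distrib, Finset.sum_neg_distrib, ih f, ih (fun G => f (insert a G))]
    ring

/-- off-diagonal weight -/
def Zk (M : ℝ) (D A B : Finset PP) : ℂ := ∑' k, (open Classical in if k = 0 then 0 else Hk M D A B k)

open Classical in
lemma off_diag {M N0 Bd : ℝ} (hB : 0 ≤ Bd)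
    (hT : ∀ (S : Finset (Finset PP)) (G D : Finset PP), D ⊆ G →
      (∀ P ∈ S, G ⊆ P ∧ N0 ≤ Nm (el P) ∧ Nm (el P) ≤ 3/2 * N0) → ∀ c : Finset PP → ℂ,
      ‖∑ P1 ∈ S, ∑ P2 ∈ S, c P1 * (starRingEnd ℂ) (c P2) * Zk M D (P1 \ G) (P2 \ G)‖ ≤ Bd * ∑ P ∈ S, ‖c P‖ ^ 2)
    (S : Finset (Finset PP)) (hS : ∀ P ∈ S, N0 ≤ Nm (el P) ∧ Nm (el P) ≤ 3/2 * N0) (c : Finset PP → ℂ) :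
    ‖∑ P1 ∈ S, ∑ P2 ∈ S, c P1 * (starRingEnd ℂ) (c P2) *
      ∑ D ∈ (P1 ∩ P2).powerset, (-1 : ℂ) ^ D.card * Zk M D (P1 \ (P1 ∩ P2)) (P2 \ (P1 ∩ P2))‖ ≤
      Bd * ∑ P ∈ S, 8 ^ P.card * ‖c P‖ ^ 2 := by
  set GG := S.biUnion Finset.powerset with hGG
  set f : Finset PP → Finset PP → Finset PP → ℂ := fun P1 P2 G => ∑ D ∈ G.powerset, (-1 : ℂ) ^ D.card * Zk M D (P1 \ G) (P2 \ G) with hf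
  have e1 : ∀ P1 ∈ S, ∀ P2 ∈ S, c P1 * (starRingEnd ℂ) (c P2) * f P1 P2 (P1 ∩ P2) =
      ∑ X ∈ GG, if X ⊆ P1 ∧ X ⊆ P2 then c P1 * (starRingEnd ℂ) (c P2) * ∑ G ∈ X.powerset, (-1 : ℂ) ^ (X.card + G.card) * f P1 P2 G else 0 := by
    intro P1 h1 P2 h2
    rw [← Finset.sum_filter, ← Finset.mul_sum]
    congr 1
    rw [← mobius_ps (P1 ∩ P2) (f P1 P2)]
    apply Finset.sum_congr _ (fun _ _ => rfl)
    ext X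
    simp only [Finset.mem_powerset, Finset.mem_filter, hGG, Finset.mem_biUnion, Finset.subset_inter_iff]
    exact ⟨fun h => ⟨⟨P1, h1, h.1⟩, h⟩, fun h => h.2⟩
  have e2 : ∑ P1 ∈ S, ∑ P2 ∈ S, c P1 * (starRingEnd ℂ) (c P2) * f P1 P2 (P1 ∩ P2) =
      ∑ X ∈ GG, ∑ G ∈ X.powerset, ∑ D ∈ G.powerset, (-1 : ℂ) ^ (X.card + G.card) * (-1) ^ D.card *
        ∑ P1 ∈ S.filter (X ⊆ ·), ∑ P2 ∈ S.filter (X ⊆ ·), c P1 * (starRingEnd ℂ) (c P2) * Zk M D (P1 \ G) (P2 \ G) := by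
    rw [Finset.sum_congr rfl (fun P1 h1 => Finset.sum_congr rfl (e1 P1 h1))]
    rw [Finset.sum_congr rfl (fun P1 h1 => Finset.sum_comm), Finset.sum_comm]
    apply Finset.sum_congr rfl; intro X _
    have : ∀ P1 ∈ S, ∑ P2 ∈ S, (if X ⊆ P1 ∧ X ⊆ P2 then c P1 * (starRingEnd ℂ) (c P2) * ∑ G ∈ X.powerset, (-1 : ℂ) ^ (X.card + G.card) * f P1 P2 G else 0)
        = if X ⊆ P1 then ∑ P2 ∈ S.filter (X ⊆ ·), c P1 * (starRingEnd ℂ) (c P2) * ∑ G ∈ X.powerset, (-1 : ℂ) ^ (X.card + G.card) * f P1 P2 G else 0 := by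
      intro P1 _
      by_cases h : X ⊆ P1
      · simp only [h, true_and, if_true, Finset.sum_filter]
      · simp [h]
    rw [Finset.sum_congr rfl this, ← Finset.sum_filter]
    simp only [hf, Finset.mul_sum]
    rw [Finset.sum_congr rfl (fun P1 h1 => Finset.sum_comm), Finset.sum_comm]
    apply Finset.sum_congr rfl; intro G _
    rw [Finset.sum_congr rfl (fun P1 h1 => Finset.sum_comm), Finset.sum_comm]
    apply Finset.sum_congr rfl; intro D _
    apply Finset.sum_congr rfl; intro P1 _
    apply Finset.sum_congr rfl; intro P2 _
    ring
  change ‖∑ P1 ∈ S, ∑ P2 ∈ S, c P1 * (starRingEnd ℂ) (c P2) * f P1 P2 (P1 ∩ P2)‖ ≤ _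
  rw [e2]
  calc _ ≤ ∑ X ∈ GG, ∑ G ∈ X.powerset, ∑ D ∈ G.powerset, Bd * ∑ P ∈ S.filter (X ⊆ ·), ‖c P‖ ^ 2 := by
        refine norm_sum_le_of_le _ fun X _ => norm_sum_le_of_le _ fun G hG => norm_sum_le_of_le _ fun D hD => ?_
        rw [norm_mul, norm_mul, norm_pow, norm_pow, norm_neg, norm_one, one_pow, one_pow, one_mul, one_mul]
        refine hT _ G D (Finset.mem_powerset.1 hD) ?_ c
        intro P hP
        rw [Finset.mem_filter] at hP
        exact ⟨(Finset.mem_powerset.1 hG).trans hP.2, hS P hP.1⟩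
    _ ≤ ∑ X ∈ GG, ∑ P ∈ S.filter (X ⊆ ·), Bd * (4 ^ P.card * ‖c P‖ ^ 2) := by
        apply Finset.sum_le_sum; intro X _
        rw [Finset.sum_congr rfl (fun G _ => Finset.sum_const _)]
        simp only [Finset.card_powerset, nsmul_eq_mul]
        rw [← Finset.sum_mul, Finset.mul_sum, Finset.mul_sum]
        apply Finset.sum_le_sum; intro P hP
        have hXP := (Finset.mem_filter.1 hP).2
        have : ∑ G ∈ X.powerset, ((2 ^ G.card : ℕ) : ℝ) ≤ 4 ^ P.card := by
          calc _ ≤ ∑ G ∈ X.powerset, (2 : ℝ) ^ P.card := by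
                apply Finset.sum_le_sum; intro G hG
                push_cast
                exact pow_le_pow_right₀ (by norm_num) (Finset.card_le_card ((Finset.mem_powerset.1 hG).trans hXP))
            _ = 2 ^ X.card * 2 ^ P.card := by simp
            _ ≤ 2 ^ P.card * 2 ^ P.card := by
                gcongr; norm_num
            _ = _ := by rw [← mul_pow]; norm_num
        calc _ ≤ 4 ^ P.card * (Bd * ‖c P‖ ^ 2) := by gcongr
          _ = _ := by ring
    _ = ∑ P ∈ S, ∑ X ∈ GG.filter (· ⊆ P), Bd * (4 ^ P.card * ‖c P‖ ^ 2) := by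
        simp only [Finset.sum_filter]
        rw [Finset.sum_comm]
    _ ≤ _ := by
        rw [Finset.mul_sum]
        apply Finset.sum_le_sum; intro P hP
        rw [Finset.sum_const, nsmul_eq_mul]
        have : ((GG.filter (· ⊆ P)).card : ℝ) ≤ 2 ^ P.card := by
          have := Finset.card_le_card (s := GG.filter (· ⊆ P)) (t := P.powerset) (fun X hX => Finset.mem_powerset.2 (Finset.mem_filter.1 hX).2)
          rw [Finset.card_powerset] at this
          exact_mod_cast this
        calc _ ≤ 2 ^ P.card * (Bd * (4 ^ P.card * ‖c P‖ ^ 2)) := by gcongr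
          _ = Bd * ((2 * 4) ^ P.card * ‖c P‖ ^ 2) := by rw [mul_pow]; ring
          _ = _ := by norm_num

open Classical in
lemma pair_split0 (P1 P2 : Finset PP) {M : ℝ} (hM : 0 < M) :
    ∑' m : Eis, ch P1 m * (starRingEnd ℂ) (ch P2 m) * cexp (-((c0 / M * Nm m : ℝ) : ℂ)) =
    (∑ D ∈ (P1 ∩ P2).powerset, (-1 : ℂ) ^ D.card * Hk M D (P1 \ (P1 ∩ P2)) (P2 \ (P1 ∩ P2)) 0) +
    ∑ D ∈ (P1 ∩ P2).powerset, (-1 : ℂ) ^ D.card * Zk M D (P1 \ (P1 ∩ P2)) (P2 \ (P1 ∩ P2)) := by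
  rw [pair_poisson P1 P2 hM, ← Finset.sum_add_distrib]
  apply Finset.sum_congr rfl; intro D _
  rw [← mul_add, Summable.tsum_eq_add_tsum_ite (Hk_summable hM D _ _) 0, Zk]

lemma ch_zero {P : Finset PP} (h : P ≠ ∅) : ch P 0 = 0 := by
  obtain ⟨p, hp⟩ := Finset.nonempty_iff_ne_empty.2 h
  exact ch_eq_zero.2 ⟨p, hp, dvd_zero _⟩

open Classical in
lemma diag_zero {P1 P2 : Finset PP} (h : P1 ≠ P2) (M : ℝ) (D : Finset PP) :
    Hk M D (P1 \ (P1 ∩ P2)) (P2 \ (P1 ∩ P2)) 0 = 0 := by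
  have : chAB (P1 \ (P1 ∩ P2)) (P2 \ (P1 ∩ P2)) 0 = 0 := by
    unfold chAB
    by_cases h1 : P1 \ (P1 ∩ P2) = ∅
    · have h2 : P2 \ (P1 ∩ P2) ≠ ∅ := by
        intro h2
        rw [Finset.sdiff_eq_empty_iff_subset] at h1 h2
        exact h (Finset.Subset.antisymm (h1.trans Finset.inter_subset_right) (h2.trans Finset.inter_subset_left))
      rw [ch_zero h2]; simp
    · rw [ch_zero h1]; simp
  unfold Hk; rw [this]; simp

open Classical in
lemma diag_le (P : Finset PP) {M : ℝ} (hM : 0 < M) (D : Finset PP) :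
    ‖Hk M D (P \ (P ∩ P)) (P \ (P ∩ P)) 0‖ ≤ M := by
  have hD := one_le_Nm_el D
  have e : P \ (P ∩ P) = ∅ := by simp
  rw [e]
  unfold Hk
  rw [norm_mul, norm_mul, norm_mul, norm_mul, norm_mul, RCLike.norm_conj, RCLike.norm_conj, (wG_spec ∅).W1]
  have h1 := chAB_norm_le ∅ ∅ (el D)
  have h2 := chAB_norm_le ∅ ∅ 0
  have h3 : ‖cexp (-((c0 * M / (Nm (el D) * (Nm (el ∅) * Nm (el ∅))) * Nm 0 : ℝ) : ℂ))‖ = 1 := by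
    rw [Nm_zero]; simp
  rw [h3]
  have h4 : ‖((M / (Nm (el D) * Real.sqrt (Nm (el ∅) * Nm (el ∅))) : ℝ) : ℂ)‖ ≤ M := by
    rw [el_empty, Nm_one, mul_one, Real.sqrt_one, mul_one, Complex.norm_real, Real.norm_eq_abs, abs_of_nonneg (by positivity)]
    exact div_le_self hM.le hD
  calc _ ≤ 1 * (1 * 1) * M * (1 * 1) := by gcongr
    _ = M := by ring

open Classical in
lemma shell_LS {M N0 Bd : ℝ} (hM : 1 ≤ M) (hB : 0 ≤ Bd)
    (hT : ∀ (S : Finset (Finset PP)) (G D : Finset PP), D ⊆ G →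
      (∀ P ∈ S, G ⊆ P ∧ N0 ≤ Nm (el P) ∧ Nm (el P) ≤ 3/2 * N0) → ∀ c : Finset PP → ℂ,
      ‖∑ P1 ∈ S, ∑ P2 ∈ S, c P1 * (starRingEnd ℂ) (c P2) * Zk M D (P1 \ G) (P2 \ G)‖ ≤ Bd * ∑ P ∈ S, ‖c P‖ ^ 2)
    (S : Finset (Finset PP)) (hS : ∀ P ∈ S, N0 ≤ Nm (el P) ∧ Nm (el P) ≤ 3/2 * N0) (c : Finset PP → ℂ) :
    ∑ A ∈ SS M, ‖∑ P ∈ S, c P * ch P (el A)‖ ^ 2 ≤ Real.exp c0 * ((M + Bd) * ∑ P ∈ S, 8 ^ P.card * ‖c P‖ ^ 2) := by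
  have pM : 0 < M := by linarith
  have hc := c0_pos
  set f : Eis → ℝ := fun m => ‖∑ P ∈ S, c P * ch P m‖ ^ 2 * Real.exp (-(c0 / M * Nm m)) with hf
  set g : Finset PP → Finset PP → Eis → ℂ := fun P1 P2 m => ch P1 m * (starRingEnd ℂ) (ch P2 m) * cexp (-((c0 / M * Nm m : ℝ) : ℂ)) with hg
  have hgs : ∀ P1 P2, Summable (g P1 P2) := fun P1 P2 =>
    chexp_summable (fun m => ch P1 m * (starRingEnd ℂ) (ch P2 m)) (chAB_norm_le P1 P2) (by positivity)
  have hfg : ∀ m, ((f m : ℝ) : ℂ) = ∑ P1 ∈ S, ∑ P2 ∈ S, c P1 * (starRingEnd ℂ) (c P2) * g P1 P2 m := by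
    intro m
    have : ((‖∑ P ∈ S, c P * ch P m‖ ^ 2 : ℝ) : ℂ) = (∑ P ∈ S, c P * ch P m) * (starRingEnd ℂ) (∑ P ∈ S, c P * ch P m) := by
      rw [Complex.mul_conj, Complex.normSq_eq_norm_sq]
    simp only [hf]
    rw [Complex.ofReal_mul, this, map_sum, Finset.sum_mul_sum, Finset.sum_mul, Complex.ofReal_exp, Complex.ofReal_neg]
    apply Finset.sum_congr rfl; intro P1 _
    rw [Finset.sum_mul]
    apply Finset.sum_congr rfl; intro P2 _
    simp only [hg, map_mul]; ring
  have hfs : Summable (fun m => ((f m : ℝ) : ℂ)) := by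
    simp only [hfg]
    exact summable_sum fun P1 _ => summable_sum fun P2 _ => (hgs P1 P2).mul_left _
  have hfs' : Summable f := Complex.summable_ofReal.1 hfs
  have hf0 : ∀ m, 0 ≤ f m := fun m => by positivity
  have e0 : ∑ A ∈ SS M, ‖∑ P ∈ S, c P * ch P (el A)‖ ^ 2 ≤ Real.exp c0 * ∑' m, f m := by
    calc _ ≤ ∑ A ∈ SS M, Real.exp c0 * f (el A) := by
          apply Finset.sum_le_sum; intro A hA
          have hA' := mem_SS.1 hA
          have : 1 ≤ Real.exp c0 * Real.exp (-(c0 / M * Nm (el A))) := by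
            rw [← Real.exp_add]; apply Real.one_le_exp
            have : c0 / M * Nm (el A) ≤ c0 / M * M := by gcongr
            rw [div_mul_cancel₀ _ pM.ne'] at this
            linarith
          simp only [hf]
          nlinarith [sq_nonneg ‖∑ P ∈ S, c P * ch P (el A)‖]
      _ = Real.exp c0 * ∑ m ∈ (SS M).image el, f m := by
          rw [Finset.sum_image (fun _ _ _ _ h => el_inj h), Finset.mul_sum]
      _ ≤ _ := by
          gcongr
          exact hfs'.sum_le_tsum _ (fun m _ => hf0 m)
  refine e0.trans ?_
  gcongr
  have e1 : ((∑' m, f m : ℝ) : ℂ) = ∑ P1 ∈ S, ∑ P2 ∈ S, c P1 * (starRingEnd ℂ) (c P2) * ∑' m, g P1 P2 m := by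
    rw [Complex.ofReal_tsum]
    simp only [hfg]
    rw [Summable.tsum_finsetSum (fun P1 _ => summable_sum fun P2 _ => (hgs P1 P2).mul_left _)]
    apply Finset.sum_congr rfl; intro P1 _
    rw [Summable.tsum_finsetSum (fun P2 _ => (hgs P1 P2).mul_left _)]
    apply Finset.sum_congr rfl; intro P2 _
    rw [tsum_mul_left]
  have e2 : ((∑' m, f m : ℝ) : ℂ) = (∑ P1 ∈ S, ∑ P2 ∈ S, c P1 * (starRingEnd ℂ) (c P2) *
      ∑ D ∈ (P1 ∩ P2).powerset, (-1 : ℂ) ^ D.card * Hk M D (P1 \ (P1 ∩ P2)) (P2 \ (P1 ∩ P2)) 0) +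
      ∑ P1 ∈ S, ∑ P2 ∈ S, c P1 * (starRingEnd ℂ) (c P2) *
      ∑ D ∈ (P1 ∩ P2).powerset, (-1 : ℂ) ^ D.card * Zk M D (P1 \ (P1 ∩ P2)) (P2 \ (P1 ∩ P2)) := by
    rw [e1, ← Finset.sum_add_distrib]
    apply Finset.sum_congr rfl; intro P1 _
    rw [← Finset.sum_add_distrib]
    apply Finset.sum_congr rfl; intro P2 _
    rw [← mul_add, ← pair_split0 P1 P2 pM]
  have e3 : ∑' m, f m = ‖((∑' m, f m : ℝ) : ℂ)‖ := by
    rw [Complex.norm_real, Real.norm_eq_abs, abs_of_nonneg (tsum_nonneg hf0)]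
  rw [e3, e2, add_mul]
  refine (norm_add_le _ _).trans (add_le_add ?_ (off_diag hB hT S hS c))
  rw [Finset.mul_sum]
  refine norm_sum_le_of_le _ fun P1 h1 => ?_
  rw [Finset.sum_eq_single P1]
  · rw [norm_mul, norm_mul, RCLike.norm_conj]
    have : ‖∑ D ∈ (P1 ∩ P1).powerset, (-1 : ℂ) ^ D.card * Hk M D (P1 \ (P1 ∩ P1)) (P1 \ (P1 ∩ P1)) 0‖ ≤ 8 ^ P1.card * M := by
      refine (norm_sum_le_of_le _ (n := fun _ => M) fun D _ => ?_).trans ?_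
      · rw [norm_mul, norm_pow, norm_neg, norm_one, one_pow, one_mul]
        exact diag_le P1 pM D
      · rw [Finset.sum_const, nsmul_eq_mul, Finset.inter_self, Finset.card_powerset]
        push_cast
        gcongr; norm_num
    calc _ ≤ ‖c P1‖ * ‖c P1‖ * (8 ^ P1.card * M) := by gcongr
      _ = _ := by ring
  · intro P2 _ hne
    rw [Finset.sum_eq_zero, mul_zero]
    intro D _; rw [diag_zero (Ne.symm hne), mul_zero]
  · exact fun h => absurd h1 h

open Classical in
theorem F2 {ι : Type} (I : Finset ι) (β γ : ι → ℝ) (hβ : ∀ i, 0 ≤ β i) (hγ : ∀ i, 0 ≤ γ i) (h1 : ∀ i, 1 ≤ 2 * β i + γ i)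
    (hLS : ∀ ε : ℝ, 0 < ε → ∃ C : ℝ, 0 < C ∧ ∀ K N : ℝ, 1 ≤ K → 1 ≤ N → LS2 K N (C * (K * N) ^ ε * ∑ i ∈ I, K ^ β i * N ^ γ i))
    (ε : ℝ) (hε : 0 < ε) : ∃ C : ℝ, 0 < C ∧ ∀ M N : ℝ, 1 ≤ M → 1 ≤ N →
      LS1 M N (C * (M * N) ^ ε * (M + ∑ i ∈ I, M ^ (1 - β i) * N ^ (2 * β i + γ i - 1))) := by
  set η := min 1 (ε / 7) with hη
  have hη0 : 0 < η := by rw [hη]; positivity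
  have hη1 : η ≤ 1 := min_le_left _ _
  have hηε : 7 * η ≤ ε := by have := min_le_right 1 (ε / 7); linarith
  obtain ⟨C, hC, hL⟩ := hLS η hη0
  obtain ⟨C', hC', hT⟩ := T_bound I β γ hβ hγ h1 hη0 hη1 hC hL
  obtain ⟨C8, hC8, h8⟩ := pow_card_le hη0 8 (by norm_num)
  have hgeo := geo_hasSum hη0
  set g0 := (1 - (3/2 : ℝ) ^ (-η))⁻¹ with hg0
  have hg0' : 0 ≤ g0 := by rw [← hgeo.tsum_eq]; exact tsum_nonneg fun j => by positivity
  refine ⟨g0 * (Real.exp c0 * ((1 + C') * C8)) + 1, by positivity, ?_⟩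
  intro M N hM hN c
  have pM : 0 < M := by linarith
  have pN : 0 < N := by linarith
  set W := ∑ i ∈ I, M ^ (1 - β i) * N ^ (2 * β i + γ i - 1) with hW
  have hW0 : 0 ≤ W := Finset.sum_nonneg fun i _ => by positivity
  choose idx hidx using fun P : Finset PP => exists_nat_pow_near (one_le_Nm_el P) (show (1 : ℝ) < 3/2 by norm_num)
  set J := (SS N).image idx with hJ
  set Sh : ℕ → Finset (Finset PP) := fun j => (SS N).filter (fun P => idx P = j) with hSh
  have hsum : ∀ {X : Type} [AddCommMonoid X] (f : Finset PP → X), ∑ j ∈ J, ∑ P ∈ Sh j, f P = ∑ P ∈ SS N, f P := by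
    intro X _ f
    exact Finset.sum_fiberwise_of_maps_to (fun P hP => Finset.mem_image_of_mem _ hP) f
  have hjN : ∀ j ∈ J, (3/2 : ℝ) ^ j ≤ N := by
    intro j hj
    obtain ⟨P, hP, rfl⟩ := Finset.mem_image.1 hj
    exact (hidx P).1.trans (mem_SS.1 hP)
  set E := Real.exp c0 * ((M + C' * N ^ (5 * η) * W) * (C8 * N ^ η)) with hE
  have hE0 : 0 ≤ E := by positivity
  have hsh : ∀ j ∈ J, ∑ A ∈ SS M, ‖∑ P ∈ Sh j, c P * ch P (el A)‖ ^ 2 ≤ E * ∑ P ∈ Sh j, ‖c P‖ ^ 2 := by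
    intro j hj
    have hj1 : (1 : ℝ) ≤ (3/2 : ℝ) ^ j := one_le_pow₀ (by norm_num)
    have hW' : ∑ i ∈ I, M ^ (1 - β i) * ((3/2 : ℝ) ^ j) ^ (2 * β i + γ i - 1) ≤ W := by
      apply Finset.sum_le_sum; intro i _
      have := h1 i
      have := hjN j hj
      gcongr
    have hpos : 0 ≤ ∑ i ∈ I, M ^ (1 - β i) * ((3/2 : ℝ) ^ j) ^ (2 * β i + γ i - 1) :=
      Finset.sum_nonneg fun i _ => by positivity
    have := shell_LS (M := M) (N0 := (3/2 : ℝ) ^ j) (Bd := C' * ((3/2 : ℝ) ^ j) ^ (5 * η) * (∑ i ∈ I, M ^ (1 - β i) * ((3/2 : ℝ) ^ j) ^ (2 * β i + γ i - 1))) hM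
      (by positivity) (fun S G D hDG hS c => hT M _ hM hj1 S G D hDG hS c) (Sh j) (by
        intro P hP
        obtain ⟨hP1, hP2⟩ := Finset.mem_filter.1 hP
        have := hidx P
        rw [hP2, pow_succ] at this
        exact ⟨this.1, by linarith [this.2]⟩) c
    refine this.trans ?_
    rw [hE, mul_assoc (Real.exp c0), mul_assoc (M + _) _ (∑ P ∈ Sh j, ‖c P‖ ^ 2)]
    have hjN' := hjN j hj
    have h2 : ∑ P ∈ Sh j, 8 ^ P.card * ‖c P‖ ^ 2 ≤ C8 * N ^ η * ∑ P ∈ Sh j, ‖c P‖ ^ 2 := by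
      rw [Finset.mul_sum]
      apply Finset.sum_le_sum; intro P hP
      have hPN := mem_SS.1 (Finset.mem_filter.1 hP).1
      have := h8 P
      have h0 : 0 ≤ Nm (el P) := Nm_nonneg _
      have : (8 : ℝ) ^ P.card ≤ C8 * N ^ η := this.trans (by gcongr)
      gcongr
    have h3 : C' * ((3/2 : ℝ) ^ j) ^ (5 * η) * (∑ i ∈ I, M ^ (1 - β i) * ((3/2 : ℝ) ^ j) ^ (2 * β i + γ i - 1)) ≤ C' * N ^ (5 * η) * W := by
      gcongr
    gcongr
  calc ∑ A ∈ SS M, ‖∑ P ∈ SS N, c P * ch P (el A)‖ ^ 2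
      = ∑ A ∈ SS M, ‖∑ j ∈ J, ∑ P ∈ Sh j, c P * ch P (el A)‖ ^ 2 := by
        apply Finset.sum_congr rfl; intro A _; rw [hsum]
    _ ≤ ∑ A ∈ SS M, (∑ j ∈ J, ((3/2 : ℝ) ^ j) ^ (-η)) * ∑ j ∈ J, (((3/2 : ℝ) ^ j) ^ (-η))⁻¹ * ‖∑ P ∈ Sh j, c P * ch P (el A)‖ ^ 2 := by
        apply Finset.sum_le_sum; intro A _
        exact csum_w J _ (fun j _ => by positivity) _
    _ ≤ ∑ A ∈ SS M, g0 * ∑ j ∈ J, N ^ η * ‖∑ P ∈ Sh j, c P * ch P (el A)‖ ^ 2 := by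
        apply Finset.sum_le_sum; intro A _
        apply mul_le_mul (sum_le_hasSum _ (fun j _ => by positivity) hgeo) _ (Finset.sum_nonneg fun j _ => by positivity) hg0'
        apply Finset.sum_le_sum; intro j hj
        have := hjN j hj
        rw [Real.rpow_neg (by positivity), inv_inv]
        gcongr
    _ = g0 * N ^ η * ∑ j ∈ J, ∑ A ∈ SS M, ‖∑ P ∈ Sh j, c P * ch P (el A)‖ ^ 2 := by
        rw [Finset.sum_comm, Finset.mul_sum]
        apply Finset.sum_congr rfl; intro A _
        rw [← Finset.mul_sum]; ring
    _ ≤ g0 * N ^ η * ∑ j ∈ J, E * ∑ P ∈ Sh j, ‖c P‖ ^ 2 := by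
        gcongr with j hj; exact hsh j hj
    _ = g0 * N ^ η * E * ∑ P ∈ SS N, ‖c P‖ ^ 2 := by
        rw [← Finset.mul_sum, hsum]; ring
    _ ≤ _ := by
        apply mul_le_mul_of_nonneg_right _ (by positivity)
        have hN5 : 1 ≤ N ^ (5 * η) := Real.one_le_rpow hN (by positivity)
        have hMN : N ≤ M * N := by nlinarith
        calc g0 * N ^ η * E ≤ g0 * N ^ η * (Real.exp c0 * (((1 + C') * N ^ (5 * η) * (M + W)) * (C8 * N ^ η))) := by
              rw [hE]; gcongr
              have : M * 1 ≤ M * N ^ (5 * η) := by gcongr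
              have : 0 ≤ C' * N ^ (5 * η) * M := by positivity
              have : 0 ≤ N ^ (5 * η) * W := by positivity
              nlinarith
          _ = (g0 * (Real.exp c0 * ((1 + C') * C8))) * N ^ (7 * η) * (M + W) := by
              have : N ^ (7 * η) = N ^ η * N ^ (5 * η) * N ^ η := by
                rw [← Real.rpow_add pN, ← Real.rpow_add pN]; congr 1; ring
              rw [this]; ring
          _ ≤ (g0 * (Real.exp c0 * ((1 + C') * C8)) + 1) * (M * N) ^ ε * (M + W) := by
              have : N ^ (7 * η) ≤ (M * N) ^ ε := by
                calc N ^ (7 * η) ≤ N ^ ε := Real.rpow_le_rpow_of_exponent_le hN hηε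
                  _ ≤ _ := by gcongr
              gcongr
              linarith

lemma PLS_two : PLS 2 := by
  have hb : ∀ ε : ℝ, 0 < ε → ∃ C : ℝ, 0 < C ∧ ∀ K N : ℝ, 1 ≤ K → 1 ≤ N →
      LS2 K N (C * (K * N) ^ ε * ∑ i ∈ (Finset.univ : Finset Unit), K ^ (1:ℝ) * N ^ (1:ℝ)) := by
    intro ε hε
    obtain ⟨C1, hC1, h1⟩ := sum_Nm_le hε
    obtain ⟨C2, hC2, h2⟩ := sum_SS_le hε
    refine ⟨C1 * C2, by positivity, fun K N hK hN c => ?_⟩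
    have a1 := h1 (Ball K) K 0 (by linarith) (by linarith) (fun x hx => mem_Ball.1 hx)
    have a2 := h2 (SS N) N 0 (by linarith) (by linarith) (fun x hx => mem_SS.1 hx)
    simp only [neg_zero, Real.rpow_zero, Finset.sum_const, nsmul_eq_mul, mul_one, sub_zero] at a1 a2
    have hS0 : 0 ≤ ∑ P ∈ SS N, ‖c P‖ ^ 2 := by positivity
    calc _ ≤ ∑ m ∈ Ball K, ((SS N).card : ℝ) * ∑ P ∈ SS N, ‖c P‖ ^ 2 := by
          apply Finset.sum_le_sum; intro m _
          refine (csum (SS N) (fun P => ch P m) c |> fun h => ?_)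
          have e : ∑ P ∈ SS N, c P * ch P m = ∑ P ∈ SS N, ch P m * c P := by simp only [mul_comm]
          rw [e]; refine h.trans ?_
          gcongr
          calc _ ≤ ∑ P ∈ SS N, (1:ℝ) := by
                apply Finset.sum_le_sum; intro P _
                exact pow_le_one₀ (norm_nonneg _) (ch_norm_le _ _)
            _ = _ := by simp
      _ = (Ball K).card * (SS N).card * ∑ P ∈ SS N, ‖c P‖ ^ 2 := by
          rw [Finset.sum_const, nsmul_eq_mul]; ring
      _ ≤ (C1 * K ^ (1 + ε)) * (C2 * N ^ (1 + ε)) * ∑ P ∈ SS N, ‖c P‖ ^ 2 := by gcongr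
      _ = _ := by
          rw [Real.rpow_add (by linarith), Real.rpow_add (by linarith), Real.mul_rpow (by linarith) (by linarith)]
          simp only [Finset.univ_unique, Finset.sum_const, Finset.card_singleton, one_smul]
          ring
  intro ε hε
  obtain ⟨C, hC, h⟩ := F2 (Finset.univ : Finset Unit) (fun _ => 1) (fun _ => 1) (by simp) (by simp) (by intro; norm_num) hb ε hε
  refine ⟨C, hC, fun M N hM hN => (h M N hM hN).mono le_rfl ?_⟩
  simp only [Finset.univ_unique, Finset.sum_const, Finset.card_singleton, one_smul]
  have : 0 ≤ (M * N) ^ (2/3 : ℝ) := by positivity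
  have e : M ^ (1 - 1 : ℝ) * N ^ (2 * 1 + 1 - 1 : ℝ) = N ^ (2:ℝ) := by norm_num
  rw [e]
  gcongr
  linarith

lemma PLS_step {δ : ℝ} (h0 : 0 ≤ δ) (h1 : δ ≤ 1) (h : PLS (4/3 + δ)) : PLS (4/3 + 2/3 * δ) := by
  have hb := F1 (by linarith) h
  set β : Fin 3 → ℝ := ![1/3, 2/3, 4/3 + δ] with hβ
  set γ : Fin 3 → ℝ := ![1, 2/3, 0] with hγ
  have hF := F2 (Finset.univ : Finset (Fin 3)) β γ (by intro i; fin_cases i <;> simp [hβ] <;> linarith) (by intro i; fin_cases i <;> simp [hγ] <;> norm_num)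
    (by intro i; fin_cases i <;> simp [hβ, hγ] <;> linarith) (by
      intro ε hε
      obtain ⟨C, hC, h2⟩ := hb ε hε
      refine ⟨C, hC, fun K N hK hN => ?_⟩
      have := h2 K N hK hN
      have e : ∑ i, K ^ β i * N ^ γ i = Q2 K N (4/3 + δ) := by
        rw [Q2, Real.mul_rpow (x := K) (y := N) (by linarith) (by linarith)]
        simp [Fin.sum_univ_three, hβ, hγ, mul_comm]
      rw [e]; exact this)
  intro ε hε
  obtain ⟨C, hC, hL⟩ := hF (ε / 4) (by positivity)
  refine ⟨C * 2 ^ (ε/4) * 10, by positivity, fun M N hM hN => ?_⟩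
  have pM : 0 < M := by linarith
  have pN : 0 < N := by linarith
  set Y := N ^ (1 + δ) with hY
  have hY1 : 1 ≤ Y := Real.one_le_rpow hN (by linarith)
  have hYN : N ≤ Y := by
    calc N = N ^ (1:ℝ) := by simp
      _ ≤ _ := Real.rpow_le_rpow_of_exponent_le hN (by linarith)
  set M' := M + Y with hM'
  have pM' : 0 < M' := by linarith
  refine (hL M' N (by linarith) hN).mono (by linarith) ?_
  set Z := N ^ (4/3 + 2/3 * δ) with hZ
  have b0 : 0 ≤ Z := by positivity
  have b1 : Y ≤ Z := Real.rpow_le_rpow_of_exponent_le hN (by linarith)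
  have b2 : (M' * N) ^ (2/3 : ℝ) ≤ (M * N) ^ (2/3 : ℝ) + Z := by
    have e : (Y * N) ^ (2/3 : ℝ) = Z := by
      rw [hY, hZ]
      have : N ^ (1 + δ) * N = N ^ (2 + δ) := by
        rw [← Real.rpow_add_one pN.ne']; congr 1; ring
      rw [this, ← Real.rpow_mul pN.le]; congr 1; ring
    rw [hM', add_mul, ← e]
    exact Real.rpow_add_le_add_rpow (by positivity) (by positivity) (by norm_num) (by norm_num)
  have b3 : M' ^ (1 - 1/3 : ℝ) * N ^ (2 * (1/3) + 1 - 1 : ℝ) = (M' * N) ^ (2/3 : ℝ) := by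
    rw [Real.mul_rpow pM'.le pN.le]; norm_num
  have b4 : M' ^ (1 - 2/3 : ℝ) * N ^ (2 * (2/3) + 2/3 - 1 : ℝ) ≤ (M' * N) ^ (2/3 : ℝ) := by
    rw [Real.mul_rpow pM'.le pN.le]
    have e1 : N ^ (2 * (2/3) + 2/3 - 1 : ℝ) = N ^ (1/3 : ℝ) * N ^ (2/3 : ℝ) := by
      rw [← Real.rpow_add pN]; norm_num
    have e2 : M' ^ (2/3 : ℝ) = M' ^ (1 - 2/3 : ℝ) * M' ^ (1/3 : ℝ) := by
      rw [← Real.rpow_add pM']; norm_num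
    have : N ^ (1/3 : ℝ) ≤ M' ^ (1/3 : ℝ) := by gcongr; linarith
    rw [e1, e2]
    calc _ = M' ^ (1 - 2/3 : ℝ) * N ^ (1/3 : ℝ) * N ^ (2/3 : ℝ) := by ring
      _ ≤ _ := by gcongr
  have b5 : M' ^ (1 - (4/3 + δ)) * N ^ (2 * (4/3 + δ) + 0 - 1) ≤ Z := by
    have : M' ^ (1 - (4/3 + δ)) ≤ Y ^ (1 - (4/3 + δ)) := by
      apply Real.rpow_le_rpow_of_nonpos (by linarith) (by linarith) (by linarith)
    calc _ ≤ Y ^ (1 - (4/3 + δ)) * N ^ (2 * (4/3 + δ) + 0 - 1) := by gcongr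
      _ = N ^ ((1 + δ) * (1 - (4/3 + δ)) + (2 * (4/3 + δ) + 0 - 1)) := by
          rw [hY, ← Real.rpow_mul pN.le, ← Real.rpow_add pN]
      _ ≤ Z := Real.rpow_le_rpow_of_exponent_le hN (by nlinarith)
  have b6 : (M' * N) ^ (ε / 4) ≤ 2 ^ (ε / 4) * (M * N) ^ ε := by
    have hMN : 1 ≤ M * N := by nlinarith
    have : M' * N ≤ 2 * (M * N) ^ (4:ℝ) := by
      have a1 : Y ≤ N ^ (2:ℝ) := Real.rpow_le_rpow_of_exponent_le hN (by linarith)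
      have a2 : N ≤ M * N := by nlinarith
      have a4 : M ≤ M * N := by nlinarith
      have a3 : (M * N) ^ (4:ℝ) = (M * N) ^ 4 := by norm_cast
      have a5 : N ^ (2:ℝ) = N ^ 2 := by norm_cast
      rw [a3]; rw [a5] at a1
      have a6 : M * N ≤ (M * N) ^ 4 := le_self_pow₀ hMN (by norm_num)
      have a7 : Y * N ≤ (M * N) ^ 4 := by
        calc Y * N ≤ N ^ 2 * N := by gcongr
          _ ≤ (M * N) ^ 2 * (M * N) := by gcongr
          _ = (M * N) ^ 3 := by ring
          _ ≤ _ := pow_le_pow_right₀ hMN (by norm_num)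
      rw [hM']; linarith
    calc _ ≤ (2 * (M * N) ^ (4:ℝ)) ^ (ε / 4) := by gcongr
      _ = _ := by
        rw [Real.mul_rpow (by norm_num) (by positivity), ← Real.rpow_mul (by positivity)]
        congr 2; ring
  have b7 : M' + ∑ i, M' ^ (1 - β i) * N ^ (2 * β i + γ i - 1) ≤ 10 * (M + (M * N) ^ (2/3 : ℝ) + Z) := by
    rw [Fin.sum_univ_three]
    simp only [hβ, hγ, Matrix.cons_val_zero, Matrix.cons_val_one, Matrix.cons_val_two, Matrix.head_cons, Matrix.tail_cons, Matrix.cons_val]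
    rw [b3]
    have : 0 ≤ (M * N) ^ (2/3 : ℝ) := by positivity
    linarith
  have b8 : 0 ≤ M' + ∑ i, M' ^ (1 - β i) * N ^ (2 * β i + γ i - 1) := by positivity
  calc _ ≤ C * (2 ^ (ε / 4) * (M * N) ^ ε) * (10 * (M + (M * N) ^ (2/3 : ℝ) + Z)) := by gcongr
    _ = _ := by ring

lemma PLS_seq (n : ℕ) : PLS (4/3 + (2/3 : ℝ) ^ (n + 1)) := by
  induction n with
  | zero => have := PLS_two; norm_num at this ⊢; exact this
  | succ n ih =>
    have := PLS_step (by positivity) (pow_le_one₀ (by norm_num) (by norm_num)) ih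
    rw [pow_succ', ]; exact this

theorem HB (ε : ℝ) (hε : 0 < ε) : ∃ C : ℝ, 0 < C ∧ ∀ M N : ℝ, 1 ≤ M → 1 ≤ N →
    LS1 M N (C * (M * N) ^ ε * (M + N + (M * N) ^ (2/3 : ℝ))) := by
  obtain ⟨n, hn⟩ := exists_pow_lt_of_lt_one (show 0 < ε / 2 by positivity) (show (2/3 : ℝ) < 1 by norm_num)
  have hn' : (2/3 : ℝ) ^ (n + 1) ≤ ε / 2 := by
    rw [pow_succ]; nlinarith [show (0:ℝ) < (2/3) ^ n by positivity]
  obtain ⟨C, hC, h⟩ := PLS_seq n (ε / 2) (by positivity)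
  have key : ∀ M N : ℝ, 1 ≤ N → N ≤ M → LS1 M N (2 * C * (M * N) ^ ε * (M + N + (M * N) ^ (2/3 : ℝ))) := by
    intro M N hN hNM
    have hM : 1 ≤ M := hN.trans hNM
    refine (h M N hM hN).mono le_rfl ?_
    have pN : 0 < N := by linarith
    have pM : 0 < M := by linarith
    have hMN : N ≤ M * N := by nlinarith
    have hMN1 : 1 ≤ M * N := by linarith
    have a1 : N ^ (4/3 + (2/3 : ℝ) ^ (n + 1)) ≤ (M * N) ^ (2/3 : ℝ) * (M * N) ^ (ε / 2) := by
      rw [Real.rpow_add pN]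
      have : N ^ (4/3 : ℝ) ≤ (M * N) ^ (2/3 : ℝ) := by
        calc N ^ (4/3 : ℝ) = (N * N) ^ (2/3 : ℝ) := by
              rw [Real.mul_rpow pN.le pN.le, ← Real.rpow_add pN]; norm_num
          _ ≤ _ := by gcongr
      have : N ^ ((2/3 : ℝ) ^ (n + 1)) ≤ (M * N) ^ (ε / 2) := by
        calc _ ≤ N ^ (ε / 2) := Real.rpow_le_rpow_of_exponent_le hN hn'
          _ ≤ _ := by gcongr
      gcongr
    have a2 : 1 ≤ (M * N) ^ (ε / 2) := Real.one_le_rpow hMN1 (by positivity)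
    have a3 : (M * N) ^ ε = (M * N) ^ (ε / 2) * (M * N) ^ (ε / 2) := by
      rw [← Real.rpow_add (by positivity)]; congr 1; ring
    rw [a3]
    set x := (M * N) ^ (ε / 2)
    set y := (M * N) ^ (2/3 : ℝ) with hy
    have hy0 : 0 ≤ y := by positivity
    calc _ ≤ C * x * (M + y + y * x) := by gcongr
      _ ≤ C * x * (x * (2 * (M + N + y))) := by
          gcongr
          nlinarith
      _ = _ := by ring
  refine ⟨2 * C, by positivity, fun M N hM hN => ?_⟩
  rcases le_total N M with hNM | hNM
  · exact key M N hN hNM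
  · have := (key N M hM hNM).symm (by positivity)
    refine this.mono le_rfl (le_of_eq ?_)
    rw [mul_comm N M]; ring

open Classical in
/-- the finset of all divisors -/
def dvs (m : Eis) : Finset Eis := (Ball (Nm m)).filter (· ∣ m)

open Classical in
lemma mem_dvs {m b : Eis} (hm : m ≠ 0) : b ∈ dvs m ↔ b ∣ m := by
  unfold dvs; rw [Finset.mem_filter, mem_Ball]
  refine ⟨fun h => h.2, fun h => ⟨⟨ne_zero_of_dvd_ne_zero hm h, ?_⟩, h⟩⟩
  obtain ⟨c, rfl⟩ := h
  have := one_le_Nm (right_ne_zero_of_mul hm)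
  rw [Nm_mul]; have := Nm_nonneg b; nlinarith

open Classical in
lemma dvs_prime_pow {p m : Eis} (hp : Prime p) (hm : m ≠ 0) (k : ℕ) :
    (dvs (p ^ k * m)).card ≤ (k + 1) * (dvs m).card := by
  induction k with
  | zero => simp
  | succ k ih =>
    have h0 : p ^ k * m ≠ 0 := mul_ne_zero (pow_ne_zero _ hp.ne_zero) hm
    have h1 : p ^ (k + 1) * m ≠ 0 := mul_ne_zero (pow_ne_zero _ hp.ne_zero) hm
    have hsub : dvs (p ^ (k + 1) * m) ⊆ (dvs (p ^ k * m)).image (p * ·) ∪ dvs m := by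
      intro b hb
      rw [mem_dvs h1] at hb
      rw [Finset.mem_union, Finset.mem_image]
      by_cases hpb : p ∣ b
      · obtain ⟨b', rfl⟩ := hpb
        left
        refine ⟨b', (mem_dvs h0).2 ?_, rfl⟩
        rw [pow_succ', mul_assoc] at hb
        exact (mul_dvd_mul_iff_left hp.ne_zero).1 hb
      · right
        rw [mem_dvs hm]
        have hc : IsCoprime p b := (Irreducible.coprime_iff_not_dvd hp.irreducible).2 hpb
        exact (hc.symm.pow_right).dvd_of_dvd_mul_left hb
    calc _ ≤ _ := Finset.card_le_card hsub
      _ ≤ _ := Finset.card_union_le _ _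
      _ ≤ (k + 1) * (dvs m).card + (dvs m).card := by
          gcongr; exact Finset.card_image_le.trans ih
      _ = _ := by ring

lemma dvs_unit {u : Eis} (hu : IsUnit u) : (dvs u).card = (dvs 1).card := by
  congr 1; ext b
  rw [mem_dvs hu.ne_zero, mem_dvs one_ne_zero, ← isUnit_iff_dvd_one]
  exact ⟨fun h => isUnit_of_dvd_unit h hu, fun h => h.dvd⟩

lemma two_le_Nm_prime {p : Eis} (hp : Prime p) : 2 ≤ Nm p := by
  have h1 : NmN p ≠ 1 := fun h => hp.not_unit (isUnit_iff_NmN.2 h)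
  have h2 := NmN_pos hp.ne_zero
  rw [Nm_eq_NmN]; exact_mod_cast (show 2 ≤ NmN p by omega)

lemma dvs_bound {ε : ℝ} (hε : 0 < ε) : ∃ C : ℝ, 1 ≤ C ∧ ∀ m : Eis, m ≠ 0 → ((dvs m).card : ℝ) ≤ C * Nm m ^ ε := by
  classical
  set B : ℝ := 2 ^ (1 / ε) with hB
  have main : ∀ F : Finset Eis, ∃ C : ℝ, 1 ≤ C ∧ ∀ m : Eis, m ≠ 0 → (∀ p, Prime p → p ∣ m → B ≤ Nm p ∨ p ∈ F) →
      ((dvs m).card : ℝ) ≤ C * Nm m ^ ε := by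
    intro F
    induction F using Finset.induction_on with
    | empty =>
      have hd1 : 1 ≤ (dvs 1).card := Finset.card_pos.2 ⟨1, (mem_dvs one_ne_zero).2 (dvd_refl 1)⟩
      refine ⟨(dvs 1).card, by exact_mod_cast hd1, fun m => ?_⟩
      refine UniqueFactorizationMonoid.induction_on_prime m (fun h => absurd rfl h) ?_ ?_
      · intro u hu h0 _
        rw [dvs_unit hu]
        have := Real.one_le_rpow (one_le_Nm h0) hε.le
        exact le_mul_of_one_le_right (by positivity) this
      · intro a p ha hp ih h0 hall
        have h2 := dvs_prime_pow hp ha 1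
        rw [pow_one] at h2
        have hpB : B ≤ Nm p := by simpa using hall p hp (dvd_mul_right p a)
        have hp2 : (2:ℝ) ≤ Nm p ^ ε := by
          calc (2:ℝ) = B ^ ε := by rw [hB, ← Real.rpow_mul (by norm_num), one_div_mul_cancel hε.ne', Real.rpow_one]
            _ ≤ _ := by gcongr
        have ih' := ih ha (fun q hq hqa => hall q hq (hqa.mul_left p))
        have h2' : ((dvs (p * a)).card : ℝ) ≤ 2 * (dvs a).card := by exact_mod_cast h2
        rw [Nm_mul, Real.mul_rpow (Nm_nonneg _) (Nm_nonneg _)]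
        have hx : 0 ≤ Nm a ^ ε := Real.rpow_nonneg (Nm_nonneg _) _
        calc _ ≤ 2 * ((dvs 1).card * Nm a ^ ε) := h2'.trans (by gcongr)
          _ ≤ Nm p ^ ε * ((dvs 1).card * Nm a ^ ε) := by gcongr
          _ = _ := by ring
    | insert f F hf ih =>
      obtain ⟨C, hC, h⟩ := ih
      set K : ℝ := 1 + 1 / (ε * Real.log 2) with hK
      have hl2 : 0 < Real.log 2 := Real.log_pos (by norm_num)
      have hK1 : 1 ≤ K := by
        have : 0 ≤ 1 / (ε * Real.log 2) := by positivity
        linarith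
      refine ⟨K * C, by nlinarith, fun m hm hall => ?_⟩
      by_cases hfp : Prime f
      · obtain ⟨m', hmm, hnd⟩ := (FiniteMultiplicity.of_not_isUnit hfp.not_unit hm).exists_eq_pow_mul_and_not_dvd
        generalize multiplicity f m = k at hmm
        subst hmm
        have hm' : m' ≠ 0 := right_ne_zero_of_mul hm
        have h1 := h m' hm' (by
          intro p hp hpm
          rcases hall p hp (hpm.mul_left _) with h3 | h3
          · exact Or.inl h3
          · rcases Finset.mem_insert.1 h3 with rfl | h4
            · exact absurd hpm hnd
            · exact Or.inr h4)
        have h2 := dvs_prime_pow hfp hm' k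
        have h2' : ((dvs (f ^ k * m')).card : ℝ) ≤ (k + 1) * (dvs m').card := by exact_mod_cast h2
        have hf2 := two_le_Nm_prime hfp
        have h3 : (k + 1 : ℝ) ≤ K * (Nm f ^ k) ^ ε := by
          have a1 : (2:ℝ) ^ (k * ε) ≤ (Nm f ^ k) ^ ε := by
            rw [← Real.rpow_natCast, ← Real.rpow_mul (by linarith)]; gcongr
          have a2 : 1 + k * ε * Real.log 2 ≤ (2:ℝ) ^ (k * ε) := by
            rw [Real.rpow_def_of_pos (by norm_num)]
            have := Real.add_one_le_exp (Real.log 2 * (k * ε)); linarith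
          calc (k + 1 : ℝ) ≤ K * (1 + k * ε * Real.log 2) := by
                rw [hK]
                have e : (1 + 1 / (ε * Real.log 2)) * (1 + k * ε * Real.log 2) = 1 + k * ε * Real.log 2 + 1 / (ε * Real.log 2) + k := by
                  field_simp; ring
                rw [e]
                have : 0 ≤ k * ε * Real.log 2 := by positivity
                have : 0 ≤ 1 / (ε * Real.log 2) := by positivity
                linarith
            _ ≤ _ := by gcongr; linarith
        rw [Nm_mul, Nm_pow, Real.mul_rpow (by positivity) (Nm_nonneg _)]
        have hx : 0 ≤ Nm m' ^ ε := Real.rpow_nonneg (Nm_nonneg _) _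
        calc _ ≤ (k + 1) * (C * Nm m' ^ ε) := h2'.trans (by gcongr)
          _ ≤ (K * (Nm f ^ k) ^ ε) * (C * Nm m' ^ ε) := by gcongr
          _ = _ := by ring
      · have := h m hm (by
          intro p hp hpm
          rcases hall p hp hpm with h3 | h3
          · exact Or.inl h3
          · rcases Finset.mem_insert.1 h3 with rfl | h4
            · exact absurd hp hfp
            · exact Or.inr h4)
        refine this.trans ?_
        have hx : 0 ≤ Nm m ^ ε := Real.rpow_nonneg (Nm_nonneg _) _
        gcongr; nlinarith
  obtain ⟨C, hC, h⟩ := main (finite_Nm_le B).toFinset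
  refine ⟨C, hC, fun m hm => h m hm fun p _ _ => ?_⟩
  rcases le_total B (Nm p) with h1 | h1
  · exact Or.inl h1
  · exact Or.inr (by simpa using h1)

open Classical in
set_option maxHeartbeats 1000000 in
lemma G1 {ε : ℝ} (hε : 0 < ε) : ∃ C : ℝ, 0 < C ∧ ∀ Q Y : ℝ, 1 ≤ Q → 1 ≤ Y → ∀ d : Eis → ℂ,
    (∀ m, m ≠ 0 → ‖d m‖ ≤ Nm m ^ (-(1/2) : ℝ)) →
    ∑ P ∈ SS Q, ‖∑ m ∈ Ball Y, d m * ch P m‖ ^ 2 ≤ C * (Q * Y) ^ ε * (Q + Y + (Q * Y) ^ (2/3 : ℝ)) := by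
  set η := ε / 8 with hη
  have hη0 : 0 < η := by positivity
  obtain ⟨C1, hC1, h1⟩ := HB η hη0
  obtain ⟨C2, hC2, h2⟩ := sum_SS_le hη0
  obtain ⟨C3, hC3, h3⟩ := sum_Nm_le hη0
  refine ⟨(VF.card * (C2 * C3)) * (C1 * C2) * (VF.card * (C2 * C3)) + 1, by positivity, ?_⟩
  intro Q Y hQ hY d hd
  have pQ : 0 < Q := by linarith
  have pY : 0 < Y := by linarith
  have hQY : 1 ≤ Q * Y := by nlinarith
  have hYQ : Y ≤ Q * Y := by nlinarith
  have ef : ∀ x : Eis, ∃ v, ∃ A B : Finset PP, ∃ c : Eis, x ≠ 0 → v ∈ VF ∧ c ≠ 0 ∧ x = v * el A * el B ^ 2 * c ^ 3 := by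
    intro x
    by_cases h0 : x = 0
    · exact ⟨1, ∅, ∅, 1, fun h => absurd h0 h⟩
    · obtain ⟨v, hv, A, B, c, hc, _, hx⟩ := exists_fact h0
      exact ⟨v, A, B, c, fun _ => ⟨hv, hc, hx⟩⟩
  choose v A B c hall using ef
  have hv : ∀ m, m ≠ 0 → v m ∈ VF := fun m h => (hall m h).1
  have hc : ∀ m, m ≠ 0 → c m ≠ 0 := fun m h => (hall m h).2.1
  have hx : ∀ m, m ≠ 0 → m = v m * el (A m) * el (B m) ^ 2 * c m ^ 3 := fun m h => (hall m h).2.2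
  set φ : Eis → Eis × Finset PP × Eis := fun m => (v m, B m, c m) with hφ
  set Ts : Finset (Eis × Finset PP × Eis) := VF ×ˢ (SS Y ×ˢ Ball Y) with hTs
  have hN : ∀ m ∈ Ball Y, Nm (el (A m)) * Nm (el (B m)) ^ 2 * Nm (c m) ^ 3 ≤ Y := by
    intro m hm
    obtain ⟨h0, hY'⟩ := mem_Ball.1 hm
    refine fact_Nm (hv m h0) (hc m h0) ?_
    rw [← hx m h0]; exact hY'
  have hmaps : ∀ m ∈ Ball Y, φ m ∈ Ts := by
    intro m hm
    obtain ⟨h0, hY'⟩ := mem_Ball.1 hm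
    have hh := hN m hm
    have a1 := one_le_Nm_el (A m)
    have a2 := one_le_Nm_el (B m)
    have a3 := one_le_Nm (hc m h0)
    have b2 : Nm (el (B m)) ≤ Nm (el (B m)) ^ 2 := le_self_pow₀ a2 (by norm_num)
    have b3 : Nm (c m) ≤ Nm (c m) ^ 3 := le_self_pow₀ a3 (by norm_num)
    simp only [hTs, hφ, Finset.mem_product, mem_SS, mem_Ball]
    refine ⟨hv m h0, ?_, hc m h0, ?_⟩
    · calc _ ≤ 1 * Nm (el (B m)) ^ 2 * 1 := by linarith
        _ ≤ Nm (el (A m)) * Nm (el (B m)) ^ 2 * Nm (c m) ^ 3 := by gcongr; exact one_le_pow₀ a3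
        _ ≤ Y := hh
    · calc _ ≤ 1 * 1 * Nm (c m) ^ 3 := by linarith
        _ ≤ Nm (el (A m)) * Nm (el (B m)) ^ 2 * Nm (c m) ^ 3 := by gcongr; exact one_le_pow₀ a2
        _ ≤ Y := hh
  -- coefficients on each fibre
  set d' : (Eis × Finset PP × Eis) → Finset PP → ℂ := fun t X =>
    if t.1 * el X * el t.2.1 ^ 2 * t.2.2 ^ 3 ∈ (Ball Y).filter (fun m => φ m = t) ∧ A (t.1 * el X * el t.2.1 ^ 2 * t.2.2 ^ 3) = X then
      d (t.1 * el X * el t.2.1 ^ 2 * t.2.2 ^ 3) else 0 with hd'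
  have hfib : ∀ t ∈ Ts, ∀ P : Finset PP, ∑ m ∈ (Ball Y).filter (fun m => φ m = t), d m * ch P m =
      ch P (t.1 * el t.2.1 ^ 2 * t.2.2 ^ 3) * ∑ X ∈ SS Y, d' t X * ch X (el P) := by
    rintro ⟨v0, B0, c0⟩ ht P
    rw [Finset.mul_sum]
    have e1 : ∀ X ∈ SS Y, ch P (v0 * el B0 ^ 2 * c0 ^ 3) * (d' (v0, B0, c0) X * ch X (el P)) =
        d' (v0, B0, c0) X * ch P (v0 * el X * el B0 ^ 2 * c0 ^ 3) := by
      intro X _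
      have : v0 * el X * el B0 ^ 2 * c0 ^ 3 = (v0 * el B0 ^ 2 * c0 ^ 3) * el X := by ring
      rw [this, ch_mul P (v0 * el B0 ^ 2 * c0 ^ 3), ch_recip P X]; ring
    simp only []
    rw [Finset.sum_congr rfl e1]
    refine Finset.sum_bij_ne_zero (fun m _ _ => A m) ?_ ?_ ?_ ?_
    · intro m hm _
      obtain ⟨hm1, hm2⟩ := Finset.mem_filter.1 hm
      obtain ⟨h0, hY'⟩ := mem_Ball.1 hm1
      have hh := hN m hm1
      have a1 := one_le_Nm_el (A m)
      have a2 := one_le_Nm_el (B m)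
      have a3 := one_le_Nm (hc m h0)
      rw [mem_SS]
      calc _ = Nm (el (A m)) * 1 * 1 := by ring
        _ ≤ Nm (el (A m)) * Nm (el (B m)) ^ 2 * Nm (c m) ^ 3 := by
            gcongr
            · exact one_le_pow₀ a2
            · exact one_le_pow₀ a3
        _ ≤ Y := hh
    · intro m hm _ m' hm' _ hAA
      obtain ⟨hm1, hm2⟩ := Finset.mem_filter.1 hm
      obtain ⟨hm1', hm2'⟩ := Finset.mem_filter.1 hm'
      have e := hm2.trans hm2'.symm
      simp only [hφ, Prod.mk.injEq] at e
      rw [hx m (mem_Ball.1 hm1).1, hx m' (mem_Ball.1 hm1').1, hAA, e.1, e.2.1, e.2.2]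
    · intro X _ hne
      have hcond := left_ne_zero_of_mul hne
      simp only [hd'] at hcond
      have h4 : v0 * el X * el B0 ^ 2 * c0 ^ 3 ∈ (Ball Y).filter (fun m => φ m = (v0, B0, c0)) ∧ A (v0 * el X * el B0 ^ 2 * c0 ^ 3) = X := by
        by_contra h5; exact hcond (if_neg h5)
      refine ⟨_, h4.1, ?_, h4.2⟩
      simp only [hd', h4, and_self, if_true] at hne
      exact hne
    · intro m hm _
      obtain ⟨hm1, hm2⟩ := Finset.mem_filter.1 hm
      obtain ⟨h0, hY'⟩ := mem_Ball.1 hm1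
      have e := hm2
      simp only [hφ, Prod.mk.injEq] at e
      have em : v0 * el (A m) * el B0 ^ 2 * c0 ^ 3 = m := by
        rw [← e.1, ← e.2.1, ← e.2.2]; exact (hx m h0).symm
      simp only [hd']
      rw [em, if_pos ⟨hm, rfl⟩]
  have hd'n : ∀ t ∈ Ts, ∀ X, ‖d' t X‖ ^ 2 ≤ Nm (el X) ^ (-1 : ℝ) * (Nm (el t.2.1) ^ (-2 : ℝ) * Nm t.2.2 ^ (-3 : ℝ)) := by
    rintro ⟨v0, B0, c0⟩ ht X
    simp only [hTs, Finset.mem_product, mem_SS, mem_Ball] at ht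
    have a1 := one_le_Nm_el X
    have a2 := one_le_Nm_el B0
    have a3 := one_le_Nm ht.2.2.1
    have a0 := one_le_Nm (VV_ne_zero ht.1)
    simp only [hd']
    split_ifs with hif
    · have h0 := (mem_Ball.1 (Finset.mem_filter.1 hif.1).1).1
      have h5 := hd _ h0
      calc _ ≤ (Nm (v0 * el X * el B0 ^ 2 * c0 ^ 3) ^ (-(1/2) : ℝ)) ^ 2 := by gcongr
        _ = Nm (v0 * el X * el B0 ^ 2 * c0 ^ 3) ^ (-1 : ℝ) := by
            rw [← Real.rpow_natCast, ← Real.rpow_mul (Nm_nonneg _)]; norm_num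
        _ ≤ (Nm (el X) * Nm (el B0) ^ 2 * Nm c0 ^ 3) ^ (-1 : ℝ) := by
            apply Real.rpow_le_rpow_of_nonpos (by positivity) _ (by norm_num)
            simp only [Nm_mul, Nm_pow]
            have : 0 ≤ Nm (el X) * Nm (el B0) ^ 2 * Nm c0 ^ 3 := by positivity
            nlinarith
        _ = _ := by
            rw [Real.mul_rpow (by positivity) (by positivity), Real.mul_rpow (by positivity) (by positivity), ← Real.rpow_natCast, ← Real.rpow_natCast,
              ← Real.rpow_mul (by positivity), ← Real.rpow_mul (by positivity)]
            norm_num [mul_assoc]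
    · simp; positivity
  -- fibre bound
  set EE := Q + Y + (Q * Y) ^ (2/3 : ℝ) with hEE
  have hEE0 : 0 ≤ EE := by positivity
  have hfb : ∀ t ∈ Ts, ∑ P ∈ SS Q, ‖∑ m ∈ (Ball Y).filter (fun m => φ m = t), d m * ch P m‖ ^ 2 ≤
      C1 * (Q * Y) ^ η * EE * (C2 * (Q * Y) ^ η) * (Nm (el t.2.1) ^ (-2 : ℝ) * Nm t.2.2 ^ (-3 : ℝ)) := by
    intro t ht
    have hpos : 0 ≤ Nm (el t.2.1) ^ (-2 : ℝ) * Nm t.2.2 ^ (-3 : ℝ) :=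
      mul_nonneg (Real.rpow_nonneg (Nm_nonneg _) _) (Real.rpow_nonneg (Nm_nonneg _) _)
    calc _ ≤ ∑ P ∈ SS Q, ‖∑ X ∈ SS Y, d' t X * ch X (el P)‖ ^ 2 := by
          apply Finset.sum_le_sum; intro P _
          rw [hfib t ht P, norm_mul]
          gcongr
          exact mul_le_of_le_one_left (norm_nonneg _) (ch_norm_le _ _)
      _ ≤ C1 * (Q * Y) ^ η * EE * ∑ X ∈ SS Y, ‖d' t X‖ ^ 2 := h1 Q Y hQ hY (d' t)
      _ ≤ C1 * (Q * Y) ^ η * EE * ((C2 * (Q * Y) ^ η) * (Nm (el t.2.1) ^ (-2 : ℝ) * Nm t.2.2 ^ (-3 : ℝ))) := by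
          gcongr
          calc _ ≤ ∑ X ∈ SS Y, Nm (el X) ^ (-1 : ℝ) * (Nm (el t.2.1) ^ (-2 : ℝ) * Nm t.2.2 ^ (-3 : ℝ)) :=
                Finset.sum_le_sum fun X _ => hd'n t ht X
            _ = (∑ X ∈ SS Y, Nm (el X) ^ (-1 : ℝ)) * (Nm (el t.2.1) ^ (-2 : ℝ) * Nm t.2.2 ^ (-3 : ℝ)) := by rw [Finset.sum_mul]
            _ ≤ _ := by
                gcongr
                refine (h2 (SS Y) Y 1 pY.le (by linarith) (fun P hP => mem_SS.1 hP)).trans ?_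
                rw [show 1 + η - 1 = η by ring]; gcongr
      _ = _ := by ring
  set w : (Eis × Finset PP × Eis) → ℝ := fun t => Nm (el t.2.1) ^ (-1 : ℝ) * Nm t.2.2 ^ (-1 : ℝ) with hw
  have hwpos : ∀ t ∈ Ts, 0 < w t := by
    intro t ht
    simp only [hTs, Finset.mem_product, mem_SS, mem_Ball] at ht
    have a2 := one_le_Nm_el t.2.1
    have a3 := one_le_Nm ht.2.2.1
    simp only [hw]; positivity
  have hwsum : ∑ t ∈ Ts, w t ≤ VF.card * (C2 * C3) * (Q * Y) ^ (2 * η) := by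
    simp only [hTs, hw]
    rw [Finset.sum_product]
    simp only []
    rw [Finset.sum_const, nsmul_eq_mul, Finset.sum_product]
    simp only []
    rw [← Finset.sum_mul_sum]
    have b1 : ∑ P ∈ SS Y, Nm (el P) ^ (-1 : ℝ) ≤ C2 * (Q * Y) ^ η := by
      refine (h2 (SS Y) Y 1 pY.le (by linarith) (fun P hP => mem_SS.1 hP)).trans ?_
      rw [show 1 + η - 1 = η by ring]; gcongr
    have b2 : ∑ x ∈ Ball Y, Nm x ^ (-1 : ℝ) ≤ C3 * (Q * Y) ^ η := by
      refine (h3 (Ball Y) Y 1 pY.le (by linarith) (fun P hP => mem_Ball.1 hP)).trans ?_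
      rw [show 1 + η - 1 = η by ring]; gcongr
    have b0 : 0 ≤ ∑ x ∈ Ball Y, Nm x ^ (-1 : ℝ) := Finset.sum_nonneg fun x _ => Real.rpow_nonneg (Nm_nonneg _) _
    calc _ ≤ VF.card * ((C2 * (Q * Y) ^ η) * (C3 * (Q * Y) ^ η)) := by gcongr
      _ = _ := by
        have : (Q * Y) ^ (2 * η) = (Q * Y) ^ η * (Q * Y) ^ η := by rw [← Real.rpow_add (by positivity)]; congr 1; ring
        rw [this]; ring
  have hwinv : ∀ t ∈ Ts, (w t)⁻¹ * (Nm (el t.2.1) ^ (-2 : ℝ) * Nm t.2.2 ^ (-3 : ℝ)) ≤ w t := by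
    intro t ht
    simp only [hTs, Finset.mem_product, mem_SS, mem_Ball] at ht
    have a2 := one_le_Nm_el t.2.1
    have a3 := one_le_Nm ht.2.2.1
    have p2 : 0 < Nm (el t.2.1) := by linarith
    have p3 : 0 < Nm t.2.2 := by linarith
    simp only [hw]
    have c3 : Nm t.2.2 ^ (-3 : ℝ) ≤ Nm t.2.2 ^ (-2 : ℝ) := Real.rpow_le_rpow_of_exponent_le a3 (by norm_num)
    have e2 : ∀ x : ℝ, 0 < x → (x ^ (-1 : ℝ))⁻¹ * x ^ (-2 : ℝ) = x ^ (-1 : ℝ) := by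
      intro x hx
      rw [← Real.rpow_neg hx.le, ← Real.rpow_add hx]; norm_num
    rw [mul_inv]
    calc _ ≤ (Nm (el t.2.1) ^ (-1 : ℝ))⁻¹ * (Nm t.2.2 ^ (-1 : ℝ))⁻¹ * (Nm (el t.2.1) ^ (-2 : ℝ) * Nm t.2.2 ^ (-2 : ℝ)) := by gcongr
      _ = ((Nm (el t.2.1) ^ (-1 : ℝ))⁻¹ * Nm (el t.2.1) ^ (-2 : ℝ)) * ((Nm t.2.2 ^ (-1 : ℝ))⁻¹ * Nm t.2.2 ^ (-2 : ℝ)) := by ring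
      _ = _ := by rw [e2 _ p2, e2 _ p3]
  have hw0 : 0 ≤ ∑ t ∈ Ts, w t := Finset.sum_nonneg fun t ht => (hwpos t ht).le
  calc _ = ∑ P ∈ SS Q, ‖∑ t ∈ Ts, ∑ m ∈ (Ball Y).filter (fun m => φ m = t), d m * ch P m‖ ^ 2 := by
        apply Finset.sum_congr rfl; intro P _
        rw [Finset.sum_fiberwise_of_maps_to hmaps]
    _ ≤ ∑ P ∈ SS Q, (∑ t ∈ Ts, w t) * ∑ t ∈ Ts, (w t)⁻¹ * ‖∑ m ∈ (Ball Y).filter (fun m => φ m = t), d m * ch P m‖ ^ 2 := by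
        apply Finset.sum_le_sum; intro P _
        exact csum_w Ts w hwpos _
    _ = (∑ t ∈ Ts, w t) * ∑ t ∈ Ts, (w t)⁻¹ * ∑ P ∈ SS Q, ‖∑ m ∈ (Ball Y).filter (fun m => φ m = t), d m * ch P m‖ ^ 2 := by
        rw [← Finset.mul_sum, Finset.sum_comm]
        congr 1
        apply Finset.sum_congr rfl; intro t _; rw [Finset.mul_sum]
    _ ≤ (∑ t ∈ Ts, w t) * ∑ t ∈ Ts, C1 * (Q * Y) ^ η * EE * (C2 * (Q * Y) ^ η) * w t := by
        apply mul_le_mul_of_nonneg_left _ hw0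
        apply Finset.sum_le_sum; intro t ht
        have p := hwpos t ht
        calc _ ≤ (w t)⁻¹ * (C1 * (Q * Y) ^ η * EE * (C2 * (Q * Y) ^ η) * (Nm (el t.2.1) ^ (-2 : ℝ) * Nm t.2.2 ^ (-3 : ℝ))) := by
              exact mul_le_mul_of_nonneg_left (hfb t ht) (inv_nonneg.2 p.le)
          _ = C1 * (Q * Y) ^ η * EE * (C2 * (Q * Y) ^ η) * ((w t)⁻¹ * (Nm (el t.2.1) ^ (-2 : ℝ) * Nm t.2.2 ^ (-3 : ℝ))) := by ring
          _ ≤ _ := mul_le_mul_of_nonneg_left (hwinv t ht) (by positivity)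
    _ = (∑ t ∈ Ts, w t) * (C1 * (Q * Y) ^ η * EE * (C2 * (Q * Y) ^ η) * ∑ t ∈ Ts, w t) := by rw [← Finset.mul_sum]
    _ ≤ (VF.card * (C2 * C3) * (Q * Y) ^ (2 * η)) * (C1 * (Q * Y) ^ η * EE * (C2 * (Q * Y) ^ η) * (VF.card * (C2 * C3) * (Q * Y) ^ (2 * η))) := by gcongr
    _ = ((VF.card * (C2 * C3)) * (C1 * C2) * (VF.card * (C2 * C3))) * (Q * Y) ^ (6 * η) * EE := by
        have : (Q * Y) ^ (6 * η) = (Q * Y) ^ (2 * η) * (Q * Y) ^ η * (Q * Y) ^ η * (Q * Y) ^ (2 * η) := by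
          rw [← Real.rpow_add (by positivity), ← Real.rpow_add (by positivity), ← Real.rpow_add (by positivity)]; congr 1; ring
        rw [this]; ring
    _ ≤ _ := by
        have : (Q * Y) ^ (6 * η) ≤ (Q * Y) ^ ε := Real.rpow_le_rpow_of_exponent_le hQY (by rw [hη]; linarith)
        gcongr
        linarith

/-- main term of the large sieve bound -/
def EE (Q₁ Q₂ Y : ℝ) : ℝ := min Q₁ Q₂ * (max Q₁ Q₂ + Y + (max Q₁ Q₂ * Y) ^ (2/3 : ℝ))

lemma EE_symm (Q₁ Q₂ Y : ℝ) : EE Q₁ Q₂ Y = EE Q₂ Q₁ Y := by unfold EE; rw [min_comm, max_comm]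
lemma EE_nonneg {Q₁ Q₂ Y : ℝ} (h1 : 0 ≤ Q₁) (h2 : 0 ≤ Q₂) (hY : 0 ≤ Y) : 0 ≤ EE Q₁ Q₂ Y := by
  unfold EE
  have : 0 ≤ min Q₁ Q₂ := le_min h1 h2
  have : 0 ≤ max Q₁ Q₂ := le_max_of_le_left h1
  positivity
lemma EE_scale {Q₁ Q₂ Y k : ℝ} (h1 : 0 ≤ Q₁) (h2 : 0 ≤ Q₂) (hY : 0 ≤ Y) (hk : 1 ≤ k) : EE Q₁ Q₂ (k * Y) ≤ k * EE Q₁ Q₂ Y := by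
  unfold EE
  have a0 : 0 ≤ min Q₁ Q₂ := le_min h1 h2
  have b0 : 0 ≤ max Q₁ Q₂ := le_max_of_le_left h1
  set m := max Q₁ Q₂
  have e : (m * (k * Y)) ^ (2/3 : ℝ) ≤ k * (m * Y) ^ (2/3 : ℝ) := by
    rw [show m * (k * Y) = k * (m * Y) by ring, Real.mul_rpow (by linarith) (by positivity)]
    have : k ^ (2/3 : ℝ) ≤ k ^ (1:ℝ) := Real.rpow_le_rpow_of_exponent_le hk (by norm_num)
    rw [Real.rpow_one] at this
    gcongr
  have : m ≤ k * m := by nlinarith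
  calc _ ≤ min Q₁ Q₂ * (k * m + k * Y + k * (m * Y) ^ (2/3 : ℝ)) := by gcongr
    _ = _ := by ring
lemma EE_mono {Q₁ Q₂ Y Y' : ℝ} (h1 : 0 ≤ Q₁) (h2 : 0 ≤ Q₂) (hY : 0 ≤ Y) (h : Y ≤ Y') : EE Q₁ Q₂ Y ≤ EE Q₁ Q₂ Y' := by
  unfold EE
  have a0 : 0 ≤ min Q₁ Q₂ := le_min h1 h2
  have b0 : 0 ≤ max Q₁ Q₂ := le_max_of_le_left h1
  gcongr

lemma MS0 {ε : ℝ} (hε : 0 < ε) : ∃ C : ℝ, 0 < C ∧ ∀ Q₁ Q₂ Y : ℝ, 1 ≤ Q₁ → 1 ≤ Q₂ → 1 ≤ Y → Q₁ ≤ Q₂ → ∀ d : Eis → ℂ,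
    (∀ m, m ≠ 0 → ‖d m‖ ≤ Nm m ^ (-(1/2) : ℝ)) →
    ∑ A ∈ SS Q₁, ∑ B ∈ SS Q₂, ‖∑ m ∈ Ball Y, d m * ((starRingEnd ℂ) (ch A m) * ch B m)‖ ^ 2 ≤
      C * (Q₁ * Q₂ * Y) ^ ε * EE Q₁ Q₂ Y := by
  obtain ⟨C1, hC1, h1⟩ := G1 hε
  obtain ⟨C2, hC2, h2⟩ := sum_SS_le hε
  refine ⟨C2 * C1, by positivity, ?_⟩
  intro Q₁ Q₂ Y hQ1 hQ2 hY hle d hd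
  have hcard : ((SS Q₁).card : ℝ) ≤ C2 * Q₁ ^ (1 + ε) := by
    have := h2 (SS Q₁) Q₁ 0 (by linarith) (by linarith) (fun P hP => mem_SS.1 hP)
    simpa using this
  have key : ∀ A ∈ SS Q₁, ∑ B ∈ SS Q₂, ‖∑ m ∈ Ball Y, d m * ((starRingEnd ℂ) (ch A m) * ch B m)‖ ^ 2 ≤
      C1 * (Q₂ * Y) ^ ε * (Q₂ + Y + (Q₂ * Y) ^ (2/3 : ℝ)) := by
    intro A _
    have := h1 Q₂ Y hQ2 hY (fun m => d m * (starRingEnd ℂ) (ch A m)) (by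
      intro m hm
      rw [norm_mul, RCLike.norm_conj]
      exact (mul_le_of_le_one_right (norm_nonneg _) (ch_norm_le _ _)).trans (hd m hm))
    simpa only [mul_assoc] using this
  have p1 : 0 < Q₁ := by linarith
  have p2 : 0 < Q₂ := by linarith
  have p3 : 0 < Y := by linarith
  calc _ ≤ ∑ A ∈ SS Q₁, C1 * (Q₂ * Y) ^ ε * (Q₂ + Y + (Q₂ * Y) ^ (2/3 : ℝ)) := Finset.sum_le_sum key
    _ = (SS Q₁).card * (C1 * (Q₂ * Y) ^ ε * (Q₂ + Y + (Q₂ * Y) ^ (2/3 : ℝ))) := by rw [Finset.sum_const, nsmul_eq_mul]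
    _ ≤ (C2 * Q₁ ^ (1 + ε)) * (C1 * (Q₂ * Y) ^ ε * (Q₂ + Y + (Q₂ * Y) ^ (2/3 : ℝ))) := by
        apply mul_le_mul_of_nonneg_right hcard (by positivity)
    _ = _ := by
        unfold EE
        rw [min_eq_left hle, max_eq_right hle, Real.rpow_add p1, Real.rpow_one, mul_assoc Q₁ Q₂ Y, Real.mul_rpow p1.le (by positivity)]
        ring

lemma MS1 {ε : ℝ} (hε : 0 < ε) : ∃ C : ℝ, 0 < C ∧ ∀ Q₁ Q₂ Y : ℝ, 1 ≤ Q₁ → 1 ≤ Q₂ → 1 ≤ Y → ∀ d : Eis → ℂ,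
    (∀ m, m ≠ 0 → ‖d m‖ ≤ Nm m ^ (-(1/2) : ℝ)) →
    ∑ p ∈ SS Q₁ ×ˢ SS Q₂, ‖∑ m ∈ Ball Y, d m * (ch p.1 m * (starRingEnd ℂ) (ch p.2 m))‖ ^ 2 ≤
      C * (Q₁ * Q₂ * Y) ^ ε * EE Q₁ Q₂ Y := by
  obtain ⟨C, hC, h⟩ := MS0 hε
  refine ⟨C, hC, ?_⟩
  intro Q₁ Q₂ Y hQ1 hQ2 hY d hd
  rcases le_total Q₁ Q₂ with hle | hle
  · rw [Finset.sum_product]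
    refine le_trans (le_of_eq ?_) (h Q₁ Q₂ Y hQ1 hQ2 hY hle (fun m => (starRingEnd ℂ) (d m)) (fun m hm => by rw [RCLike.norm_conj]; exact hd m hm))
    apply Finset.sum_congr rfl; intro A _
    apply Finset.sum_congr rfl; intro B _
    rw [← RCLike.norm_conj, map_sum]
    simp [mul_comm]
  · rw [Finset.sum_product_right]
    have := h Q₂ Q₁ Y hQ2 hQ1 hY hle d hd
    rw [EE_symm, mul_comm Q₂ Q₁] at this
    refine le_trans (le_of_eq ?_) this
    apply Finset.sum_congr rfl; intro A _
    apply Finset.sum_congr rfl; intro B _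
    simp only [mul_comm]

open Classical in
lemma MS2 {ε : ℝ} (hε : 0 < ε) : ∃ C : ℝ, 0 < C ∧ ∀ Q₁ Q₂ Y R : ℝ, 1 ≤ Q₁ → 1 ≤ Q₂ → 1 ≤ Y → 1 ≤ R → ∀ c r u : Eis → ℂ,
    ∀ K k : ℝ, 0 ≤ K → 0 ≤ k → (∀ m, m ≠ 0 → ‖c m‖ ≤ k * Nm m ^ (-(1/2) : ℝ)) → (∀ m, m ≠ 0 → ‖r m‖ ≤ K * Nm m ^ (-(1/2) : ℝ)) →
    (∀ m, ‖u m‖ ≤ 1) → (∀ m n, u (m * n) = u m * u n) → ∀ s ⊆ Ball Y,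
    ∑ p ∈ SS Q₁ ×ˢ SS Q₂, ‖(∑ m ∈ s, c m * (ch p.1 m * (starRingEnd ℂ) (ch p.2 m) * u m)) *
        (∑ m ∈ Ball R, r m * (ch p.1 m * (starRingEnd ℂ) (ch p.2 m) * u m))‖ ^ 2 ≤
      C * (K * k) ^ 2 * (Q₁ * Q₂ * (Y * R)) ^ ε * EE Q₁ Q₂ (Y * R) := by
  set η := ε / 3 with hη
  have hη0 : 0 < η := by positivity
  obtain ⟨C1, hC1, h1⟩ := MS1 hη0
  obtain ⟨C2, hC2, h2⟩ := dvs_bound hη0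
  refine ⟨C2 ^ 2 * C1, by positivity, ?_⟩
  intro Q₁ Q₂ Y R hQ1 hQ2 hY hR c r u K k hK hk hc hr hu hum s hs
  have pY : 0 < Y := by linarith
  have pR : 0 < R := by linarith
  set D : ℝ := C2 * (Y * R) ^ η * (K * k) with hD
  have hD0 : 0 ≤ D := by positivity
  have hYR : 1 ≤ Y * R := by nlinarith
  -- combined coefficients
  set d : Eis → ℂ := fun m => ∑ p ∈ (s ×ˢ Ball R).filter (fun p => p.1 * p.2 = m), c p.1 * r p.2 with hd
  have hprod : ∀ p : Finset PP × Finset PP, (∑ m ∈ s, c m * (ch p.1 m * (starRingEnd ℂ) (ch p.2 m) * u m)) *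
        (∑ m ∈ Ball R, r m * (ch p.1 m * (starRingEnd ℂ) (ch p.2 m) * u m)) =
        ∑ m ∈ Ball (Y * R), (d m * u m) * (ch p.1 m * (starRingEnd ℂ) (ch p.2 m)) := by
    intro p
    rw [Finset.sum_mul_sum, ← Finset.sum_product']
    have hmaps : ∀ q ∈ s ×ˢ Ball R, q.1 * q.2 ∈ Ball (Y * R) := by
      intro q hq
      obtain ⟨q1, q2⟩ := Finset.mem_product.1 hq
      have q1' := mem_Ball.1 (hs q1)
      have q2' := mem_Ball.1 q2
      rw [mem_Ball, Nm_mul]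
      exact ⟨mul_ne_zero q1'.1 q2'.1, mul_le_mul q1'.2 q2'.2 (Nm_nonneg _) pY.le⟩
    rw [← Finset.sum_fiberwise_of_maps_to hmaps]
    apply Finset.sum_congr rfl; intro m _
    simp only [hd]
    rw [Finset.sum_mul, Finset.sum_mul]
    apply Finset.sum_congr rfl; intro q hq
    have e := (Finset.mem_filter.1 hq).2
    rw [← e, ch_mul, ch_mul, hum, map_mul]; ring
  have hdn : ∀ m ∈ Ball (Y * R), ‖d m‖ ≤ D * Nm m ^ (-(1/2) : ℝ) := by
    intro m hm
    obtain ⟨h0, hY'⟩ := mem_Ball.1 hm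
    have b1 : ∀ p ∈ (s ×ˢ Ball R).filter (fun p => p.1 * p.2 = m), ‖c p.1 * r p.2‖ ≤ K * k * Nm m ^ (-(1/2) : ℝ) := by
      intro p hp
      obtain ⟨hp1, hp2⟩ := Finset.mem_filter.1 hp
      have n1 : p.1 ≠ 0 := by rintro h; rw [h, zero_mul] at hp2; exact h0 hp2.symm
      have n2 : p.2 ≠ 0 := by rintro h; rw [h, mul_zero] at hp2; exact h0 hp2.symm
      rw [norm_mul, ← hp2, Nm_mul, Real.mul_rpow (Nm_nonneg _) (Nm_nonneg _)]
      calc _ ≤ (k * Nm p.1 ^ (-(1/2) : ℝ)) * (K * Nm p.2 ^ (-(1/2) : ℝ)) :=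
            mul_le_mul (hc _ n1) (hr _ n2) (norm_nonneg _) ((norm_nonneg _).trans (hc _ n1))
        _ = _ := by ring
    have b2 : ((s ×ˢ Ball R).filter (fun p => p.1 * p.2 = m)).card ≤ (dvs m).card := by
      apply Finset.card_le_card_of_injOn (fun p => p.1)
      · intro p hp
        have hp2 := (Finset.mem_filter.1 hp).2
        exact (mem_dvs h0).2 ⟨p.2, hp2.symm⟩
      · intro p hp q hq e
        have hp2 := (Finset.mem_filter.1 hp).2
        have hq2 := (Finset.mem_filter.1 hq).2
        have e' : p.1 = q.1 := e
        have n1 : p.1 ≠ 0 := by rintro h; rw [h, zero_mul] at hp2; exact h0 hp2.symm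
        refine Prod.ext e' (mul_left_cancel₀ n1 ?_)
        rw [hp2, e', hq2]
    have b3 : ((dvs m).card : ℝ) ≤ C2 * (Y * R) ^ η := (h2 m h0).trans (by
      have := Nm_nonneg m
      gcongr)
    have b4 : 0 ≤ K * k * Nm m ^ (-(1/2) : ℝ) := mul_nonneg (by positivity) (Real.rpow_nonneg (Nm_nonneg _) _)
    calc ‖d m‖ ≤ ∑ p ∈ (s ×ˢ Ball R).filter (fun p => p.1 * p.2 = m), ‖c p.1 * r p.2‖ := norm_sum_le _ _
      _ ≤ ((s ×ˢ Ball R).filter (fun p => p.1 * p.2 = m)).card • (K * k * Nm m ^ (-(1/2) : ℝ)) := Finset.sum_le_card_nsmul _ _ _ b1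
      _ = ((s ×ˢ Ball R).filter (fun p => p.1 * p.2 = m)).card * (K * k * Nm m ^ (-(1/2) : ℝ)) := by rw [nsmul_eq_mul]
      _ ≤ (C2 * (Y * R) ^ η) * (K * k * Nm m ^ (-(1/2) : ℝ)) := by
          apply mul_le_mul_of_nonneg_right _ b4
          exact le_trans (by exact_mod_cast b2) b3
      _ = _ := by rw [hD]; ring
  set e : Eis → ℂ := fun m => if m ∈ Ball (Y * R) then (D : ℂ)⁻¹ * (d m * u m) else 0 with he
  have hen : ∀ m, m ≠ 0 → ‖e m‖ ≤ Nm m ^ (-(1/2) : ℝ) := by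
    intro m hm
    simp only [he]
    split_ifs with hif
    · rw [norm_mul, norm_mul, norm_inv, Complex.norm_of_nonneg hD0]
      have := hdn m hif
      have h5 : ‖d m‖ * ‖u m‖ ≤ D * Nm m ^ (-(1/2) : ℝ) := (mul_le_of_le_one_right (norm_nonneg _) (hu m)).trans this
      rcases hD0.eq_or_lt with h6 | h6
      · rw [← h6]; simp; exact Real.rpow_nonneg (Nm_nonneg _) _
      · rw [inv_mul_le_iff₀ h6]; exact h5
    · simp; exact Real.rpow_nonneg (Nm_nonneg _) _
  have h7 := h1 Q₁ Q₂ (Y * R) hQ1 hQ2 hYR e hen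
  have hee : ∀ m ∈ Ball (Y * R), d m * u m = D * e m := by
    intro m hm
    simp only [he, if_pos hm]
    rcases hD0.eq_or_lt with h6 | h6
    · have := hdn m hm
      rw [← h6, zero_mul] at this
      have : d m = 0 := by simpa using this
      rw [this]; simp
    · have : (D : ℂ) ≠ 0 := by exact_mod_cast h6.ne'
      field_simp
  have p0 : 1 ≤ Q₁ * Q₂ := by nlinarith
  calc _ = ∑ p ∈ SS Q₁ ×ˢ SS Q₂, D ^ 2 * ‖∑ m ∈ Ball (Y * R), e m * (ch p.1 m * (starRingEnd ℂ) (ch p.2 m))‖ ^ 2 := by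
        apply Finset.sum_congr rfl; intro p _
        rw [hprod p]
        have : ∑ m ∈ Ball (Y * R), (d m * u m) * (ch p.1 m * (starRingEnd ℂ) (ch p.2 m)) =
            D * ∑ m ∈ Ball (Y * R), e m * (ch p.1 m * (starRingEnd ℂ) (ch p.2 m)) := by
          rw [Finset.mul_sum]
          apply Finset.sum_congr rfl; intro m hm
          rw [hee m hm]; ring
        rw [this, norm_mul, Complex.norm_of_nonneg hD0]; ring
    _ = D ^ 2 * ∑ p ∈ SS Q₁ ×ˢ SS Q₂, ‖∑ m ∈ Ball (Y * R), e m * (ch p.1 m * (starRingEnd ℂ) (ch p.2 m))‖ ^ 2 := by rw [Finset.mul_sum]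
    _ ≤ D ^ 2 * (C1 * (Q₁ * Q₂ * (Y * R)) ^ η * EE Q₁ Q₂ (Y * R)) := by
        apply mul_le_mul_of_nonneg_left h7 (by positivity)
    _ ≤ _ := by
        have z0 : 0 ≤ EE Q₁ Q₂ (Y * R) := EE_nonneg (by linarith) (by linarith) (by linarith)
        have z1 : (Y * R) ^ η ≤ (Q₁ * Q₂ * (Y * R)) ^ η := by
          apply Real.rpow_le_rpow (by positivity) _ hη0.le
          nlinarith
        have z2 : (Q₁ * Q₂ * (Y * R)) ^ ε = (Q₁ * Q₂ * (Y * R)) ^ η * (Q₁ * Q₂ * (Y * R)) ^ η * (Q₁ * Q₂ * (Y * R)) ^ η := by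
          rw [← Real.rpow_add (by positivity), ← Real.rpow_add (by positivity)]; congr 1; rw [hη]; ring
        rw [hD, z2]
        set x := (Q₁ * Q₂ * (Y * R)) ^ η with hx
        have hx0 : 0 ≤ x := by positivity
        calc _ = C2 ^ 2 * C1 * (K * k) ^ 2 * ((Y * R) ^ η * (Y * R) ^ η * x) * EE Q₁ Q₂ (Y * R) := by ring
          _ ≤ C2 ^ 2 * C1 * (K * k) ^ 2 * (x * x * x) * EE Q₁ Q₂ (Y * R) := by gcongr
          _ = _ := by ring

/-- the character attached to a pair, twisted by a fixed function -/
def cX (u : Eis → ℂ) (p : Finset PP × Finset PP) (m : Eis) : ℂ := ch p.1 m * (starRingEnd ℂ) (ch p.2 m) * u m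

lemma cX_norm {u : Eis → ℂ} (hu : ∀ m, ‖u m‖ ≤ 1) (p : Finset PP × Finset PP) (m : Eis) : ‖cX u p m‖ ≤ 1 := by
  unfold cX
  rw [norm_mul, norm_mul, RCLike.norm_conj]
  have a := ch_norm_le p.1 m
  have b := ch_norm_le p.2 m
  exact mul_le_one₀ (mul_le_one₀ a (norm_nonneg _) b) (norm_nonneg _) (hu m)

lemma tendsto_Bl {f : Eis → ℂ} (hf : Summable f) (h0 : f 0 = 0) :
    Filter.Tendsto (fun J => ∑ k ∈ Bl J, f k) Filter.atTop (nhds (∑' k, f k)) := by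
  have hB : Filter.Tendsto (fun J => insert 0 (Bl J)) Filter.atTop Filter.atTop := by
    refine Filter.tendsto_atTop_finset_of_monotone ?_ ?_
    · intro a b hab; exact Finset.insert_subset_insert _ (Bl_mono hab)
    · intro k
      obtain ⟨n, hn⟩ := pow_unbounded_of_one_lt (Nm k) (show (1:ℝ) < 3/2 by norm_num)
      by_cases hk : k = 0
      · exact ⟨0, by simp [hk]⟩
      · exact ⟨n, Finset.mem_insert_of_mem (mem_Bl.2 ⟨hk, hn⟩)⟩
  refine (hf.hasSum.comp hB).congr fun J => ?_
  simp only [Function.comp]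
  rw [Finset.sum_insert (by simp [mem_Bl]), h0, zero_add]

lemma shell_aux {τ X y k M : ℝ} (hτ : 0 < τ) (hτ1 : τ ≤ 1/2) (hX : 0 < X) (hy : 0 < y) (hk : k = min 1 (X / y)) (hM : M = max 1 (3/2 * y / X)) :
    k ^ 2 * (M * M ^ τ) ≤ 9/4 * (X ^ τ * y ^ (-τ)) := by
  have e1 : X ^ τ * y ^ (-τ) = (X / y) ^ τ := by rw [Real.div_rpow hX.le hy.le, Real.rpow_neg hy.le]; rfl
  rw [e1]
  rcases le_total y X with h | h
  · have a1 : 1 ≤ X / y := by rw [le_div_iff₀ hy]; linarith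
    have a2 : k = 1 := by rw [hk, min_eq_left a1]
    have a3 : M ≤ 3/2 := by
      rw [hM]; apply max_le (by norm_num)
      rw [div_le_iff₀ hX]; linarith
    have a4 : 1 ≤ M := by rw [hM]; exact le_max_left _ _
    have a5 : M ^ τ ≤ 3/2 := by
      calc M ^ τ ≤ M ^ (1:ℝ) := Real.rpow_le_rpow_of_exponent_le a4 (by linarith)
        _ ≤ 3/2 := by rw [Real.rpow_one]; exact a3
    have a6 : 1 ≤ (X / y) ^ τ := Real.one_le_rpow a1 hτ.le
    have a7 : 0 ≤ M ^ τ := by positivity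
    rw [a2]; nlinarith
  · have a1 : X / y ≤ 1 := by rw [div_le_iff₀ hy]; linarith
    have a2 : k = X / y := by rw [hk, min_eq_right a1]
    set x := X / y with hx
    have hx0 : 0 < x := by positivity
    have a3 : M ≤ 3/2 * x⁻¹ := by
      rw [hM, hx, inv_div]; apply max_le
      · rw [← mul_div_assoc, le_div_iff₀ hX]; linarith
      · rw [mul_div_assoc]
    have a4 : 1 ≤ M := by rw [hM]; exact le_max_left _ _
    have a5 : M ^ τ ≤ 3/2 * x ^ (-τ) := by
      calc M ^ τ ≤ (3/2 * x⁻¹) ^ τ := by gcongr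
        _ = (3/2) ^ τ * x ^ (-τ) := by rw [Real.mul_rpow (by norm_num) (by positivity), Real.inv_rpow hx0.le, Real.rpow_neg hx0.le]
        _ ≤ (3/2) ^ (1:ℝ) * x ^ (-τ) := by
            apply mul_le_mul_of_nonneg_right _ (by positivity)
            exact Real.rpow_le_rpow_of_exponent_le (by norm_num) (by linarith)
        _ = _ := by rw [Real.rpow_one]
    have a6 : x ^ (1 - τ) ≤ x ^ τ := Real.rpow_le_rpow_of_exponent_ge hx0 a1 (by linarith)
    rw [a2]
    calc x ^ 2 * (M * M ^ τ) ≤ x ^ 2 * ((3/2 * x⁻¹) * (3/2 * x ^ (-τ))) := by gcongr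
      _ = 9/4 * (x ^ (1:ℝ) * x ^ (-τ)) := by rw [Real.rpow_one]; field_simp; norm_num
      _ = 9/4 * x ^ (1 - τ) := by rw [← Real.rpow_add hx0]; rfl
      _ ≤ _ := by gcongr

open Classical in
set_option maxHeartbeats 1000000 in
lemma MS3 {ε : ℝ} (hε : 0 < ε) (hε1 : ε ≤ 1) : ∃ C : ℝ, 0 < C ∧ ∀ Q₁ Q₂ X R : ℝ, 1 ≤ Q₁ → 1 ≤ Q₂ → 1 ≤ X → 1 ≤ R → ∀ c r u : Eis → ℂ,
    ∀ K : ℝ, 0 ≤ K → c 0 = 0 → (∀ m, m ≠ 0 → ‖c m‖ ≤ Nm m ^ (-(1/2) : ℝ) * min 1 (X / Nm m)) →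
    (∀ m, m ≠ 0 → ‖r m‖ ≤ K * Nm m ^ (-(1/2) : ℝ)) →
    (∀ m, ‖u m‖ ≤ 1) → (∀ m n, u (m * n) = u m * u n) →
    ∑ p ∈ SS Q₁ ×ˢ SS Q₂, ‖(∑' m, c m * cX u p m) * (∑ m ∈ Ball R, r m * cX u p m)‖ ^ 2 ≤
      C * K ^ 2 * (Q₁ * Q₂ * (X * R)) ^ ε * EE Q₁ Q₂ (X * R) := by
  set τ := ε / 2 with hτ
  have hτ0 : 0 < τ := by positivity
  obtain ⟨C1, hC1, h1⟩ := MS2 hτ0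
  have hgeo := geo_hasSum (η := τ / 2) (by positivity)
  set G := (1 - (3/2 : ℝ) ^ (-(τ/2)))⁻¹ with hG
  have hG0 : 0 ≤ G := hgeo.nonneg (fun j => by positivity)
  refine ⟨G ^ 2 * (9/4 * C1) + 1, by positivity, ?_⟩
  intro Q₁ Q₂ X R hQ1 hQ2 hX hR c r u K hK hc0 hc hr hu hum
  have pX : 0 < X := by linarith
  have pR : 0 < R := by linarith
  have p1 : 0 < Q₁ := by linarith
  have p2 : 0 < Q₂ := by linarith
  have hXR : 1 ≤ X * R := by nlinarith
  have hQQ : 1 ≤ Q₁ * Q₂ := by nlinarith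
  have hE0 : 0 ≤ EE Q₁ Q₂ (X * R) := EE_nonneg p1.le p2.le (by positivity)
  have hsum : ∀ p : Finset PP × Finset PP, Summable (fun m => c m * cX u p m) := by
    intro p
    apply Summable.of_norm_bounded ((summable_Nm (s := 3/2) (by norm_num)).mul_left X)
    intro m
    rw [norm_mul]
    by_cases hm : m = 0
    · subst hm; rw [hc0]; simp
    · have hN := Nm_pos hm
      calc _ ≤ ‖c m‖ := mul_le_of_le_one_right (norm_nonneg _) (cX_norm hu p m)
        _ ≤ Nm m ^ (-(1/2) : ℝ) * min 1 (X / Nm m) := hc m hm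
        _ ≤ Nm m ^ (-(1/2) : ℝ) * (X / Nm m) := by gcongr; exact min_le_right _ _
        _ = X * (Nm m ^ (-(1/2) : ℝ) * Nm m ^ (-1 : ℝ)) := by rw [Real.rpow_neg_one]; ring
        _ = _ := by rw [← Real.rpow_add hN]; norm_num
  set Rr : Finset PP × Finset PP → ℂ := fun p => ∑ m ∈ Ball R, r m * cX u p m with hRr
  set B : ℝ := C1 * K ^ 2 * ((Q₁ * Q₂ * (X * R)) ^ τ * EE Q₁ Q₂ (X * R)) * (9/4 * X ^ τ) with hB
  have hB0 : 0 ≤ B := by positivity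
  have hshell : ∀ j : ℕ, ∑ p ∈ SS Q₁ ×ˢ SS Q₂, ‖(∑ m ∈ Sl j, c m * cX u p m) * Rr p‖ ^ 2 ≤ B * ((3/2 : ℝ) ^ j) ^ (-τ) := by
    intro j
    set y : ℝ := (3/2) ^ j with hy
    have hy1 : 1 ≤ y := one_le_pow₀ (by norm_num)
    have py : 0 < y := by linarith
    set k := min 1 (X / y) with hk
    have hk0 : 0 ≤ k := le_min (by norm_num) (by positivity)
    set M := max 1 (3/2 * y / X) with hM
    have hM1 : 1 ≤ M := le_max_left _ _
    have h2 := h1 Q₁ Q₂ (3/2 * y) R hQ1 hQ2 (by linarith) hR (fun m => if m ∈ Sl j then c m else 0) r u K k hK hk0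
      (by
        intro m hm
        have hN := Nm_pos hm
        split_ifs with hif
        · have := (mem_Sl.1 hif).2.1
          calc _ ≤ Nm m ^ (-(1/2) : ℝ) * min 1 (X / Nm m) := hc m hm
            _ ≤ Nm m ^ (-(1/2) : ℝ) * k := by
                apply mul_le_mul_of_nonneg_left _ (by positivity)
                apply min_le_min le_rfl
                gcongr
            _ = _ := by ring
        · simp; positivity) hr hu hum (Sl j) (by
          intro m hm
          obtain ⟨a, b, c'⟩ := mem_Sl.1 hm
          rw [mem_Ball]; refine ⟨a, c'.le.trans ?_⟩
          rw [pow_succ, hy]; linarith)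
    have e2 : ∀ p : Finset PP × Finset PP, ∑ m ∈ Sl j, (fun m => if m ∈ Sl j then c m else 0) m * (ch p.1 m * (starRingEnd ℂ) (ch p.2 m) * u m) =
        ∑ m ∈ Sl j, c m * cX u p m := by
      intro p
      apply Finset.sum_congr rfl; intro m hm
      simp only [if_pos hm]; rfl
    simp only [] at h2 e2
    have e3 : ∑ p ∈ SS Q₁ ×ˢ SS Q₂, ‖(∑ m ∈ Sl j, c m * cX u p m) * Rr p‖ ^ 2 ≤
        C1 * (K * k) ^ 2 * (Q₁ * Q₂ * (3/2 * y * R)) ^ τ * EE Q₁ Q₂ (3/2 * y * R) := by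
      refine le_trans (le_of_eq ?_) h2
      apply Finset.sum_congr rfl; intro p _
      rw [e2 p]; rfl
    have hMy : 3/2 * y * R ≤ M * (X * R) := by
      have : 3/2 * y / X ≤ M := le_max_right _ _
      rw [div_le_iff₀ pX] at this
      calc _ ≤ M * X * R := by gcongr
        _ = _ := by ring
    have e4 : EE Q₁ Q₂ (3/2 * y * R) ≤ M * EE Q₁ Q₂ (X * R) :=
      (EE_mono p1.le p2.le (by positivity) hMy).trans (EE_scale p1.le p2.le (by positivity) hM1)
    have e5 : (Q₁ * Q₂ * (3/2 * y * R)) ^ τ ≤ M ^ τ * (Q₁ * Q₂ * (X * R)) ^ τ := by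
      rw [← Real.mul_rpow (by positivity) (by positivity)]
      apply Real.rpow_le_rpow (by positivity) _ hτ0.le
      calc _ ≤ Q₁ * Q₂ * (M * (X * R)) := by gcongr
        _ = _ := by ring
    have e6 := shell_aux hτ0 (by rw [hτ]; linarith) pX py hk hM
    have e7 : 0 ≤ EE Q₁ Q₂ (3/2 * y * R) := EE_nonneg p1.le p2.le (by positivity)
    calc _ ≤ C1 * (K * k) ^ 2 * (Q₁ * Q₂ * (3/2 * y * R)) ^ τ * EE Q₁ Q₂ (3/2 * y * R) := e3
      _ ≤ C1 * (K * k) ^ 2 * (M ^ τ * (Q₁ * Q₂ * (X * R)) ^ τ) * (M * EE Q₁ Q₂ (X * R)) := by gcongr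
      _ = C1 * K ^ 2 * ((Q₁ * Q₂ * (X * R)) ^ τ * EE Q₁ Q₂ (X * R)) * (k ^ 2 * (M * M ^ τ)) := by ring
      _ ≤ C1 * K ^ 2 * ((Q₁ * Q₂ * (X * R)) ^ τ * EE Q₁ Q₂ (X * R)) * (9/4 * (X ^ τ * y ^ (-τ))) := by
          apply mul_le_mul_of_nonneg_left e6 (by positivity)
      _ = _ := by rw [hB]; ring
  have hJ : ∀ J : ℕ, ∑ p ∈ SS Q₁ ×ˢ SS Q₂, ‖(∑ m ∈ Bl J, c m * cX u p m) * Rr p‖ ^ 2 ≤ G ^ 2 * B := by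
    intro J
    set w : ℕ → ℝ := fun j => ((3/2 : ℝ) ^ j) ^ (-(τ/2)) with hw
    have hw0 : ∀ j, 0 < w j := fun j => by simp only [hw]; positivity
    have hws : ∑ j ∈ Finset.range J, w j ≤ G := sum_le_hasSum _ (fun j _ => (hw0 j).le) hgeo
    have hw2 : ∀ j, ((3/2 : ℝ) ^ j) ^ (-τ) = w j * w j := by
      intro j; simp only [hw]; rw [← Real.rpow_add (by positivity)]; congr 1; ring
    have hs0 : 0 ≤ ∑ j ∈ Finset.range J, w j := Finset.sum_nonneg fun j _ => (hw0 j).le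
    calc _ = ∑ p ∈ SS Q₁ ×ˢ SS Q₂, ‖∑ j ∈ Finset.range J, (∑ m ∈ Sl j, c m * cX u p m) * Rr p‖ ^ 2 := by
          apply Finset.sum_congr rfl; intro p _
          rw [sum_Bl, Finset.sum_mul]
      _ ≤ ∑ p ∈ SS Q₁ ×ˢ SS Q₂, (∑ j ∈ Finset.range J, w j) * ∑ j ∈ Finset.range J, (w j)⁻¹ * ‖(∑ m ∈ Sl j, c m * cX u p m) * Rr p‖ ^ 2 := by
          apply Finset.sum_le_sum; intro p _
          exact csum_w _ w (fun j _ => hw0 j) _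
      _ = (∑ j ∈ Finset.range J, w j) * ∑ j ∈ Finset.range J, (w j)⁻¹ * ∑ p ∈ SS Q₁ ×ˢ SS Q₂, ‖(∑ m ∈ Sl j, c m * cX u p m) * Rr p‖ ^ 2 := by
          rw [← Finset.mul_sum, Finset.sum_comm]
          congr 1
          apply Finset.sum_congr rfl; intro j _; rw [Finset.mul_sum]
      _ ≤ (∑ j ∈ Finset.range J, w j) * ∑ j ∈ Finset.range J, B * w j := by
          apply mul_le_mul_of_nonneg_left _ hs0
          apply Finset.sum_le_sum; intro j _
          calc _ ≤ (w j)⁻¹ * (B * ((3/2 : ℝ) ^ j) ^ (-τ)) := mul_le_mul_of_nonneg_left (hshell j) (inv_nonneg.2 (hw0 j).le)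
            _ = _ := by rw [hw2]; have := (hw0 j).ne'; field_simp
      _ = (∑ j ∈ Finset.range J, w j) * (∑ j ∈ Finset.range J, w j) * B := by rw [← Finset.mul_sum]; ring
      _ ≤ G * G * B := by gcongr
      _ = _ := by ring
  have hlim : Filter.Tendsto (fun J : ℕ => ∑ p ∈ SS Q₁ ×ˢ SS Q₂, ‖(∑ m ∈ Bl J, c m * cX u p m) * Rr p‖ ^ 2) Filter.atTop
      (nhds (∑ p ∈ SS Q₁ ×ˢ SS Q₂, ‖(∑' m, c m * cX u p m) * Rr p‖ ^ 2)) := by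
    apply tendsto_finsetSum; intro p _
    exact (((tendsto_Bl (hsum p) (by rw [hc0, zero_mul])).mul_const _).norm).pow 2
  refine (le_of_tendsto hlim (Filter.Eventually.of_forall hJ)).trans ?_
  have z1 : X ^ τ ≤ (Q₁ * Q₂ * (X * R)) ^ τ := by
    apply Real.rpow_le_rpow pX.le _ hτ0.le
    calc X = 1 * (X * 1) := by ring
      _ ≤ _ := by gcongr
  have z2 : (Q₁ * Q₂ * (X * R)) ^ ε = (Q₁ * Q₂ * (X * R)) ^ τ * (Q₁ * Q₂ * (X * R)) ^ τ := by
    rw [← Real.rpow_add (by positivity)]; congr 1; rw [hτ]; ring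
  rw [hB, z2]
  set x := (Q₁ * Q₂ * (X * R)) ^ τ with hx
  have hx0 : 0 ≤ x := by positivity
  calc _ = G ^ 2 * (9/4 * C1) * K ^ 2 * (x * X ^ τ) * EE Q₁ Q₂ (X * R) := by ring
    _ ≤ (G ^ 2 * (9/4 * C1) + 1) * K ^ 2 * (x * x) * EE Q₁ Q₂ (X * R) := by gcongr; linarith

lemma mellin_strip {f : ℝ → ℂ} {a b : ℝ} (ha : MellinConvergent f a) (hb : MellinConvergent f b) :
    ∃ K : ℝ, 0 ≤ K ∧ ∀ s : ℂ, a ≤ s.re → s.re ≤ b → ‖mellin f s‖ ≤ K := by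
  refine ⟨∫ t in Set.Ioi (0:ℝ), (‖(t:ℂ) ^ ((a:ℂ) - 1) • f t‖ + ‖(t:ℂ) ^ ((b:ℂ) - 1) • f t‖), ?_, ?_⟩
  · exact MeasureTheory.integral_nonneg fun t => by positivity
  · intro s h1 h2
    unfold mellin
    apply MeasureTheory.norm_integral_le_of_norm_le (ha.norm.add hb.norm)
    refine (MeasureTheory.ae_restrict_mem measurableSet_Ioi).mono fun t ht => ?_
    have ht0 : 0 < t := ht
    show ‖(t:ℂ)^(s-1) • f t‖ ≤ ‖(t:ℂ)^((a:ℂ)-1) • f t‖ + ‖(t:ℂ)^((b:ℂ)-1) • f t‖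
    rw [norm_smul, norm_smul, norm_smul, Complex.norm_cpow_eq_rpow_re_of_pos ht0, Complex.norm_cpow_eq_rpow_re_of_pos ht0,
      Complex.norm_cpow_eq_rpow_re_of_pos ht0, ← add_mul]
    apply mul_le_mul_of_nonneg_right _ (norm_nonneg _)
    simp only [sub_re, one_re, ofReal_re]
    rcases le_total t 1 with h | h
    · have := Real.rpow_le_rpow_of_exponent_ge ht0 h (show a - 1 ≤ s.re - 1 by linarith)
      have := Real.rpow_nonneg ht0.le (b - 1)
      linarith
    · have := Real.rpow_le_rpow_of_exponent_le h (show s.re - 1 ≤ b - 1 by linarith)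
      have := Real.rpow_nonneg ht0.le (a - 1)
      linarith

lemma Gamma_strip {a b : ℝ} (ha : 0 < a) (hab : a ≤ b) : ∃ K : ℝ, 0 ≤ K ∧ ∀ s : ℂ, a ≤ s.re → s.re ≤ b → ‖Gamma s‖ ≤ K := by
  have hconv : ∀ x : ℝ, 0 < x → MellinConvergent (fun x : ℝ => ((Real.exp (-x) : ℝ) : ℂ)) x := by
    intro x hx
    have := Complex.GammaIntegral_convergent (s := x) (by simpa using hx)
    refine this.congr_fun (fun t _ => ?_) measurableSet_Ioi
    simp [mul_comm]
  obtain ⟨K, hK, h⟩ := mellin_strip (hconv a ha) (hconv b (by linarith))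
  refine ⟨K, hK, fun s h1 h2 => ?_⟩
  rw [Complex.Gamma_eq_integral (by linarith), Complex.GammaIntegral_eq_mellin]
  exact h s h1 h2

/-- at most exponential growth in a vertical strip -/
def Gr (a b : ℝ) (f : ℂ → ℂ) : Prop := ∃ K A : ℝ, 0 ≤ K ∧ 0 ≤ A ∧ ∀ z : ℂ, a ≤ z.re → z.re ≤ b → ‖f z‖ ≤ K * Real.exp (A * |z.im|)

lemma Gr.mul {a b : ℝ} {f g : ℂ → ℂ} (hf : Gr a b f) (hg : Gr a b g) : Gr a b (fun z => f z * g z) := by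
  obtain ⟨K, A, hK, hA, h⟩ := hf
  obtain ⟨K', A', hK', hA', h'⟩ := hg
  refine ⟨K * K', A + A', by positivity, by positivity, fun z h1 h2 => ?_⟩
  rw [norm_mul, add_mul, Real.exp_add]
  calc _ ≤ (K * Real.exp (A * |z.im|)) * (K' * Real.exp (A' * |z.im|)) := mul_le_mul (h z h1 h2) (h' z h1 h2) (norm_nonneg _) (by positivity)
    _ = _ := by ring

lemma Gr.add {a b : ℝ} {f g : ℂ → ℂ} (hf : Gr a b f) (hg : Gr a b g) : Gr a b (fun z => f z + g z) := by
  obtain ⟨K, A, hK, hA, h⟩ := hf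
  obtain ⟨K', A', hK', hA', h'⟩ := hg
  refine ⟨K + K', A + A', by positivity, by positivity, fun z h1 h2 => ?_⟩
  have e1 : Real.exp (A * |z.im|) ≤ Real.exp ((A + A') * |z.im|) := by gcongr; linarith
  have e2 : Real.exp (A' * |z.im|) ≤ Real.exp ((A + A') * |z.im|) := by gcongr; linarith
  calc _ ≤ ‖f z‖ + ‖g z‖ := norm_add_le _ _
    _ ≤ K * Real.exp (A * |z.im|) + K' * Real.exp (A' * |z.im|) := add_le_add (h z h1 h2) (h' z h1 h2)
    _ ≤ K * Real.exp ((A + A') * |z.im|) + K' * Real.exp ((A + A') * |z.im|) := by gcongr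
    _ = _ := by ring

lemma Gr.const {a b : ℝ} (c : ℂ) : Gr a b (fun _ => c) := ⟨‖c‖, 0, norm_nonneg _, le_rfl, fun z _ _ => by simp⟩

lemma Gr.of_bdd {a b : ℝ} {f : ℂ → ℂ} (K : ℝ) (hK : 0 ≤ K) (h : ∀ z : ℂ, a ≤ z.re → z.re ≤ b → ‖f z‖ ≤ K) : Gr a b f :=
  ⟨K, 0, hK, le_rfl, fun z h1 h2 => by simpa using h z h1 h2⟩

lemma Gr.neg {a b : ℝ} {f : ℂ → ℂ} (hf : Gr a b f) : Gr a b (fun z => - f z) := by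
  obtain ⟨K, A, hK, hA, h⟩ := hf
  exact ⟨K, A, hK, hA, fun z h1 h2 => by rw [norm_neg]; exact h z h1 h2⟩

lemma Gr.sub {a b : ℝ} {f g : ℂ → ℂ} (hf : Gr a b f) (hg : Gr a b g) : Gr a b (fun z => f z - g z) := by
  simpa only [sub_eq_add_neg] using hf.add hg.neg

lemma Gr.sum {a b : ℝ} {ι : Type*} (s : Finset ι) {f : ι → ℂ → ℂ} (h : ∀ i ∈ s, Gr a b (f i)) : Gr a b (fun z => ∑ i ∈ s, f i z) := by
  classical
  induction s using Finset.induction_on with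
  | empty => simpa using Gr.const (a := a) (b := b) 0
  | insert i s hi ih =>
    simp only [Finset.sum_insert hi]
    exact (h i (Finset.mem_insert_self _ _)).add (ih fun j hj => h j (Finset.mem_insert_of_mem hj))

lemma Gr.id {a b : ℝ} : Gr a b (fun z => z) := by
  refine ⟨|a| + |b| + 1, 1, by positivity, zero_le_one, fun z h1 h2 => ?_⟩
  have e := Real.add_one_le_exp (|z.im|)
  have e1 : |z.re| ≤ |a| + |b| := by
    rw [abs_le]; constructor
    · have := neg_abs_le a; have := abs_nonneg b; linarith
    · have := le_abs_self b; have := abs_nonneg a; linarith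
  have := Complex.norm_le_abs_re_add_abs_im z
  have h0 := abs_nonneg z.im
  have h3 := abs_nonneg a
  have h4 := abs_nonneg b
  rw [one_mul]
  nlinarith

lemma Gr.cpow {a b : ℝ} {x : ℝ} (hx : 0 < x) (α β : ℝ) : Gr a b (fun z => (x : ℂ) ^ ((α : ℂ) * z + β)) := by
  refine Gr.of_bdd (Real.exp (|Real.log x| * (|α| * (|a| + |b|) + |β|))) (Real.exp_pos _).le fun z h1 h2 => ?_
  rw [Complex.norm_cpow_eq_rpow_re_of_pos hx, Real.rpow_def_of_pos hx]
  have e1 : |z.re| ≤ |a| + |b| := by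
    rw [abs_le]; constructor
    · have := neg_abs_le a; have := abs_nonneg b; linarith
    · have := le_abs_self b; have := abs_nonneg a; linarith
  apply Real.exp_le_exp.2
  refine (le_abs_self _).trans ?_
  rw [abs_mul]
  apply mul_le_mul_of_nonneg_left _ (abs_nonneg _)
  simp only [add_re, mul_re, ofReal_re, ofReal_im, zero_mul, sub_zero]
  calc _ ≤ |α * z.re| + |β| := abs_add_le _ _
    _ ≤ _ := by rw [abs_mul]; gcongr

lemma expsq_norm (z z0 : ℂ) : ‖cexp ((z - z0) ^ 2)‖ = Real.exp ((z.re - z0.re) ^ 2 - (z.im - z0.im) ^ 2) := by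
  rw [Complex.norm_exp]
  congr 1
  simp [sq]

lemma Gr.expsq {a b : ℝ} (z0 : ℂ) : Gr a b (fun z => cexp ((z - z0) ^ 2)) := by
  refine Gr.of_bdd (Real.exp ((|a| + |b| + |z0.re|) ^ 2)) (Real.exp_pos _).le fun z h1 h2 => ?_
  rw [expsq_norm]
  have e1 : |z.re| ≤ |a| + |b| := by
    rw [abs_le]; constructor
    · have := neg_abs_le a; have := abs_nonneg b; linarith
    · have := le_abs_self b; have := abs_nonneg a; linarith
  apply Real.exp_le_exp.2
  have e2 : |z.re - z0.re| ≤ |a| + |b| + |z0.re| := (abs_sub _ _).trans (by linarith)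
  have e3 : (z.re - z0.re) ^ 2 ≤ (|a| + |b| + |z0.re|) ^ 2 := by rw [← sq_abs]; gcongr
  have := sq_nonneg (z.im - z0.im)
  linarith

lemma sin_growth (z : ℂ) : ‖Complex.sin z‖ ≤ Real.exp |z.im| := by
  unfold Complex.sin
  rw [norm_div, norm_mul, Complex.norm_I, mul_one]
  have e1 : ‖cexp (-z * I)‖ ≤ Real.exp |z.im| := by
    rw [Complex.norm_exp]; apply Real.exp_le_exp.2; simp; exact le_abs_self _
  have e2 : ‖cexp (z * I)‖ ≤ Real.exp |z.im| := by
    rw [Complex.norm_exp]; apply Real.exp_le_exp.2; simp; exact neg_le_abs _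
  have := norm_sub_le (cexp (-z * I)) (cexp (z * I))
  rw [show ‖(2:ℂ)‖ = 2 by simp, div_le_iff₀ (by norm_num)]
  linarith

lemma invGamma_gr : Gr (-(1/2)) (3/2) (fun z => (Gamma z)⁻¹) := by
  obtain ⟨K1, hK1, h1⟩ := Gamma_strip (a := 3/2) (b := 7/2) (by norm_num) (by norm_num)
  have hcomp : IsCompact (Set.Icc (-(1/2) : ℝ) (3/2) ×ℂ Set.Icc (-1 : ℝ) 1) := isCompact_Icc.reProdIm isCompact_Icc
  obtain ⟨K2, h2⟩ := hcomp.exists_bound_of_continuousOn (f := fun z => (Gamma z)⁻¹) differentiable_one_div_Gamma.continuous.continuousOn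
  refine ⟨K1 + |K2|, Real.pi, by positivity, Real.pi_pos.le, fun z ha hb => ?_⟩
  have hexp : 1 ≤ Real.exp (Real.pi * |z.im|) := Real.one_le_exp (mul_nonneg Real.pi_pos.le (abs_nonneg _))
  by_cases hz : |z.im| ≤ 1
  · have := h2 z ⟨⟨ha, hb⟩, abs_le.1 hz⟩
    have := le_abs_self K2
    calc _ ≤ |K2| * 1 := by linarith
      _ ≤ _ := by gcongr; linarith
  · push Not at hz
    have him : z.im ≠ 0 := by intro h; rw [h] at hz; simp at hz; linarith
    have n1 : (1:ℂ) - z ≠ 0 := by intro h; have := congrArg Complex.im h; simp at this; exact him this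
    have n2 : (2:ℂ) - z ≠ 0 := by intro h; have := congrArg Complex.im h; simp at this; exact him this
    have e1 : Gamma (3 - z) = (2 - z) * ((1 - z) * Gamma (1 - z)) := by
      rw [← Complex.Gamma_add_one _ n1, show (1:ℂ) - z + 1 = 2 - z by ring, ← Complex.Gamma_add_one _ n2]; congr 1; ring
    have hs : Complex.sin (Real.pi * z) ≠ 0 := by
      rw [Complex.sin_ne_zero_iff]; intro k h
      have := congrArg Complex.im h
      simp [Real.pi_ne_zero] at this
      exact him this
    have e2 := Complex.Gamma_mul_Gamma_one_sub z
    have hpi : (Real.pi : ℂ) ≠ 0 := by exact_mod_cast Real.pi_ne_zero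
    have hG : Gamma z ≠ 0 := by
      intro h; rw [h, zero_mul] at e2
      exact (div_ne_zero hpi hs) e2.symm
    have e3 : (Gamma z)⁻¹ = Complex.sin (Real.pi * z) * Gamma (3 - z) * ((Real.pi : ℂ) * (2 - z) * (1 - z))⁻¹ := by
      rw [e1]
      rw [eq_div_iff hs] at e2
      generalize Complex.sin (Real.pi * z) = S at *
      generalize (Real.pi : ℂ) = π' at *
      field_simp
      linear_combination -e2
    show ‖(Gamma z)⁻¹‖ ≤ _
    rw [e3, norm_mul, norm_mul, norm_inv, norm_mul, norm_mul]
    have g1 : ‖Complex.sin (Real.pi * z)‖ ≤ Real.exp (Real.pi * |z.im|) := by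
      refine (sin_growth _).trans (le_of_eq ?_)
      simp [abs_mul, abs_of_pos Real.pi_pos]
    have g2 : ‖Gamma (3 - z)‖ ≤ K1 := h1 _ (by simp; linarith) (by simp; linarith)
    have g3 : 1 ≤ ‖(2:ℂ) - z‖ := by
      refine hz.le.trans ?_
      have := Complex.abs_im_le_norm (2 - z); simpa using this
    have g4 : 1 ≤ ‖(1:ℂ) - z‖ := by
      refine hz.le.trans ?_
      have := Complex.abs_im_le_norm (1 - z); simpa using this
    have g5 : 1 ≤ ‖(Real.pi : ℂ)‖ := by
      rw [Complex.norm_of_nonneg Real.pi_pos.le]; linarith [Real.pi_gt_three]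
    have g6 : (‖(Real.pi : ℂ)‖ * ‖(2:ℂ) - z‖ * ‖(1:ℂ) - z‖)⁻¹ ≤ 1 := by
      apply inv_le_one_of_one_le₀
      nlinarith [mul_le_mul g5 g3 (by norm_num) (by positivity)]
    calc _ ≤ Real.exp (Real.pi * |z.im|) * K1 * 1 := by gcongr
      _ = K1 * Real.exp (Real.pi * |z.im|) := by ring
      _ ≤ _ := by gcongr; have := abs_nonneg K2; linarith

/-- the completed quotient of Gamma factors -/
def gq (z : ℂ) : ℂ := Gamma (2 - z) * (Gamma z)⁻¹

lemma gq_gr : Gr (-(1/2)) (3/2) gq := by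
  obtain ⟨K1, hK1, h1⟩ := Gamma_strip (a := 1/2) (b := 5/2) (by norm_num) (by norm_num)
  exact (Gr.of_bdd (f := fun z => Gamma (2 - z)) K1 hK1 (fun z ha hb => h1 _ (by simp; linarith) (by simp; linarith))).mul invGamma_gr

lemma gq_diff {z : ℂ} (hz : z.re < 2) : DifferentiableAt ℂ gq z := by
  unfold gq
  apply DifferentiableAt.mul
  · have : DifferentiableAt ℂ Gamma (2 - z) := by
      apply Complex.differentiableAt_Gamma
      intro m h
      have := congrArg Complex.re h
      simp at this
      have h3 : (0:ℝ) ≤ m := Nat.cast_nonneg m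
      linarith
    exact this.comp z (f := fun z => 2 - z) (by fun_prop)
  · exact differentiable_one_div_Gamma z

lemma gq_half {z : ℂ} (hz : z.re = 1/2) : ‖gq z‖ = ‖z‖ := by
  have e : 2 - z = (starRingEnd ℂ) z + 1 := by
    apply Complex.ext <;> simp [hz]; norm_num
  have h0 : (starRingEnd ℂ) z ≠ 0 := by intro h; have := congrArg Complex.re h; simp [hz] at this
  have hG : Gamma z ≠ 0 := Complex.Gamma_ne_zero_of_re_pos (by rw [hz]; norm_num)
  unfold gq
  rw [e, Complex.Gamma_add_one _ h0, Complex.Gamma_conj, norm_mul, norm_mul, norm_inv, RCLike.norm_conj, RCLike.norm_conj]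
  have : ‖Gamma z‖ ≠ 0 := norm_ne_zero_iff.2 hG
  field_simp

lemma gq_right {z : ℂ} (hz : z.re = 3/2) : ‖gq z‖ = ‖2 - z‖⁻¹ := by
  have e : z = (starRingEnd ℂ) (2 - z) + 1 := by
    apply Complex.ext <;> simp [hz]; norm_num
  have h0 : (starRingEnd ℂ) (2 - z) ≠ 0 := by intro h; have := congrArg Complex.re h; simp [hz] at this; norm_num at this
  have hG : Gamma (2 - z) ≠ 0 := Complex.Gamma_ne_zero_of_re_pos (by simp [hz]; norm_num)
  have e2 : Gamma z = (starRingEnd ℂ) (2 - z) * (starRingEnd ℂ) (Gamma (2 - z)) := by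
    conv_lhs => rw [e]
    rw [Complex.Gamma_add_one _ h0, Complex.Gamma_conj]
  unfold gq
  rw [norm_mul, norm_inv, e2, norm_mul, RCLike.norm_conj, RCLike.norm_conj]
  have : ‖Gamma (2 - z)‖ ≠ 0 := norm_ne_zero_iff.2 hG
  field_simp

lemma gq_left {z : ℂ} (hz : z.re = -(1/2)) : ‖gq z‖ = ‖z + 2‖ * (‖z + 1‖ * ‖z‖) := by
  set w := (starRingEnd ℂ) z with hw
  have hwre : w.re = -(1/2) := by simp [hw, hz]
  have e : 2 - z = w + 1 + 1 + 1 := by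
    apply Complex.ext <;> simp [hz, hw]; norm_num
  have h0 : w ≠ 0 := by intro h; have := congrArg Complex.re h; simp [hwre] at this
  have h1 : w + 1 ≠ 0 := by intro h; have := congrArg Complex.re h; simp [hwre] at this; norm_num at this
  have h2 : w + 1 + 1 ≠ 0 := by intro h; have := congrArg Complex.re h; simp [hwre] at this; norm_num at this
  have hG : Gamma z ≠ 0 := by
    apply Complex.Gamma_ne_zero
    intro m h
    have := congrArg Complex.re h
    simp [hz] at this
    have h5 : ((2 * m : ℕ) : ℝ) = (1 : ℕ) := by push_cast; linarith
    have h6 := Nat.cast_injective h5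
    omega
  unfold gq
  rw [e, Complex.Gamma_add_one _ h2, Complex.Gamma_add_one _ h1, Complex.Gamma_add_one _ h0, hw, Complex.Gamma_conj]
  simp only [norm_mul, norm_inv, RCLike.norm_conj]
  have : ‖Gamma z‖ ≠ 0 := norm_ne_zero_iff.2 hG
  have e3 : ‖(starRingEnd ℂ) z + 1 + 1‖ = ‖z + 2‖ := by
    rw [← RCLike.norm_conj (z + 2)]; congr 1; rw [map_add]
    have : (starRingEnd ℂ) (2:ℂ) = 2 := Complex.conj_ofNat _
    rw [this]; ring
  have e4 : ‖(starRingEnd ℂ) z + 1‖ = ‖z + 1‖ := by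
    rw [← RCLike.norm_conj (z + 1)]; simp
  rw [e3, e4]
  field_simp

lemma PLvec {ι : Type*} (s : Finset ι) (f : ι → ℂ → ℂ) {a b M : ℝ} (hab : a < b) (hba : b - a ≤ 2)
    (hd : ∀ i ∈ s, ∀ z : ℂ, a ≤ z.re → z.re ≤ b → DifferentiableAt ℂ (f i) z) (hg : ∀ i ∈ s, Gr a b (f i))
    (ha : ∀ z : ℂ, z.re = a → ∑ i ∈ s, ‖f i z‖ ^ 2 ≤ M) (hb : ∀ z : ℂ, z.re = b → ∑ i ∈ s, ‖f i z‖ ^ 2 ≤ M)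
    {z : ℂ} (h1 : a ≤ z.re) (h2 : z.re ≤ b) : ∑ i ∈ s, ‖f i z‖ ^ 2 ≤ M := by
  set S := ∑ i ∈ s, ‖f i z‖ ^ 2 with hS
  have hS0 : 0 ≤ S := Finset.sum_nonneg fun i _ => by positivity
  set F : ℂ → ℂ := fun w => ∑ i ∈ s, (starRingEnd ℂ) (f i z) * f i w with hF
  have hM0 : 0 ≤ M := le_trans (Finset.sum_nonneg fun i _ => by positivity) (ha (a : ℂ) (by simp))
  have hedge : ∀ w : ℂ, ∑ i ∈ s, ‖f i w‖ ^ 2 ≤ M → ‖F w‖ ≤ Real.sqrt S * Real.sqrt M := by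
    intro w hw
    have := Finset.sum_mul_sq_le_sq_mul_sq s (fun i => ‖f i z‖) (fun i => ‖f i w‖)
    calc ‖F w‖ ≤ ∑ i ∈ s, ‖f i z‖ * ‖f i w‖ := by
          refine (norm_sum_le _ _).trans (le_of_eq ?_)
          apply Finset.sum_congr rfl; intro i _; rw [norm_mul, RCLike.norm_conj]
      _ ≤ Real.sqrt (S * M) := by
          apply Real.le_sqrt_of_sq_le
          exact this.trans (mul_le_mul_of_nonneg_left hw hS0)
      _ = _ := Real.sqrt_mul hS0 _
  have hcl : closure (Complex.re ⁻¹' Set.Ioo a b) ⊆ Complex.re ⁻¹' Set.Icc a b :=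
    closure_minimal (Set.preimage_mono Set.Ioo_subset_Icc_self) (isClosed_Icc.preimage Complex.continuous_re)
  have hFd : DiffContOnCl ℂ F (Complex.re ⁻¹' Set.Ioo a b) := by
    apply DifferentiableOn.diffContOnCl
    intro w hw
    obtain ⟨w1, w2⟩ := hcl hw
    apply DifferentiableAt.differentiableWithinAt
    simp only [hF]
    apply DifferentiableAt.fun_sum
    intro i hi
    exact (hd i hi w w1 w2).const_mul _
  have hFg : Gr a b F := Gr.sum s fun i hi => (Gr.const _).mul (hg i hi)
  obtain ⟨K, A, hK, hA, hKA⟩ := hFg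
  have key := PhragmenLindelof.vertical_strip (f := F) (C := Real.sqrt S * Real.sqrt M) hFd
    ⟨1, by
      rw [lt_div_iff₀ (by linarith)]; linarith [Real.pi_gt_three], A, by
      apply Asymptotics.IsBigO.of_bound K
      rw [Filter.eventually_inf_principal]
      refine Filter.Eventually.of_forall fun w hw => ?_
      refine (hKA w hw.1.le hw.2.le).trans ?_
      rw [Real.norm_of_nonneg (Real.exp_pos _).le]
      have := Real.add_one_le_exp (|w.im|)
      gcongr
      rw [one_mul]; linarith⟩
    (fun w hw => hedge w (ha w hw)) (fun w hw => hedge w (hb w hw)) h1 h2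
  have hFz : F z = S := by
    simp only [hF, hS]
    push_cast
    apply Finset.sum_congr rfl; intro i _
    rw [mul_comm, Complex.mul_conj, Complex.normSq_eq_norm_sq]; push_cast; rfl
  rw [hFz, Complex.norm_of_nonneg hS0] at key
  rcases hS0.eq_or_lt with h | h
  · rw [← h]; exact hM0
  · have h3 : 0 < Real.sqrt S := Real.sqrt_pos.2 h
    have h4 : Real.sqrt S ≤ Real.sqrt M := by
      apply le_of_mul_le_mul_left _ h3
      rwa [Real.mul_self_sqrt hS0]
    exact (Real.sqrt_le_sqrt_iff hM0).1 h4

/-- truncated Dirichlet polynomial -/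
def DS (X : ℝ) (ψ : Eis → ℂ) (w : ℂ) : ℂ := ∑ m ∈ Ball X, ψ m * (Nm m : ℂ) ^ (-w)

lemma cpow_conj_real {x : ℝ} (hx : 0 ≤ x) (w : ℂ) : (x : ℂ) ^ (-(starRingEnd ℂ) w) = (starRingEnd ℂ) ((x : ℂ) ^ (-w)) := by
  rw [← map_neg, Complex.cpow_conj, Complex.conj_ofReal]
  rw [Complex.arg_ofReal_of_nonneg hx]
  exact Real.pi_ne_zero.symm

lemma DS_conj (X : ℝ) (ψ : Eis → ℂ) (w : ℂ) : DS X (fun x => (starRingEnd ℂ) (ψ x)) w = (starRingEnd ℂ) (DS X ψ ((starRingEnd ℂ) w)) := by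
  unfold DS
  rw [map_sum]
  apply Finset.sum_congr rfl; intro m _
  rw [map_mul, cpow_conj_real (Nm_nonneg m), Complex.conj_conj]

lemma LS_conj (ψ : Eis → ℂ) (w : ℂ) : LS (fun x => (starRingEnd ℂ) (ψ x)) w = (starRingEnd ℂ) (LS ψ ((starRingEnd ℂ) w)) := by
  unfold LS
  rw [Complex.conj_tsum]
  apply tsum_congr; intro m
  rw [map_mul, cpow_conj_real (Nm_nonneg m), Complex.conj_conj]

lemma norm_Nm_cpow {m : Eis} (hm : m ≠ 0) (w : ℂ) : ‖(Nm m : ℂ) ^ (-w)‖ = Nm m ^ (-w.re) := by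
  rw [Complex.norm_cpow_eq_rpow_re_of_pos (Nm_pos hm), neg_re]

/-- the mean square hypothesis -/
def HB0 {ι : Type*} (s : Finset ι) (χ : ι → Eis → ℂ) (Rr : ι → ℂ) (X B : ℝ) : Prop :=
  ∀ c : Eis → ℂ, c 0 = 0 → (∀ m, m ≠ 0 → ‖c m‖ ≤ Nm m ^ (-(1/2) : ℝ) * min 1 (X / Nm m)) →
    ∑ i ∈ s, ‖(∑' m, c m * χ i m) * Rr i‖ ^ 2 ≤ B

open Classical in
lemma DS_tsum (X : ℝ) (ψ : Eis → ℂ) (w : ℂ) (k : ℂ) :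
    ∑' m, (if m ∈ Ball X then k * (Nm m : ℂ) ^ (-w) else 0) * ψ m = k * DS X ψ w := by
  rw [tsum_eq_sum (s := Ball X)]
  · unfold DS
    rw [Finset.mul_sum]
    apply Finset.sum_congr rfl; intro m hm
    rw [if_pos hm]; ring
  · intro m hm; rw [if_neg hm, zero_mul]

open Classical in
lemma LSD_tsum {X : ℝ} {ψ : Eis → ℂ} (hψ : ∀ x, ‖ψ x‖ ≤ 1) (h0 : ψ 0 = 0) {w : ℂ} (hw : 1 < w.re) (k : ℂ) :
    ∑' m, (if m ∈ Ball X ∨ m = 0 then 0 else k * (Nm m : ℂ) ^ (-w)) * ψ m = k * (LS ψ w - DS X ψ w) := by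
  have h1 := (LS_summable ψ hψ hw)
  have e : LS ψ w - DS X ψ w = ∑' m, (ψ m * (Nm m : ℂ) ^ (-w) - (if m ∈ Ball X then 1 * (Nm m : ℂ) ^ (-w) else 0) * ψ m) := by
    rw [Summable.tsum_sub h1, DS_tsum, one_mul]; rfl
    apply summable_of_ne_finset_zero (s := Ball X)
    intro m hm; rw [if_neg hm, zero_mul]
  rw [e, ← tsum_mul_left]
  apply tsum_congr; intro m
  by_cases hm : m ∈ Ball X
  · simp [hm]; right; ring
  · by_cases h : m = 0
    · subst h; simp [h0]
    · simp [hm, h]; ring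

lemma sum_scale {ι : Type*} {s : Finset ι} {k : ℂ} (hk : k ≠ 0) {x y : ι → ℂ} {B : ℝ}
    (h : ∑ i ∈ s, ‖(k * x i) * y i‖ ^ 2 ≤ B) : ∑ i ∈ s, ‖x i * y i‖ ^ 2 ≤ (‖k‖ ^ 2)⁻¹ * B := by
  have e : ∑ i ∈ s, ‖(k * x i) * y i‖ ^ 2 = ‖k‖ ^ 2 * ∑ i ∈ s, ‖x i * y i‖ ^ 2 := by
    rw [Finset.mul_sum]; apply Finset.sum_congr rfl; intro i _; simp only [norm_mul]; ring
  have hk' : 0 < ‖k‖ ^ 2 := by positivity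
  rw [e] at h
  rw [inv_mul_eq_div, le_div_iff₀ hk']; linarith

open Classical in
lemma edgeA {ι : Type*} {s : Finset ι} {χ : ι → Eis → ℂ} {Rr : ι → ℂ} {X B : ℝ} (H : HB0 s χ Rr X B) (hX : 1 ≤ X) {w : ℂ} (hw : w.re = -(1/2)) :
    ∑ i ∈ s, ‖DS X (χ i) w * Rr i‖ ^ 2 ≤ X ^ 2 * B := by
  have hX0 : 0 < X := by linarith
  have hk : ((X : ℂ)⁻¹) ≠ 0 := by simp; exact hX0.ne'
  have := H (fun m => if m ∈ Ball X then (X : ℂ)⁻¹ * (Nm m : ℂ) ^ (-w) else 0) (by simp [mem_Ball]) (by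
    intro m hm
    have hN := Nm_pos hm
    by_cases h : m ∈ Ball X
    · have h2 := (mem_Ball.1 h).2
      simp only [if_pos h]
      rw [min_eq_left (by rw [le_div_iff₀ hN]; linarith), norm_mul, norm_inv, Complex.norm_of_nonneg hX0.le, norm_Nm_cpow hm, hw, mul_one]
      rw [inv_mul_le_iff₀ hX0]
      have : Nm m ^ (-(-(1/2)) : ℝ) = Nm m * Nm m ^ (-(1/2) : ℝ) := by
        nth_rewrite 2 [← Real.rpow_one (Nm m)]
        rw [← Real.rpow_add hN]; norm_num
      rw [this]
      gcongr
    · simp only [if_neg h, norm_zero]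
      have := Nm_nonneg m
      positivity)
  simp only [DS_tsum] at this
  refine (sum_scale hk this).trans (le_of_eq ?_)
  rw [norm_inv, Complex.norm_of_nonneg hX0.le]; field_simp

open Classical in
lemma edgeC {ι : Type*} {s : Finset ι} {χ : ι → Eis → ℂ} {Rr : ι → ℂ} {X B : ℝ} (H : HB0 s χ Rr X B) (hX : 1 ≤ X) {w : ℂ} (hw : w.re = 1/2) :
    ∑ i ∈ s, ‖DS X (χ i) w * Rr i‖ ^ 2 ≤ B := by
  have := H (fun m => if m ∈ Ball X then 1 * (Nm m : ℂ) ^ (-w) else 0) (by simp [mem_Ball]) (by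
    intro m hm
    have hN := Nm_pos hm
    by_cases h : m ∈ Ball X
    · have h2 := (mem_Ball.1 h).2
      simp only [if_pos h]
      rw [min_eq_left (by rw [le_div_iff₀ hN]; linarith), one_mul, norm_Nm_cpow hm, hw, mul_one]
    · simp only [if_neg h, norm_zero]
      have := Nm_nonneg m
      have : 0 ≤ X := by linarith
      positivity)
  simp only [DS_tsum] at this
  simpa only [one_mul] using this

open Classical in
lemma edgeB {ι : Type*} {s : Finset ι} {χ : ι → Eis → ℂ} {Rr : ι → ℂ} {X B : ℝ} (H : HB0 s χ Rr X B) (hX : 1 ≤ X)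
    (hχ : ∀ i ∈ s, ∀ m, ‖χ i m‖ ≤ 1) (h0 : ∀ i ∈ s, χ i 0 = 0) {w : ℂ} (hw : w.re = 3/2) :
    ∑ i ∈ s, ‖(LS (χ i) w - DS X (χ i) w) * Rr i‖ ^ 2 ≤ (X ^ 2)⁻¹ * B := by
  have hX0 : 0 < X := by linarith
  have hk : (X : ℂ) ≠ 0 := by simp; exact hX0.ne'
  have := H (fun m => if m ∈ Ball X ∨ m = 0 then 0 else (X : ℂ) * (Nm m : ℂ) ^ (-w)) (by simp) (by
    intro m hm
    have hN := Nm_pos hm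
    by_cases h : m ∈ Ball X
    · simp only [h, true_or, if_true, norm_zero]
      positivity
    · have h2 : X < Nm m := by
        by_contra h3; push Not at h3; exact h (mem_Ball.2 ⟨hm, h3⟩)
      rw [if_neg (by tauto)]
      rw [min_eq_right (by rw [div_le_iff₀ hN]; linarith), norm_mul, Complex.norm_of_nonneg hX0.le, norm_Nm_cpow hm, hw]
      have : Nm m ^ (-(1/2) : ℝ) = Nm m * Nm m ^ (-(3/2) : ℝ) := by
        nth_rewrite 2 [← Real.rpow_one (Nm m)]
        rw [← Real.rpow_add hN]; norm_num
      rw [this]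
      apply le_of_eq; field_simp)
  have h2 : ∑ i ∈ s, ‖((X : ℂ) * (LS (χ i) w - DS X (χ i) w)) * Rr i‖ ^ 2 ≤ B := by
    refine le_trans (le_of_eq ?_) this
    apply Finset.sum_congr rfl; intro i hi
    rw [LSD_tsum (hχ i hi) (h0 i hi) (by rw [hw]; norm_num)]
  refine (sum_scale hk h2).trans (le_of_eq ?_)
  rw [Complex.norm_of_nonneg hX0.le]

lemma sum_conj_eq {ι : Type*} {s : Finset ι} {x y x' : ι → ℂ} (h : ∀ i ∈ s, x' i = (starRingEnd ℂ) (x i)) :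
    ∑ i ∈ s, ‖x' i * y i‖ ^ 2 = ∑ i ∈ s, ‖x i * y i‖ ^ 2 := by
  apply Finset.sum_congr rfl; intro i hi; rw [h i hi, norm_mul, norm_mul, RCLike.norm_conj]

lemma L_gr {r : Eis} {ψ : Eis → ℂ} {W : ℂ} (g : GaussData r ψ W) (h0 : ψ 0 = 0) {L : ℂ → ℂ}
    (hL : Differentiable ℂ L) (hL1 : ∀ s : ℂ, 1 < s.re → L s = LS ψ s) : Gr (-(1/2)) (3/2) L := by
  have h1 : Gr (-(1/2)) (3/2) (fun s => (fePair g h0).Λ s) := by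
    obtain ⟨K, hK, h⟩ := mellin_strip (f := (fePair g h0).f) (a := -(1/2)) (b := 3/2) ((fePair_strong g h0).hasMellin _).1 ((fePair_strong g h0).hasMellin _).1
    refine Gr.of_bdd K hK fun z h1 h2 => ?_
    rw [(fePair_strong g h0).Λ_eq]
    exact h z h1 h2
  have h2 : Gr (-(1/2)) (3/2) (fun s => (cG r : ℂ) ^ s) := by
    simpa using Gr.cpow (a := -(1/2)) (b := 3/2) (cG_pos g.hr) 1 0
  have h3 := (h1.mul invGamma_gr).mul h2
  have : L = fun s => (fePair g h0).Λ s * (Gamma s)⁻¹ * (cG r : ℂ) ^ s := funext fun s => L_eq_Lam g h0 hL hL1 s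
  rw [this]; exact h3

lemma DS_diff (X : ℝ) (ψ : Eis → ℂ) : Differentiable ℂ (DS X ψ) := by
  intro z
  unfold DS
  apply DifferentiableAt.fun_sum
  intro m hm
  have : (Nm m : ℂ) ≠ 0 := by exact_mod_cast (Nm_pos (mem_Ball.1 hm).1).ne'
  exact ((differentiableAt_id.neg).const_cpow (Or.inl this)).const_mul _

lemma DS_gr (X : ℝ) (ψ : Eis → ℂ) (a b : ℝ) : Gr a b (DS X ψ) := by
  unfold DS
  apply Gr.sum
  intro m hm
  have := (Gr.const (a := a) (b := b) (ψ m)).mul (Gr.cpow (a := a) (b := b) (Nm_pos (mem_Ball.1 hm).1) (-1) 0)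
  simpa using this

lemma DS_gr' (X : ℝ) (ψ : Eis → ℂ) (a b : ℝ) : Gr a b (fun z => DS X ψ (1 - z)) := by
  unfold DS
  apply Gr.sum
  intro m hm
  have := (Gr.const (a := a) (b := b) (ψ m)).mul (Gr.cpow (a := a) (b := b) (Nm_pos (mem_Ball.1 hm).1) 1 (-1))
  convert this using 4
  push_cast; ring

lemma poly_gauss (v : ℝ) : (1 + |v|) ^ 3 * Real.exp (1 - v ^ 2) ≤ Real.exp 4 := by
  have h := Real.add_one_le_exp (|v|)
  have h0 := abs_nonneg v
  calc (1 + |v|) ^ 3 * Real.exp (1 - v ^ 2) ≤ (Real.exp |v|) ^ 3 * Real.exp (1 - v ^ 2) := by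
        apply mul_le_mul_of_nonneg_right _ (Real.exp_pos _).le
        gcongr; linarith
    _ = Real.exp (3 * |v| + (1 - v ^ 2)) := by
        rw [← Real.exp_nat_mul, ← Real.exp_add]; norm_num
    _ ≤ _ := by
        apply Real.exp_le_exp.2
        rw [← sq_abs v]; nlinarith [sq_nonneg (|v| - 3/2)]

lemma norm_le_two {z : ℂ} (h : |z.re| ≤ 2) : ‖z‖ ≤ 2 + |z.im| := by
  have := Complex.norm_le_abs_re_add_abs_im z; linarith

lemma T_bd (u t : ℝ) : 2 + |u| ≤ 2 * ((|t| + 1) * (1 + |u - t|)) := by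
  have h1 : |u| ≤ |t| + |u - t| := by
    have := abs_add_le t (u - t); simpa using this
  have := abs_nonneg t
  have := abs_nonneg (u - t)
  nlinarith [mul_nonneg (abs_nonneg t) (abs_nonneg (u-t))]

lemma cG_sq {r : Eis} (hr : r ≠ 0) : cG r ^ 2 = 4 * Real.pi ^ 2 / (3 * Nm r) := by
  unfold cG
  rw [div_pow, mul_pow, mul_pow, Real.sq_sqrt (by norm_num), Real.sq_sqrt (Nm_nonneg r)]; norm_num

/-- scalar factor bounds on the edges -/
lemma scal_lin {z z0 : ℂ} (h1 : (z.re - z0.re) ^ 2 = 1) (h2 : |z.re| ≤ 3/2 ) (h2' : |z.re - 1| ≤ 2) {b T : ℝ} (hb : 1 ≤ b) (hT : T = |z0.im| + 1) :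
    ‖cexp ((z - z0) ^ 2)‖ * ‖z - 1‖ ≤ 64 * b * Real.exp 4 * T := by
  rw [expsq_norm, h1]
  have e := poly_gauss (z.im - z0.im)
  set v := z.im - z0.im
  have h3 : ‖z - 1‖ ≤ 2 * (T * (1 + |v|)) := by
    refine (norm_le_two (by simpa using h2')).trans ?_
    have := T_bd z.im z0.im
    rw [hT]; simpa using this
  have hT1 : 1 ≤ T := by rw [hT]; have := abs_nonneg z0.im; linarith
  have hv := abs_nonneg v
  have h4 : (1 + |v|) ≤ (1 + |v|) ^ 3 := le_self_pow₀ (by linarith) (by norm_num)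
  calc _ ≤ Real.exp (1 - v ^ 2) * (2 * (T * (1 + |v|) ^ 3)) := by
        apply mul_le_mul_of_nonneg_left _ (Real.exp_pos _).le
        refine h3.trans ?_
        have : 0 ≤ T := by linarith
        gcongr
    _ = 2 * T * ((1 + |v|) ^ 3 * Real.exp (1 - v ^ 2)) := by ring
    _ ≤ 2 * T * Real.exp 4 := by apply mul_le_mul_of_nonneg_left e; linarith
    _ = 2 * 1 * Real.exp 4 * T := by ring
    _ ≤ _ := by
      have : 0 ≤ T := by linarith
      gcongr; norm_num

lemma scal_left {z z0 : ℂ} (h1 : (z.re - z0.re) ^ 2 = 1) (h2 : z.re = -(1/2)) {b T : ℝ} (hb : 1 ≤ b) (hT : T = |z0.im| + 1) :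
    ‖cexp ((z - z0) ^ 2)‖ * (b * (T ^ 2)⁻¹ * ‖gq z‖) ≤ 64 * b * Real.exp 4 * T := by
  rw [expsq_norm, h1]
  have e := poly_gauss (z.im - z0.im)
  set v := z.im - z0.im
  have hT1 : 1 ≤ T := by rw [hT]; have := abs_nonneg z0.im; linarith
  have hT0 : 0 < T := by linarith
  have hv := abs_nonneg v
  have h3 : 2 + |z.im| ≤ 2 * (T * (1 + |v|)) := by
    have := T_bd z.im z0.im
    rw [hT]; simpa using this
  have g : ‖gq z‖ ≤ 8 * T ^ 3 * (1 + |v|) ^ 3 := by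
    rw [gq_left h2]
    have a1 : ‖z + 2‖ ≤ 2 * (T * (1 + |v|)) := by
      refine le_trans (norm_le_two ?_) (le_trans ?_ h3)
      · simp [h2]; rw [abs_le]; constructor <;> norm_num
      · simp
    have a2 : ‖z + 1‖ ≤ 2 * (T * (1 + |v|)) := by
      refine le_trans (norm_le_two ?_) (le_trans ?_ h3)
      · simp [h2]; rw [abs_le]; constructor <;> norm_num
      · simp
    have a3 : ‖z‖ ≤ 2 * (T * (1 + |v|)) := by
      refine le_trans (norm_le_two ?_) (le_trans ?_ h3)
      · rw [h2, abs_le]; constructor <;> norm_num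
      · simp
    calc _ ≤ (2 * (T * (1 + |v|))) * ((2 * (T * (1 + |v|))) * (2 * (T * (1 + |v|)))) := by gcongr
      _ = _ := by ring
  calc _ ≤ Real.exp (1 - v ^ 2) * (b * (T ^ 2)⁻¹ * (8 * T ^ 3 * (1 + |v|) ^ 3)) := by gcongr
    _ = 8 * b * T * ((1 + |v|) ^ 3 * Real.exp (1 - v ^ 2)) := by field_simp
    _ ≤ 8 * b * T * Real.exp 4 := by apply mul_le_mul_of_nonneg_left e; positivity
    _ = 8 * b * Real.exp 4 * T := by ring
    _ ≤ _ := by gcongr; norm_num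

lemma scal_right {z z0 : ℂ} (h1 : (z.re - z0.re) ^ 2 = 1) (h2 : z.re = 3/2) {b T : ℝ} (hb : 1 ≤ b) (hT : T = |z0.im| + 1) :
    ‖cexp ((z - z0) ^ 2)‖ * (14 * b * T ^ 2 * ‖gq z‖) ≤ 64 * b * Real.exp 4 * T := by
  rw [expsq_norm, h1, gq_right h2]
  have e := poly_gauss (z.im - z0.im)
  have hT1 : 1 ≤ T := by rw [hT]; have := abs_nonneg z0.im; linarith
  have hT0 : 0 < T := by linarith
  have h4 : T ≤ 3 * (1 + |z.im - z0.im|) * ‖2 - z‖ := by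
    have e1 : 1/2 ≤ ‖2 - z‖ := by
      have := Complex.abs_re_le_norm (2 - z); simp [h2] at this
      refine le_trans ?_ this
      rw [le_abs]; left; norm_num
    have e2 : |z.im| ≤ ‖2 - z‖ := by
      have := Complex.abs_im_le_norm (2 - z); simpa using this
    have e3 : |z0.im| ≤ |z.im| + |z.im - z0.im| := by
      have := abs_sub z.im (z.im - z0.im); simpa using this
    have := abs_nonneg (z.im - z0.im)
    rw [hT]
    nlinarith [mul_nonneg this (abs_nonneg z.im)]
  set v := z.im - z0.im
  have hv := abs_nonneg v
  have hn : 0 < ‖2 - z‖ := by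
    by_contra h
    push Not at h
    have : 3 * (1 + |v|) * ‖2 - z‖ ≤ 0 := mul_nonpos_of_nonneg_of_nonpos (by positivity) h
    linarith
  have h5 : T * ‖2 - z‖⁻¹ ≤ 3 * (1 + |v|) ^ 3 := by
    rw [← div_eq_mul_inv, div_le_iff₀ hn]
    refine h4.trans ?_
    have h4 : (1 + |v|) ≤ (1 + |v|) ^ 3 := le_self_pow₀ (by linarith) (by norm_num)
    gcongr
  calc _ = Real.exp (1 - v ^ 2) * (14 * b * T * (T * ‖2 - z‖⁻¹)) := by ring
    _ ≤ Real.exp (1 - v ^ 2) * (14 * b * T * (3 * (1 + |v|) ^ 3)) := by gcongr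
    _ = 42 * b * T * ((1 + |v|) ^ 3 * Real.exp (1 - v ^ 2)) := by ring
    _ ≤ 42 * b * T * Real.exp 4 := by apply mul_le_mul_of_nonneg_left e; positivity
    _ = 42 * b * Real.exp 4 * T := by ring
    _ ≤ _ := by gcongr; norm_num

/-- combine two terms -/
lemma two_terms {ι : Type*} {s : Finset ι} {f x y : ι → ℂ} {S B P Q : ℝ} (hS : 0 ≤ S) (hB : 0 ≤ B)
    {α β : ι → ℝ}
    (hf : ∀ i ∈ s, ‖f i‖ ≤ α i * ‖x i‖ + β i * ‖y i‖)
    (hα : ∀ i ∈ s, 0 ≤ α i ∧ α i * P ≤ S) (hβ : ∀ i ∈ s, 0 ≤ β i ∧ β i * Q ≤ S) (hP : 0 < P) (hQ : 0 < Q)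
    (hx : ∑ i ∈ s, ‖x i‖ ^ 2 ≤ P ^ 2 * B) (hy : ∑ i ∈ s, ‖y i‖ ^ 2 ≤ Q ^ 2 * B) :
    ∑ i ∈ s, ‖f i‖ ^ 2 ≤ 4 * S ^ 2 * B := by
  have key : ∀ i ∈ s, ‖f i‖ ^ 2 ≤ 2 * (S / P) ^ 2 * ‖x i‖ ^ 2 + 2 * (S / Q) ^ 2 * ‖y i‖ ^ 2 := by
    intro i hi
    have a1 : α i ≤ S / P := by rw [le_div_iff₀ hP]; exact (hα i hi).2
    have a2 : β i ≤ S / Q := by rw [le_div_iff₀ hQ]; exact (hβ i hi).2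
    have a3 : ‖f i‖ ≤ S / P * ‖x i‖ + S / Q * ‖y i‖ := (hf i hi).trans (by gcongr)
    calc ‖f i‖ ^ 2 ≤ (S / P * ‖x i‖ + S / Q * ‖y i‖) ^ 2 := by gcongr
      _ ≤ _ := by nlinarith [sq_nonneg (S / P * ‖x i‖ - S / Q * ‖y i‖)]
  calc _ ≤ ∑ i ∈ s, (2 * (S / P) ^ 2 * ‖x i‖ ^ 2 + 2 * (S / Q) ^ 2 * ‖y i‖ ^ 2) := Finset.sum_le_sum key
    _ = 2 * (S / P) ^ 2 * ∑ i ∈ s, ‖x i‖ ^ 2 + 2 * (S / Q) ^ 2 * ∑ i ∈ s, ‖y i‖ ^ 2 := by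
        rw [Finset.sum_add_distrib, Finset.mul_sum, Finset.mul_sum]
    _ ≤ 2 * (S / P) ^ 2 * (P ^ 2 * B) + 2 * (S / Q) ^ 2 * (Q ^ 2 * B) := by gcongr
    _ = _ := by field_simp; ring

set_option maxHeartbeats 1000000 in
lemma half_line {b : ℝ} (hb : 1 ≤ b) {ι : Type*} (s : Finset ι) (χ : ι → Eis → ℂ) (Rr W : ι → ℂ) (ρ : ι → Eis) (L : ι → ℂ → ℂ) {V X B t : ℝ}
    (hX : 1 ≤ X) (hV : 0 < V) (hXV : X ^ 2 = V * (|t| + 1) ^ 2) (H : HB0 s χ Rr X B)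
    (g : ∀ i ∈ s, GaussData (ρ i) (χ i) (W i)) (h0 : ∀ i ∈ s, χ i 0 = 0)
    (hL : ∀ i ∈ s, Differentiable ℂ (L i)) (hL1 : ∀ i ∈ s, ∀ z : ℂ, 1 < z.re → L i z = LS (χ i) z)
    (hρ1 : ∀ i ∈ s, V ≤ b * Nm (ρ i)) (hρ2 : ∀ i ∈ s, Nm (ρ i) ≤ b * V) :
    ∑ i ∈ s, ‖L i ((1/2 : ℂ) + t * I) * Rr i‖ ^ 2 ≤ (3 * (32 * (64 * b * Real.exp 4) ^ 2 + 2)) * B := by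
  set z0 : ℂ := (1/2 : ℂ) + t * I with hz0
  have hz0re : z0.re = 1/2 := by simp [hz0]
  have hz0im : z0.im = t := by simp [hz0]
  set T := |t| + 1 with hT
  have hT' : T = |z0.im| + 1 := by rw [hz0im]
  have hT1 : 1 ≤ T := by rw [hT]; have := abs_nonneg t; linarith
  have hT0 : 0 < T := by linarith
  have hX0 : 0 < X := by linarith
  have hXc : (X : ℂ) ≠ 0 := by exact_mod_cast hX0.ne'
  have hB : 0 ≤ B := by
    refine le_trans ?_ (edgeC H hX hz0re)
    exact Finset.sum_nonneg fun i _ => by positivity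
  set cχ : ι → Eis → ℂ := fun i x => (starRingEnd ℂ) (χ i x) with hcχ
  set F : ι → ℂ → ℂ := fun i z => cexp ((z - z0) ^ 2) * (X : ℂ) ^ (z - 1/2) *
    ((z - 1) * (L i z - DS X (χ i) z) + W i * (cG (ρ i) : ℂ) ^ (2 * z - 1) * gq z * DS X (cχ i) (1 - z)) * Rr i with hF
  set S := 64 * b * Real.exp 4 * T with hS
  have hS0 : 0 ≤ S := by positivity
  have hχ1 : ∀ i ∈ s, ∀ m, ‖χ i m‖ ≤ 1 := fun i hi => (g i hi).le
  have hcGn : ∀ i ∈ s, ∀ z : ℂ, ‖(cG (ρ i) : ℂ) ^ (2 * z - 1)‖ = cG (ρ i) ^ (2 * z.re - 1) := by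
    intro i hi z
    rw [Complex.norm_cpow_eq_rpow_re_of_pos (cG_pos (g i hi).hr)]; simp
  have hXn : ∀ z : ℂ, ‖(X : ℂ) ^ (z - 1/2)‖ = X ^ (z.re - 1/2) := by
    intro z; rw [Complex.norm_cpow_eq_rpow_re_of_pos hX0]; simp
  have hpi1 := Real.pi_gt_three
  have hpi2 := Real.pi_lt_d2
  -- edges
  have hedgeL : ∀ z : ℂ, z.re = -(1/2) → ∑ i ∈ s, ‖F i z‖ ^ 2 ≤ 4 * S ^ 2 * B := by
    intro z hz
    have hw : ((starRingEnd ℂ) (1 - z)).re = 3/2 := by simp [hz]; norm_num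
    have ex := edgeA H hX hz
    have ey := edgeB H hX hχ1 h0 hw
    have ey2 : ∑ i ∈ s, ‖(LS (cχ i) (1 - z) - DS X (cχ i) (1 - z)) * Rr i‖ ^ 2 ≤ (X ^ 2)⁻¹ * B := by
      refine le_trans (le_of_eq (sum_conj_eq ?_)) ey
      intro i _
      rw [hcχ, LS_conj, DS_conj]; simp only [map_sub]
    refine two_terms hS0 hB (P := X) (Q := X⁻¹) (α := fun i => ‖cexp ((z - z0) ^ 2)‖ * X⁻¹ * ‖z - 1‖)
      (β := fun i => ‖cexp ((z - z0) ^ 2)‖ * X⁻¹ * ((cG (ρ i) ^ 2)⁻¹ * ‖gq z‖)) ?_ ?_ ?_ hX0 (by positivity) ex (by rw [inv_pow]; exact ey2)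
    · intro i hi
      have hg1 : (1:ℂ) - z ≠ 0 := by intro h; have := congrArg Complex.re h; simp [hz] at this; norm_num at this
      have e1 : (z - 1) * L i z = - (W i * (cG (ρ i) : ℂ) ^ (2 * z - 1) * gq z * LS (cχ i) (1 - z)) := by
        rw [L_FE (g i hi) (h0 i hi) (hL i hi) (hL1 i hi) (by rw [hz]; norm_num)]
        have : Gamma (2 - z) = (1 - z) * Gamma (1 - z) := by
          rw [← Complex.Gamma_add_one _ hg1]; congr 1; ring
        unfold gq
        rw [this]; ring
      have e2 : F i z = cexp ((z - z0) ^ 2) * (X : ℂ) ^ (z - 1/2) * (-(z - 1)) * (DS X (χ i) z * Rr i)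
          + cexp ((z - z0) ^ 2) * (X : ℂ) ^ (z - 1/2) * (- (W i * (cG (ρ i) : ℂ) ^ (2 * z - 1) * gq z)) * ((LS (cχ i) (1 - z) - DS X (cχ i) (1 - z)) * Rr i) := by
        simp only [hF]
        linear_combination (cexp ((z - z0) ^ 2) * (X : ℂ) ^ (z - 1/2) * Rr i) * e1
      rw [e2]
      refine (norm_add_le _ _).trans (le_of_eq ?_)
      rw [norm_mul _ (DS X (χ i) z * Rr i), norm_mul _ ((LS (cχ i) (1 - z) - DS X (cχ i) (1 - z)) * Rr i)]
      congr 2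
      · rw [norm_mul, norm_mul, norm_neg, hXn, hz]
        norm_num [Real.rpow_neg_one]
      · rw [norm_mul, norm_mul, norm_neg, norm_mul, norm_mul, hXn, hcGn i hi, hz, (g i hi).W1, one_mul]
        congr 2
        · norm_num [Real.rpow_neg_one]
        · rw [show (2 * -(1/2) - 1 : ℝ) = -((2:ℕ):ℝ) by norm_num, Real.rpow_neg (cG_pos (g i hi).hr).le, Real.rpow_natCast]
    · intro i hi
      refine ⟨by positivity, ?_⟩
      have := scal_lin (z := z) (z0 := z0) (by rw [hz, hz0re]; norm_num) (by rw [hz, abs_le]; constructor <;> norm_num) (by rw [hz, abs_le]; constructor <;> norm_num) hb hT'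
      calc _ = ‖cexp ((z - z0) ^ 2)‖ * ‖z - 1‖ := by field_simp
        _ ≤ _ := this
    · intro i hi
      refine ⟨by positivity, ?_⟩
      have := scal_left (z := z) (z0 := z0) (by rw [hz, hz0re]; norm_num) hz hb hT'
      refine le_trans ?_ this
      rw [mul_assoc, mul_assoc]
      apply mul_le_mul_of_nonneg_left _ (norm_nonneg _)
      rw [cG_sq (g i hi).hr]
      have hN := Nm_pos (g i hi).hr
      have : (4 * Real.pi ^ 2 / (3 * Nm (ρ i)))⁻¹ ≤ b * V := by
        rw [inv_div]
        rw [div_le_iff₀ (by positivity)]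
        have := hρ2 i hi
        have h5 : b * V * 3 ≤ b * V * (4 * Real.pi ^ 2) := by
          apply mul_le_mul_of_nonneg_left _ (by positivity); nlinarith
        linarith
      calc _ = (4 * Real.pi ^ 2 / (3 * Nm (ρ i)))⁻¹ * (X ^ 2)⁻¹ * ‖gq z‖ := by ring
        _ ≤ (b * V) * (X ^ 2)⁻¹ * ‖gq z‖ := by gcongr
        _ = _ := by rw [hXV]; field_simp
  have hedgeR : ∀ z : ℂ, z.re = 3/2 → ∑ i ∈ s, ‖F i z‖ ^ 2 ≤ 4 * S ^ 2 * B := by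
    intro z hz
    have hw : ((starRingEnd ℂ) (1 - z)).re = -(1/2) := by simp [hz]; norm_num
    have ex := edgeB H hX hχ1 h0 hz
    have ey := edgeA H hX hw
    have ey2 : ∑ i ∈ s, ‖DS X (cχ i) (1 - z) * Rr i‖ ^ 2 ≤ X ^ 2 * B := by
      refine le_trans (le_of_eq (sum_conj_eq ?_)) ey
      intro i _
      rw [hcχ, DS_conj]
    refine two_terms hS0 hB (P := X⁻¹) (Q := X) (α := fun i => ‖cexp ((z - z0) ^ 2)‖ * X * ‖z - 1‖)
      (β := fun i => ‖cexp ((z - z0) ^ 2)‖ * X * ((cG (ρ i) ^ 2) * ‖gq z‖)) ?_ ?_ ?_ (by positivity) hX0 (by rw [inv_pow]; exact ex) ey2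
    · intro i hi
      have e2 : F i z = cexp ((z - z0) ^ 2) * (X : ℂ) ^ (z - 1/2) * (z - 1) * ((LS (χ i) z - DS X (χ i) z) * Rr i)
          + cexp ((z - z0) ^ 2) * (X : ℂ) ^ (z - 1/2) * (W i * (cG (ρ i) : ℂ) ^ (2 * z - 1) * gq z) * (DS X (cχ i) (1 - z) * Rr i) := by
        simp only [hF]
        rw [hL1 i hi z (by rw [hz]; norm_num)]; ring
      rw [e2]
      refine (norm_add_le _ _).trans (le_of_eq ?_)
      rw [norm_mul _ ((LS (χ i) z - DS X (χ i) z) * Rr i), norm_mul _ (DS X (cχ i) (1 - z) * Rr i)]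
      congr 2
      · rw [norm_mul, norm_mul, hXn, hz]
        norm_num
      · rw [norm_mul, norm_mul, norm_mul, norm_mul, hXn, hcGn i hi, hz, (g i hi).W1, one_mul]
        congr 2
        · norm_num
        · rw [show (2 * (3/2) - 1 : ℝ) = ((2:ℕ):ℝ) by norm_num, Real.rpow_natCast]
    · intro i hi
      refine ⟨by positivity, ?_⟩
      have := scal_lin (z := z) (z0 := z0) (by rw [hz, hz0re]; norm_num) (by rw [hz, abs_le]; constructor <;> norm_num) (by rw [hz, abs_le]; constructor <;> norm_num) hb hT'
      calc _ = ‖cexp ((z - z0) ^ 2)‖ * ‖z - 1‖ := by field_simp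
        _ ≤ _ := this
    · intro i hi
      refine ⟨by positivity, ?_⟩
      have := scal_right (z := z) (z0 := z0) (by rw [hz, hz0re]; norm_num) hz hb hT'
      refine le_trans ?_ this
      rw [mul_assoc, mul_assoc]
      apply mul_le_mul_of_nonneg_left _ (norm_nonneg _)
      rw [cG_sq (g i hi).hr]
      have hN := Nm_pos (g i hi).hr
      have : 4 * Real.pi ^ 2 / (3 * Nm (ρ i)) ≤ 14 * b / V := by
        rw [div_le_div_iff₀ (by positivity) hV]
        have := hρ1 i hi
        have h5 : 4 * Real.pi ^ 2 ≤ 42 := by nlinarith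
        calc _ ≤ 42 * V := by gcongr
          _ ≤ 42 * (b * Nm (ρ i)) := by gcongr
          _ = _ := by ring
      calc _ = (4 * Real.pi ^ 2 / (3 * Nm (ρ i))) * X ^ 2 * ‖gq z‖ := by ring
        _ ≤ (14 * b / V) * X ^ 2 * ‖gq z‖ := by gcongr
        _ = _ := by rw [hXV]; field_simp
  have hPL := PLvec s F (a := -(1/2)) (b := 3/2) (M := 4 * S ^ 2 * B) (by norm_num) (by norm_num) (by
      intro i hi z h1 h2
      have d1 : DifferentiableAt ℂ (fun z : ℂ => (X : ℂ) ^ (z - 1/2)) z :=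
        DifferentiableAt.const_cpow (by fun_prop) (Or.inl hXc)
      have hcc : (cG (ρ i) : ℂ) ≠ 0 := by exact_mod_cast (cG_pos (g i hi).hr).ne'
      have d2 : DifferentiableAt ℂ (fun z : ℂ => (cG (ρ i) : ℂ) ^ (2 * z - 1)) z :=
        DifferentiableAt.const_cpow (by fun_prop) (Or.inl hcc)
      have d3 : DifferentiableAt ℂ gq z := gq_diff (by linarith)
      have d4 : DifferentiableAt ℂ (L i) z := hL i hi z
      have d5 : DifferentiableAt ℂ (DS X (χ i)) z := DS_diff _ _ z
      have d6 : DifferentiableAt ℂ (fun z => DS X (cχ i) (1 - z)) z := (DS_diff X (cχ i) (1 - z)).comp z (f := fun z => 1 - z) (by fun_prop)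
      have d7 : DifferentiableAt ℂ (fun z : ℂ => cexp ((z - z0) ^ 2)) z := by fun_prop
      exact (((d7.mul d1).mul (((differentiableAt_id.sub_const 1).mul (d4.sub d5)).add ((((d2.const_mul (W i))).mul d3).mul d6))).mul_const (Rr i))) (by
      intro i hi
      have g1 : Gr (-(1/2)) (3/2) (fun z => (X : ℂ) ^ (z - 1/2)) := by
        convert Gr.cpow (a := -(1/2)) (b := 3/2) hX0 1 (-(1/2)) using 3
        push_cast; ring
      have g2 : Gr (-(1/2)) (3/2) (fun z => (cG (ρ i) : ℂ) ^ (2 * z - 1)) := by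
        convert Gr.cpow (a := -(1/2)) (b := 3/2) (cG_pos (g i hi).hr) 2 (-1) using 3
        push_cast; ring
      exact (((Gr.expsq z0).mul g1).mul (((Gr.id.sub (Gr.const 1)).mul ((L_gr (g i hi) (h0 i hi) (hL i hi) (hL1 i hi)).sub (DS_gr X _ _ _))).add
        ((((Gr.const (W i)).mul g2).mul gq_gr).mul (DS_gr' X _ _ _)))).mul (Gr.const (Rr i))) hedgeL hedgeR (z := z0) (by rw [hz0re]; norm_num) (by rw [hz0re]; norm_num)
  have ex := edgeC H hX hz0re
  have hw : ((starRingEnd ℂ) (1 - z0)).re = 1/2 := by simp [hz0re]; norm_num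
  have ey := edgeC H hX hw
  have ey2 : ∑ i ∈ s, ‖DS X (cχ i) (1 - z0) * Rr i‖ ^ 2 ≤ B := by
    refine le_trans (le_of_eq (sum_conj_eq ?_)) ey
    intro i _
    rw [hcχ, DS_conj]
  have hn : ‖z0 - 1‖ ^ 2 = 1/4 + t ^ 2 := by
    rw [Complex.sq_norm, Complex.normSq_apply]; simp [hz0re, hz0im]; ring
  have hn2 : ‖z0‖ = ‖z0 - 1‖ := by
    have : ‖z0‖ ^ 2 = ‖z0 - 1‖ ^ 2 := by
      rw [hn, Complex.sq_norm, Complex.normSq_apply, hz0re, hz0im]; ring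
    exact (pow_left_inj₀ (norm_nonneg _) (norm_nonneg _) two_ne_zero).1 this
  have hnT : T ^ 2 ≤ 8 * ‖z0 - 1‖ ^ 2 := by
    rw [hn, hT]; nlinarith [sq_nonneg (|t| - 1), sq_abs t]
  have hnpos : 0 < ‖z0 - 1‖ ^ 2 := by rw [hn]; positivity
  have key : ∀ i ∈ s, ‖L i z0 * Rr i‖ ^ 2 ≤ 3 * (8 / T ^ 2 * ‖F i z0‖ ^ 2 + ‖DS X (cχ i) (1 - z0) * Rr i‖ ^ 2 + ‖DS X (χ i) z0 * Rr i‖ ^ 2) := by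
    intro i hi
    have hu : ‖(X : ℂ) ^ (z0 - 1/2)‖ = 1 := by rw [hXn, hz0re]; simp
    have e1 : (X : ℂ) ^ (z0 - 1/2) * ((z0 - 1) * (L i z0 * Rr i)) = F i z0 - (X : ℂ) ^ (z0 - 1/2) * (W i * (cG (ρ i) : ℂ) ^ (2 * z0 - 1) * gq z0 * (DS X (cχ i) (1 - z0) * Rr i)) + (X : ℂ) ^ (z0 - 1/2) * ((z0 - 1) * (DS X (χ i) z0 * Rr i)) := by
      have : cexp ((z0 - z0) ^ 2) = 1 := by simp
      simp only [hF, this]; ring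
    have e2 := congrArg norm e1
    have e3 : ‖z0 - 1‖ * ‖L i z0 * Rr i‖ ≤ ‖F i z0‖ + ‖z0 - 1‖ * ‖DS X (cχ i) (1 - z0) * Rr i‖ + ‖z0 - 1‖ * ‖DS X (χ i) z0 * Rr i‖ := by
      rw [norm_mul _ ((z0 - 1) * (L i z0 * Rr i)), hu, one_mul, norm_mul _ (L i z0 * Rr i)] at e2
      rw [e2]
      refine (norm_add_le _ _).trans (add_le_add ((norm_sub_le _ _).trans (add_le_add le_rfl (le_of_eq ?_))) (le_of_eq ?_))
      · rw [norm_mul, hu, one_mul, norm_mul _ (DS X (cχ i) (1 - z0) * Rr i), norm_mul, norm_mul, (g i hi).W1, hcGn i hi, hz0re, gq_half hz0re, hn2]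
        norm_num
      · rw [norm_mul, hu, one_mul, norm_mul]
    have hn' : 0 < ‖z0 - 1‖ := by
      by_contra h; push Not at h
      have : ‖z0 - 1‖ = 0 := le_antisymm h (norm_nonneg _)
      rw [this] at hnpos; norm_num at hnpos
    have e4 : ‖L i z0 * Rr i‖ ≤ ‖F i z0‖ / ‖z0 - 1‖ + ‖DS X (cχ i) (1 - z0) * Rr i‖ + ‖DS X (χ i) z0 * Rr i‖ := by
      refine le_of_mul_le_mul_left (e3.trans (le_of_eq ?_)) hn'
      field_simp
    have e5 : (‖F i z0‖ / ‖z0 - 1‖) ^ 2 ≤ 8 / T ^ 2 * ‖F i z0‖ ^ 2 := by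
      rw [div_pow, div_mul_eq_mul_div, div_le_div_iff₀ hnpos (by positivity)]
      nlinarith [mul_le_mul_of_nonneg_left hnT (sq_nonneg ‖F i z0‖)]
    refine le_trans (pow_le_pow_left₀ (norm_nonneg _) e4 2) ?_
    generalize ‖F i z0‖ / ‖z0 - 1‖ = f at *
    generalize ‖DS X (cχ i) (1 - z0) * Rr i‖ = d1 at *
    generalize ‖DS X (χ i) z0 * Rr i‖ = d2 at *
    nlinarith [sq_nonneg (f - d1), sq_nonneg (f - d2), sq_nonneg (d1 - d2)]
  calc _ ≤ ∑ i ∈ s, 3 * (8 / T ^ 2 * ‖F i z0‖ ^ 2 + ‖DS X (cχ i) (1 - z0) * Rr i‖ ^ 2 + ‖DS X (χ i) z0 * Rr i‖ ^ 2) := Finset.sum_le_sum key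
    _ = 3 * (8 / T ^ 2 * ∑ i ∈ s, ‖F i z0‖ ^ 2 + ∑ i ∈ s, ‖DS X (cχ i) (1 - z0) * Rr i‖ ^ 2 + ∑ i ∈ s, ‖DS X (χ i) z0 * Rr i‖ ^ 2) := by
        rw [← Finset.mul_sum, Finset.sum_add_distrib, Finset.sum_add_distrib, ← Finset.mul_sum]
    _ ≤ 3 * (8 / T ^ 2 * (4 * S ^ 2 * B) + B + B) := by gcongr
    _ = _ := by rw [hS]; field_simp; ring

lemma Gr.mono {a b a' b' : ℝ} {f : ℂ → ℂ} (h : Gr a b f) (h1 : a ≤ a') (h2 : b' ≤ b) : Gr a' b' f := by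
  obtain ⟨K, A, hK, hA, h⟩ := h
  exact ⟨K, A, hK, hA, fun z hz1 hz2 => h z (h1.trans hz1) (hz2.trans h2)⟩

open Classical in
lemma edgeL {ι : Type*} {s : Finset ι} {χ : ι → Eis → ℂ} {Rr : ι → ℂ} {X B : ℝ} (H : HB0 s χ Rr X B) (hX : 1 ≤ X)
    (hχ : ∀ i ∈ s, ∀ m, ‖χ i m‖ ≤ 1) (h0 : ∀ i ∈ s, χ i 0 = 0) {w : ℂ} (hw : w.re = 3/2) :
    ∑ i ∈ s, ‖LS (χ i) w * Rr i‖ ^ 2 ≤ B := by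
  have hX0 : 0 < X := by linarith
  have := H (fun m => if m ∈ Ball 0 ∨ m = 0 then 0 else 1 * (Nm m : ℂ) ^ (-w)) (by simp) (by
    intro m hm
    have hN := Nm_pos hm
    have hN1 := one_le_Nm hm
    have h : m ∉ Ball 0 := by rw [mem_Ball]; rintro ⟨_, h⟩; linarith
    rw [if_neg (by tauto), one_mul, norm_Nm_cpow hm, hw]
    have : Nm m ^ (-(3/2) : ℝ) = Nm m ^ (-(1/2) : ℝ) * (1 / Nm m) := by
      rw [show 1 / Nm m = Nm m ^ (-1 : ℝ) by rw [Real.rpow_neg_one, one_div], ← Real.rpow_add hN]; norm_num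
    rw [this]
    apply mul_le_mul_of_nonneg_left _ (by positivity)
    apply le_min
    · rw [div_le_one hN]; exact hN1
    · gcongr)
  refine le_trans (le_of_eq ?_) this
  apply Finset.sum_congr rfl; intro i hi
  rw [LSD_tsum (hχ i hi) (h0 i hi) (by rw [hw]; norm_num)]
  have : DS 0 (χ i) w = 0 := by
    unfold DS
    apply Finset.sum_eq_zero
    intro m hm
    have := mem_Ball.1 hm
    have := one_le_Nm this.1
    linarith
  rw [this, sub_zero, one_mul]

lemma lin_gauss (v : ℝ) : (1 + |v|) * Real.exp (1 - v ^ 2) ≤ Real.exp 4 := by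
  refine le_trans ?_ (poly_gauss v)
  apply mul_le_mul_of_nonneg_right _ (Real.exp_pos _).le
  exact le_self_pow₀ (by have := abs_nonneg v; linarith) (by norm_num)

set_option maxHeartbeats 1000000 in
lemma strip_line {b : ℝ} (hb : 1 ≤ b) {ι : Type*} (s : Finset ι) (χ : ι → Eis → ℂ) (Rr W : ι → ℂ) (ρ : ι → Eis) (L : ι → ℂ → ℂ) {V σ t : ℝ}
    (B : ℝ → ℝ) (hV : 1 ≤ V) (hσ : 1/2 ≤ σ) (hσ' : σ ≤ 1)
    (H : ∀ X, 1 ≤ X → HB0 s χ Rr X (B X))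
    (hBm : ∀ X X' k, 1 ≤ X → 1 ≤ X' → 1 ≤ k → X' ≤ k * X → B X' ≤ k ^ 2 * B X)
    (g : ∀ i ∈ s, GaussData (ρ i) (χ i) (W i)) (h0 : ∀ i ∈ s, χ i 0 = 0)
    (hL : ∀ i ∈ s, Differentiable ℂ (L i)) (hL1 : ∀ i ∈ s, ∀ z : ℂ, 1 < z.re → L i z = LS (χ i) z)
    (hρ1 : ∀ i ∈ s, V ≤ b * Nm (ρ i)) (hρ2 : ∀ i ∈ s, Nm (ρ i) ≤ b * V) :
    ∑ i ∈ s, ‖L i ((σ : ℂ) + t * I) * Rr i‖ ^ 2 ≤ (Real.exp 8 * (3 * (32 * (64 * b * Real.exp 4) ^ 2 + 2))) * B (Real.sqrt V * (|t| + 1)) := by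
  set CC := (3 * (32 * (64 * b * Real.exp 4) ^ 2 + 2)) with hCC
  have hCC1 : 1 ≤ CC := by rw [hCC]; have := sq_nonneg (64 * b * Real.exp 4); linarith
  set z0 : ℂ := (σ : ℂ) + t * I with hz0
  have hz0re : z0.re = σ := by simp [hz0]
  have hz0im : z0.im = t := by simp [hz0]
  have hsV : 1 ≤ Real.sqrt V := by rw [Real.one_le_sqrt]; exact hV
  have hX1 : ∀ u : ℝ, 1 ≤ Real.sqrt V * (|u| + 1) := by
    intro u; have := abs_nonneg u; nlinarith
  set X := Real.sqrt V * (|t| + 1) with hX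
  have hχ1 : ∀ i ∈ s, ∀ m, ‖χ i m‖ ≤ 1 := fun i hi => (g i hi).le
  have hB0 : 0 ≤ B X := by
    refine le_trans ?_ (edgeC (H X (hX1 t)) (hX1 t) (w := 1/2) (by simp))
    exact Finset.sum_nonneg fun i _ => by positivity
  have hexp8 : Real.exp 8 = Real.exp 4 ^ 2 := by rw [← Real.exp_nat_mul]; norm_num
  set F : ι → ℂ → ℂ := fun i z => cexp ((z - z0) ^ 2) * (L i z * Rr i) with hF
  have hsum : ∀ z, ∑ i ∈ s, ‖F i z‖ ^ 2 = ‖cexp ((z - z0) ^ 2)‖ ^ 2 * ∑ i ∈ s, ‖L i z * Rr i‖ ^ 2 := by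
    intro z
    rw [Finset.mul_sum]; apply Finset.sum_congr rfl; intro i _
    simp only [hF]; rw [norm_mul, mul_pow]
  have he : ∀ z : ℂ, |z.re - σ| ≤ 1 → ‖cexp ((z - z0) ^ 2)‖ ≤ Real.exp (1 - (z.im - t) ^ 2) := by
    intro z hz
    rw [expsq_norm, hz0re, hz0im]
    apply Real.exp_le_exp.2
    have : (z.re - σ) ^ 2 ≤ 1 := by rw [sq_le_one_iff_abs_le_one]; exact hz
    linarith
  have hPL := PLvec s F (a := 1/2) (b := 3/2) (M := Real.exp 8 * CC * B X) (by norm_num) (by norm_num) (by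
      intro i hi z h1 h2
      have d4 : DifferentiableAt ℂ (L i) z := hL i hi z
      have d7 : DifferentiableAt ℂ (fun z : ℂ => cexp ((z - z0) ^ 2)) z := by fun_prop
      exact d7.mul (d4.mul_const _)) (by
      intro i hi
      exact (Gr.expsq z0).mul (((L_gr (g i hi) (h0 i hi) (hL i hi) (hL1 i hi)).mono (by norm_num) le_rfl).mul (Gr.const _)))
    (by
      intro z hz
      rw [hsum]
      have hzz : z = (1/2 : ℂ) + (z.im : ℂ) * I := by
        apply Complex.ext <;> simp [hz]
      have e1 := half_line hb s χ Rr W ρ L (V := V) (X := Real.sqrt V * (|z.im| + 1)) (t := z.im) (hX1 z.im) (by linarith)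
        (by rw [mul_pow, Real.sq_sqrt (by linarith)]) (H _ (hX1 z.im)) g h0 hL hL1 hρ1 hρ2
      rw [← hzz] at e1
      set v := z.im - t with hv
      have hk : 1 ≤ 1 + |v| := by have := abs_nonneg v; linarith
      have e2 := hBm X (Real.sqrt V * (|z.im| + 1)) (1 + |v|) (hX1 t) (hX1 z.im) hk (by
        rw [hX]
        have h1 : |z.im| ≤ |t| + |v| := by
          have := abs_add_le t v; rw [hv] at this ⊢; simpa using this
        have : |z.im| + 1 ≤ (1 + |v|) * (|t| + 1) := by
          nlinarith [mul_nonneg (abs_nonneg v) (abs_nonneg t)]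
        calc _ ≤ Real.sqrt V * ((1 + |v|) * (|t| + 1)) := by gcongr
          _ = _ := by ring)
      have e3 := he z (by rw [hz, abs_le]; constructor <;> linarith)
      calc _ ≤ (Real.exp (1 - v ^ 2)) ^ 2 * (CC * ((1 + |v|) ^ 2 * B X)) := by
            apply mul_le_mul (by gcongr) (e1.trans _) (Finset.sum_nonneg fun i _ => by positivity) (by positivity)
            apply mul_le_mul_of_nonneg_left e2 (by linarith)
        _ = ((1 + |v|) * Real.exp (1 - v ^ 2)) ^ 2 * (CC * B X) := by ring
        _ ≤ (Real.exp 4) ^ 2 * (CC * B X) := by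
            apply mul_le_mul_of_nonneg_right _ (by positivity)
            apply pow_le_pow_left₀ (by positivity) (lin_gauss v)
        _ = _ := by rw [hexp8]; ring)
    (by
      intro z hz
      rw [hsum]
      have e1 := edgeL (H X (hX1 t)) (hX1 t) hχ1 h0 hz
      have e2 : ∑ i ∈ s, ‖L i z * Rr i‖ ^ 2 ≤ B X := by
        refine le_trans (le_of_eq ?_) e1
        apply Finset.sum_congr rfl; intro i hi
        rw [hL1 i hi z (by rw [hz]; norm_num)]
      have e3 := he z (by rw [hz, abs_le]; constructor <;> linarith)
      have e4 : ‖cexp ((z - z0) ^ 2)‖ ≤ Real.exp 4 := e3.trans (Real.exp_le_exp.2 (by nlinarith [sq_nonneg (z.im - t)]))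
      calc _ ≤ (Real.exp 4) ^ 2 * (1 * B X) := by
            rw [one_mul]
            apply mul_le_mul (by gcongr) e2 (Finset.sum_nonneg fun i _ => by positivity) (by positivity)
        _ ≤ (Real.exp 4) ^ 2 * (CC * B X) := by gcongr
        _ = _ := by rw [hexp8]; ring)
    (z := z0) (by rw [hz0re]; exact hσ) (by rw [hz0re]; linarith)
  rw [hsum] at hPL
  simpa using hPL

/-- combination with the large sieve -/
lemma moment_core {ε b σ : ℝ} (hε : 0 < ε) (hε1 : ε ≤ 1) (hb : 1 ≤ b) (hσ : 1/2 ≤ σ) (hσ' : σ ≤ 1) :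
    ∃ C : ℝ, 0 < C ∧ ∀ Q₁ Q₂ R V t : ℝ, 1 ≤ Q₁ → 1 ≤ Q₂ → 1 ≤ R → 1 ≤ V → ∀ r u : Eis → ℂ, ∀ K : ℝ, 0 ≤ K →
    (∀ m, m ≠ 0 → ‖r m‖ ≤ K * Nm m ^ (-(1/2) : ℝ)) →
    (∀ m, ‖u m‖ ≤ 1) → (∀ m n, u (m * n) = u m * u n) →
    ∀ (s : Finset (Finset PP × Finset PP)), s ⊆ SS Q₁ ×ˢ SS Q₂ → ∀ (W : Finset PP × Finset PP → ℂ) (ρ : Finset PP × Finset PP → Eis) (L : Finset PP × Finset PP → ℂ → ℂ),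
    (∀ i ∈ s, GaussData (ρ i) (cX u i) (W i)) → (∀ i ∈ s, cX u i 0 = 0) →
    (∀ i ∈ s, Differentiable ℂ (L i)) → (∀ i ∈ s, ∀ z : ℂ, 1 < z.re → L i z = LS (cX u i) z) →
    (∀ i ∈ s, V ≤ b * Nm (ρ i)) → (∀ i ∈ s, Nm (ρ i) ≤ b * V) →
    ∑ i ∈ s, ‖L i ((σ : ℂ) + t * I) * (∑ m ∈ Ball R, r m * cX u i m)‖ ^ 2 ≤
      C * K ^ 2 * (Q₁ * Q₂ * (Real.sqrt V * (|t| + 1) * R)) ^ ε * EE Q₁ Q₂ (Real.sqrt V * (|t| + 1) * R) := by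
  obtain ⟨C, hC, h⟩ := MS3 hε hε1
  refine ⟨(Real.exp 8 * (3 * (32 * (64 * b * Real.exp 4) ^ 2 + 2))) * C, by positivity, ?_⟩
  intro Q₁ Q₂ R V t hQ1 hQ2 hR hV r u K hK hr hu hum s hs W ρ L g h0 hL hL1 hρ1 hρ2
  have := strip_line hb s (cX u) (fun i => ∑ m ∈ Ball R, r m * cX u i m) W ρ L (t := t)
    (fun X => C * K ^ 2 * (Q₁ * Q₂ * (X * R)) ^ ε * EE Q₁ Q₂ (X * R)) hV hσ hσ' (by
      intro X hX c hc0 hc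
      refine le_trans (Finset.sum_le_sum_of_subset_of_nonneg hs fun i _ _ => by positivity) (h Q₁ Q₂ X R hQ1 hQ2 hX hR c r u K hK hc0 hc hr hu hum)) (by
      intro X X' k hX hX' hk hle
      have a1 : (0:ℝ) < Q₁ := by linarith
      have a2 : (0:ℝ) < Q₂ := by linarith
      have a3 : (0:ℝ) < X := by linarith
      have a4 : (0:ℝ) < R := by linarith
      have a5 : (0:ℝ) < X' := by linarith
      have e1 : EE Q₁ Q₂ (X' * R) ≤ k * EE Q₁ Q₂ (X * R) := by
        refine le_trans (EE_mono a1.le a2.le (by positivity) (?_ : X' * R ≤ k * (X * R))) (EE_scale a1.le a2.le (by positivity) hk)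
        calc X' * R ≤ (k * X) * R := by gcongr
          _ = _ := by ring
      have e2 : (Q₁ * Q₂ * (X' * R)) ^ ε ≤ k * (Q₁ * Q₂ * (X * R)) ^ ε := by
        calc _ ≤ (k * (Q₁ * Q₂ * (X * R))) ^ ε := by
              apply Real.rpow_le_rpow (by positivity) _ hε.le
              calc _ ≤ Q₁ * Q₂ * ((k * X) * R) := by gcongr
                _ = _ := by ring
          _ = k ^ ε * (Q₁ * Q₂ * (X * R)) ^ ε := Real.mul_rpow (by linarith) (by positivity)
          _ ≤ _ := by
              apply mul_le_mul_of_nonneg_right _ (by positivity)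
              calc k ^ ε ≤ k ^ (1:ℝ) := Real.rpow_le_rpow_of_exponent_le hk hε1
                _ = k := Real.rpow_one k
      have e3 : 0 ≤ EE Q₁ Q₂ (X * R) := EE_nonneg a1.le a2.le (by positivity)
      have e4 : 0 ≤ EE Q₁ Q₂ (X' * R) := EE_nonneg a1.le a2.le (by positivity)
      show C * K ^ 2 * (Q₁ * Q₂ * (X' * R)) ^ ε * EE Q₁ Q₂ (X' * R) ≤ k ^ 2 * (C * K ^ 2 * (Q₁ * Q₂ * (X * R)) ^ ε * EE Q₁ Q₂ (X * R))
      calc _ ≤ C * K ^ 2 * (k * (Q₁ * Q₂ * (X * R)) ^ ε) * (k * EE Q₁ Q₂ (X * R)) := by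
            apply mul_le_mul _ e1 e4 (by positivity)
            apply mul_le_mul_of_nonneg_left e2 (by positivity)
        _ = _ := by ring) g h0 hL hL1 hρ1 hρ2
  refine this.trans (le_of_eq ?_)
  ring

lemma sym_prime {χ : Eis → Eis → Eis} (hχ : IsCubicSymbol χ) (p : PP) (a : Eis) : χ p.1 a = cs p a := by
  by_cases h : p.1 ∣ a
  · rw [(hχ.prime_eq_zero p.1 a p.2.1 p.2.2).2 h, cs_eq_zero.2 h]
  · symm
    apply cs_unique
    · rcases hχ.prime_vals p.1 a p.2.1 p.2.2 with h' | h'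
      · exact absurd ((hχ.prime_eq_zero p.1 a p.2.1 p.2.2).1 h') h
      · exact h'
    · have := hχ.prime_congr p.1 a p.2.1 p.2.2
      rw [← map_pow, eq_comm, rd_eq]
      exact this

open Classical in
lemma sym_el {χ : Eis → Eis → Eis} (hχ : IsCubicSymbol χ) (A : Finset PP) (a : Eis) : ((χ (el A) a : Eis) : ℂ) = ch A a := by
  induction A using Finset.induction_on with
  | empty => simp [hχ.one_bot]
  | insert p P hp ih =>
    rw [el_insert hp, hχ.mul_bot _ _ _ p.2.2 (el_Pr P), sym_prime hχ]
    unfold ch at ih ⊢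
    rw [Finset.prod_insert hp, ← ih]; push_cast; rfl

lemma sym_AB {χ : Eis → Eis → Eis} (hχ : IsCubicSymbol χ) (A B : Finset PP) (a : Eis) :
    ((χ (el A * el B ^ 2) a : Eis) : ℂ) = chAB A B a := by
  rw [pow_two, hχ.mul_bot _ _ _ (el_Pr A) ((el_Pr B).mul (el_Pr B)), hχ.mul_bot _ _ _ (el_Pr B) (el_Pr B)]
  push_cast
  rw [sym_el hχ, sym_el hχ, ← pow_two, ch_sq]; rfl

open Classical in
lemma NmN_el_mod (A : Finset PP) : ∃ k : ℕ, NmN (el A) = 1 + 3 * (∑ p ∈ A, ex p) + 9 * k := by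
  induction A using Finset.induction_on with
  | empty => exact ⟨0, by simp⟩
  | insert p P hp ih =>
    obtain ⟨k, hk⟩ := ih
    rw [el_insert hp, NmN_mul, hk, ← ex_eq, Finset.sum_insert hp]
    exact ⟨k * (3 * ex p + 1) + ex p * (∑ p ∈ P, ex p), by ring⟩

lemma ch_ωE (A : Finset PP) : ch A ωE = (ωE : ℂ) ^ (∑ p ∈ A, ex p) := by
  unfold ch
  rw [← Finset.prod_pow_eq_pow_sum]
  apply Finset.prod_congr rfl
  intro p _
  rw [cs_ωE]; push_cast; rfl

lemma chAB_norm (A B : Finset PP) (x : Eis) : ‖chAB A B x‖ ≤ 1 := by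
  unfold chAB
  rw [norm_mul, RCLike.norm_conj]
  exact mul_le_one₀ (ch_norm_le _ _) (norm_nonneg _) (ch_norm_le _ _)

lemma chAB_ωE {A B : Finset PP} (h : NmN (el A * el B ^ 2) % 9 = 1) : chAB A B ωE = 1 := by
  unfold chAB
  rw [← ch_sq, ch_ωE, ch_ωE, ← pow_mul, ← pow_add]
  obtain ⟨k, hk⟩ := NmN_el_mod A
  obtain ⟨l, hl⟩ := NmN_el_mod B
  generalize ∑ p ∈ A, ex p = e at *
  generalize ∑ p ∈ B, ex p = f at *
  have h3 : (e + f * 2) % 3 = 0 := by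
    rw [pow_two, NmN_mul, NmN_mul, hk, hl] at h
    have : (1 + 3 * e + 9 * k) * ((1 + 3 * f + 9 * l) * (1 + 3 * f + 9 * l)) = 1 + 3 * (e + f * 2) + 9 * (k * ((1 + 3 * f + 9 * l) * (1 + 3 * f + 9 * l)) + e * ((2 * f + 6 * l) + (f + 3 * l) ^ 2 * 3) + 2 * l + (f + 3 * l) ^ 2) := by ring
    rw [this] at h; omega
  obtain ⟨m, hm⟩ := Nat.dvd_of_mod_eq_zero h3
  rw [hm, pow_mul]
  have : (ωE : ℂ) ^ 3 = 1 := by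
    have := congrArg (fun x : Eis => (x : ℂ)) ωE_cube
    simpa using this
  rw [this, one_pow]

lemma chAB_unit {A B : Finset PP} (h : NmN (el A * el B ^ 2) % 9 = 1) {u : Eis} (hu : IsUnit u) : chAB A B u = 1 := by
  have e1 := chAB_ωE h
  have e2 : chAB A B (-1) = 1 := by unfold chAB; rw [ch_neg_one, ch_neg_one]; simp
  have e3 : chAB A B (ωE ^ 2) = 1 := by rw [pow_two, chAB_mul, e1, one_mul]
  rcases unit_cases hu with h' | h' | h' | h' | h' | h'
  · rw [h']; unfold chAB; simp
  · rw [h', e2]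
  · rw [h', e1]
  · rw [h', ← neg_one_mul, chAB_mul, e1, e2, one_mul]
  · rw [h', e3]
  · rw [h', ← neg_one_mul, chAB_mul, e3, e2, one_mul]

lemma Nm_unit_mul {u x : Eis} (hu : IsUnit u) : Nm (u * x) = Nm x := by
  rw [Nm_mul, Nm_eq_NmN u, isUnit_iff_NmN.1 hu]; simp

/-- nonzero elements are units times canonical representatives -/
def repEquiv : Eisˣ × {x : Eis // Rep x} ≃ {x : Eis // x ≠ 0} := Equiv.ofBijective
  (fun p => ⟨p.1 * p.2.1, mul_ne_zero p.1.ne_zero p.2.2.ne_zero⟩) ⟨by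
    rintro ⟨u, x, hx⟩ ⟨v, y, hy⟩ h
    have h : (u : Eis) * x = v * y := congrArg Subtype.val h
    have hxy : x = y := Rep_unique hx hy ⟨u * v⁻¹, by
      push_cast
      calc x * (u * ((v⁻¹ : Eisˣ) : Eis)) = (u * x) * ((v⁻¹ : Eisˣ) : Eis) := by ring
        _ = y * (v * ((v⁻¹ : Eisˣ) : Eis)) := by rw [h]; ring
        _ = y := by rw [Units.mul_inv, mul_one]⟩
    subst hxy
    have := mul_right_cancel₀ hx.ne_zero h
    have := Units.ext this
    subst this; rfl, by
    rintro ⟨x, hx⟩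
    obtain ⟨u, hu⟩ := exists_Rep hx
    exact ⟨(u⁻¹, ⟨u * x, hu⟩), Subtype.ext (by simp)⟩⟩

lemma LS_eq_rep {ψ : Eis → ℂ} (hψ : ∀ x, ‖ψ x‖ ≤ 1) (h0 : ψ 0 = 0) (hm : ∀ u x, IsUnit u → ψ (u * x) = ψ x)
    {s : ℂ} (hs : 1 < s.re) :
    LS ψ s = (Nat.card Eisˣ : ℂ) * ∑' n : {x : Eis // Rep x}, ψ n.1 * (Nm n.1 : ℂ) ^ (-s) := by
  have hS := LS_summable ψ hψ hs
  unfold LS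
  set F : Eis → ℂ := fun x => ψ x * (Nm x : ℂ) ^ (-s) with hF
  have e1 : ∑' x : Eis, F x = ∑' x : {x : Eis // x ≠ 0}, F x.1 := by
    symm
    have := tsum_subtype_eq_of_support_subset (f := F) (s := {x : Eis | x ≠ 0}) (by
      intro x hx
      simp only [Set.mem_setOf_eq]
      rintro rfl
      apply hx; simp [hF, h0])
    exact this
  have hS2 : Summable fun x : {x : Eis // x ≠ 0} => F x.1 := hS.subtype {x : Eis | x ≠ 0}
  have hS3 : Summable (fun c : Eisˣ × {x : Eis // Rep x} => F (repEquiv c).1) := (repEquiv.summable_iff (f := fun x : {x : Eis // x ≠ 0} => F x.1)).2 hS2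
  rw [e1, ← repEquiv.tsum_eq (fun x : {x : Eis // x ≠ 0} => F x.1), hS3.tsum_prod]
  have e2 : ∀ (u : Eisˣ) (n : {x : Eis // Rep x}), F (repEquiv (u, n)).1 = F n.1 := by
    intro u n
    have : (repEquiv (u, n)).1 = u * n.1 := rfl
    rw [this]; simp only [hF]
    rw [hm _ _ u.isUnit, Nm_unit_mul u.isUnit]
  simp only [e2]
  rw [tsum_const, nsmul_eq_mul]

lemma hecke_LS {χ : Eis → Eis → Eis} (hχ : IsCubicSymbol χ) {A B : Finset PP} (h : NmN (el A * el B ^ 2) % 9 = 1)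
    (h0 : chAB A B 0 = 0) {s : ℂ} (hs : 1 < s.re) :
    LS (chAB A B) s = (Nat.card Eisˣ : ℂ) * heckeSeries χ (el A * el B ^ 2) s := by
  rw [LS_eq_rep (chAB_norm A B) h0 (fun u x hu => by rw [chAB_mul, chAB_unit h hu, one_mul]) hs]
  unfold heckeSeries
  simp only [sym_AB hχ]

lemma card_units_pos : (1:ℝ) ≤ Nat.card Eisˣ := by
  have : 0 < Nat.card Eisˣ := Nat.card_pos
  exact_mod_cast this

/-- squarefree products of primary elements -/
lemma exists_el_pair {x y : Eis} (hx : Pr x) (hy : Pr y) (h : Squarefree (x * y)) :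
    ∃ A B, x = el A ∧ y = el B ∧ Disjoint A B := by
  obtain ⟨A, hA⟩ := exists_el hx (h.of_mul_left)
  obtain ⟨B, hB⟩ := exists_el hy (h.of_mul_right)
  refine ⟨A, B, hA, hB, ?_⟩
  rw [Finset.disjoint_left]
  intro p hpA hpB
  apply p.2.1.not_unit
  apply h p.1
  rw [hA, hB]
  exact mul_dvd_mul (dvd_el.2 hpA) (dvd_el.2 hpB)

open Classical in
lemma Rpoly_eq {χ : Eis → Eis → Eis} (hχ : IsCubicSymbol χ) (a : Eis → ℂ) (R : ℝ) (A B : Finset PP) :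
    Rpoly χ a R (el A * el B ^ 2) = ∑ m ∈ Ball R, (if Rep m then a m * ((Real.sqrt (Nm m) : ℂ))⁻¹ else 0) * chAB A B m := by
  unfold Rpoly
  have : {b : Eis | Rep b ∧ Nm b ≤ R} = ↑((Ball R).filter (fun b => Rep b)) := by
    ext b
    simp only [Finset.coe_filter, Set.mem_setOf_eq, mem_Ball]
    constructor
    · rintro ⟨h1, h2⟩; exact ⟨⟨h1.ne_zero, h2⟩, h1⟩
    · rintro ⟨⟨h1, h2⟩, h3⟩; exact ⟨h3, h2⟩
  rw [this, finsum_mem_coe_finset, Finset.sum_filter]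
  apply Finset.sum_congr rfl
  intro m _
  split_ifs
  · rw [sym_AB hχ]; ring
  · simp

/-- coefficients of the Dirichlet polynomial, supported on canonical generators -/
def rr (a : Eis → ℂ) (R : ℝ) (m : Eis) : ℂ := open Classical in if Rep m ∧ Nm m ≤ R then a m * ((Real.sqrt (Nm m) : ℂ))⁻¹ else 0

lemma rr_bound {a : Eis → ℂ} {A δ R : ℝ} (hA : 0 ≤ A) (hδ : 0 < δ) (ha : ∀ b : Eis, ‖a b‖ ≤ A * Nm b ^ δ) (hR0 : 0 < R) (m : Eis) (hm : m ≠ 0) :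
    ‖rr a R m‖ ≤ A * R ^ δ * Nm m ^ (-(1/2) : ℝ) := by
  have hN := Nm_pos hm
  unfold rr
  split_ifs with h
  · rw [norm_mul, norm_inv, Complex.norm_real, Real.norm_of_nonneg (Real.sqrt_nonneg _), Real.sqrt_eq_rpow, ← Real.rpow_neg hN.le]
    apply mul_le_mul_of_nonneg_right _ (Real.rpow_nonneg hN.le _)
    exact (ha m).trans (mul_le_mul_of_nonneg_left (Real.rpow_le_rpow hN.le h.2 hδ.le) hA)
  · simp only [norm_zero]; positivity

lemma Rpoly_rr {χ : Eis → Eis → Eis} (hχ : IsCubicSymbol χ) (a : Eis → ℂ) (R : ℝ) (A B : Finset PP) :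
    Rpoly χ a R (el A * el B ^ 2) = ∑ m ∈ Ball R, rr a R m * chAB A B m := by
  rw [Rpoly_eq hχ]
  apply Finset.sum_congr rfl
  intro m hm
  unfold rr
  have h2 := (mem_Ball.1 hm).2
  by_cases h : Rep m
  · rw [if_pos h, if_pos ⟨h, h2⟩]
  · rw [if_neg h, if_neg (fun h' => h h'.1)]

lemma Rpoly_small {χ : Eis → Eis → Eis} (a : Eis → ℂ) {R : ℝ} (hR : R < 1) (q : Eis) : Rpoly χ a R q = 0 := by
  unfold Rpoly
  have : {b : Eis | Rep b ∧ Nm b ≤ R} = ∅ := by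
    ext b
    simp only [Set.mem_setOf_eq, Set.mem_empty_iff_false, iff_false, not_and, not_le]
    intro hb
    exact hR.trans_le (one_le_Nm hb.ne_zero)
  rw [this]; simp

lemma numer1 {Q₁ Q₂ H T R c δ ε : ℝ} (hQ1 : 1/2 ≤ Q₁) (hQ2 : 1/2 ≤ Q₂) (hH : 4 ≤ H) (hT : 1 ≤ T) (hR : 1 ≤ R)
    (hc : 1 ≤ c) (hδ : 0 < δ) (hδ1 : δ ≤ 1) (hδε : 302 * δ ≤ ε) (hRV : R ≤ (Q₁ * Q₂ * H) ^ (100:ℝ)) :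
    (R ^ δ) ^ 2 * (c * Q₁ * (c * Q₂) * (Real.sqrt (Q₁ * Q₂ * H) * T * R)) ^ δ ≤ c ^ 2 * (Q₁ * Q₂ * H * T) ^ ε := by
  have hQQ : 1/4 ≤ Q₁ * Q₂ := by nlinarith
  set V := Q₁ * Q₂ * H with hV
  have hV1 : 1 ≤ V := by nlinarith
  have hQV : Q₁ * Q₂ ≤ V := by nlinarith
  have hs : Real.sqrt V ≤ V := Real.sqrt_le_iff.2 ⟨by linarith, by nlinarith⟩
  have hVT : V ≤ V * T := by nlinarith
  have hVT1 : 1 ≤ V * T := hV1.trans hVT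
  have hTVT : T ≤ V * T := by nlinarith
  have hQ0 : 0 < Q₁ := by linarith
  have hQ0' : 0 < Q₂ := by linarith
  have hR' : R ≤ (V * T) ^ (100:ℝ) := hRV.trans (Real.rpow_le_rpow (by linarith) hVT (by norm_num))
  have b1 : (R ^ δ) ^ 2 ≤ (V * T) ^ (200 * δ) := by
    calc (R ^ δ) ^ 2 ≤ (((V * T) ^ (100:ℝ)) ^ δ) ^ 2 := by gcongr
      _ = _ := by
        rw [← Real.rpow_mul (by linarith), ← Real.rpow_natCast, ← Real.rpow_mul (by linarith)]
        congr 1; push_cast; ring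
  have b2 : c * Q₁ * (c * Q₂) * (Real.sqrt V * T * R) ≤ c ^ 2 * (V * T) ^ (102:ℝ) := by
    have e : (V * T) ^ (102:ℝ) = (V * T) * (V * T) * (V * T) ^ (100:ℝ) := by
      rw [show (102:ℝ) = 1 + 1 + 100 by norm_num, Real.rpow_add (by linarith), Real.rpow_add (by linarith), Real.rpow_one]
    rw [e]
    calc c * Q₁ * (c * Q₂) * (Real.sqrt V * T * R) = c ^ 2 * ((Q₁ * Q₂) * (Real.sqrt V * T) * R) := by ring
      _ ≤ c ^ 2 * ((V * T) * (V * T) * (V * T) ^ (100:ℝ)) := by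
        have hq : 0 ≤ Q₁ * Q₂ := by positivity
        have a1 := hQV.trans hVT
        generalize Q₁ * Q₂ = q at *
        gcongr
  have b3 : (c * Q₁ * (c * Q₂) * (Real.sqrt V * T * R)) ^ δ ≤ c ^ 2 * (V * T) ^ (102 * δ) := by
    calc (c * Q₁ * (c * Q₂) * (Real.sqrt V * T * R)) ^ δ ≤ (c ^ 2 * (V * T) ^ (102:ℝ)) ^ δ :=
          Real.rpow_le_rpow (by positivity) b2 hδ.le
      _ = (c ^ 2) ^ δ * (V * T) ^ (102 * δ) := by
          rw [Real.mul_rpow (by positivity) (by positivity), ← Real.rpow_mul (by linarith)]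
      _ ≤ _ := by
          apply mul_le_mul_of_nonneg_right _ (by positivity)
          calc (c ^ 2) ^ δ ≤ (c ^ 2) ^ (1:ℝ) := Real.rpow_le_rpow_of_exponent_le (by nlinarith) hδ1
            _ = _ := Real.rpow_one _
  calc (R ^ δ) ^ 2 * (c * Q₁ * (c * Q₂) * (Real.sqrt V * T * R)) ^ δ ≤ (V * T) ^ (200 * δ) * (c ^ 2 * (V * T) ^ (102 * δ)) := by
        gcongr
    _ = c ^ 2 * (V * T) ^ (302 * δ) := by
        rw [show (302:ℝ) * δ = 200 * δ + 102 * δ by ring, Real.rpow_add (by linarith)]; ring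
    _ ≤ _ := by
        gcongr

lemma EE_cc {Q₁ Q₂ Y c : ℝ} (h1 : 0 ≤ Q₁) (h2 : 0 ≤ Q₂) (hY : 0 ≤ Y) (hc : 1 ≤ c) : EE (c * Q₁) (c * Q₂) Y ≤ c ^ 2 * EE Q₁ Q₂ Y := by
  unfold EE
  rw [← mul_min_of_nonneg _ _ (by linarith : (0:ℝ) ≤ c), ← mul_max_of_nonneg _ _ (by linarith : (0:ℝ) ≤ c)]
  have hm : 0 ≤ min Q₁ Q₂ := le_min h1 h2
  have hM : 0 ≤ max Q₁ Q₂ := h1.trans (le_max_left _ _)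
  have e : (c * max Q₁ Q₂ * Y) ^ (2/3:ℝ) ≤ c * (max Q₁ Q₂ * Y) ^ (2/3:ℝ) := by
    rw [mul_assoc, Real.mul_rpow (by linarith) (by positivity)]
    apply mul_le_mul_of_nonneg_right _ (by positivity)
    calc c ^ (2/3:ℝ) ≤ c ^ (1:ℝ) := Real.rpow_le_rpow_of_exponent_le hc (by norm_num)
      _ = c := Real.rpow_one _
  have e2 : Y ≤ c * Y := by nlinarith
  calc c * min Q₁ Q₂ * (c * max Q₁ Q₂ + Y + (c * max Q₁ Q₂ * Y) ^ (2/3:ℝ))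
      ≤ c * min Q₁ Q₂ * (c * max Q₁ Q₂ + c * Y + c * (max Q₁ Q₂ * Y) ^ (2/3:ℝ)) := by gcongr
    _ = _ := by ring

lemma numer2 {Q₁ Q₂ H T R : ℝ} (hQ1 : 1/2 ≤ Q₁) (hQ2 : 1/2 ≤ Q₂) (hH : 4 ≤ H) (hT : 1 ≤ T) (hR : 1 ≤ R) :
    EE Q₁ Q₂ (Real.sqrt (Q₁ * Q₂ * H) * T * R) ≤ 2 * (min Q₁ Q₂ * (Q₁ * Q₂ * H) ^ ((1:ℝ)/2) * T * R
                + (min Q₁ Q₂ * H) ^ ((1:ℝ)/3) * (Q₁ * Q₂) * (T * R) ^ ((2:ℝ)/3)) := by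
  have hm : 1/2 ≤ min Q₁ Q₂ := le_min hQ1 hQ2
  have hM : 1/2 ≤ max Q₁ Q₂ := hQ1.trans (le_max_left _ _)
  have hmM : Q₁ * Q₂ = min Q₁ Q₂ * max Q₁ Q₂ := (min_mul_max _ _).symm
  unfold EE
  rw [hmM, Real.sqrt_eq_rpow]
  generalize min Q₁ Q₂ = m at *
  generalize max Q₁ Q₂ = M at *
  have hm0 : 0 < m := by linarith
  have hM0 : 0 < M := by linarith
  have hH0 : 0 < H := by linarith
  have hTR : 1 ≤ T * R := by nlinarith
  have hTR0 : 0 < T * R := by linarith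
  have e1 : m * (M * ((m * M * H) ^ ((1:ℝ)/2) * T * R)) ^ (2/3 : ℝ) = (m * H) ^ ((1:ℝ)/3) * (m * M) * (T * R) ^ ((2:ℝ)/3) := by
    rw [show M * ((m * M * H) ^ ((1:ℝ)/2) * T * R) = M * (m * M * H) ^ ((1:ℝ)/2) * (T * R) by ring]
    rw [Real.mul_rpow (by positivity) (by positivity), Real.mul_rpow (by positivity) (by positivity), ← Real.rpow_mul (by positivity)]
    rw [show m * M * H = M * (m * H) by ring, Real.mul_rpow (by positivity) (by positivity)]
    have : M ^ (2/3:ℝ) * M ^ ((1:ℝ)/2 * (2/3)) = M := by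
      rw [← Real.rpow_add hM0]; norm_num
    rw [show (1:ℝ)/3 = 1/2 * (2/3) by norm_num]
    linear_combination (m * (m * H) ^ ((1:ℝ)/2 * (2/3)) * (T * R) ^ ((2:ℝ)/3)) * this
  have e2 : m * M ≤ (m * H) ^ ((1:ℝ)/3) * (m * M) * (T * R) ^ ((2:ℝ)/3) := by
    have a1 : 1 ≤ (m * H) ^ ((1:ℝ)/3) := Real.one_le_rpow (by nlinarith) (by norm_num)
    have a2 : 1 ≤ (T * R) ^ ((2:ℝ)/3) := Real.one_le_rpow hTR (by norm_num)
    have a3 := one_le_mul_of_one_le_of_one_le a1 a2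
    calc m * M = m * M * 1 := by ring
      _ ≤ m * M * ((m * H) ^ ((1:ℝ)/3) * (T * R) ^ ((2:ℝ)/3)) := by gcongr
      _ = _ := by ring
  have e3 : 0 ≤ m * (m * M * H) ^ ((1:ℝ)/2) * T * R := by positivity
  have : m * (M + (m * M * H) ^ ((1:ℝ)/2) * T * R + (M * ((m * M * H) ^ ((1:ℝ)/2) * T * R)) ^ (2/3 : ℝ))
     = m * M + m * (m * M * H) ^ ((1:ℝ)/2) * T * R + (m * H) ^ ((1:ℝ)/3) * (m * M) * (T * R) ^ ((2:ℝ)/3) := by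
    rw [← e1]; ring
  rw [this]
  linarith

lemma chAB_union {A B C D : Finset PP} (h1 : Disjoint A C) (h2 : Disjoint B D) (m : Eis) :
    chAB (A ∪ C) (B ∪ D) m = cX (chAB C D) (A, B) m := by
  unfold chAB cX
  rw [ch_union h1, ch_union h2, map_mul]; ring

lemma chAB_zero {A B : Finset PP} (h : el A * el B ^ 2 ≠ 1) : chAB A B 0 = 0 := by
  unfold chAB
  by_cases hA : A = ∅
  · by_cases hB : B = ∅
    · subst hA; subst hB; simp at h
    · rw [ch_zero hB]; simp
  · rw [ch_zero hA]; simp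

lemma sqf_el {A B : Finset PP} (h : Disjoint A B) : Squarefree (el A * el B) := by
  rw [← el_union h]; exact el_squarefree _

/-- data attached to a member of the family -/
structure QData (c₁ c₂ Q₁ Q₂ : ℝ) (H1 H2 : Finset PP) (q : Eis) (p : Finset PP × Finset PP) : Prop where
  eq : q = el p.1 * el p.2 ^ 2
  dj : Disjoint p.1 p.2
  n9 : NmN q % 9 = 1
  d9 : (9 : Eis) ∣ q - 1
  ne : q ≠ 1
  l1 : c₁ * Q₁ ≤ Nm (el p.1)
  u1 : Nm (el p.1) ≤ c₂ * Q₁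
  l2 : c₁ * Q₂ ≤ Nm (el p.2)
  u2 : Nm (el p.2) ≤ c₂ * Q₂
  d11 : Disjoint p.1 H1
  d12 : Disjoint p.1 H2
  d21 : Disjoint p.2 H1
  d22 : Disjoint p.2 H2

lemma exists_QData {c₁ c₂ Q₁ Q₂ : ℝ} {H1 H2 : Finset PP} {q : Eis} (h : memF₃Q c₁ c₂ Q₁ Q₂ q)
    (hc : IsCoprime q (el H1 * el H2 ^ 2)) : ∃ p, QData c₁ c₂ Q₁ Q₂ H1 H2 q p := by
  obtain ⟨q₁, q₂, h1, h2, hs, h9, rfl, hd, hne, l1, u1, l2, u2⟩ := h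
  obtain ⟨A, B, rfl, rfl, hAB⟩ := exists_el_pair h1 h2 hs
  rw [IsCoprime.mul_left_iff, IsCoprime.mul_right_iff, IsCoprime.mul_right_iff,
    IsCoprime.pow_left_iff two_pos, IsCoprime.pow_left_iff two_pos, IsCoprime.pow_right_iff two_pos,
    IsCoprime.pow_right_iff two_pos, isCoprime_el_el, isCoprime_el_el, isCoprime_el_el, isCoprime_el_el] at hc
  exact ⟨(A, B), rfl, hAB, h9, hd, hne, l1, u1, l2, u2, hc.1.1, hc.1.2, hc.2.1, hc.2.2⟩

lemma QData.prod {c₁ c₂ Q₁ Q₂ : ℝ} {H1 H2 : Finset PP} {q : Eis} {p : Finset PP × Finset PP}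
    (g : QData c₁ c₂ Q₁ Q₂ H1 H2 q p) :
    q * (el H1 * el H2 ^ 2) = el (p.1 ∪ H1) * el (p.2 ∪ H2) ^ 2 := by
  rw [el_union g.d11, el_union g.d22, g.eq]; ring

lemma QData.djU {c₁ c₂ Q₁ Q₂ : ℝ} {H1 H2 : Finset PP} {q : Eis} {p : Finset PP × Finset PP}
    (g : QData c₁ c₂ Q₁ Q₂ H1 H2 q p) (hH : Disjoint H1 H2) : Disjoint (p.1 ∪ H1) (p.2 ∪ H2) := by
  rw [Finset.disjoint_union_left, Finset.disjoint_union_right, Finset.disjoint_union_right]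
  exact ⟨⟨g.dj, g.d12⟩, g.d21.symm, hH⟩

lemma QData.n9U {c₁ c₂ Q₁ Q₂ : ℝ} {H1 H2 : Finset PP} {q : Eis} {p : Finset PP × Finset PP}
    (g : QData c₁ c₂ Q₁ Q₂ H1 H2 q p) (hH : NmN (el H1 * el H2 ^ 2) % 9 = 1) :
    NmN (el (p.1 ∪ H1) * el (p.2 ∪ H2) ^ 2) % 9 = 1 := by
  rw [← g.prod, NmN_mul, Nat.mul_mod, g.n9, hH]

lemma QData.neU {c₁ c₂ Q₁ Q₂ : ℝ} {H1 H2 : Finset PP} {q : Eis} {p : Finset PP × Finset PP}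
    (g : QData c₁ c₂ Q₁ Q₂ H1 H2 q p) : q * (el H1 * el H2 ^ 2) ≠ 1 := by
  intro h
  apply g.ne
  apply unit_Pr (IsUnit.of_mul_eq_one _ h)
  rw [g.eq]
  exact (el_Pr _).mul ((el_Pr _).pow 2)

lemma QData.mem {c₁ c₂ Q₁ Q₂ : ℝ} {H1 H2 : Finset PP} {q : Eis} {p : Finset PP × Finset PP}
    (g : QData c₁ c₂ Q₁ Q₂ H1 H2 q p) (hH : Disjoint H1 H2) (hH9 : NmN (el H1 * el H2 ^ 2) % 9 = 1)
    (hd : (9 : Eis) ∣ el H1 * el H2 ^ 2 - 1) : memF₃ (q * (el H1 * el H2 ^ 2)) := by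
  refine ⟨el (p.1 ∪ H1), el (p.2 ∪ H2), el_Pr _, el_Pr _, sqf_el (g.djU hH), g.n9U hH9, g.prod, ?_, g.neU⟩
  have : q * (el H1 * el H2 ^ 2) - 1 = (q - 1) * (el H1 * el H2 ^ 2) + (el H1 * el H2 ^ 2 - 1) := by ring
  rw [this]
  exact dvd_add (g.d9.mul_right _) hd

lemma conductor_ge {H1 H2 : Finset PP} (hne : el H1 * el H2 ^ 2 ≠ 1) : 4 ≤ Nm (el H1 * el H2) := by
  have hP := (el_Pr H1).mul (el_Pr H2)
  have h3 := hP.NmN_mod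
  have h1 : NmN (el H1 * el H2) ≠ 1 := by
    intro h
    rw [← isUnit_iff_NmN] at h
    have e1 := unit_Pr (isUnit_of_mul_isUnit_left h) (el_Pr H1)
    have e2 := unit_Pr (isUnit_of_mul_isUnit_right h) (el_Pr H2)
    apply hne; rw [e1, e2]; ring
  rw [Nm_eq_NmN]
  have : 4 ≤ NmN (el H1 * el H2) := by omega
  exact_mod_cast this

lemma final_bound {c₁ c₂ δ σ : ℝ} (hc₁ : 0 < c₁) (hc₁₂ : c₁ ≤ c₂) (hδ : 0 < δ) (hδ1 : δ ≤ 1)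
    (hσ : 1/2 ≤ σ) (hσ' : σ ≤ 1) : ∃ C : ℝ, 0 < C ∧ ∀ (χ : Eis → Eis → Eis), IsCubicSymbol χ →
      ∀ (a : Eis → ℂ) (A : ℝ), 0 ≤ A → (∀ b : Eis, ‖a b‖ ≤ A * Nm b ^ δ) →
      ∀ H1 H2 : Finset PP, Disjoint H1 H2 → NmN (el H1 * el H2 ^ 2) % 9 = 1 → (9 : Eis) ∣ el H1 * el H2 ^ 2 - 1 →
        el H1 * el H2 ^ 2 ≠ 1 →
      ∀ L : Eis → ℂ → ℂ, (∀ q : Eis, memF₃ q → IsHeckeL χ q (L q)) →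
      ∀ Q₁ Q₂ R : ℝ, 1/2 ≤ Q₁ → 1/2 ≤ Q₂ → 1 ≤ R → ∀ t : ℝ,
        (∑ᶠ q ∈ {q : Eis | memF₃Q c₁ c₂ Q₁ Q₂ q ∧ IsCoprime q (el H1 * el H2 ^ 2)},
            ‖L (q * (el H1 * el H2 ^ 2)) ((σ : ℂ) + t * Complex.I) * Rpoly χ a R (q * (el H1 * el H2 ^ 2))‖ ^ 2)
          ≤ C * (A * R ^ δ) ^ 2 * ((c₂ + 2) * Q₁ * ((c₂ + 2) * Q₂) * (Real.sqrt (Q₁ * Q₂ * Nm (el H1 * el H2)) * (|t| + 1) * R)) ^ δ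
            * EE ((c₂ + 2) * Q₁) ((c₂ + 2) * Q₂) (Real.sqrt (Q₁ * Q₂ * Nm (el H1 * el H2)) * (|t| + 1) * R) := by
  have hc2 : 0 < c₂ := hc₁.trans_le hc₁₂
  have hb : 1 ≤ 1 + c₂ ^ 2 + (c₁ ^ 2)⁻¹ := by
    have : 0 < c₂ ^ 2 + (c₁ ^ 2)⁻¹ := by positivity
    linarith
  obtain ⟨C, hC, key⟩ := moment_core hδ hδ1 hb hσ hσ'
  refine ⟨C, hC, ?_⟩
  intro χ hχ a A hA ha H1 H2 hH hH9 hHd hHne L hL Q₁ Q₂ R hQ1 hQ2 hR t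
  have hQ10 : 0 < Q₁ := by linarith
  have hQ20 : 0 < Q₂ := by linarith
  set S := {q : Eis | memF₃Q c₁ c₂ Q₁ Q₂ q ∧ IsCoprime q (el H1 * el H2 ^ 2)} with hS
  have hex : ∀ q, q ∈ S → ∃ p, QData c₁ c₂ Q₁ Q₂ H1 H2 q p := fun q hq => exists_QData hq.1 hq.2
  choose! φ hφ using hex
  have hfin : S.Finite := by
    apply (finite_Nm_le (c₂ * Q₁ * (c₂ * Q₂) ^ 2)).subset
    intro q hq
    have g := hφ q hq
    simp only [Set.mem_setOf_eq]
    rw [g.eq, Nm_mul, Nm_pow]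
    have := g.u1
    have := g.u2
    have := Nm_nonneg (el (φ q).1)
    have := Nm_nonneg (el (φ q).2)
    gcongr
  rw [finsum_mem_eq_finite_toFinset_sum _ hfin]
  set gq : Finset PP × Finset PP → Eis := fun p => el p.1 * el p.2 ^ 2 with hgq
  have hgφ : ∀ q ∈ S, gq (φ q) = q := fun q hq => (hφ q hq).eq.symm
  set s := hfin.toFinset.image φ with hs
  have hmem : ∀ i ∈ s, QData c₁ c₂ Q₁ Q₂ H1 H2 (gq i) i := by
    intro i hi
    obtain ⟨q, hq, rfl⟩ := Finset.mem_image.1 hi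
    rw [Set.Finite.mem_toFinset] at hq
    rw [hgφ q hq]; exact hφ q hq
  have hinj : Set.InjOn φ hfin.toFinset := by
    intro q hq q' hq' h
    rw [Set.Finite.coe_toFinset] at hq hq'
    rw [← hgφ q hq, ← hgφ q' hq', h]
  have e1 : ∑ q ∈ hfin.toFinset, ‖L (q * (el H1 * el H2 ^ 2)) ((σ : ℂ) + t * Complex.I) * Rpoly χ a R (q * (el H1 * el H2 ^ 2))‖ ^ 2
      = ∑ i ∈ s, ‖L (gq i * (el H1 * el H2 ^ 2)) ((σ : ℂ) + t * Complex.I) * Rpoly χ a R (gq i * (el H1 * el H2 ^ 2))‖ ^ 2 := by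
    rw [hs, Finset.sum_image hinj]
    apply Finset.sum_congr rfl
    intro q hq
    rw [Set.Finite.mem_toFinset] at hq
    rw [hgφ q hq]
  rw [e1]
  have hH4 := conductor_ge hHne
  set V := Q₁ * Q₂ * Nm (el H1 * el H2) with hV
  have hV1 : 1 ≤ V := by
    have : 1/4 ≤ Q₁ * Q₂ := by nlinarith
    nlinarith
  have hρ : ∀ i ∈ s, Nm (el (i.1 ∪ H1) * el (i.2 ∪ H2)) = Nm (el i.1) * Nm (el i.2) * Nm (el H1 * el H2) := by
    intro i hi
    have g := hmem i hi
    rw [el_union g.d11, el_union g.d22]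
    simp only [Nm_mul]; ring
  have hcX : ∀ i ∈ s, cX (chAB H1 H2) i = chAB (i.1 ∪ H1) (i.2 ∪ H2) := by
    intro i hi
    have g := hmem i hi
    funext m
    rw [chAB_union g.d11 g.d22]
  have hch0 : ∀ i ∈ s, chAB (i.1 ∪ H1) (i.2 ∪ H2) 0 = 0 := by
    intro i hi
    have g := hmem i hi
    apply chAB_zero
    rw [← g.prod]; exact g.neU
  have := key ((c₂ + 2) * Q₁) ((c₂ + 2) * Q₂) R V t (by nlinarith) (by nlinarith) hR hV1 (rr a R) (chAB H1 H2)
    (A * R ^ δ) (by positivity) (fun m hm => rr_bound hA hδ ha (by linarith) m hm) (chAB_norm H1 H2) (chAB_mul H1 H2)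
    s (by
      intro i hi
      have g := hmem i hi
      rw [Finset.mem_product, mem_SS, mem_SS]
      exact ⟨g.u1.trans (by nlinarith), g.u2.trans (by nlinarith)⟩)
    (fun i => wG (i.1 ∪ H1) * (starRingEnd ℂ) (wG (i.2 ∪ H2))) (fun i => el (i.1 ∪ H1) * el (i.2 ∪ H2))
    (fun i z => (Nat.card Eisˣ : ℂ) * L (gq i * (el H1 * el H2 ^ 2)) z)
    (by
      intro i hi
      rw [hcX i hi]
      exact gauss_AB ((hmem i hi).djU hH))
    (by
      intro i hi
      rw [hcX i hi]; exact hch0 i hi)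
    (by
      intro i hi
      exact ((hL _ ((hmem i hi).mem hH hH9 hHd)).1).const_mul _)
    (by
      intro i hi z hz
      have g := hmem i hi
      rw [hcX i hi, hecke_LS hχ (g.n9U hH9) (hch0 i hi) hz, ← g.prod]
      rw [(hL _ (g.mem hH hH9 hHd)).2 z hz])
    (by
      intro i hi
      have g := hmem i hi
      rw [hρ i hi]
      have h1 : c₁ * Q₁ * (c₁ * Q₂) ≤ Nm (el i.1) * Nm (el i.2) :=
        mul_le_mul g.l1 g.l2 (by positivity) (Nm_nonneg _)
      have h2 : V = (c₁ ^ 2)⁻¹ * ((c₁ * Q₁ * (c₁ * Q₂)) * Nm (el H1 * el H2)) := by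
        rw [hV]; field_simp
      have hH0 := Nm_nonneg (el H1 * el H2)
      have hN0 := Nm_nonneg (el i.1)
      have hN0' := Nm_nonneg (el i.2)
      rw [h2]
      apply mul_le_mul _ _ (by positivity) (by positivity)
      · have : 0 < c₂ ^ 2 := by positivity
        linarith
      · exact mul_le_mul_of_nonneg_right h1 hH0)
    (by
      intro i hi
      have g := hmem i hi
      rw [hρ i hi]
      have h1 : Nm (el i.1) * Nm (el i.2) ≤ c₂ * Q₁ * (c₂ * Q₂) :=
        mul_le_mul g.u1 g.u2 (Nm_nonneg _) (by positivity)
      have hH0 := Nm_nonneg (el H1 * el H2)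
      calc Nm (el i.1) * Nm (el i.2) * Nm (el H1 * el H2) ≤ c₂ * Q₁ * (c₂ * Q₂) * Nm (el H1 * el H2) :=
            mul_le_mul_of_nonneg_right h1 hH0
        _ = c₂ ^ 2 * V := by rw [hV]; ring
        _ ≤ _ := by
          apply mul_le_mul_of_nonneg_right _ (by linarith)
          have : 0 < (c₁ ^ 2)⁻¹ := by positivity
          linarith)
  refine le_trans (Finset.sum_le_sum ?_) this
  intro i hi
  have g := hmem i hi
  have e2 : Rpoly χ a R (gq i * (el H1 * el H2 ^ 2)) = ∑ m ∈ Ball R, rr a R m * cX (chAB H1 H2) i m := by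
    rw [g.prod, Rpoly_rr hχ, hcX i hi]
  rw [e2]
  apply pow_le_pow_left₀ (norm_nonneg _)
  rw [norm_mul, norm_mul]
  apply mul_le_mul_of_nonneg_right _ (norm_nonneg _)
  rw [norm_mul]
  have hn := card_units_pos
  have : ‖(Nat.card Eisˣ : ℂ)‖ = (Nat.card Eisˣ : ℝ) := by simp
  rw [this]
  exact le_mul_of_one_le_left (norm_nonneg _) hn

/-- Proposition 4.2: bound for the twisted second moment
`∑_{q ∈ F₃(Q₁,Q₂), (q,h)=1} |L(s, χ_{qh}) ℛ(qh)|²`. -/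
theorem twisted_second_moment_bound
    (c₁ c₂ : ℝ) (hc₁ : 0 < c₁) (hc₁₂ : c₁ ≤ c₂)
    (Ca : ℝ → ℝ) (ε : ℝ) (hε : 0 < ε)
    (σ : ℝ) (hσ : 1/2 ≤ σ) (hσ' : σ ≤ 1) :
    ∃ C : ℝ, ∀ (χ : Eis → Eis → Eis), IsCubicSymbol χ →
      ∀ a : Eis → ℂ, (∀ ε' : ℝ, 0 < ε' → ∀ b : Eis, ‖a b‖ ≤ Ca ε' * Nm b ^ ε') →
      ∀ h h₁ h₂ : Eis, (3 : Eis) ∣ (h₁ - 1) → (3 : Eis) ∣ (h₂ - 1) →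
        Squarefree (h₁ * h₂) → h = h₁ * h₂ ^ 2 → memF₃ h →
      ∀ L : Eis → ℂ → ℂ, (∀ q : Eis, memF₃ q → IsHeckeL χ q (L q)) →
      ∀ Q₁ Q₂ R : ℝ, 1/2 ≤ Q₁ → 1/2 ≤ Q₂ →
        1/2 ≤ R → R ≤ (Q₁ * Q₂ * Nm (h₁ * h₂)) ^ (100 : ℝ) →
      ∀ t : ℝ,
        (∑ᶠ q ∈ {q : Eis | memF₃Q c₁ c₂ Q₁ Q₂ q ∧ IsCoprime q h},
            ‖L (q * h) ((σ : ℂ) + t * Complex.I) * Rpoly χ a R (q * h)‖ ^ 2)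
          ≤ C * (Q₁ * Q₂ * Nm (h₁ * h₂) * (|t| + 1)) ^ ε *
              (min Q₁ Q₂ * (Q₁ * Q₂ * Nm (h₁ * h₂)) ^ ((1:ℝ)/2) * (|t| + 1) * R
                + (min Q₁ Q₂ * Nm (h₁ * h₂)) ^ ((1:ℝ)/3) * (Q₁ * Q₂) *
                    ((|t| + 1) * R) ^ ((2:ℝ)/3)) := by
  set δ : ℝ := min ε 1 / 400 with hδdef
  have hmin : 0 < min ε 1 := lt_min hε one_pos
  have hδ : 0 < δ := by positivity
  have hδ1 : δ ≤ 1 := by have := min_le_right ε 1; rw [hδdef]; linarith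
  have hδε : 302 * δ ≤ ε := by have := min_le_left ε 1; rw [hδdef]; linarith
  obtain ⟨C, hC, key⟩ := final_bound hc₁ hc₁₂ hδ hδ1 hσ hσ'
  have hc2 : 0 < c₂ := hc₁.trans_le hc₁₂
  refine ⟨C * |Ca δ| ^ 2 * (c₂ + 2) ^ 2 * ((c₂ + 2) ^ 2 * 2), ?_⟩
  intro χ hχ a ha h h₁ h₂ hh1 hh2 hsq hh hmem L hL Q₁ Q₂ R hQ1 hQ2 hR hRV t
  obtain ⟨H1, H2, rfl, rfl, hH⟩ := exists_el_pair hh1 hh2 hsq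
  have h9 : NmN h % 9 = 1 ∧ (9 : Eis) ∣ h - 1 ∧ h ≠ 1 := by
    obtain ⟨q₁, q₂, -, -, -, h9, he, hd, hne⟩ := hmem
    rw [he]; rw [he] at hd hne
    exact ⟨h9, hd, hne⟩
  rw [hh] at h9
  subst hh
  have hH4 := conductor_ge h9.2.2
  have hT : 1 ≤ |t| + 1 := by have := abs_nonneg t; linarith
  have hQ10 : 0 < Q₁ := by linarith
  have hQ20 : 0 < Q₂ := by linarith
  have hR0 : 0 < R := by linarith
  have hm0 : 0 < min Q₁ Q₂ := lt_min hQ10 hQ20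
  have hNH : 0 < Nm (el H1 * el H2) := by linarith
  by_cases hR1 : R < 1
  · have : ∀ q : Eis, ‖L (q * (el H1 * el H2 ^ 2)) ((σ : ℂ) + t * Complex.I) * Rpoly χ a R (q * (el H1 * el H2 ^ 2))‖ ^ 2 = 0 := by
      intro q; rw [Rpoly_small a hR1]; simp
    simp only [this, finsum_zero]
    positivity
  push Not at hR1
  have hbd := key χ hχ a |Ca δ| (abs_nonneg _) (fun b => (ha δ hδ b).trans
    (mul_le_mul_of_nonneg_right (le_abs_self _) (Real.rpow_nonneg (Nm_nonneg _) _))) H1 H2 hH h9.1 h9.2.1 h9.2.2 L hL Q₁ Q₂ R hQ1 hQ2 hR1 t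
  refine hbd.trans ?_
  have n1 := numer1 hQ1 hQ2 hH4 hT hR1 (by linarith : 1 ≤ c₂ + 2) hδ hδ1 hδε hRV
  have n2 := (EE_cc hQ10.le hQ20.le (by positivity) (by linarith : 1 ≤ c₂ + 2)).trans
    (mul_le_mul_of_nonneg_left (numer2 hQ1 hQ2 hH4 hT hR1) (by positivity : 0 ≤ (c₂ + 2) ^ 2))
  have n3 := mul_le_mul n1 n2 (EE_nonneg (by positivity) (by positivity) (by positivity)) (by positivity)
  have n4 := mul_le_mul_of_nonneg_left n3 (by positivity : 0 ≤ C * |Ca δ| ^ 2)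
  refine le_trans (le_of_eq ?_) (n4.trans (le_of_eq ?_))
  · ring
  · ring

end CubicPaper
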